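/- Let H be a complex Hénon map and let p be a periodic saddle point of H, with Φ^s_p : ℂ → ℂ² a parametrization of the stable manifold W^s_p with Φ^s_p(0) = p. Let V be a connected component of ℂ ∖ J*_{p,s}. Then the function G⁻ ∘ Φ^s_p restricted to V either vanishes identically or is strictly positive at every point of V. -/

import Mathlib

open Filter Metric Topology Set

noncomputable section

/-- An elementary Hénon map `(z,w) ↦ (P(z) + a·w, b·z)` with `deg P ≥ 2`, `a ≠ 0`, `b ≠ 0`. -/
structure ElemHenon where
  P : Polynomial ℂ
  a : ℂ
  b : ℂ
  ha : a ≠ 0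
  hb : b ≠ 0
  hdeg : 2 ≤ P.natDegree

def ElemHenon.toFun (h : ElemHenon) : ℂ × ℂ → ℂ × ℂ :=
  fun p => (h.P.eval p.1 + h.a * p.2, h.b * p.1)

def ElemHenon.invFun (h : ElemHenon) : ℂ × ℂ → ℂ × ℂ :=
  fun p => (p.2 / h.b, (p.1 - h.P.eval (p.2 / h.b)) / h.a)

/-- A complex Hénon map: a nonempty composition `H = H₁ ∘ ⋯ ∘ Hₙ` of elementary Hénon maps. -/
structure HenonMap where
  comps : List ElemHenon
  ne : comps ≠ []

/-- The map `H = H₁ ∘ ⋯ ∘ Hₙ`. -/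
def HenonMap.toFun (H : HenonMap) : ℂ × ℂ → ℂ × ℂ :=
  H.comps.foldr (fun h f => h.toFun ∘ f) id

/-- The inverse map `H⁻¹ = Hₙ⁻¹ ∘ ⋯ ∘ H₁⁻¹`. -/
def HenonMap.invFun (H : HenonMap) : ℂ × ℂ → ℂ × ℂ :=
  H.comps.foldl (fun f h => h.invFun ∘ f) id

/-- The degree `d = ∏ deg Pᵢ`. -/
def HenonMap.deg (H : HenonMap) : ℕ :=
  (H.comps.map fun h => h.P.natDegree).prod

/-- The (constant) Jacobian determinant of `H`; each factor contributes `-aᵢbᵢ`. -/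
def HenonMap.jacDet (H : HenonMap) : ℂ :=
  (H.comps.map fun h => -(h.a * h.b)).prod

/-- Points with bounded forward orbit. -/
def Kplus (H : HenonMap) : Set (ℂ × ℂ) :=
  {p | Bornology.IsBounded (Set.range fun n : ℕ => H.toFun^[n] p)}

/-- Points with bounded backward orbit. -/
def Kminus (H : HenonMap) : Set (ℂ × ℂ) :=
  {p | Bornology.IsBounded (Set.range fun n : ℕ => H.invFun^[n] p)}

def Jplus (H : HenonMap) : Set (ℂ × ℂ) := frontier (Kplus H)

def Jminus (H : HenonMap) : Set (ℂ × ℂ) := frontier (Kminus H)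

/-- The Julia set `J = J⁺ ∩ J⁻`. -/
def Jset (H : HenonMap) : Set (ℂ × ℂ) := Jplus H ∩ Jminus H

/-- The forward escape function `G⁺(p) = lim d⁻ⁿ log⁺ ‖Hⁿ(p)‖`. -/
def Gplus (H : HenonMap) (p : ℂ × ℂ) : ℝ :=
  limUnder atTop fun n : ℕ => Real.log (max ‖H.toFun^[n] p‖ 1) / (H.deg : ℝ) ^ n

/-- The backward escape function `G⁻(p) = lim d⁻ⁿ log⁺ ‖H⁻ⁿ(p)‖`. -/
def Gminus (H : HenonMap) (p : ℂ × ℂ) : ℝ :=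
  limUnder atTop fun n : ℕ => Real.log (max ‖H.invFun^[n] p‖ 1) / (H.deg : ℝ) ^ n

/-- `p` is a periodic saddle point: `H^k(p) = p` for some `k ≥ 1` and `D(H^k)_p` has
an eigenvalue of modulus `< 1` and an eigenvalue of modulus `> 1`. -/
def IsSaddlePeriodic (H : HenonMap) (p : ℂ × ℂ) : Prop :=
  ∃ k : ℕ, 1 ≤ k ∧ H.toFun^[k] p = p ∧
    ∃ (v₁ v₂ : ℂ × ℂ) (μ₁ μ₂ : ℂ), v₁ ≠ 0 ∧ v₂ ≠ 0 ∧
      fderiv ℂ (H.toFun^[k]) p v₁ = μ₁ • v₁ ∧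
      fderiv ℂ (H.toFun^[k]) p v₂ = μ₂ • v₂ ∧
      ‖μ₁‖ < 1 ∧ 1 < ‖μ₂‖

/-- `J*`: the closure of the set of periodic saddle points. -/
def Jstar (H : HenonMap) : Set (ℂ × ℂ) :=
  closure {p | IsSaddlePeriodic H p}

/-- The stable set of a point. -/
def Ws (H : HenonMap) (p : ℂ × ℂ) : Set (ℂ × ℂ) :=
  {x | Tendsto (fun n : ℕ => dist (H.toFun^[n] x) (H.toFun^[n] p)) atTop (𝓝 0)}

/-- The unstable set of a point. -/
def Wu (H : HenonMap) (p : ℂ × ℂ) : Set (ℂ × ℂ) :=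
  {x | Tendsto (fun n : ℕ => dist (H.invFun^[n] x) (H.invFun^[n] p)) atTop (𝓝 0)}

/-- The stable set of a set. -/
def WsSet (H : HenonMap) (S : Set (ℂ × ℂ)) : Set (ℂ × ℂ) :=
  {x | Tendsto (fun n : ℕ => infDist (H.toFun^[n] x) S) atTop (𝓝 0)}

/-- The unstable set of a set. -/
def WuSet (H : HenonMap) (S : Set (ℂ × ℂ)) : Set (ℂ × ℂ) :=
  {x | Tendsto (fun n : ℕ => infDist (H.invFun^[n] x) S) atTop (𝓝 0)}

/-- The local stable set of size `ε`. -/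
def WsLoc (H : HenonMap) (ε : ℝ) (p : ℂ × ℂ) : Set (ℂ × ℂ) :=
  {x | (∀ n : ℕ, dist (H.toFun^[n] x) (H.toFun^[n] p) ≤ ε) ∧
       Tendsto (fun n : ℕ => dist (H.toFun^[n] x) (H.toFun^[n] p)) atTop (𝓝 0)}

/-- The local unstable set of size `ε`. -/
def WuLoc (H : HenonMap) (ε : ℝ) (p : ℂ × ℂ) : Set (ℂ × ℂ) :=
  {x | (∀ n : ℕ, dist (H.invFun^[n] x) (H.invFun^[n] p) ≤ ε) ∧
       Tendsto (fun n : ℕ => dist (H.invFun^[n] x) (H.invFun^[n] p)) atTop (𝓝 0)}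

/-- A parametrization of the stable manifold of `p`: an injective holomorphic immersion
`Φ : ℂ → ℂ²` with `Φ(0) = p` and image `W^s_p`. -/
def IsStableParam (H : HenonMap) (p : ℂ × ℂ) (Φ : ℂ → ℂ × ℂ) : Prop :=
  Differentiable ℂ Φ ∧ Function.Injective Φ ∧ (∀ z, deriv Φ z ≠ 0) ∧
    Φ 0 = p ∧ Set.range Φ = Ws H p

/-- A parametrization of the unstable manifold of `p`. -/
def IsUnstableParam (H : HenonMap) (p : ℂ × ℂ) (Ψ : ℂ → ℂ × ℂ) : Prop :=
  Differentiable ℂ Ψ ∧ Function.Injective Ψ ∧ (∀ z, deriv Ψ z ≠ 0) ∧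
    Ψ 0 = p ∧ Set.range Ψ = Wu H p

/-- Uniform hyperbolicity of `H` on a compact completely invariant set `S`:
a continuous invariant splitting `ℂ² = E^s_x ⊕ E^u_x` into complex lines, with uniform
contraction on `E^s` and uniform expansion on `E^u`.  Continuity of the line fields is
expressed by the closedness of their total spaces over `S` (equivalent to continuity
for fields of lines of constant dimension over a compact set). -/
def UniformlyHyperbolicOn (H : HenonMap) (S : Set (ℂ × ℂ)) : Prop :=
  IsCompact S ∧ H.toFun '' S = S ∧
  ∃ (Es Eu : (ℂ × ℂ) → Submodule ℂ (ℂ × ℂ)) (c lam : ℝ),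
    0 < c ∧ 0 < lam ∧ lam < 1 ∧
    (∀ x ∈ S, Module.finrank ℂ (Es x) = 1) ∧
    (∀ x ∈ S, Module.finrank ℂ (Eu x) = 1) ∧
    (∀ x ∈ S, IsCompl (Es x) (Eu x)) ∧
    IsClosed {q : (ℂ × ℂ) × (ℂ × ℂ) | q.1 ∈ S ∧ q.2 ∈ Es q.1} ∧
    IsClosed {q : (ℂ × ℂ) × (ℂ × ℂ) | q.1 ∈ S ∧ q.2 ∈ Eu q.1} ∧
    (∀ x ∈ S, (Es x).map (fderiv ℂ H.toFun x : (ℂ × ℂ) →ₗ[ℂ] (ℂ × ℂ)) = Es (H.toFun x)) ∧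
    (∀ x ∈ S, (Eu x).map (fderiv ℂ H.toFun x : (ℂ × ℂ) →ₗ[ℂ] (ℂ × ℂ)) = Eu (H.toFun x)) ∧
    (∀ x ∈ S, ∀ v ∈ Es x, ∀ n : ℕ, 1 ≤ n →
      ‖fderiv ℂ (H.toFun^[n]) x v‖ ≤ (lam ^ n / c) * ‖v‖) ∧
    (∀ x ∈ S, ∀ v ∈ Eu x, ∀ n : ℕ, 1 ≤ n →
      ‖fderiv ℂ (H.toFun^[n]) x v‖ ≥ (c / lam ^ n) * ‖v‖)

/-- `p ∈ J*` is weakly stably exposed: there are a parametrization `Φ` of `W^s_p` and a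
nonempty simply connected open set `V ⊂ ℂ` with `0 ∈ ∂V`, `∂V ⊂ J*_{p,s}` and
`Φ(V) ⊂ K ∖ J*`. -/
def WeaklyStablyExposed (H : HenonMap) (p : ℂ × ℂ) : Prop :=
  ∃ (Φ : ℂ → ℂ × ℂ) (V : Set ℂ), IsStableParam H p Φ ∧
    V.Nonempty ∧ IsOpen V ∧ SimplyConnectedSpace V ∧
    (0 : ℂ) ∈ frontier V ∧ frontier V ⊆ Φ ⁻¹' Jstar H ∧
    Φ '' V ⊆ (Kplus H ∩ Kminus H) \ Jstar H

/-- `p ∈ J*` is weakly unstably exposed. -/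
def WeaklyUnstablyExposed (H : HenonMap) (p : ℂ × ℂ) : Prop :=
  ∃ (Ψ : ℂ → ℂ × ℂ) (V : Set ℂ), IsUnstableParam H p Ψ ∧
    V.Nonempty ∧ IsOpen V ∧ SimplyConnectedSpace V ∧
    (0 : ℂ) ∈ frontier V ∧ frontier V ⊆ Ψ ⁻¹' Jstar H ∧
    Ψ '' V ⊆ (Kplus H ∩ Kminus H) \ Jstar H

namespace HenonAux

/-- Mean value over the unit circle. -/
def av (f : ℂ → ℝ) : ℝ := Real.circleAverage f 0 1

lemma circleIntegrable_of_sphere {f : ℂ → ℝ} (hf : ContinuousOn f (sphere 0 1)) :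
    CircleIntegrable f 0 1 :=
  ContinuousOn.circleIntegrable (by norm_num) hf

lemma av_mono {f g : ℂ → ℝ} (hf : ContinuousOn f (sphere 0 1)) (hg : ContinuousOn g (sphere 0 1))
    (h : ∀ ζ : ℂ, ‖ζ‖ = 1 → f ζ ≤ g ζ) : av f ≤ av g := by
  refine Real.circleAverage_mono (circleIntegrable_of_sphere hf) (circleIntegrable_of_sphere hg) ?_
  intro x hx
  exact h x (by simpa using hx)

lemma av_const (a : ℝ) : av (fun _ => a) = a := Real.circleAverage_const a 0 1

lemma av_le {f : ℂ → ℝ} {a : ℝ} (hf : ContinuousOn f (sphere 0 1))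
    (h : ∀ ζ : ℂ, ‖ζ‖ = 1 → f ζ ≤ a) : av f ≤ a := by
  have := av_mono hf continuousOn_const h
  rwa [av_const] at this

lemma le_av {f : ℂ → ℝ} {a : ℝ} (hf : ContinuousOn f (sphere 0 1))
    (h : ∀ ζ : ℂ, ‖ζ‖ = 1 → a ≤ f ζ) : a ≤ av f := by
  have := av_mono continuousOn_const hf h
  rwa [av_const] at this

lemma av_add {f g : ℂ → ℝ} (hf : ContinuousOn f (sphere 0 1)) (hg : ContinuousOn g (sphere 0 1)) :
    av (fun ζ => f ζ + g ζ) = av f + av g :=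
  Real.circleAverage_fun_add (circleIntegrable_of_sphere hf) (circleIntegrable_of_sphere hg)

lemma av_sub {f g : ℂ → ℝ} (hf : ContinuousOn f (sphere 0 1)) (hg : ContinuousOn g (sphere 0 1)) :
    av (fun ζ => f ζ - g ζ) = av f - av g :=
  Real.circleAverage_fun_sub (circleIntegrable_of_sphere hf) (circleIntegrable_of_sphere hg)

lemma av_mul (a : ℝ) (f : ℂ → ℝ) : av (fun ζ => a * f ζ) = a * av f :=
  Real.circleAverage_fun_smul (a := a) (f := f) (c := (0 : ℂ)) (R := 1)

lemma av_congr {f g : ℂ → ℝ} (h : ∀ ζ : ℂ, ‖ζ‖ = 1 → f ζ = g ζ) : av f = av g := by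
  refine Real.circleAverage_congr_sphere ?_
  intro x hx
  exact h x (by simpa using hx)

lemma av_re {f : ℂ → ℂ} (hf : DifferentiableOn ℂ f (closedBall 0 1)) :
    av (fun ζ => (f ζ).re) = (f 0).re := by
  have h1 : DiffContOnCl ℂ f (ball 0 |1|) := by
    refine DifferentiableOn.diffContOnCl ?_
    rw [abs_one, closure_ball _ one_ne_zero]
    exact hf
  have h2 := h1.circleAverage
  have hc : CircleIntegrable f 0 1 :=
    ContinuousOn.circleIntegrable (by norm_num) (hf.continuousOn.mono sphere_subset_closedBall)
  have h3 := Complex.reCLM.circleAverage_comp_comm hc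
  rw [h2] at h3
  exact h3

lemma av_log {f : ℂ → ℂ} (hf : AnalyticOnNhd ℂ f (closedBall 0 1))
    (h0 : ∀ ζ ∈ closedBall (0 : ℂ) 1, f ζ ≠ 0) :
    av (fun ζ => Real.log ‖f ζ‖) = Real.log ‖f 0‖ := by
  refine AnalyticOnNhd.circleAverage_log_norm_of_ne_zero ?_ ?_
  · simpa using hf
  · simpa using h0

/-- A maximum principle along complex discs. -/
lemma exists_isMaxOn_of_submean {E : Type*} [NormedAddCommGroup E] [NormedSpace ℂ E] {K : Set E}
    (hK : IsCompact K) (hne : K.Nonempty) {q : E → ℝ} (hq : ContinuousOn q K) (B : E → Prop)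
    (hI : ∀ x ∈ K, ¬ B x → ∃ ν : E, (∀ ζ : ℂ, ‖ζ‖ = 1 → x + ζ • ν ∈ K) ∧
      q x < av (fun ζ => q (x + ζ • ν))) :
    ∃ x ∈ K, B x ∧ ∀ y ∈ K, q y ≤ q x := by
  obtain ⟨x, hx, hmax⟩ := hK.exists_isMaxOn hne hq
  refine ⟨x, hx, ?_, fun y hy => hmax hy⟩
  by_contra hB
  obtain ⟨ν, h1, h2⟩ := hI x hx hB
  refine absurd h2 (not_lt.mpr (av_le ?_ fun ζ hζ => hmax (h1 ζ hζ)))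
  refine hq.comp (by fun_prop) fun ζ hζ => h1 ζ (by simpa using hζ)

/-- Mean value property on small circles. -/
def MV (g : ℂ → ℝ) (x : ℂ) : Prop :=
  ∃ r > 0, ∀ ν : ℂ, ‖ν‖ < r → av (fun ζ => g (x + ζ * ν)) = g x

/-- Continuous, nonnegative, harmonic where positive. -/
structure PosHarm (g : ℂ → ℝ) (U : Set ℂ) : Prop where
  cont : ContinuousOn g U
  nonneg : ∀ x ∈ U, 0 ≤ g x
  mv : ∀ x ∈ U, 0 < g x → MV g x

lemma PosHarm.mono {g : ℂ → ℝ} {U V : Set ℂ} (h : PosHarm g U) (hV : V ⊆ U) : PosHarm g V :=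
  ⟨h.cont.mono hV, fun x hx => h.nonneg x (hV hx), fun x hx => h.mv x (hV hx)⟩

lemma add_mul_mem_ball {x ν ζ : ℂ} {r : ℝ} (hν : ‖ν‖ < r) (hζ : ‖ζ‖ = 1) :
    x + ζ * ν ∈ ball x r := by
  simp [mem_ball, dist_eq_norm, hζ, hν]

lemma continuousOn_circle {g : ℂ → ℝ} {x ν : ℂ} {r : ℝ} (hg : ContinuousOn g (ball x r))
    (hν : ‖ν‖ < r) : ContinuousOn (fun ζ => g (x + ζ * ν)) (sphere 0 1) :=
  hg.comp (by fun_prop) fun ζ hζ => add_mul_mem_ball hν (by simpa using hζ)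

lemma PosHarm.submean {g : ℂ → ℝ} {U : Set ℂ} (h : PosHarm g U) (hU : IsOpen U) {x : ℂ}
    (hx : x ∈ U) : ∃ r > 0, ball x r ⊆ U ∧ ∀ ν : ℂ, ‖ν‖ < r →
      g x ≤ av (fun ζ => g (x + ζ * ν)) ∧ (0 < g x → av (fun ζ => g (x + ζ * ν)) = g x) := by
  obtain ⟨r, hr, hrU⟩ := Metric.isOpen_iff.1 hU x hx
  by_cases hg : 0 < g x
  · obtain ⟨r', hr', h'⟩ := h.mv x hx hg
    refine ⟨min r r', lt_min hr hr', (ball_subset_ball (min_le_left _ _)).trans hrU, fun ν hν => ?_⟩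
    have := h' ν (hν.trans_le (min_le_right _ _))
    exact ⟨this.ge, fun _ => this⟩
  · refine ⟨r, hr, hrU, fun ν hν => ⟨?_, fun h => absurd h hg⟩⟩
    refine (not_lt.1 hg).trans (le_av (continuousOn_circle (h.cont.mono hrU) hν) fun ζ hζ => ?_)
    exact h.nonneg _ (hrU (add_mul_mem_ball hν hζ))

/-- Strictly subharmonic comparison functions. -/
def Barrier (κ : ℂ → ℝ) : Prop :=
  Continuous κ ∧ ∃ c > 0, ∀ x ν : ℂ, κ x + c * ‖ν‖ ^ 2 ≤ av (fun ζ => κ (x + ζ * ν))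

/-- Circle means of quadratic polynomials. -/
lemma barrier_quadratic_av (a : ℝ) (β γ : ℂ) (b : ℝ) (x₀ x ν : ℂ) :
    av (fun ζ => a + (β * (x + ζ * ν - x₀)).re + (γ * (x + ζ * ν - x₀) ^ 2).re
      + b * ‖x + ζ * ν - x₀‖ ^ 2) =
    a + (β * (x - x₀)).re + (γ * (x - x₀) ^ 2).re + b * ‖x - x₀‖ ^ 2 + b * ‖ν‖ ^ 2 := by
  set P : ℂ → ℂ := fun ζ => (a : ℂ) + β * (x + ζ * ν - x₀) + γ * (x + ζ * ν - x₀) ^ 2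
    + b * (‖x - x₀‖ ^ 2 + ‖ν‖ ^ 2 : ℝ) + 2 * b * ((starRingEnd ℂ) (x - x₀) * (ζ * ν)) with hP
  have h1 : av (fun ζ => (P ζ).re) = (P 0).re := by
    refine av_re ?_
    rw [hP]
    fun_prop
  have h2 : av (fun ζ => a + (β * (x + ζ * ν - x₀)).re + (γ * (x + ζ * ν - x₀) ^ 2).re
      + b * ‖x + ζ * ν - x₀‖ ^ 2) = av (fun ζ => (P ζ).re) := by
    refine av_congr fun ζ hζ => ?_
    have e1 : ‖x + ζ * ν - x₀‖ ^ 2 = ‖x - x₀‖ ^ 2 + ‖ν‖ ^ 2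
        + 2 * ((starRingEnd ℂ) (x - x₀) * (ζ * ν)).re := by
      have : x + ζ * ν - x₀ = (x - x₀) + ζ * ν := by ring
      rw [this, ← Complex.normSq_eq_norm_sq, Complex.normSq_add, Complex.normSq_eq_norm_sq,
        Complex.normSq_eq_norm_sq, norm_mul, hζ, one_mul]
      congr 2
      simp [Complex.mul_re]
      ring
    rw [e1]
    simp only [hP, Complex.add_re, Complex.ofReal_re]
    have e2 : ((b : ℂ) * ((‖x - x₀‖ ^ 2 + ‖ν‖ ^ 2 : ℝ) : ℂ)).re = b * (‖x - x₀‖ ^ 2 + ‖ν‖ ^ 2) := by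
      rw [← Complex.ofReal_mul, Complex.ofReal_re]
    have e3 : (2 * (b : ℂ) * ((starRingEnd ℂ) (x - x₀) * (ζ * ν))).re
        = 2 * b * ((starRingEnd ℂ) (x - x₀) * (ζ * ν)).re := by
      rw [← Complex.re_ofReal_mul]; push_cast; rfl
    rw [e2, e3]; ring
  rw [h2, h1]
  simp only [hP, Complex.add_re, Complex.ofReal_re, zero_mul, mul_zero, add_zero]
  have e2 : ((b : ℂ) * ((‖x - x₀‖ ^ 2 + ‖ν‖ ^ 2 : ℝ) : ℂ)).re = b * (‖x - x₀‖ ^ 2 + ‖ν‖ ^ 2) := by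
    rw [← Complex.ofReal_mul, Complex.ofReal_re]
  rw [e2]
  ring

/-- Quadratic polynomials with positive Laplacian are barriers. -/
lemma barrier_quadratic (a : ℝ) (β γ : ℂ) {b : ℝ} (hb : 0 < b) (x₀ : ℂ) :
    Barrier (fun x => a + (β * (x - x₀)).re + (γ * (x - x₀) ^ 2).re + b * ‖x - x₀‖ ^ 2) :=
  ⟨by fun_prop, b, hb, fun x ν => (barrier_quadratic_av a β γ b x₀ x ν).ge⟩

lemma submean_sub_barrier {g κ : ℂ → ℝ} {U : Set ℂ} (hg : PosHarm g U) (hU : IsOpen U)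
    (hκ : Barrier κ) {x : ℂ} (hx : x ∈ U) (hpos : 0 < g x) {W : Set ℂ} (hW : W ∈ 𝓝 x) :
    ∃ ν : ℂ, (∀ ζ : ℂ, ‖ζ‖ = 1 → x + ζ • ν ∈ W) ∧
      κ x - g x < av (fun ζ => κ (x + ζ • ν) - g (x + ζ • ν)) := by
  obtain ⟨r, hr, hrU, h⟩ := hg.submean hU hx
  obtain ⟨r', hr', hW'⟩ := Metric.mem_nhds_iff.1 hW
  obtain ⟨hκc, c, hc, hκ'⟩ := hκ
  set ν : ℂ := ((min r r' / 2 : ℝ) : ℂ)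
  have hm : 0 < min r r' := lt_min hr hr'
  have hν : ‖ν‖ = min r r' / 2 := by
    rw [Complex.norm_real, Real.norm_of_nonneg (by positivity)]
  have hν1 : ‖ν‖ < r := by have := min_le_left r r'; linarith
  have hν2 : ‖ν‖ < r' := by have := min_le_right r r'; linarith
  refine ⟨ν, fun ζ hζ => hW' (by simpa [smul_eq_mul] using add_mul_mem_ball (x := x) hν2 hζ), ?_⟩
  simp only [smul_eq_mul]
  rw [av_sub (by fun_prop) (continuousOn_circle (hg.cont.mono hrU) hν1), ((h ν hν1).2 hpos)]
  have := hκ' x ν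
  have : 0 < c * ‖ν‖ ^ 2 := by rw [hν]; positivity
  linarith

/-- A barrier lying below `g` on a circle but not inside forces a zero of `g`. -/
lemma exists_zero_of_barrier {g κ : ℂ → ℝ} {U : Set ℂ} (hg : PosHarm g U) (hU : IsOpen U)
    (hκ : Barrier κ) {c : ℂ} {ρ : ℝ} (hcU : closedBall c ρ ⊆ U)
    (hb : ∀ x ∈ sphere c ρ, κ x < g x) {ξ : ℂ} (hξ : ξ ∈ closedBall c ρ) (h : g ξ < κ ξ) :
    ∃ s ∈ ball c ρ, g s = 0 ∧ 0 < κ s ∧ ∀ x ∈ closedBall c ρ, κ x - g x ≤ κ s := by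
  obtain ⟨s, hs, hB, hmax⟩ := exists_isMaxOn_of_submean (isCompact_closedBall c ρ) ⟨ξ, hξ⟩
    (q := fun x => κ x - g x) (hκ.1.continuousOn.sub (hg.cont.mono hcU))
    (fun x => x ∈ sphere c ρ ∨ g x = 0) (by
      intro x hx hxB
      push Not at hxB
      refine submean_sub_barrier hg hU hκ (hcU hx)
        (lt_of_le_of_ne (hg.nonneg x (hcU hx)) (Ne.symm hxB.2)) (closedBall_mem_nhds_of_mem ?_)
      rw [mem_ball]
      exact lt_of_le_of_ne hx hxB.1)
  have h1 := hmax ξ hξ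
  have h2 : s ∉ sphere c ρ := fun hs' => by
    have := hb s hs'
    linarith
  have h3 : g s = 0 := hB.resolve_left h2
  simp only [h3, sub_zero] at h1 hmax
  exact ⟨s, lt_of_le_of_ne hs h2, h3, by linarith, hmax⟩

/-- `ξ` is a zero on the boundary of a disc on which `g` is positive. -/
def Touched (g : ℂ → ℝ) (U : Set ℂ) (ξ : ℂ) : Prop :=
  ξ ∈ U ∧ g ξ = 0 ∧ ∃ s : ℂ, ∃ η > 0, dist ξ s = η ∧ ∀ x ∈ ball s η, x ∈ U ∧ 0 < g x

/-- `ξ` is a zero in the closure of the positivity set. -/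
def EdgeZero (g : ℂ → ℝ) (U : Set ℂ) (ξ : ℂ) : Prop :=
  ξ ∈ U ∧ g ξ = 0 ∧ ξ ∈ closure {x | x ∈ U ∧ 0 < g x}

lemma touched_core {g : ℂ → ℝ} {U : Set ℂ} (hg : PosHarm g U) {ξ s : ℂ} {η ρ : ℝ}
    (hη : 0 < η) (hs : dist ξ s = η) (hpos : ∀ x ∈ ball s η, x ∈ U ∧ 0 < g x)
    (hρ : 0 < ρ) (hρη : ρ < η / 2) (hρU : closedBall ξ ρ ⊆ U) :
    ∃ κ : ℂ → ℝ, (∀ a : ℝ, Barrier (fun x => a + κ x)) ∧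
      κ ξ = 0 ∧ (∀ x ∈ sphere ξ ρ, κ x < g x) ∧
      (∀ x ∈ closedBall ξ ρ, dist x s = η → κ x ≤ 0) ∧
      ∃ c > 0, ∀ r ∈ Icc 0 ρ, ∃ x ∈ closedBall s η, dist x ξ = r ∧ c * r ≤ κ x := by
  set ν : ℂ := (ξ - s) / η with hν
  have hν1 : ‖ν‖ = 1 := by
    rw [hν, norm_div, ← dist_eq_norm, hs, Complex.norm_real, Real.norm_of_nonneg hη.le,
      div_self hη.ne']
  have hνν : (starRingEnd ℂ) ν * ν = 1 := by
    rw [mul_comm, Complex.mul_conj, Complex.normSq_eq_norm_sq, hν1]; norm_num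
  have hsξ : ξ - s = η * ν := by
    have : (η : ℂ) ≠ 0 := Complex.ofReal_ne_zero.2 hη.ne'
    rw [hν]; field_simp
  set w : ℂ → ℂ := fun x => (starRingEnd ℂ) ν * (x - ξ) with hw
  have hwn : ∀ x, ‖w x‖ = dist x ξ := fun x => by
    rw [hw]; simp only [norm_mul, RCLike.norm_conj, hν1, one_mul, dist_eq_norm]
  have hws : ∀ x, ‖w x + η‖ = dist x s := fun x => by
    have : w x + η = (starRingEnd ℂ) ν * (x - s) := by
      have : x - s = (x - ξ) + η * ν := by rw [← hsξ]; ring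
      rw [this, mul_add, hw]
      linear_combination (-(η : ℂ)) * hνν
    rw [this, norm_mul, RCLike.norm_conj, hν1, one_mul, dist_eq_norm]
  have hwn2 : ∀ x, (w x).re ^ 2 + (w x).im ^ 2 = dist x ξ ^ 2 := fun x => by
    rw [← hwn, ← Complex.normSq_eq_norm_sq, Complex.normSq_apply]; ring
  have hws2 : ∀ x, ((w x).re + η) ^ 2 + (w x).im ^ 2 = dist x s ^ 2 := fun x => by
    rw [← hws, ← Complex.normSq_eq_norm_sq, Complex.normSq_apply]; simp; ring
  set k : ℂ → ℝ := fun x => -(w x).re + (2 * (w x).re ^ 2 - (w x).im ^ 2) / η with hk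
  have hkc : Continuous k := by rw [hk]; fun_prop
  have hbar : ∀ e > 0, ∀ a : ℝ, Barrier (fun x => a + e * k x) := by
    intro e he a
    have hb : 0 < e / (2 * η) := by positivity
    convert barrier_quadratic a (-e * (starRingEnd ℂ) ν)
      ((e * (3 / (2 * η)) : ℝ) * (starRingEnd ℂ) ν ^ 2) hb ξ using 2 with x
    have e1 : (-(e : ℂ) * (starRingEnd ℂ) ν * (x - ξ)).re = -e * (w x).re := by
      rw [← Complex.re_ofReal_mul]; simp only [hw]; congr 1; push_cast; ring
    have e2 : (((e * (3 / (2 * η)) : ℝ) : ℂ) * (starRingEnd ℂ) ν ^ 2 * (x - ξ) ^ 2).re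
        = (e * (3 / (2 * η))) * ((w x).re ^ 2 - (w x).im ^ 2) := by
      have : ((w x) ^ 2).re = (w x).re ^ 2 - (w x).im ^ 2 := by simp [sq]
      rw [← this, ← Complex.re_ofReal_mul]; simp only [hw]; congr 1; ring
    rw [e1, e2, ← dist_eq_norm, ← hwn2 x, hk]
    field_simp
    ring
  have hsph : ∀ x ∈ sphere ξ ρ, k x < 0 ∨ x ∈ ball s η := by
    intro x hx
    by_contra hcon
    push Not at hcon
    obtain ⟨h1, h2⟩ := hcon
    rw [mem_ball, not_lt] at h2
    rw [mem_sphere] at hx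
    have h3 := hwn2 x
    have h4 := hws2 x
    rw [hx] at h3
    have h5 : η ^ 2 ≤ dist x s ^ 2 := by gcongr
    set X := (w x).re
    set Y := (w x).im
    have h6 : -ρ ^ 2 ≤ 2 * η * X := by nlinarith
    have h7 : 0 ≤ -X * η + (2 * X ^ 2 - Y ^ 2) := by
      have : k x = (-X * η + (2 * X ^ 2 - Y ^ 2)) / η := by
        rw [hk]; simp only [X, Y]; field_simp
      rw [this] at h1
      by_contra hneg
      exact absurd (div_neg_of_neg_of_pos (not_le.1 hneg) hη) (not_lt.2 h1)
    have h8 : X ^ 2 ≤ ρ ^ 2 := by nlinarith [sq_nonneg Y]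
    have h9 : X ≤ ρ := abs_le_of_sq_le_sq' h8 hρ.le |>.2
    -- convexity on the chord
    have h10 : 0 ≤ -X * η + 3 * X ^ 2 - ρ ^ 2 := by nlinarith
    by_cases hX : 0 ≤ X
    · rcases h9.lt_or_eq with h | h
      · have h11 : 0 < (3 * X + ρ) * (ρ - X) := mul_pos (by positivity) (by linarith)
        have h12 : 0 ≤ X * (η - 2 * ρ) := mul_nonneg hX (by linarith)
        nlinarith
      · rw [h] at h10
        nlinarith
    · push Not at hX
      have h11 : (2 * η * X) ^ 2 ≤ (ρ ^ 2) ^ 2 := by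
        apply sq_le_sq' h6; nlinarith [sq_nonneg ρ, mul_pos hη (neg_pos.2 hX)]
      have h12 : 4 * η ^ 2 * X ^ 2 ≤ ρ ^ 2 * (η ^ 2 / 4) := by
        have h13 : ρ ^ 2 ≤ η ^ 2 / 4 := by nlinarith
        have h14 := mul_le_mul_of_nonneg_left h13 (sq_nonneg ρ)
        nlinarith
      have h13 : X ^ 2 ≤ ρ ^ 2 / 16 := by
        have : η ^ 2 * (16 * X ^ 2) ≤ η ^ 2 * ρ ^ 2 := by nlinarith
        have := le_of_mul_le_mul_left this (by positivity)
        linarith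
      nlinarith
  obtain ⟨e, he, hlt⟩ : ∃ e > 0, ∀ x ∈ sphere ξ ρ, e * k x < g x := by
    set T := sphere ξ ρ ∩ {x | 0 ≤ k x} with hT
    have hTc : IsCompact T := (isCompact_sphere ξ ρ).inter_right (isClosed_le continuous_const hkc)
    have hgc : ContinuousOn g T :=
      hg.cont.mono fun x hx => hρU (sphere_subset_closedBall hx.1)
    obtain ⟨m, hm, hmT⟩ : ∃ m > 0, ∀ x ∈ T, m ≤ g x := by
      rcases T.eq_empty_or_nonempty with h | h
      · exact ⟨1, one_pos, by simp [h]⟩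
      · obtain ⟨x, hx, hmin⟩ := hTc.exists_isMinOn h hgc
        refine ⟨g x, (hpos x ((hsph x hx.1).resolve_left (not_lt.2 hx.2))).2, fun y hy => hmin hy⟩
    obtain ⟨C, hC⟩ := hTc.exists_bound_of_continuousOn hkc.continuousOn
    refine ⟨m / (2 * (|C| + 1)), by positivity, fun x hx => ?_⟩
    by_cases hkx : 0 ≤ k x
    · have h1 := hC x ⟨hx, hkx⟩
      rw [Real.norm_of_nonneg hkx] at h1
      have h2 := hmT x ⟨hx, hkx⟩
      have h3 : m / (2 * (|C| + 1)) * k x ≤ m / (2 * (|C| + 1)) * (|C| + 1) := by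
        gcongr
        linarith [le_abs_self C]
      have h4 : m / (2 * (|C| + 1)) * (|C| + 1) = m / 2 := by field_simp
      linarith
    · have h1 : m / (2 * (|C| + 1)) * k x < 0 := mul_neg_of_pos_of_neg (by positivity) (not_le.1 hkx)
      exact h1.trans_le (hg.nonneg x (hρU (sphere_subset_closedBall hx)))
  refine ⟨fun x => e * k x, hbar e he, by simp [hk, hw], hlt, ?_, e, he, ?_⟩
  · intro x hx hxs
    refine mul_nonpos_of_nonneg_of_nonpos he.le ?_
    have h3 := hwn2 x
    have h4 := hws2 x
    rw [hxs] at h4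
    have h5 : dist x ξ ^ 2 ≤ ρ ^ 2 := by
      have : dist x ξ ≤ ρ := hx
      gcongr
    have : k x = (-(w x).re * η + (2 * (w x).re ^ 2 - (w x).im ^ 2)) / η := by
      rw [hk]; field_simp
    rw [this]
    refine div_nonpos_of_nonpos_of_nonneg ?_ hη.le
    set X := (w x).re
    set Y := (w x).im
    have h6 : 2 * η * X = - dist x ξ ^ 2 := by linarith
    have h7 : X ≤ 0 := by nlinarith [sq_nonneg (dist x ξ)]
    have h8 : Y ^ 2 = -(2 * η * X) - X ^ 2 := by linarith
    rw [h8]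
    have h9 : -ρ ^ 2 ≤ 2 * η * X := by linarith
    have h10 : 0 ≤ η + 3 * X := by nlinarith
    nlinarith
  · intro r hr
    refine ⟨ξ - r * ν, ?_, ?_, ?_⟩
    · rw [mem_closedBall, dist_eq_norm]
      have : ξ - r * ν - s = ((η - r : ℝ) : ℂ) * ν := by
        push_cast; linear_combination hsξ
      rw [this, norm_mul, hν1, mul_one, Complex.norm_real, Real.norm_of_nonneg]
      · linarith [hr.1]
      · linarith [hr.2]
    · rw [dist_eq_norm]
      simp [hν1, abs_of_nonneg hr.1]
    · refine mul_le_mul_of_nonneg_left ?_ he.le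
      have : w (ξ - r * ν) = ((-r : ℝ) : ℂ) := by
        simp only [hw]; push_cast; linear_combination (-(r : ℂ)) * hνν
      rw [hk]; simp only [this, Complex.ofReal_re, Complex.ofReal_im]
      have : 0 ≤ (2 * (-r) ^ 2 - 0 ^ 2) / η := div_nonneg (by nlinarith [sq_nonneg r]) hη.le
      linarith

lemma av_affine {f g : ℂ → ℝ} (hf : ContinuousOn f (sphere 0 1)) (hg : ContinuousOn g (sphere 0 1))
    (m e : ℝ) : av (fun ζ => m + e * (f ζ + g ζ)) = m + e * (av f + av g) := by
  rw [← av_add hf hg, ← av_mul]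
  have := av_add (f := fun _ => m) (g := fun ζ => e * (f ζ + g ζ)) continuousOn_const
    (continuousOn_const.mul (hf.add hg))
  rwa [av_const] at this

lemma Touched.barrier {g : ℂ → ℝ} {U : Set ℂ} (hg : PosHarm g U) (hU : IsOpen U) {ξ : ℂ}
    (h : Touched g U ξ) : ∃ ρ₀ > 0, ∀ ρ, 0 < ρ → ρ < ρ₀ → closedBall ξ ρ ⊆ U ∧
      ∃ κ : ℂ → ℝ, Barrier κ ∧ 0 < κ ξ ∧ ∀ x ∈ sphere ξ ρ, κ x < g x := by
  obtain ⟨hξ, hgξ, s, η, hη, hs, hpos⟩ := h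
  obtain ⟨r, hr, hrU⟩ := Metric.isOpen_iff.1 hU ξ hξ
  refine ⟨min r (η / 2), by positivity, fun ρ hρ hρ0 => ?_⟩
  have hρU : closedBall ξ ρ ⊆ U :=
    (closedBall_subset_ball (hρ0.trans_le (min_le_left _ _))).trans hrU
  obtain ⟨κ, hbar, h0, hlt, -⟩ :=
    touched_core hg hη hs hpos hρ (hρ0.trans_le (min_le_right _ _)) hρU
  refine ⟨hρU, ?_⟩
  have hκc : Continuous κ := by simpa using (hbar 0).1
  obtain ⟨x, hx, hmin⟩ := (isCompact_sphere ξ ρ).exists_isMinOn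
    (NormedSpace.sphere_nonempty.2 hρ.le) ((hg.cont.mono (sphere_subset_closedBall.trans hρU)).sub
      hκc.continuousOn)
  have hm := hlt x hx
  refine ⟨fun y => (g x - κ x) / 2 + κ y, hbar _, by simp [h0]; linarith, fun y hy => ?_⟩
  have this : g x - κ x ≤ g y - κ y := hmin hy
  linarith

lemma Touched.growth {g : ℂ → ℝ} {U : Set ℂ} (hg : PosHarm g U) (hU : IsOpen U) {ξ : ℂ}
    (h : Touched g U ξ) : ∃ c > 0, ∃ ρ > 0, closedBall ξ ρ ⊆ U ∧ ∀ r ∈ Icc 0 ρ,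
      ∃ x ∈ closedBall ξ r, c * r ≤ g x := by
  obtain ⟨hξ, hgξ, s, η, hη, hs, hpos⟩ := h
  obtain ⟨r, hr, hrU⟩ := Metric.isOpen_iff.1 hU ξ hξ
  set ρ := min r (η / 2) / 2 with hρdef
  have hm : 0 < min r (η / 2) := by positivity
  have hρ : 0 < ρ := by positivity
  have hρ1 : ρ < r := by have := min_le_left r (η / 2); linarith
  have hρ2 : ρ < η / 2 := by have := min_le_right r (η / 2); linarith
  have hρU : closedBall ξ ρ ⊆ U := (closedBall_subset_ball hρ1).trans hrU
  obtain ⟨κ, hbar, h0, hlt, hle, c, hc, hgr⟩ := touched_core hg hη hs hpos hρ hρ2 hρU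
  have hκ : Barrier κ := by simpa using hbar 0
  refine ⟨c, hc, ρ, hρ, hρU, fun t ht => ?_⟩
  obtain ⟨x, hx, hxt, hcx⟩ := hgr t ht
  refine ⟨x, by simp [hxt], hcx.trans ?_⟩
  set K := closedBall s η ∩ closedBall ξ ρ
  have hxK : x ∈ K := ⟨hx, by rw [mem_closedBall, hxt]; exact ht.2⟩
  obtain ⟨y, hy, hB, hmax⟩ := exists_isMaxOn_of_submean
    ((isCompact_closedBall s η).inter_right isClosed_closedBall) ⟨x, hxK⟩
    (q := fun x => κ x - g x) (hκ.1.continuousOn.sub (hg.cont.mono fun x hx => hρU hx.2))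
    (fun x => κ x - g x ≤ 0) (by
      intro x hx hxB
      have hxs : x ∈ ball s η := by
        refine mem_ball.2 <| lt_of_le_of_ne (mem_closedBall.1 hx.1) fun h => hxB ?_
        have := hle x hx.2 h
        have := hg.nonneg x (hρU hx.2)
        linarith
      have hxξ : x ∈ ball ξ ρ := by
        refine mem_ball.2 <| lt_of_le_of_ne (mem_closedBall.1 hx.2) fun h => hxB ?_
        have := hlt x h
        linarith
      refine submean_sub_barrier hg hU hκ (hρU hx.2) (hpos x hxs).2 ?_
      exact inter_mem (closedBall_mem_nhds_of_mem hxs) (closedBall_mem_nhds_of_mem hxξ))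
  have := hmax x hxK
  linarith

lemma EdgeZero.exists_touched {g : ℂ → ℝ} {U : Set ℂ} (hg : ContinuousOn g U) (h0 : ∀ x ∈ U, 0 ≤ g x)
    (hU : IsOpen U) {ξ : ℂ}
    (h : EdgeZero g U ξ) {ρ : ℝ} (hρ : 0 < ρ) : ∃ ξ', dist ξ' ξ < ρ ∧ Touched g U ξ' := by
  obtain ⟨hξ, hgξ, hcl⟩ := h
  obtain ⟨r, hr, hrU⟩ := Metric.isOpen_iff.1 hU ξ hξ
  set r' := min r ρ / 3
  have hm : 0 < min r ρ := lt_min hr hρ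
  have hr' : 0 < r' := by positivity
  obtain ⟨x, ⟨hxU, hxpos⟩, hx⟩ := Metric.mem_closure_iff.1 hcl r' hr'
  have hsub : closedBall x r' ⊆ ball ξ (min r ρ) := by
    intro y hy
    rw [mem_ball]
    have := dist_triangle y x ξ
    rw [mem_closedBall] at hy
    rw [dist_comm x ξ] at this
    simp only [r'] at *
    linarith
  have hsubU : closedBall x r' ⊆ U := hsub.trans ((ball_subset_ball (min_le_left _ _)).trans hrU)
  have hcZ : IsCompact (closedBall x r' ∩ g ⁻¹' {0}) := by
    refine (isCompact_closedBall x r').of_isClosed_subset ?_ inter_subset_left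
    exact (hg.mono hsubU).preimage_isClosed_of_isClosed isClosed_closedBall isClosed_singleton
  obtain ⟨ξ', hξ', hmin⟩ := hcZ.exists_isMinOn ⟨ξ, hx.le, hgξ⟩
    (f := fun y => dist y x) (by fun_prop)
  refine ⟨ξ', lt_of_lt_of_le (hsub hξ'.1) (min_le_right _ _), hsubU hξ'.1, hξ'.2, x, dist ξ' x, ?_,
    rfl, fun y hy => ?_⟩
  · refine dist_pos.2 ?_
    rintro rfl
    exact hxpos.ne' hξ'.2
  · have hyc : y ∈ closedBall x r' := (mem_ball.1 hy).le.trans hξ'.1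
    refine ⟨hsubU hyc, lt_of_le_of_ne (h0 y (hsubU hyc)) fun h => ?_⟩
    have this : dist ξ' x ≤ dist y x := hmin ⟨hyc, h.symm⟩
    exact absurd hy (not_lt.2 this)

lemma exists_edgeZero {g : ℂ → ℝ} {U S : Set ℂ} (hg : ContinuousOn g U) (h0 : ∀ x ∈ U, 0 ≤ g x)
    (hU : IsOpen U) (hS : IsPreconnected S) (hSU : S ⊆ U) {x y : ℂ} (hx : x ∈ S) (hy : y ∈ S)
    (hgx : g x = 0) (hgy : 0 < g y) : ∃ ξ ∈ S, EdgeZero g U ξ := by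
  have hopen : IsOpen {x | x ∈ U ∧ 0 < g x} := hg.isOpen_inter_preimage hU isOpen_Ioi
  by_contra! hcon
  have hcl : ∀ ξ ∈ S, ξ ∈ closure {x | x ∈ U ∧ 0 < g x} → ξ ∈ {x | x ∈ U ∧ 0 < g x} := by
    intro ξ hξS hξ
    refine ⟨hSU hξS, lt_of_le_of_ne (h0 ξ (hSU hξS)) fun h => ?_⟩
    exact hcon ξ hξS ⟨hSU hξS, h.symm, hξ⟩
  obtain ⟨ξ, -, h1, h2⟩ := hS _ _ hopen isClosed_closure.isOpen_compl (by
      intro ξ hξ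
      by_cases h : ξ ∈ closure {x | x ∈ U ∧ 0 < g x}
      · exact Or.inl (hcl ξ hξ h)
      · exact Or.inr h) ⟨y, hy, hSU hy, hgy⟩ ⟨x, hx, fun h => (hcl x hx h).2.ne' hgx⟩
  exact h2 (subset_closure h1)

lemma not_isolated_zero {g : ℂ → ℝ} {U : Set ℂ} (hg : PosHarm g U) (hU : IsOpen U) {ξ : ℂ} {r : ℝ}
    (hr : 0 < r) (hrU : closedBall ξ r ⊆ U) (hpos : ∀ x ∈ closedBall ξ r, x ≠ ξ → 0 < g x) :
    0 < g ξ := by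
  obtain ⟨y, hy, hmin⟩ := (isCompact_sphere ξ r).exists_isMinOn
    (NormedSpace.sphere_nonempty.2 hr.le) (hg.cont.mono (sphere_subset_closedBall.trans hrU))
  set m := g y
  have hm : 0 < m := hpos y (sphere_subset_closedBall hy) (by
    rintro rfl; simp [hr.ne] at hy)
  have hfar : ∀ x ∈ closedBall ξ r, x ≠ ξ → m ≤ g x := by
    intro x hx hxξ
    refine le_of_forall_pos_le_add fun ε hε => ?_
    -- reduce to a barrier with a logarithmic pole
    have hd : 0 < dist x ξ := dist_pos.2 hxξ
    set L := |Real.log (dist x ξ / r)| + r ^ 2 + 1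
    have hL : 0 < L := by positivity
    set e := ε / L
    have he : 0 < e := by positivity
    set k : ℂ → ℝ := fun z => m + e * (Real.log (‖z - ξ‖ / r) + (‖z - ξ‖ ^ 2 - r ^ 2)) with hk
    have hmain : k x ≤ g x := by
      set δ := min (dist x ξ) (r * Real.exp (-(m / e)))
      have hδ : 0 < δ := lt_min hd (by positivity)
      set K := closedBall ξ r \ ball ξ δ
      have hK : IsCompact K := (isCompact_closedBall ξ r).diff isOpen_ball
      have hKne : ∀ z ∈ K, z - ξ ≠ 0 := by
        rintro z hz h
        rw [sub_eq_zero] at h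
        exact hz.2 (by simp [h, hδ])
      have hxK : x ∈ K := ⟨hx, by simp [δ]⟩
      obtain ⟨w, hw, hB, hmax⟩ := exists_isMaxOn_of_submean hK ⟨x, hxK⟩
        (q := fun z => k z - g z) (by
          refine ContinuousOn.sub ?_ (hg.cont.mono fun z hz => hrU hz.1)
          refine continuousOn_const.add (continuousOn_const.mul (ContinuousOn.add ?_ (by fun_prop)))
          refine ContinuousOn.log (by fun_prop) fun z hz => ?_
          exact div_ne_zero (norm_ne_zero_iff.2 (hKne z hz)) hr.ne')
        (fun z => k z - g z ≤ 0) (by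
          intro z hz hzB
          have hzξ := hKne z hz
          have hzpos := hpos z hz.1 (by rintro rfl; simp at hzξ)
          have hz1 : z ∈ ball ξ r := by
            refine mem_ball.2 <| lt_of_le_of_ne (mem_closedBall.1 hz.1) fun h => hzB ?_
            have h1 : m ≤ g z := hmin h
            have h2 : ‖z - ξ‖ = r := by rw [← dist_eq_norm]; exact h
            simp only [hk, h2, div_self hr.ne', Real.log_one]
            linarith
          have hz2 : z ∉ closedBall ξ δ := by
            intro h
            apply hzB
            have h2 : ‖z - ξ‖ ≤ r * Real.exp (-(m / e)) := by
              rw [← dist_eq_norm]; exact h.trans (min_le_right _ _)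
            have h3 : Real.log (‖z - ξ‖ / r) ≤ -(m / e) := by
              rw [Real.log_le_iff_le_exp (by positivity), div_le_iff₀ hr, mul_comm]
              exact h2
            have h4 : ‖z - ξ‖ ^ 2 ≤ r ^ 2 := by
              have : ‖z - ξ‖ ≤ r := by rw [← dist_eq_norm]; exact hz.1
              gcongr
            have h5 : e * (Real.log (‖z - ξ‖ / r) + (‖z - ξ‖ ^ 2 - r ^ 2)) ≤ e * (-(m / e)) := by
              refine mul_le_mul_of_nonneg_left ?_ he.le
              linarith
            have h6 : e * (-(m / e)) = -m := by field_simp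
            simp only [hk]
            linarith
          obtain ⟨r₁, hr₁, hr₁U, h⟩ := hg.submean hU (hrU hz.1)
          have hW : ball ξ r \ closedBall ξ δ ∈ 𝓝 z :=
            (isOpen_ball.sdiff isClosed_closedBall).mem_nhds ⟨hz1, hz2⟩
          obtain ⟨r₂, hr₂, hW'⟩ := Metric.mem_nhds_iff.1 hW
          set t := min (min r₁ r₂) ‖z - ξ‖ / 2
          have hzn : 0 < ‖z - ξ‖ := norm_pos_iff.2 hzξ
          have ht : 0 < t := by positivity
          have ht1 : t < r₁ := by
            have := (min_le_left (min r₁ r₂) ‖z - ξ‖).trans (min_le_left _ _)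
            simp only [t] at *; linarith
          have ht2 : t < r₂ := by
            have := (min_le_left (min r₁ r₂) ‖z - ξ‖).trans (min_le_right _ _)
            simp only [t] at *; linarith
          have ht3 : t < ‖z - ξ‖ := by
            have := (min_le_right (min r₁ r₂) ‖z - ξ‖)
            simp only [t] at *; linarith
          have hν : ‖(t : ℂ)‖ = t := by rw [Complex.norm_real, Real.norm_of_nonneg ht.le]
          have hsub : ∀ ζ : ℂ, ‖ζ‖ = 1 → z + ζ * t ∈ ball ξ r \ closedBall ξ δ := fun ζ hζ =>
            hW' (add_mul_mem_ball (hν.trans_lt ht2) hζ)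
          have hnz : ∀ ζ ∈ closedBall (0 : ℂ) 1, (z + ζ * t - ξ) / r ≠ 0 := by
            intro ζ hζ
            refine div_ne_zero (fun h0 => ?_) (Complex.ofReal_ne_zero.2 hr.ne')
            have : z - ξ = - (ζ * t) := by linear_combination h0
            rw [this, norm_neg, norm_mul, hν] at ht3
            have : ‖ζ‖ ≤ 1 := by simpa using hζ
            nlinarith
          refine ⟨(t : ℂ), fun ζ hζ => ?_, ?_⟩
          · have := hsub ζ hζ
            exact ⟨ball_subset_closedBall this.1, fun h' => this.2 (ball_subset_closedBall h')⟩
          · simp only [smul_eq_mul]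
            have hlogc : ContinuousOn (fun ζ : ℂ => Real.log (‖z + ζ * t - ξ‖ / r)) (sphere 0 1) := by
              refine ContinuousOn.log (by fun_prop) fun ζ hζ => ?_
              have := hnz ζ (sphere_subset_closedBall hζ)
              rw [← norm_ne_zero_iff, norm_div, Complex.norm_real, Real.norm_of_nonneg hr.le] at this
              exact this
            have h1 : av (fun ζ => Real.log (‖z + ζ * t - ξ‖ / r)) = Real.log (‖z - ξ‖ / r) := by
              have := av_log (f := fun ζ => (z + ζ * t - ξ) / r) (by
                intro ζ _
                fun_prop (disch := simpa using hr.ne')) hnz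
              simpa [norm_div, abs_of_pos hr] using this
            have h2 : ‖z - ξ‖ ^ 2 - r ^ 2 + t ^ 2 ≤
                av (fun ζ => ‖z + ζ * t - ξ‖ ^ 2 - r ^ 2) := by
              have := barrier_quadratic_av (-r ^ 2) 0 0 1 ξ z t
              rw [hν] at this
              simp only [zero_mul, Complex.zero_re, add_zero, one_mul] at this
              refine le_of_eq ?_
              calc _ = -r ^ 2 + ‖z - ξ‖ ^ 2 + t ^ 2 := by ring
                _ = av (fun ζ => -r ^ 2 + ‖z + ζ * t - ξ‖ ^ 2) := this.symm
                _ = _ := av_congr (f := fun ζ => -r ^ 2 + ‖z + ζ * t - ξ‖ ^ 2)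
                  (g := fun ζ => ‖z + ζ * t - ξ‖ ^ 2 - r ^ 2) (fun ζ _ => by ring)
            have h3 : av (fun ζ => k (z + ζ * t)) = m + e * (Real.log (‖z - ξ‖ / r) +
                av (fun ζ => ‖z + ζ * t - ξ‖ ^ 2 - r ^ 2)) := by
              rw [← h1]
              exact av_affine (f := fun ζ => Real.log (‖z + ζ * t - ξ‖ / r))
                (g := fun ζ => ‖z + ζ * t - ξ‖ ^ 2 - r ^ 2) hlogc (by fun_prop) m e
            rw [av_sub (by
              refine continuousOn_const.add (continuousOn_const.mul (hlogc.add (by fun_prop))))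
              (continuousOn_circle (hg.cont.mono hr₁U) (hν.trans_lt ht1)),
              h3, ← (h t (hν.trans_lt ht1)).2 hzpos]
            simp only [hk]
            have : 0 < e * t ^ 2 := by positivity
            nlinarith)
      have := hmax x hxK
      linarith
    have hkx : m - ε ≤ k x := by
      simp only [hk]
      rw [← dist_eq_norm]
      have h1 : -L ≤ Real.log (dist x ξ / r) + (dist x ξ ^ 2 - r ^ 2) := by
        have := neg_abs_le (Real.log (dist x ξ / r))
        have := sq_nonneg (dist x ξ)
        simp only [L]
        linarith
      have h2 := mul_le_mul_of_nonneg_left h1 he.le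
      have h3 : e * -L = -ε := by simp only [e]; field_simp
      linarith
    linarith
  have hcont : ContinuousAt g ξ := hg.cont.continuousAt (hU.mem_nhds (hrU (mem_closedBall_self hr.le)))
  refine hm.trans_le (ge_of_tendsto (hcont.mono_left (nhdsWithin_le_nhds (s := {ξ}ᶜ))) ?_)
  filter_upwards [self_mem_nhdsWithin, mem_nhdsWithin_of_mem_nhds (closedBall_mem_nhds ξ hr)]
    with x hx hx'
  exact hfar x hx' hx

lemma isPreconnected_punctured_ball (ξ : ℂ) (r : ℝ) : IsPreconnected (ball ξ r \ {ξ}) := by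
  have h : ball ξ r \ {ξ} =
      (fun q : ℝ × ℝ => ξ + q.1 * Complex.exp (q.2 * Complex.I)) '' (Ioo 0 r ×ˢ univ) := by
    ext x
    constructor
    · rintro ⟨hx, hne⟩
      have hne' : x - ξ ≠ 0 := sub_ne_zero.2 hne
      refine ⟨(‖x - ξ‖, (x - ξ).arg), ⟨⟨norm_pos_iff.2 hne', ?_⟩, mem_univ _⟩, ?_⟩
      · simpa [dist_eq_norm] using hx
      · simp [Complex.norm_mul_exp_arg_mul_I]
    · rintro ⟨⟨a, b⟩, ⟨⟨h1, h2⟩, -⟩, rfl⟩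
      simp only at h1 h2 ⊢
      refine ⟨?_, ?_⟩
      · simp [mem_ball, dist_eq_norm, Complex.norm_exp_ofReal_mul_I, abs_of_pos h1, h2]
      · simp [h1.ne']
  rw [h]
  refine (isPreconnected_Ioo.prod isPreconnected_univ).image _ ?_
  fun_prop

lemma EdgeZero.exists_ne {g : ℂ → ℝ} {U : Set ℂ} (hg : PosHarm g U) (hU : IsOpen U) {ξ : ℂ}
    (h : EdgeZero g U ξ) {ρ : ℝ} (hρ : 0 < ρ) : ∃ ξ', dist ξ' ξ < ρ ∧ ξ' ≠ ξ ∧ EdgeZero g U ξ' := by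
  obtain ⟨hξ, hgξ, hcl⟩ := h
  obtain ⟨r, hr, hrU⟩ := Metric.isOpen_iff.1 hU ξ hξ
  have hm : 0 < min r ρ := lt_min hr hρ
  have hsub : ball ξ (min r ρ) ⊆ U := (ball_subset_ball (min_le_left _ _)).trans hrU
  obtain ⟨y, ⟨hyU, hy⟩, hyξ⟩ := Metric.mem_closure_iff.1 hcl _ hm
  obtain ⟨x, hx, hxξ, hgx⟩ : ∃ x ∈ closedBall ξ (min r ρ / 2), x ≠ ξ ∧ g x = 0 := by
    by_contra! hcon
    have hcb : closedBall ξ (min r ρ / 2) ⊆ U :=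
      (closedBall_subset_ball (half_lt_self hm)).trans hsub
    refine (not_isolated_zero hg hU (half_pos hm) hcb fun x hx hxξ => ?_).ne' hgξ
    exact lt_of_le_of_ne (hg.nonneg x (hcb hx)) (hcon x hx hxξ).symm
  obtain ⟨ξ', hξ', he⟩ := exists_edgeZero hg.cont hg.nonneg hU (isPreconnected_punctured_ball ξ _)
    (sdiff_subset.trans hsub) (x := x) (y := y)
    ⟨closedBall_subset_ball (half_lt_self hm) hx, hxξ⟩
    ⟨by rwa [dist_comm] at hyξ, by rintro rfl; exact hy.ne' hgξ⟩ hgx hy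
  exact ⟨ξ', lt_of_lt_of_le hξ'.1 (min_le_right _ _), hξ'.2, he⟩

lemma EdgeZero.exists_two_touched {g : ℂ → ℝ} {U : Set ℂ} (hg : PosHarm g U) (hU : IsOpen U) {ξ : ℂ}
    (h : EdgeZero g U ξ) {ρ : ℝ} (hρ : 0 < ρ) :
    ∃ ξ₁ ξ₂, dist ξ₁ ξ < ρ ∧ dist ξ₂ ξ < ρ ∧ ξ₁ ≠ ξ₂ ∧ Touched g U ξ₁ ∧ Touched g U ξ₂ := by
  obtain ⟨ξ', hd, hne, he⟩ := h.exists_ne hg hU (half_pos hρ)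
  have hd0 : 0 < dist ξ' ξ := dist_pos.2 hne
  obtain ⟨ξ₁, h1, ht1⟩ := h.exists_touched hg.cont hg.nonneg hU (ρ := dist ξ' ξ / 3) (by positivity)
  obtain ⟨ξ₂, h2, ht2⟩ := he.exists_touched hg.cont hg.nonneg hU (ρ := dist ξ' ξ / 3) (by positivity)
  refine ⟨ξ₁, ξ₂, by linarith, ?_, ?_, ht1, ht2⟩
  · have := dist_triangle ξ₂ ξ' ξ
    linarith
  · rintro rfl
    have := dist_triangle_left ξ' ξ ξ₁
    linarith

/-- The region of escape in the first coordinate. -/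
def Reg (R : ℝ) : Set (ℂ × ℂ) := {x | R ≤ ‖x.1‖ ∧ ‖x.2‖ ≤ 2 * ‖x.1‖}

structure Esc (f : ℂ × ℂ → ℂ × ℂ) (d R C : ℝ) : Prop where
  grow : ∀ x ∈ Reg R, 2 * ‖x.1‖ ≤ ‖(f x).1‖
  cone : ∀ x ∈ Reg R, ‖(f x).2‖ ≤ ‖(f x).1‖
  log : ∀ x ∈ Reg R, |Real.log ‖(f x).1‖ - d * Real.log ‖x.1‖| ≤ C
  upper : ∀ x, Real.log (max ‖f x‖ 1) ≤ d * Real.log (max ‖x‖ 1) + C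
  out : ∀ x, x ∉ Reg R → f x ∉ Reg R → ‖(f x).2‖ ≤ max ‖x.2‖ C

lemma Esc.mem {f : ℂ × ℂ → ℂ × ℂ} {d R C : ℝ} (h : Esc f d R C) {x : ℂ × ℂ} (hx : x ∈ Reg R) :
    f x ∈ Reg R := by
  have h1 := h.grow x hx
  have h2 := h.cone x hx
  have := norm_nonneg x.1
  have := norm_nonneg (f x).1
  exact ⟨by linarith [hx.1], by linarith⟩

lemma Esc.comp {f g : ℂ × ℂ → ℂ × ℂ} {d e R C C' : ℝ} (hf : Esc f d R C) (hg : Esc g e R C')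
    (hd : 0 ≤ d) : Esc (f ∘ g) (d * e) R (max (C + d * C') (max C C')) where
  grow x hx := by
    have h1 := hg.grow x hx
    have h2 := hf.grow _ (hg.mem hx)
    have := norm_nonneg (g x).1
    simp only [Function.comp]; linarith
  cone x hx := hf.cone _ (hg.mem hx)
  log x hx := by
    have h1 := hg.log x hx
    have h2 := hf.log _ (hg.mem hx)
    refine le_trans ?_ (le_max_left _ _)
    simp only [Function.comp]
    have : Real.log ‖(f (g x)).1‖ - d * e * Real.log ‖x.1‖ =
      (Real.log ‖(f (g x)).1‖ - d * Real.log ‖(g x).1‖) +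
        d * (Real.log ‖(g x).1‖ - e * Real.log ‖x.1‖) := by ring
    rw [this]
    refine (abs_add_le _ _).trans ?_
    rw [abs_mul, abs_of_nonneg hd]
    gcongr
  upper x := by
    have h1 := hg.upper x
    have h2 := hf.upper (g x)
    have h3 := mul_le_mul_of_nonneg_left h1 hd
    have := le_max_left (C + d * C') (max C C')
    simp only [Function.comp]
    nlinarith
  out x hx hfx := by
    have hgx : g x ∉ Reg R := fun h => hfx (hf.mem h)
    have h1 := hg.out x hx hgx
    have h2 := hf.out _ hgx hfx
    refine h2.trans (max_le (h1.trans (max_le_max le_rfl ?_)) (le_max_of_le_right ?_))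
    · exact (le_max_right _ _).trans (le_max_right _ _)
    · exact (le_max_left _ _).trans (le_max_right _ _)

/-- Two-sided growth bounds of a polynomial near infinity. -/
lemma poly_bounds (P : Polynomial ℂ) (hP : P ≠ 0) :
    ∃ c > 0, ∃ C > 0, ∃ R ≥ 1, ∀ z : ℂ, R ≤ ‖z‖ →
      c * ‖z‖ ^ P.natDegree ≤ ‖P.eval z‖ ∧ ‖P.eval z‖ ≤ C * ‖z‖ ^ P.natDegree := by
  have h := (Polynomial.isEquivalent_cobounded_leading_monomial (P := P)).def (c := 1 / 2)
    (by norm_num)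
  rw [← comap_norm_atTop, eventually_comap] at h
  obtain ⟨R, hR⟩ := eventually_atTop.1 h
  have hl : 0 < ‖P.leadingCoeff‖ := norm_pos_iff.2 (Polynomial.leadingCoeff_ne_zero.2 hP)
  refine ⟨‖P.leadingCoeff‖ / 2, by positivity, 2 * ‖P.leadingCoeff‖, by positivity, max R 1,
    le_max_right _ _, fun z hz => ?_⟩
  have h1 := hR ‖z‖ ((le_max_left _ _).trans hz) z rfl
  simp only [Pi.sub_apply, norm_mul, norm_pow] at h1
  have h2 := norm_sub_norm_le (P.eval z) (P.leadingCoeff * z ^ P.natDegree)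
  have h3 := norm_sub_norm_le (P.leadingCoeff * z ^ P.natDegree) (P.eval z)
  rw [norm_sub_rev] at h3
  rw [norm_mul, norm_pow] at h2 h3
  have : 0 ≤ ‖P.leadingCoeff‖ * ‖z‖ ^ P.natDegree := by positivity
  constructor <;> linarith

lemma poly_upper (P : Polynomial ℂ) (hP : P ≠ 0) :
    ∃ K > 0, ∀ z : ℂ, ‖P.eval z‖ ≤ K * (max ‖z‖ 1) ^ P.natDegree := by
  obtain ⟨c, hc, C, hC, R, hR, h⟩ := poly_bounds P hP
  obtain ⟨B, hB⟩ := (isCompact_closedBall (0 : ℂ) R).exists_bound_of_continuousOn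
    P.continuous.continuousOn
  refine ⟨max C B, lt_max_of_lt_left hC, fun z => ?_⟩
  have h1 : 1 ≤ max ‖z‖ 1 ^ P.natDegree := one_le_pow₀ (le_max_right _ _)
  rcases le_total R ‖z‖ with hz | hz
  · refine (h z hz).2.trans ?_
    gcongr
    · exact le_max_left _ _
    · exact le_max_left _ _
  · have h2 := hB z (by simpa using hz)
    have h3 : B ≤ max C B := le_max_right _ _
    have h4 : 0 ≤ max C B := hC.le.trans (le_max_left _ _)
    nlinarith

lemma _root_.ElemHenon.esc (f : ElemHenon) :
    ∃ R₀ ≥ 1, ∀ R ≥ R₀, ∃ C, Esc f.toFun f.P.natDegree R C := by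
  have hN := f.hdeg
  set N := f.P.natDegree
  have hP : f.P ≠ 0 := by
    rintro h
    simp [N, h] at hN
  obtain ⟨c, hc, C, hC, R₁, hR₁, h⟩ := poly_bounds f.P hP
  obtain ⟨K, hK, hup⟩ := poly_upper f.P hP
  have ha := norm_nonneg f.a
  have hb := norm_nonneg f.b
  set Q := 8 + 8 * ‖f.a‖ + 4 * ‖f.b‖ + 2 * (‖f.a‖ * ‖f.b‖)
  have hQ : 0 ≤ Q := by positivity
  refine ⟨R₁ + Q / c, by have : 0 ≤ Q / c := by positivity
                         linarith, fun R hR => ?_⟩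
  have hR1 : R₁ ≤ R := by
    have : 0 ≤ Q / c := by positivity
    linarith
  have hab : 0 ≤ ‖f.a‖ * ‖f.b‖ := by positivity
  -- the basic lower bound
  have key : ∀ z : ℂ, R ≤ ‖z‖ → 1 ≤ ‖z‖ ∧ Q * ‖z‖ ≤ c * ‖z‖ ^ N ∧ c * ‖z‖ ^ N ≤ ‖f.P.eval z‖ ∧
      ‖f.P.eval z‖ ≤ C * ‖z‖ ^ N ∧ ‖z‖ ≤ ‖z‖ ^ N := by
    intro z hz
    have h1 : 1 ≤ ‖z‖ := by linarith
    have h2 := h z (hR1.trans hz)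
    have h3 : ‖z‖ ^ 2 ≤ ‖z‖ ^ N := pow_le_pow_right₀ h1 hN
    have h4 : Q ≤ c * ‖z‖ := by
      rw [← div_le_iff₀' hc]
      linarith
    refine ⟨h1, ?_, h2.1, h2.2, by nlinarith⟩
    calc Q * ‖z‖ ≤ c * ‖z‖ * ‖z‖ := by gcongr
      _ = c * ‖z‖ ^ 2 := by ring
      _ ≤ _ := by gcongr
  have low : ∀ x ∈ Reg R, c / 2 * ‖x.1‖ ^ N ≤ ‖(f.toFun x).1‖ ∧ (4 + 2 * ‖f.b‖) * ‖x.1‖ ≤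
      c / 2 * ‖x.1‖ ^ N ∧ ‖(f.toFun x).1‖ ≤ (C + 2 * ‖f.a‖) * ‖x.1‖ ^ N := by
    intro x hx
    obtain ⟨h1, h2, h3, h4, h5⟩ := key x.1 hx.1
    have h6 : ‖f.a * x.2‖ ≤ 2 * ‖f.a‖ * ‖x.1‖ := by
      rw [norm_mul]
      nlinarith [hx.2]
    have h7 : ‖f.P.eval x.1‖ - ‖f.a * x.2‖ ≤ ‖(f.toFun x).1‖ := by
      have := norm_sub_le (f.P.eval x.1 + f.a * x.2) (f.a * x.2)
      simp only [add_sub_cancel_right] at this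
      simp only [ElemHenon.toFun]
      linarith
    have h8 : ‖(f.toFun x).1‖ ≤ ‖f.P.eval x.1‖ + ‖f.a * x.2‖ := norm_add_le _ _
    have h9 : 0 ≤ ‖f.a‖ * ‖x.1‖ := by positivity
    have h10 : 0 ≤ ‖f.b‖ * ‖x.1‖ := by positivity
    have h11 : 0 ≤ ‖f.a‖ * ‖f.b‖ * ‖x.1‖ := by positivity
    have h12 : Q * ‖x.1‖ = 8 * ‖x.1‖ + 8 * (‖f.a‖ * ‖x.1‖) + 4 * (‖f.b‖ * ‖x.1‖) +
      2 * (‖f.a‖ * ‖f.b‖ * ‖x.1‖) := by simp only [Q]; ring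
    refine ⟨by nlinarith, by nlinarith, ?_⟩
    have : ‖f.a‖ * ‖x.1‖ ≤ ‖f.a‖ * ‖x.1‖ ^ N := by gcongr
    nlinarith
  set C' := max (max |Real.log (c / 2)| |Real.log (C + 2 * ‖f.a‖)|)
    (max |Real.log (K + ‖f.a‖ + ‖f.b‖ + 1)| (‖f.b‖ * R)) with hC'
  refine ⟨C', ?_, ?_, ?_, ?_, ?_⟩
  · intro x hx
    obtain ⟨h1, h2, -⟩ := low x hx
    have : 0 ≤ ‖f.b‖ * ‖x.1‖ := by positivity
    have := norm_nonneg x.1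
    nlinarith
  · intro x hx
    obtain ⟨h1, h2, -⟩ := low x hx
    have : 0 ≤ ‖f.b‖ * ‖x.1‖ := by positivity
    have := norm_nonneg x.1
    simp only [ElemHenon.toFun, norm_mul] at *
    nlinarith
  · intro x hx
    obtain ⟨h1, h2, h3⟩ := low x hx
    have hx1 : 0 < ‖x.1‖ := by linarith [(key x.1 hx.1).1]
    have hpos : 0 < c / 2 * ‖x.1‖ ^ N := by positivity
    have l1 := Real.log_le_log hpos h1
    have l2 := Real.log_le_log (hpos.trans_le h1) h3
    rw [Real.log_mul (by positivity) (by positivity), Real.log_pow] at l1 l2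
    have e1 := neg_abs_le (Real.log (c / 2))
    have e2 := le_abs_self (Real.log (C + 2 * ‖f.a‖))
    have m1 : |Real.log (c / 2)| ≤ C' := (le_max_left _ _).trans (le_max_left _ _)
    have m2 : |Real.log (C + 2 * ‖f.a‖)| ≤ C' := (le_max_right _ _).trans (le_max_left _ _)
    rw [abs_le]
    constructor <;> linarith
  · intro x
    have m3 : |Real.log (K + ‖f.a‖ + ‖f.b‖ + 1)| ≤ C' := (le_max_left _ _).trans (le_max_right _ _)
    have hm1 : 1 ≤ max ‖x‖ 1 := le_max_right _ _
    have hmN : max ‖x‖ 1 ≤ max ‖x‖ 1 ^ N := le_self_pow₀ hm1 (by omega)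
    have hx1 : ‖x.1‖ ≤ max ‖x‖ 1 := (norm_fst_le x).trans (le_max_left _ _)
    have hx2 : ‖x.2‖ ≤ max ‖x‖ 1 := (norm_snd_le x).trans (le_max_left _ _)
    have hbd : max ‖f.toFun x‖ 1 ≤ (K + ‖f.a‖ + ‖f.b‖ + 1) * max ‖x‖ 1 ^ N := by
      have t1 : ‖f.P.eval x.1‖ ≤ K * max ‖x‖ 1 ^ N := by
        refine (hup x.1).trans ?_
        gcongr
        exact norm_fst_le x
      have t2 : ‖f.a‖ * ‖x.2‖ ≤ ‖f.a‖ * max ‖x‖ 1 ^ N := by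
        gcongr; exact hx2.trans hmN
      have t3 : ‖f.b‖ * ‖x.1‖ ≤ ‖f.b‖ * max ‖x‖ 1 ^ N := by
        gcongr; exact hx1.trans hmN
      have t4 : ‖(f.toFun x).1‖ ≤ ‖f.P.eval x.1‖ + ‖f.a‖ * ‖x.2‖ := by
        rw [← norm_mul]; exact norm_add_le _ _
      have t5 : ‖(f.toFun x).2‖ = ‖f.b‖ * ‖x.1‖ := norm_mul _ _
      have t6 : 0 ≤ K * max ‖x‖ 1 ^ N := by positivity
      have t7 : 0 ≤ ‖f.a‖ * max ‖x‖ 1 ^ N := by positivity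
      have t8 : 0 ≤ ‖f.b‖ * max ‖x‖ 1 ^ N := by positivity
      refine max_le ?_ ?_
      · rw [Prod.norm_def]
        refine max_le ?_ ?_ <;> nlinarith
      · nlinarith
    have l := Real.log_le_log (lt_of_lt_of_le one_pos (le_max_right _ _)) hbd
    rw [Real.log_mul (by positivity) (by positivity), Real.log_pow] at l
    have := le_abs_self (Real.log (K + ‖f.a‖ + ‖f.b‖ + 1))
    linarith
  · intro x hx hfx
    have m4 : ‖f.b‖ * R ≤ C' := (le_max_right _ _).trans (le_max_right _ _)
    have e : ‖(f.toFun x).2‖ = ‖f.b‖ * ‖x.1‖ := norm_mul _ _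
    rw [e]
    rcases lt_or_ge ‖x.1‖ R with hz | hz
    · exact le_max_of_le_right ((mul_le_mul_of_nonneg_left hz.le hb).trans m4)
    · refine le_max_of_le_left ?_
      by_contra! hlt
      obtain ⟨h1, h2, h3, h4, h5⟩ := key x.1 hz
      have h6 : ‖f.a * x.2‖ ≤ ‖f.a‖ * ‖f.b‖ * ‖x.1‖ := by
        rw [norm_mul]
        nlinarith
      have h7 : ‖f.P.eval x.1‖ - ‖f.a * x.2‖ ≤ ‖(f.toFun x).1‖ := by
        have := norm_sub_le (f.P.eval x.1 + f.a * x.2) (f.a * x.2)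
        simp only [add_sub_cancel_right] at this
        simp only [ElemHenon.toFun]
        linarith
      have h9 : 0 ≤ ‖f.a‖ * ‖x.1‖ := by positivity
      have h10 : 0 ≤ ‖f.b‖ * ‖x.1‖ := by positivity
      have h11 : 0 ≤ ‖f.a‖ * ‖f.b‖ * ‖x.1‖ := by positivity
      have h12 : Q * ‖x.1‖ = 8 * ‖x.1‖ + 8 * (‖f.a‖ * ‖x.1‖) + 4 * (‖f.b‖ * ‖x.1‖) +
        2 * (‖f.a‖ * ‖f.b‖ * ‖x.1‖) := by simp only [Q]; ring
      refine hfx ⟨?_, ?_⟩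
      · linarith
      · rw [e]; linarith

/-- A composition of elementary maps escapes. -/
lemma esc_list (f : ElemHenon) (l : List ElemHenon) :
    ∃ R₀ ≥ 1, ∀ R ≥ R₀, ∃ C, Esc ((f :: l).foldr (fun h g => h.toFun ∘ g) id)
      (((f :: l).map fun h => h.P.natDegree).prod : ℕ) R C := by
  induction l generalizing f with
  | nil => simpa using f.esc
  | cons f' l ih =>
    obtain ⟨R₁, h1, hf⟩ := f.esc
    obtain ⟨R₂, h2, hg⟩ := ih f'
    refine ⟨max R₁ R₂, le_max_of_le_left h1, fun R hR => ?_⟩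
    obtain ⟨C, hC⟩ := hf R ((le_max_left _ _).trans hR)
    obtain ⟨C', hC'⟩ := hg R ((le_max_right _ _).trans hR)
    refine ⟨max (C + (f.P.natDegree : ℝ) * C') (max C C'), ?_⟩
    rw [List.foldr_cons, List.map_cons, List.prod_cons, Nat.cast_mul]
    exact hC.comp hC' (Nat.cast_nonneg _)

lemma _root_.HenonMap.esc (H : HenonMap) :
    ∃ R₀ ≥ 1, ∀ R ≥ R₀, ∃ C, Esc H.toFun (H.deg : ℝ) R C := by
  obtain ⟨l, hl⟩ := H
  cases l with
  | nil => exact absurd rfl hl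
  | cons f l => exact esc_list f l

end HenonAux

namespace HenonAux

/-- `log⁺` of the norm. -/
def lp (x : ℂ × ℂ) : ℝ := Real.log (max ‖x‖ 1)

lemma lp_nonneg (x : ℂ × ℂ) : 0 ≤ lp x := Real.log_nonneg (le_max_right _ _)

lemma lp_continuous : Continuous lp := by
  unfold lp
  refine Continuous.log (by fun_prop) fun x => ?_
  have : 0 < max ‖x‖ 1 := lt_max_of_lt_right one_pos
  exact this.ne'

lemma lp_le_of_norm_le {x : ℂ × ℂ} {B : ℝ} (h : ‖x‖ ≤ B) : lp x ≤ |B| := by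
  unfold lp
  have h0 : 0 ≤ B := (norm_nonneg x).trans h
  rw [abs_of_nonneg h0]
  refine (Real.log_le_sub_one_of_pos (lt_max_of_lt_right one_pos)).trans ?_
  rw [sub_le_iff_le_add]
  refine max_le (by linarith) (by linarith)

lemma lp_reg {R : ℝ} (hR : 1 ≤ R) {x : ℂ × ℂ} (hx : x ∈ Reg R) :
    |lp x - Real.log ‖x.1‖| ≤ 1 := by
  have h1 : 1 ≤ ‖x.1‖ := hR.trans hx.1
  have h2 : ‖x‖ ≤ 2 * ‖x.1‖ := by
    rw [Prod.norm_def]; exact max_le (by linarith) hx.2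
  have h3 : ‖x.1‖ ≤ ‖x‖ := norm_fst_le x
  have h4 : lp x = Real.log ‖x‖ := by rw [lp, max_eq_left (h1.trans h3)]
  rw [h4]
  have l1 := Real.log_le_log (by linarith) h3
  have l2 := Real.log_le_log (by linarith) h2
  rw [Real.log_mul (by norm_num) (by linarith)] at l2
  have : Real.log 2 < 1 := by linarith [Real.log_two_lt_d9]
  rw [abs_le]
  constructor <;> linarith

variable {F : ℂ × ℂ → ℂ × ℂ} {d R C : ℝ}

lemma Esc.iterate_mem (h : Esc F d R C) {x : ℂ × ℂ} (hx : x ∈ Reg R) (n : ℕ) :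
    F^[n] x ∈ Reg R := by
  induction n with
  | zero => exact hx
  | succ n ih => rw [Function.iterate_succ_apply']; exact h.mem ih

lemma norm_le_of_notMem_reg {x : ℂ × ℂ} (hx : x ∉ Reg R) : ‖x‖ ≤ max ‖x.2‖ R := by
  rw [Prod.norm_def]
  refine max_le ?_ (le_max_left _ _)
  by_contra! hlt
  rw [max_lt_iff] at hlt
  refine hx ⟨hlt.2.le, ?_⟩
  linarith [norm_nonneg x.1]

lemma Esc.norm_iterate_le (h : Esc F d R C) {x : ℂ × ℂ} {n : ℕ} (hx : F^[n] x ∉ Reg R) :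
    ‖F^[n] x‖ ≤ max ‖x‖ (max C R) := by
  have h2 : ‖(F^[n] x).2‖ ≤ max ‖x‖ C := by
    induction n with
    | zero => exact le_max_of_le_left (norm_snd_le x)
    | succ n ih =>
      rw [Function.iterate_succ_apply'] at hx ⊢
      have hn : F^[n] x ∉ Reg R := fun hn => hx (h.mem hn)
      exact (h.out _ hn hx).trans (max_le (ih hn) (le_max_right _ _))
  refine (norm_le_of_notMem_reg hx).trans (max_le (h2.trans ?_) ?_)
  · exact max_le_max le_rfl (le_max_left _ _)
  · exact le_max_of_le_right (le_max_right _ _)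

/-- One step of the sequence defining the Green function. -/
lemma Esc.step (h : Esc F d R C) (hd : 1 < d) (hR : 1 ≤ R) (B : ℝ) :
    ∃ M ≥ 0, ∀ x, ‖x‖ ≤ B → ∀ n, |lp (F^[n + 1] x) - d * lp (F^[n] x)| ≤ M := by
  set B' := max B (max C R)
  have hC : 0 ≤ C := (abs_nonneg _).trans (h.log (R, 0) ⟨by simp [le_abs_self], by simp⟩)
  refine ⟨(C + 1 + d) + d * |B'|, by positivity, fun x hx n => ?_⟩
  have hd0 : 0 < d := by linarith
  have hB' := abs_nonneg B'
  have hdB : 0 ≤ d * |B'| := by positivity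
  rw [Function.iterate_succ_apply']
  have hup : lp (F (F^[n] x)) ≤ d * lp (F^[n] x) + C := h.upper _
  by_cases hn : F^[n] x ∈ Reg R
  · have h1 := abs_le.1 (lp_reg hR hn)
    have h2 := abs_le.1 (lp_reg hR (h.mem hn))
    have h3 := abs_le.1 (h.log _ hn)
    rw [abs_le]
    constructor <;> nlinarith
  · have h1 : lp (F^[n] x) ≤ |B'| := lp_le_of_norm_le ((h.norm_iterate_le hn).trans
      (max_le_max hx le_rfl))
    have h2 := mul_le_mul_of_nonneg_left h1 hd0.le
    have h3 := lp_nonneg (F (F^[n] x))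
    rw [abs_le]
    constructor <;> linarith

/-- The Green function of `F`. -/
def green (F : ℂ × ℂ → ℂ × ℂ) (d : ℝ) (x : ℂ × ℂ) : ℝ :=
  limUnder atTop fun n : ℕ => lp (F^[n] x) / d ^ n

lemma dist_div_pow {a b d M : ℝ} (hd : 1 < d) {n : ℕ} (h : |b - d * a| ≤ M) :
    dist (a / d ^ n) (b / d ^ (n + 1)) ≤ M * (1 / d) ^ n := by
  have hd0 : 0 < d := by linarith
  have h1 : a / d ^ n - b / d ^ (n + 1) = -(b - d * a) / d ^ (n + 1) := by
    field_simp; ring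
  have hM : 0 ≤ M := (abs_nonneg _).trans h
  rw [Real.dist_eq, h1, abs_div, abs_neg, abs_of_pos (by positivity : 0 < d ^ (n + 1)), one_div,
    inv_pow, ← div_eq_mul_inv]
  have : d ^ n ≤ d ^ (n + 1) := pow_le_pow_right₀ hd.le (Nat.le_succ n)
  gcongr

lemma Esc.green_bound (h : Esc F d R C) (hd : 1 < d) (hR : 1 ≤ R) (B : ℝ) :
    ∃ M ≥ 0, ∀ x, ‖x‖ ≤ B → ∀ n, |lp (F^[n] x) / d ^ n - green F d x| ≤ M / d ^ n := by
  obtain ⟨M, hM, hstep⟩ := h.step hd hR B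
  have hd0 : 0 < d := by linarith
  have hr : 1 / d < 1 := by rw [div_lt_one hd0]; exact hd
  have hr' : 0 < 1 - 1 / d := by linarith
  refine ⟨M / (1 - 1 / d), by positivity, fun x hx n => ?_⟩
  have hs : ∀ n, dist (lp (F^[n] x) / d ^ n) (lp (F^[n + 1] x) / d ^ (n + 1)) ≤ M * (1 / d) ^ n :=
    fun n => dist_div_pow hd (hstep x hx n)
  have hlim : Tendsto (fun n : ℕ => lp (F^[n] x) / d ^ n) atTop (𝓝 (green F d x)) :=
    (cauchySeq_of_le_geometric _ _ hr hs).tendsto_limUnder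
  have := dist_le_of_le_geometric_of_tendsto _ _ hr hs hlim n
  rw [Real.dist_eq] at this
  refine this.trans (le_of_eq ?_)
  rw [one_div, inv_pow]
  ring

lemma Esc.green_tendsto (h : Esc F d R C) (hd : 1 < d) (hR : 1 ≤ R) (x : ℂ × ℂ) :
    Tendsto (fun n : ℕ => lp (F^[n] x) / d ^ n) atTop (𝓝 (green F d x)) := by
  obtain ⟨M, hM, hb⟩ := h.green_bound hd hR ‖x‖
  rw [tendsto_iff_dist_tendsto_zero]
  refine squeeze_zero (fun _ => dist_nonneg) (fun n => hb x le_rfl n) ?_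
  exact tendsto_const_nhds.div_atTop (tendsto_pow_atTop_atTop_of_one_lt hd)

lemma Esc.green_nonneg (h : Esc F d R C) (hd : 1 < d) (hR : 1 ≤ R) (x : ℂ × ℂ) :
    0 ≤ green F d x :=
  ge_of_tendsto' (h.green_tendsto hd hR x) fun n =>
    div_nonneg (lp_nonneg _) (pow_nonneg (by linarith) _)

lemma Esc.green_map (h : Esc F d R C) (hd : 1 < d) (hR : 1 ≤ R) (x : ℂ × ℂ) :
    green F d (F x) = d * green F d x := by
  refine tendsto_nhds_unique (h.green_tendsto hd hR (F x)) ?_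
  have h1 := ((h.green_tendsto hd hR x).comp (tendsto_add_atTop_nat 1)).const_mul d
  refine h1.congr fun n => ?_
  have hd0 : d ≠ 0 := by linarith
  simp only [Function.comp, Function.iterate_succ_apply]
  field_simp
  ring

lemma Esc.green_continuous (h : Esc F d R C) (hd : 1 < d) (hR : 1 ≤ R) (hF : Continuous F) :
    Continuous (green F d) := by
  rw [continuous_iff_continuousAt]
  intro x
  obtain ⟨M, hM, hb⟩ := h.green_bound hd hR (‖x‖ + 1)
  have hu : TendstoUniformlyOn (fun (n : ℕ) x => lp (F^[n] x) / d ^ n) (green F d) atTop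
      (ball x 1) := by
    rw [Metric.tendstoUniformlyOn_iff]
    intro ε hε
    have ht : Tendsto (fun n : ℕ => M / d ^ n) atTop (𝓝 0) :=
      tendsto_const_nhds.div_atTop (tendsto_pow_atTop_atTop_of_one_lt hd)
    filter_upwards [ht.eventually_lt_const hε] with n hn y hy
    rw [dist_comm]
    refine lt_of_le_of_lt (hb y ?_ n) hn
    have := norm_sub_norm_le y x
    rw [mem_ball, dist_eq_norm] at hy
    linarith
  refine (hu.continuousOn (Eventually.of_forall fun n => ?_).frequently).continuousAt
    (ball_mem_nhds x one_pos)
  exact ((lp_continuous.comp (hF.iterate n)).div_const _).continuousOn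

/-- Estimate on the escape region. -/
lemma Esc.green_reg (h : Esc F d R C) (hd : 1 < d) (hR : 1 ≤ R) :
    ∃ M ≥ 0, ∀ x ∈ Reg R, |green F d x - Real.log ‖x.1‖| ≤ M := by
  have hC : 0 ≤ C := (abs_nonneg _).trans (h.log (R, 0) ⟨by simp [le_abs_self], by simp⟩)
  have hd0 : 0 < d := by linarith
  have hr : 1 / d < 1 := by rw [div_lt_one hd0]; exact hd
  have hr' : 0 < 1 - 1 / d := by linarith
  refine ⟨C / (1 - 1 / d), by positivity, fun x hx => ?_⟩
  have hs : ∀ n, dist (Real.log ‖(F^[n] x).1‖ / d ^ n) (Real.log ‖(F^[n + 1] x).1‖ / d ^ (n + 1)) ≤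
      C * (1 / d) ^ n := fun n => dist_div_pow hd (by
    rw [Function.iterate_succ_apply']
    exact h.log _ (h.iterate_mem hx n))
  have hlim : Tendsto (fun n : ℕ => Real.log ‖(F^[n] x).1‖ / d ^ n) atTop (𝓝 (green F d x)) := by
    have h0 : Tendsto (fun n : ℕ => 1 / d ^ n) atTop (𝓝 0) :=
      tendsto_const_nhds.div_atTop (tendsto_pow_atTop_atTop_of_one_lt hd)
    refine (h.green_tendsto hd hR x).congr_dist (squeeze_zero (fun _ => dist_nonneg) (fun n => ?_) h0)
    rw [Real.dist_eq, ← sub_div, abs_div, abs_of_pos (by positivity : 0 < d ^ n)]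
    have := lp_reg hR (h.iterate_mem hx n)
    gcongr
  have := dist_le_of_le_geometric_of_tendsto₀ _ _ hr hs hlim
  rw [dist_comm, Real.dist_eq] at this
  simpa using this

lemma Esc.green_eq_zero (h : Esc F d R C) (hd : 1 < d) (hR : 1 ≤ R) {x : ℂ × ℂ}
    (hx : ∀ n, F^[n] x ∉ Reg R) : green F d x = 0 := by
  refine tendsto_nhds_unique (h.green_tendsto hd hR x) ?_
  refine squeeze_zero (fun n => div_nonneg (lp_nonneg _) (pow_nonneg (by linarith) _))
    (fun n => ?_) ((tendsto_const_nhds (x := |max ‖x‖ (max C R)|)).div_atTop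
      (tendsto_pow_atTop_atTop_of_one_lt hd))
  have : 0 < d ^ n := pow_pos (by linarith) _
  gcongr
  exact lp_le_of_norm_le (h.norm_iterate_le (hx n))

end HenonAux

namespace HenonAux

/-- Basic properties of an escape function. -/
structure Half (F : ℂ × ℂ → ℂ × ℂ) (D : ℝ) (G : ℂ × ℂ → ℝ) : Prop where
  cont : Continuous G
  nonneg : ∀ x, 0 ≤ G x
  map : ∀ x, G (F x) = D * G x
  mv : ∀ (φ : ℂ → ℂ × ℂ) (x : ℂ), (∀ᶠ y in 𝓝 x, DifferentiableAt ℂ φ y) → 0 < G (φ x) →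
    MV (fun y => G (φ y)) x

lemma Half.iterate_map {F : ℂ × ℂ → ℂ × ℂ} {D : ℝ} {G : ℂ × ℂ → ℝ} (h : Half F D G) (n : ℕ)
    (x : ℂ × ℂ) : G (F^[n] x) = D ^ n * G x := by
  induction n with
  | zero => simp
  | succ n ih => rw [Function.iterate_succ_apply', h.map, ih, pow_succ]; ring

lemma Half.iterate {F : ℂ × ℂ → ℂ × ℂ} {D : ℝ} {G : ℂ × ℂ → ℝ} (h : Half F D G) (k : ℕ) :
    Half (F^[k]) (D ^ k) G :=
  ⟨h.cont, h.nonneg, h.iterate_map k, h.mv⟩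

lemma Half.posHarm {F : ℂ × ℂ → ℂ × ℂ} {D : ℝ} {G : ℂ × ℂ → ℝ} (h : Half F D G) {φ : ℂ → ℂ × ℂ}
    {U : Set ℂ} (hU : IsOpen U) (hφ : DifferentiableOn ℂ φ U) : PosHarm (fun y => G (φ y)) U :=
  ⟨h.cont.comp_continuousOn hφ.continuousOn, fun _ _ => h.nonneg _, fun x hx hpos =>
    h.mv φ x (Filter.mem_of_superset (hU.mem_nhds hx) fun _ hy =>
      hφ.differentiableAt (hU.mem_nhds hy)) hpos⟩

lemma mv_of_approx {g : ℂ → ℝ} {x : ℂ} {r : ℝ} (hr : 0 < r) (hg : ContinuousOn g (ball x r))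
    (h : ∀ ε > 0, ∃ f : ℂ → ℂ, ∃ c : ℝ, DifferentiableOn ℂ f (ball x r) ∧
      (∀ y ∈ ball x r, f y ≠ 0) ∧ ∀ y ∈ ball x r, |g y - c * Real.log ‖f y‖| ≤ ε) : MV g x := by
  refine ⟨r, hr, fun ν hν => ?_⟩
  refine eq_of_forall_dist_le fun ε hε => ?_
  obtain ⟨f, c, hf, h0, hb⟩ := h (ε / 2) (half_pos hε)
  have hmaps : ∀ ζ ∈ closedBall (0 : ℂ) 1, x + ζ * ν ∈ ball x r := by
    intro ζ hζ
    have : ‖ζ‖ ≤ 1 := by simpa using hζ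
    have h2 : ‖ζ * ν‖ ≤ ‖ν‖ := by
      rw [norm_mul]; nlinarith [norm_nonneg ν]
    simp only [mem_ball, dist_eq_norm, add_sub_cancel_left]
    linarith
  have han : AnalyticOnNhd ℂ f (ball x r) := hf.analyticOnNhd isOpen_ball
  have h1 := av_log (f := fun ζ => f (x + ζ * ν)) (by
      intro ζ hζ
      refine (han _ (hmaps ζ hζ)).comp (f := fun ζ : ℂ => x + ζ * ν) ?_
      fun_prop) fun ζ hζ => h0 _ (hmaps ζ hζ)
  simp only [zero_mul, add_zero] at h1
  have hgc := continuousOn_circle hg hν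
  have hlc : ContinuousOn (fun ζ => c * Real.log ‖f (x + ζ * ν)‖) (sphere 0 1) := by
    refine continuousOn_const.mul (ContinuousOn.log ?_ fun ζ hζ => ?_)
    · exact (continuousOn_circle hf.continuousOn.norm hν)
    · exact norm_ne_zero_iff.2 (h0 _ (hmaps ζ (sphere_subset_closedBall hζ)))
  have h2 := av_sub hgc hlc
  rw [av_mul, h1] at h2
  have hx := abs_le.1 (hb x (mem_ball_self hr))
  have h3 := av_le (hgc.sub hlc) (a := ε / 2) fun ζ hζ =>
    (abs_le.1 (hb _ (add_mul_mem_ball hν hζ))).2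
  have h4 := le_av (hgc.sub hlc) (a := -(ε / 2)) fun ζ hζ =>
    (abs_le.1 (hb _ (add_mul_mem_ball hν hζ))).1
  rw [Real.dist_eq, abs_le]
  simp only [Pi.sub_def] at h3 h4
  constructor <;> linarith

lemma Esc.half {F : ℂ × ℂ → ℂ × ℂ} {d R C : ℝ} (h : Esc F d R C) (hd : 1 < d) (hR : 1 ≤ R)
    (hF : Differentiable ℂ F) : Half F d (green F d) where
  cont := h.green_continuous hd hR hF.continuous
  nonneg := h.green_nonneg hd hR
  map := h.green_map hd hR
  mv φ x hφ hpos := by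
    obtain ⟨n, hn⟩ : ∃ n, F^[n] (φ x) ∈ Reg R := by
      by_contra! hcon
      exact hpos.ne' (h.green_eq_zero hd hR hcon)
    obtain ⟨M, hM, hreg⟩ := h.green_reg hd hR
    have hc : Continuous (green F d) := h.green_continuous hd hR hF.continuous
    have hφx : ContinuousAt φ x := hφ.self_of_nhds.continuousAt
    have hFd : ∀ m, Differentiable ℂ (F^[m]) := fun m => hF.iterate m
    have h_int : ∀ᶠ y in 𝓝 x, F^[n + 1] (φ y) ∈ Reg R := by
      have hopen : IsOpen {y : ℂ × ℂ | R < ‖y.1‖ ∧ ‖y.2‖ < 2 * ‖y.1‖} :=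
        (isOpen_lt continuous_const continuous_fst.norm).inter
          (isOpen_lt continuous_snd.norm (continuous_const.mul continuous_fst.norm))
      have hmem : F^[n + 1] (φ x) ∈ {y : ℂ × ℂ | R < ‖y.1‖ ∧ ‖y.2‖ < 2 * ‖y.1‖} := by
        rw [Function.iterate_succ_apply']
        have h1 := h.grow _ hn
        have h2 := h.cone _ hn
        have h3 := hn.1
        exact ⟨by linarith, by linarith⟩
      have hcont : ContinuousAt (fun y => F^[n + 1] (φ y)) x :=
        ((hFd (n + 1)).continuous.continuousAt).comp hφx
      filter_upwards [hcont (hopen.mem_nhds hmem)] with y hy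
      exact ⟨hy.1.le, hy.2.le⟩
    obtain ⟨r, hr, hball⟩ := Metric.eventually_nhds_iff_ball.1 (hφ.and h_int)
    refine mv_of_approx hr (hc.comp_continuousOn fun y hy =>
      (hball y hy).1.continuousAt.continuousWithinAt) fun ε hε => ?_
    have ht : Tendsto (fun m : ℕ => M / d ^ (m + (n + 1))) atTop (𝓝 0) :=
      tendsto_const_nhds.div_atTop ((tendsto_pow_atTop_atTop_of_one_lt hd).comp
        (tendsto_add_atTop_nat _))
    obtain ⟨m, hm⟩ := (ht.eventually_lt_const hε).exists
    have hmem : ∀ y ∈ ball x r, F^[m + (n + 1)] (φ y) ∈ Reg R := fun y hy => by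
      rw [Function.iterate_add_apply]
      exact h.iterate_mem (hball y hy).2 m
    have hdp : 0 < d ^ (m + (n + 1)) := pow_pos (by linarith) _
    refine ⟨fun y => (F^[m + (n + 1)] (φ y)).1, (d ^ (m + (n + 1)))⁻¹, fun y hy => ?_,
      fun y hy h0 => ?_, fun y hy => ?_⟩
    · exact (((hFd _) _).comp y (hball y hy).1).fst.differentiableWithinAt
    · have := (hmem y hy).1
      rw [show (F^[m + (n + 1)] (φ y)).1 = 0 from h0, norm_zero] at this
      linarith
    · have h1 := hreg _ (hmem y hy)
      have h2 : green F d (F^[m + (n + 1)] (φ y)) = d ^ (m + (n + 1)) * green F d (φ y) := by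
        generalize m + (n + 1) = k
        induction k with
        | zero => simp
        | succ k ih => rw [Function.iterate_succ_apply', h.green_map hd hR, ih, pow_succ]; ring
      rw [h2] at h1
      refine le_trans ?_ hm.le
      rw [le_div_iff₀ hdp]
      calc _ = |d ^ (m + (n + 1)) * green F d (φ y) - Real.log ‖(F^[m + (n + 1)] (φ y)).1‖| := by
            rw [← abs_of_pos hdp, ← abs_mul, abs_of_pos hdp]
            congr 1
            field_simp
        _ ≤ M := h1

/-- A pair of mutually inverse maps with their two escape functions. -/
structure Dyn (F Fi : ℂ × ℂ → ℂ × ℂ) (D : ℝ) (Gp Gm : ℂ × ℂ → ℝ) : Prop where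
  left_inv : ∀ x, Fi (F x) = x
  right_inv : ∀ x, F (Fi x) = x
  diff : Differentiable ℂ F
  diff_inv : Differentiable ℂ Fi
  one_lt : 1 < D
  plus : Half F D Gp
  minus : Half Fi D Gm
  bound : ∃ C, ∀ x, (Gp x = 0 → |Gm x - lp x| ≤ C) ∧ (Gm x = 0 → |Gp x - lp x| ≤ C)
  sep : ∃ c > 0, ∃ R, ∀ x y, Gp y = 0 → Gm x = 0 → R ≤ max ‖x‖ ‖y‖ →
    c * max ‖x‖ ‖y‖ ≤ ‖x - y‖

lemma Dyn.symm {F Fi : ℂ × ℂ → ℂ × ℂ} {D : ℝ} {Gp Gm : ℂ × ℂ → ℝ} (h : Dyn F Fi D Gp Gm) :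
    Dyn Fi F D Gm Gp where
  left_inv := h.right_inv
  right_inv := h.left_inv
  diff := h.diff_inv
  diff_inv := h.diff
  one_lt := h.one_lt
  plus := h.minus
  minus := h.plus
  bound := by
    obtain ⟨C, hC⟩ := h.bound
    exact ⟨C, fun x => ⟨(hC x).2, (hC x).1⟩⟩
  sep := by
    obtain ⟨c, hc, R, hR⟩ := h.sep
    refine ⟨c, hc, R, fun x y hy hx hm => ?_⟩
    rw [max_comm] at hm ⊢
    rw [norm_sub_rev]
    exact hR y x hx hy hm

lemma Dyn.iterate {F Fi : ℂ × ℂ → ℂ × ℂ} {D : ℝ} {Gp Gm : ℂ × ℂ → ℝ} (h : Dyn F Fi D Gp Gm)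
    {k : ℕ} (hk : k ≠ 0) : Dyn (F^[k]) (Fi^[k]) (D ^ k) Gp Gm where
  left_inv := (Function.LeftInverse.iterate h.left_inv k)
  right_inv := (Function.LeftInverse.iterate h.right_inv k)
  diff := h.diff.iterate k
  diff_inv := h.diff_inv.iterate k
  one_lt := one_lt_pow₀ h.one_lt hk
  plus := h.plus.iterate k
  minus := h.minus.iterate k
  bound := h.bound
  sep := h.sep

/-- The elementary map conjugate to the inverse by the swap of coordinates. -/
def _root_.ElemHenon.rev (f : ElemHenon) : ElemHenon where
  P := Polynomial.C (-f.a⁻¹) * f.P.comp (Polynomial.C f.b⁻¹ * Polynomial.X)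
  a := f.a⁻¹
  b := f.b⁻¹
  ha := inv_ne_zero f.ha
  hb := inv_ne_zero f.hb
  hdeg := by
    rw [Polynomial.natDegree_C_mul (neg_ne_zero.2 (inv_ne_zero f.ha)), Polynomial.natDegree_comp,
      Polynomial.natDegree_C_mul (inv_ne_zero f.hb), Polynomial.natDegree_X, mul_one]
    exact f.hdeg

lemma _root_.ElemHenon.natDegree_rev (f : ElemHenon) : f.rev.P.natDegree = f.P.natDegree := by
  change Polynomial.natDegree (Polynomial.C (-f.a⁻¹) *
    f.P.comp (Polynomial.C f.b⁻¹ * Polynomial.X)) = _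
  rw [Polynomial.natDegree_C_mul (neg_ne_zero.2 (inv_ne_zero f.ha)), Polynomial.natDegree_comp,
    Polynomial.natDegree_C_mul (inv_ne_zero f.hb), Polynomial.natDegree_X, mul_one]

lemma _root_.ElemHenon.rev_toFun (f : ElemHenon) (x : ℂ × ℂ) :
    f.invFun x = (f.rev.toFun x.swap).swap := by
  simp only [ElemHenon.invFun, ElemHenon.toFun, ElemHenon.rev, Prod.swap, Polynomial.eval_mul,
    Polynomial.eval_C, Polynomial.eval_comp, Polynomial.eval_X]
  refine Prod.ext ?_ ?_
  · simp only; rw [div_eq_inv_mul]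
  · simp only
    rw [div_eq_inv_mul x.2]
    have := f.ha
    field_simp
    ring

lemma _root_.ElemHenon.left_inv (f : ElemHenon) (x : ℂ × ℂ) : f.invFun (f.toFun x) = x := by
  have := f.ha
  have := f.hb
  refine Prod.ext ?_ ?_
  · simp only [ElemHenon.invFun, ElemHenon.toFun]
    field_simp
  · simp only [ElemHenon.invFun, ElemHenon.toFun]
    rw [mul_div_cancel_left₀ _ f.hb]
    field_simp
    ring

lemma _root_.ElemHenon.right_inv (f : ElemHenon) (x : ℂ × ℂ) : f.toFun (f.invFun x) = x := by
  have := f.ha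
  have := f.hb
  refine Prod.ext ?_ ?_
  · simp only [ElemHenon.invFun, ElemHenon.toFun]
    field_simp
    ring
  · simp only [ElemHenon.invFun, ElemHenon.toFun]
    field_simp

lemma _root_.ElemHenon.differentiable (f : ElemHenon) : Differentiable ℂ f.toFun := by
  unfold ElemHenon.toFun
  have : Differentiable ℂ fun x : ℂ × ℂ => f.P.eval x.1 :=
    f.P.differentiable.comp differentiable_fst
  fun_prop

def _root_.HenonMap.rev (H : HenonMap) : HenonMap where
  comps := (H.comps.map ElemHenon.rev).reverse
  ne := by simpa using H.ne

lemma _root_.HenonMap.deg_rev (H : HenonMap) : H.rev.deg = H.deg := by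
  simp only [HenonMap.deg, HenonMap.rev, List.map_reverse, List.map_map, List.prod_reverse]
  congr 1
  refine List.map_congr_left fun f _ => ?_
  exact f.natDegree_rev

lemma _root_.HenonMap.rev_toFun (H : HenonMap) (x : ℂ × ℂ) :
    H.invFun x = (H.rev.toFun x.swap).swap := by
  have key : ∀ (l : List ElemHenon) (u v : ℂ × ℂ → ℂ × ℂ), (∀ x, u x = (v x.swap).swap) → ∀ x,
      l.foldl (fun f h => h.invFun ∘ f) u x =
      ((l.map ElemHenon.rev).foldl (fun f h => h.toFun ∘ f) v x.swap).swap := by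
    intro l
    induction l with
    | nil => intro u v h x; exact h x
    | cons f l ih =>
      intro u v h x
      simp only [List.foldl_cons, List.map_cons]
      refine ih _ _ (fun y => ?_) x
      simp only [Function.comp]
      rw [f.rev_toFun, h, Prod.swap_swap]
  simp only [HenonMap.invFun, HenonMap.rev, HenonMap.toFun, List.foldr_reverse]
  exact key H.comps id id (fun x => (Prod.swap_swap x).symm) x

lemma _root_.HenonMap.inv_foldl (l : List ElemHenon) (u : ℂ × ℂ → ℂ × ℂ) :
    l.foldl (fun f h => h.invFun ∘ f) u = l.foldl (fun f h => h.invFun ∘ f) id ∘ u := by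
  induction l generalizing u with
  | nil => rfl
  | cons f l ih =>
    simp only [List.foldl_cons]
    rw [ih (f.invFun ∘ u), ih (f.invFun ∘ id)]
    rfl

lemma _root_.HenonMap.left_inv (H : HenonMap) (x : ℂ × ℂ) : H.invFun (H.toFun x) = x := by
  unfold HenonMap.invFun HenonMap.toFun
  induction H.comps generalizing x with
  | nil => rfl
  | cons f l ih =>
    simp only [List.foldl_cons, List.foldr_cons]
    rw [HenonMap.inv_foldl]
    simp only [Function.comp, id]
    rw [f.left_inv]
    exact ih x

lemma _root_.HenonMap.right_inv (H : HenonMap) (x : ℂ × ℂ) : H.toFun (H.invFun x) = x := by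
  unfold HenonMap.invFun HenonMap.toFun
  induction H.comps generalizing x with
  | nil => rfl
  | cons f l ih =>
    simp only [List.foldl_cons, List.foldr_cons]
    rw [HenonMap.inv_foldl]
    simp only [Function.comp, id]
    rw [ih, f.right_inv]

lemma _root_.HenonMap.differentiable (H : HenonMap) : Differentiable ℂ H.toFun := by
  unfold HenonMap.toFun
  induction H.comps with
  | nil => exact differentiable_id
  | cons f l ih => exact f.differentiable.comp ih

lemma _root_.HenonMap.one_lt_deg (H : HenonMap) : (1 : ℝ) < H.deg := by
  have h : ∀ l : List ElemHenon, 1 ≤ (l.map fun h => h.P.natDegree).prod := by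
    intro l
    induction l with
    | nil => simp
    | cons f l ih =>
      rw [List.map_cons, List.prod_cons]
      have := f.hdeg
      nlinarith
  obtain ⟨l, hl⟩ := H
  cases l with
  | nil => exact absurd rfl hl
  | cons f l =>
    have h1 := h l
    have h2 := f.hdeg
    have : 1 < ((f :: l).map fun h => h.P.natDegree).prod := by
      rw [List.map_cons, List.prod_cons]
      nlinarith
    exact_mod_cast this

lemma norm_swap (x : ℂ × ℂ) : ‖x.swap‖ = ‖x‖ := by
  rw [Prod.norm_def, Prod.norm_def, max_comm]; rfl

lemma lp_swap (x : ℂ × ℂ) : lp x.swap = lp x := by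
  rw [lp, lp, norm_swap]

lemma iterate_swap {f g : ℂ × ℂ → ℂ × ℂ} (h : ∀ x, f x = (g x.swap).swap) (n : ℕ) (x : ℂ × ℂ) :
    f^[n] x = (g^[n] x.swap).swap := by
  induction n with
  | zero => simp
  | succ n ih =>
    rw [Function.iterate_succ_apply', Function.iterate_succ_apply', ih, h, Prod.swap_swap]

lemma green_swap {f g : ℂ × ℂ → ℂ × ℂ} (h : ∀ x, f x = (g x.swap).swap) (d : ℝ) (x : ℂ × ℂ) :
    green f d x = green g d x.swap := by
  unfold green
  congr 1
  funext n
  rw [iterate_swap h, lp_swap]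

lemma Half.swap {f g : ℂ × ℂ → ℂ × ℂ} {d : ℝ} {G G' : ℂ × ℂ → ℝ}
    (h : ∀ x, f x = (g x.swap).swap) (hG : ∀ x, G x = G' x.swap) (hg : Half g d G') :
    Half f d G where
  cont := by
    rw [funext hG]
    exact hg.cont.comp continuous_swap
  nonneg x := by rw [hG]; exact hg.nonneg _
  map x := by rw [hG, hG, h, Prod.swap_swap, hg.map]
  mv φ x hφ hpos := by
    simp only [hG] at hpos ⊢
    refine hg.mv (fun y => (φ y).swap) x ?_ hpos
    filter_upwards [hφ] with y hy
    exact hy.snd.prodMk hy.fst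

/-- Bounds in terms of the two regions of escape. -/
lemma log_near {R : ℝ} (hR : 1 ≤ R) {x : ℂ × ℂ} (h1 : x ∉ Reg R) (h2 : x.swap ∉ Reg R) :
    ‖x‖ ≤ 2 * R := by
  by_contra! hlt
  rcases le_total ‖x.1‖ ‖x.2‖ with h | h
  · have : ‖x‖ = ‖x.2‖ := by rw [Prod.norm_def]; exact max_eq_right h
    refine h2 ⟨?_, ?_⟩ <;> simp only [Prod.fst_swap, Prod.snd_swap] <;>
      linarith [norm_nonneg x.2]
  · have : ‖x‖ = ‖x.1‖ := by rw [Prod.norm_def]; exact max_eq_left h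
    refine h1 ⟨?_, ?_⟩ <;> linarith [norm_nonneg x.1]

lemma bound_of_le_of_zero {G : ℂ × ℂ → ℝ} (hc : Continuous G) {R M : ℝ} (hR : 1 ≤ R)
    (hG : ∀ x ∈ Reg R, |G x - Real.log ‖x.1‖| ≤ M) :
    ∃ C, ∀ x, x.swap ∉ Reg R → |G x - lp x| ≤ C := by
  obtain ⟨B, hB⟩ := (isCompact_closedBall (0 : ℂ × ℂ) (2 * R)).exists_bound_of_continuousOn
    (hc.sub lp_continuous).continuousOn
  refine ⟨max B (M + 1), fun x hx => ?_⟩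
  by_cases h : x ∈ Reg R
  · refine le_max_of_le_right ?_
    have h1 := abs_le.1 (hG x h)
    have h2 := abs_le.1 (lp_reg hR h)
    rw [abs_le]
    constructor <;> linarith
  · refine le_max_of_le_left ?_
    have := hB x (by simpa using log_near hR h hx)
    rwa [Real.norm_eq_abs] at this

lemma norm_small_fst {R : ℝ} {x : ℂ × ℂ} (h : x ∉ Reg R) : ‖x.1‖ ≤ max R (‖x.2‖ / 2) := by
  by_contra! hlt
  rw [max_lt_iff] at hlt
  exact h ⟨hlt.1.le, by linarith⟩

theorem _root_.HenonMap.dyn (H : HenonMap) :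
    Dyn H.toFun H.invFun (H.deg : ℝ) (Gplus H) (Gminus H) := by
  have hd := H.one_lt_deg
  have hsw := H.rev_toFun
  obtain ⟨R₁, hR₁, h₁⟩ := H.esc
  obtain ⟨R₂, hR₂, h₂⟩ := H.rev.esc
  set R₀ := max R₁ R₂
  have hR₀ : 1 ≤ R₀ := le_max_of_le_left hR₁
  obtain ⟨C₁, e₁⟩ := h₁ R₀ (le_max_left _ _)
  obtain ⟨C₂, e₂⟩ := h₂ R₀ (le_max_right _ _)
  rw [H.deg_rev] at e₂
  have half₁ := e₁.half hd hR₀ H.differentiable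
  have half₂ := e₂.half hd hR₀ H.rev.differentiable
  obtain ⟨M₁, -, g₁⟩ := e₁.green_reg hd hR₀
  obtain ⟨M₂, -, g₂⟩ := e₂.green_reg hd hR₀
  have hGm : ∀ x, Gminus H x = green H.rev.toFun H.deg x.swap := fun x =>
    green_swap (f := H.invFun) (g := H.rev.toFun) hsw H.deg x
  have hGp : Gplus H = green H.toFun H.deg := rfl
  set R := max R₀ (Real.exp (max M₁ M₂ + 1))
  have hR0 : R₀ ≤ R := le_max_left _ _
  have hR1 : 1 ≤ R := hR₀.trans hR0
  have hpos : ∀ {G : ℂ × ℂ → ℝ} {M : ℝ}, M ≤ max M₁ M₂ →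
      (∀ x ∈ Reg R₀, |G x - Real.log ‖x.1‖| ≤ M) → ∀ x ∈ Reg R, 0 < G x := by
    intro G M hM hG x hx
    have h1 := abs_le.1 (hG x ⟨hR0.trans hx.1, hx.2⟩)
    have h2 : Real.exp (max M₁ M₂ + 1) ≤ ‖x.1‖ := (le_max_right _ _).trans hx.1
    have h3 := (Real.le_log_iff_exp_le (by linarith [hx.1])).2 h2
    linarith
  have hsub : ∀ {G : ℂ × ℂ → ℝ} {M : ℝ}, (∀ x ∈ Reg R₀, |G x - Real.log ‖x.1‖| ≤ M) →
      ∀ x ∈ Reg R, |G x - Real.log ‖x.1‖| ≤ M := fun hG x hx => hG x ⟨hR0.trans hx.1, hx.2⟩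
  have hp0 : ∀ x, Gplus H x = 0 → x ∉ Reg R := fun x hx h =>
    (hpos (le_max_left _ _) g₁ x h).ne' hx
  have hm0 : ∀ x, Gminus H x = 0 → x.swap ∉ Reg R := fun x hx h =>
    (hpos (le_max_right _ _) g₂ _ h).ne' ((hGm x).symm.trans hx)
  refine ⟨H.left_inv, H.right_inv, H.differentiable, ?_, hd, half₁, half₂.swap hsw hGm, ?_, ?_⟩
  · rw [funext hsw]
    have : Differentiable ℂ fun x : ℂ × ℂ => H.rev.toFun x.swap :=
      H.rev.differentiable.comp (differentiable_snd.prodMk differentiable_fst)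
    exact (differentiable_snd.comp this).prodMk (differentiable_fst.comp this)
  · obtain ⟨B₁, hB₁⟩ := bound_of_le_of_zero half₁.cont hR1 (hsub g₁)
    obtain ⟨B₂, hB₂⟩ := bound_of_le_of_zero half₂.cont hR1 (hsub g₂)
    refine ⟨max B₁ B₂, fun x => ⟨fun hx => ?_, fun hx => ?_⟩⟩
    · rw [hGm, ← lp_swap]
      exact (hB₂ _ (by rw [Prod.swap_swap]; exact hp0 x hx)).trans (le_max_right _ _)
    · exact (hB₁ _ (hm0 x hx)).trans (le_max_left _ _)
  · refine ⟨1 / 2, by norm_num, 4 * R, fun x y hy hx hmax => ?_⟩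
    have hy' := norm_small_fst (hp0 y hy)
    have hx' := norm_small_fst (hm0 x hx)
    simp only [Prod.fst_swap, Prod.snd_swap] at hx'
    have s1 := norm_sub_norm_le x.1 y.1
    have s2 := norm_sub_norm_le y.2 x.2
    rw [norm_sub_rev y.2] at s2
    have t1 : ‖x.1 - y.1‖ ≤ ‖x - y‖ := norm_fst_le (x - y)
    have t2 : ‖x.2 - y.2‖ ≤ ‖x - y‖ := norm_snd_le (x - y)
    have nx := Prod.norm_def (x := x)
    have ny := Prod.norm_def (x := y)
    have a1 := norm_nonneg x.1
    have a2 := norm_nonneg x.2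
    have a3 := norm_nonneg y.1
    have a4 := norm_nonneg y.2
    have hxn : ‖x.2‖ ≤ max R (‖x‖ / 2) := hx'.trans (max_le_max le_rfl (by
      gcongr; exact norm_fst_le x))
    have hyn : ‖y.1‖ ≤ max R (‖y‖ / 2) := hy'.trans (max_le_max le_rfl (by
      gcongr; exact norm_snd_le y))
    rcases le_total ‖x‖ ‖y‖ with h | h
    · rw [max_eq_right h] at hmax ⊢
      have q1 : ‖y.1‖ ≤ ‖y‖ / 2 := by
        rcases le_max_iff.1 hyn with q | q <;> linarith
      have q2 : ‖y‖ = ‖y.2‖ := by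
        rcases max_choice ‖y.1‖ ‖y.2‖ with q | q <;> rw [q] at ny <;> linarith
      have q3 : ‖x.2‖ ≤ ‖y‖ / 2 := by
        rcases le_max_iff.1 hxn with q | q <;> linarith
      linarith
    · rw [max_eq_left h] at hmax ⊢
      have q1 : ‖x.2‖ ≤ ‖x‖ / 2 := by
        rcases le_max_iff.1 hxn with q | q <;> linarith
      have q2 : ‖x‖ = ‖x.1‖ := by
        rcases max_choice ‖x.1‖ ‖x.2‖ with q | q <;> rw [q] at nx <;> linarith
      have q3 : ‖y.1‖ ≤ ‖x‖ / 2 := by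
        rcases le_max_iff.1 hyn with q | q <;> linarith
      linarith

/-- Conjugation of a self-map by an affine isomorphism. -/
def conj (e : (ℂ × ℂ) ≃L[ℂ] (ℂ × ℂ)) (p : ℂ × ℂ) (F : ℂ × ℂ → ℂ × ℂ) : ℂ × ℂ → ℂ × ℂ :=
  fun u => e.symm (F (p + e u) - p)

lemma conj_spec (e : (ℂ × ℂ) ≃L[ℂ] (ℂ × ℂ)) (p : ℂ × ℂ) (F : ℂ × ℂ → ℂ × ℂ) (u : ℂ × ℂ) :
    p + e (conj e p F u) = F (p + e u) := by
  simp [conj]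

lemma conj_iterate_spec (e : (ℂ × ℂ) ≃L[ℂ] (ℂ × ℂ)) (p : ℂ × ℂ) (F : ℂ × ℂ → ℂ × ℂ) (n : ℕ)
    (u : ℂ × ℂ) : p + e ((conj e p F)^[n] u) = F^[n] (p + e u) := by
  induction n with
  | zero => rfl
  | succ n ih => rw [Function.iterate_succ_apply', Function.iterate_succ_apply', conj_spec, ih]

lemma lp_le_lp {x y : ℂ × ℂ} {A : ℝ} (hA : 1 ≤ A) (h : ‖y‖ ≤ A * max ‖x‖ 1) :
    lp y ≤ Real.log A + lp x := by
  have h1 : (1 : ℝ) ≤ max ‖x‖ 1 := le_max_right _ _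
  have h2 : max ‖y‖ 1 ≤ A * max ‖x‖ 1 := max_le h (by nlinarith)
  have := Real.log_le_log (lt_max_of_lt_right one_pos) h2
  rwa [Real.log_mul (by positivity) (by positivity)] at this

lemma Half.conj {F : ℂ × ℂ → ℂ × ℂ} {D : ℝ} {G : ℂ × ℂ → ℝ} (h : Half F D G)
    (e : (ℂ × ℂ) ≃L[ℂ] (ℂ × ℂ)) (p : ℂ × ℂ) :
    Half (conj e p F) D (fun u => G (p + e u)) where
  cont := h.cont.comp (by fun_prop)
  nonneg x := h.nonneg _
  map x := by rw [conj_spec, h.map]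
  mv φ x hφ hpos := by
    refine h.mv (fun y => p + e (φ y)) x ?_ hpos
    filter_upwards [hφ] with y hy
    fun_prop

lemma Dyn.conj {F Fi : ℂ × ℂ → ℂ × ℂ} {D : ℝ} {Gp Gm : ℂ × ℂ → ℝ} (h : Dyn F Fi D Gp Gm)
    (e : (ℂ × ℂ) ≃L[ℂ] (ℂ × ℂ)) (p : ℂ × ℂ) :
    Dyn (conj e p F) (HenonAux.conj e p Fi) D (fun u => Gp (p + e u)) (fun u => Gm (p + e u)) where
  left_inv x := by
    have := conj_spec e p Fi (HenonAux.conj e p F x)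
    rw [conj_spec e p F x, h.left_inv] at this
    simpa using this
  right_inv x := by
    have := conj_spec e p F (HenonAux.conj e p Fi x)
    rw [conj_spec e p Fi x, h.right_inv] at this
    simpa using this
  diff := by
    have := h.diff
    unfold HenonAux.conj
    fun_prop
  diff_inv := by
    have := h.diff_inv
    unfold HenonAux.conj
    fun_prop
  one_lt := h.one_lt
  plus := h.plus.conj e p
  minus := h.minus.conj e p
  bound := by
    obtain ⟨C, hC⟩ := h.bound
    set A := ‖p‖ + ‖(e : (ℂ × ℂ) →L[ℂ] (ℂ × ℂ))‖ + ‖(e.symm : (ℂ × ℂ) →L[ℂ] (ℂ × ℂ))‖ *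
      (1 + ‖p‖) + 1
    have hA : 1 ≤ A := by
      have : 0 ≤ ‖p‖ + ‖(e : (ℂ × ℂ) →L[ℂ] (ℂ × ℂ))‖ + ‖(e.symm : (ℂ × ℂ) →L[ℂ] (ℂ × ℂ))‖ *
        (1 + ‖p‖) := by positivity
      linarith
    have key : ∀ u, |lp (p + e u) - lp u| ≤ Real.log A := by
      intro u
      have hm1 : 1 ≤ max ‖u‖ 1 := le_max_right _ _
      have hm2 : ‖u‖ ≤ max ‖u‖ 1 := le_max_left _ _
      have h1 : ‖e u‖ ≤ ‖(e : (ℂ × ℂ) →L[ℂ] (ℂ × ℂ))‖ * ‖u‖ :=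
        (e : (ℂ × ℂ) →L[ℂ] (ℂ × ℂ)).le_opNorm u
      have h2 : ‖u‖ ≤ ‖(e.symm : (ℂ × ℂ) →L[ℂ] (ℂ × ℂ))‖ * ‖e u‖ := by
        have := (e.symm : (ℂ × ℂ) →L[ℂ] (ℂ × ℂ)).le_opNorm (e u)
        simpa using this
      have a1 := norm_nonneg (e : (ℂ × ℂ) →L[ℂ] (ℂ × ℂ))
      have a2 := norm_nonneg (e.symm : (ℂ × ℂ) →L[ℂ] (ℂ × ℂ))
      have a3 := norm_nonneg p
      have h3 := norm_add_le p (e u)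
      have h4 : ‖e u‖ ≤ ‖p + e u‖ + ‖p‖ := by
        have := norm_sub_le (p + e u) p
        simpa using this
      have hq1 : 1 ≤ max ‖p + e u‖ 1 := le_max_right _ _
      have hq2 : ‖p + e u‖ ≤ max ‖p + e u‖ 1 := le_max_left _ _
      have l1 : lp (p + e u) ≤ Real.log A + lp u := by
        refine lp_le_lp hA ?_
        have : ‖(e : (ℂ × ℂ) →L[ℂ] (ℂ × ℂ))‖ * ‖u‖ ≤
          ‖(e : (ℂ × ℂ) →L[ℂ] (ℂ × ℂ))‖ * max ‖u‖ 1 := by gcongr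
        have h5 : ‖p‖ ≤ ‖p‖ * max ‖u‖ 1 := le_mul_of_one_le_right a3 hm1
        have h6 : 0 ≤ ‖(e.symm : (ℂ × ℂ) →L[ℂ] (ℂ × ℂ))‖ * (1 + ‖p‖) * max ‖u‖ 1 := by positivity
        simp only [A]
        linarith
      have l2 : lp u ≤ Real.log A + lp (p + e u) := by
        refine lp_le_lp hA ?_
        have h5 : ‖(e.symm : (ℂ × ℂ) →L[ℂ] (ℂ × ℂ))‖ * ‖e u‖ ≤
          ‖(e.symm : (ℂ × ℂ) →L[ℂ] (ℂ × ℂ))‖ * ((1 + ‖p‖) * max ‖p + e u‖ 1) := by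
          gcongr
          nlinarith
        have h6 : 0 ≤ (‖p‖ + ‖(e : (ℂ × ℂ) →L[ℂ] (ℂ × ℂ))‖) * max ‖p + e u‖ 1 := by positivity
        simp only [A]
        linarith
      rw [abs_le]
      constructor <;> linarith
    refine ⟨C + Real.log A, fun u => ⟨fun hu => ?_, fun hu => ?_⟩⟩
    · have h1 := abs_le.1 ((hC _).1 hu)
      have h2 := abs_le.1 (key u)
      rw [abs_le]
      constructor <;> linarith
    · have h1 := abs_le.1 ((hC _).2 hu)
      have h2 := abs_le.1 (key u)
      rw [abs_le]
      constructor <;> linarith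
  sep := by
    obtain ⟨c, hc, R, hR⟩ := h.sep
    set E := ‖(e : (ℂ × ℂ) →L[ℂ] (ℂ × ℂ))‖ + 1
    set E' := ‖(e.symm : (ℂ × ℂ) →L[ℂ] (ℂ × ℂ))‖ + 1
    have hE : 0 < E := by positivity
    have hE' : 0 < E' := by positivity
    have up : ∀ u, ‖e u‖ ≤ E * ‖u‖ := fun u => by
      have := (e : (ℂ × ℂ) →L[ℂ] (ℂ × ℂ)).le_opNorm u
      have h2 := norm_nonneg u
      simp only [ContinuousLinearEquiv.coe_coe] at this
      simp only [E]; linarith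
    have lo : ∀ u, ‖u‖ ≤ E' * ‖e u‖ := fun u => by
      have := (e.symm : (ℂ × ℂ) →L[ℂ] (ℂ × ℂ)).le_opNorm (e u)
      have h2 := norm_nonneg (e u)
      simp only [ContinuousLinearEquiv.coe_coe, ContinuousLinearEquiv.symm_apply_apply] at this
      simp only [E']; linarith
    have lo' : ∀ u, ‖u‖ ≤ E' * (‖p + e u‖ + ‖p‖) := fun u => by
      refine (lo u).trans ?_
      gcongr
      have := norm_sub_le (p + e u) p
      simpa using this
    refine ⟨c / (2 * E' * E), by positivity, E' * (|R| + 2 * ‖p‖), fun x y hy hx hmax => ?_⟩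
    set m := max ‖p + e x‖ ‖p + e y‖
    have hm : max ‖x‖ ‖y‖ ≤ E' * (m + ‖p‖) := by
      refine max_le ((lo' x).trans ?_) ((lo' y).trans ?_)
      · gcongr; exact le_max_left _ _
      · gcongr; exact le_max_right _ _
    have hm2 : |R| + ‖p‖ ≤ m := by
      have := le_of_mul_le_mul_left (hmax.trans hm) hE'
      linarith
    have h1 := hR _ _ hy hx ((le_abs_self R).trans (by linarith [norm_nonneg p]))
    have h2 : ‖p + e x - (p + e y)‖ ≤ E * ‖x - y‖ := by
      rw [add_sub_add_left_eq_sub, ← map_sub]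
      exact up _
    have h3 : max ‖x‖ ‖y‖ ≤ E' * (2 * m) := hm.trans (by
      gcongr
      have := abs_nonneg R
      linarith)
    calc c / (2 * E' * E) * max ‖x‖ ‖y‖ ≤ c / (2 * E' * E) * (E' * (2 * m)) := by gcongr
      _ = c * m / E := by field_simp
      _ ≤ (E * ‖x - y‖) / E := div_le_div_of_nonneg_right (h1.trans h2) hE.le
      _ = ‖x - y‖ := by field_simp

end HenonAux

namespace HenonAux

/-- The diagonal linear map `(x, y) ↦ (λ x, μ y)`. -/
def diagMap (lam mu : ℂ) : (ℂ × ℂ) →L[ℂ] (ℂ × ℂ) :=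
  (lam • ContinuousLinearMap.fst ℂ ℂ ℂ).prod (mu • ContinuousLinearMap.snd ℂ ℂ ℂ)

lemma diagMap_apply (lam mu : ℂ) (x : ℂ × ℂ) : diagMap lam mu x = (lam * x.1, mu * x.2) := rfl

lemma norm_diagMap_le {lam mu : ℂ} (h : ‖lam‖ ≤ ‖mu‖) (x : ℂ × ℂ) :
    ‖diagMap lam mu x‖ ≤ ‖mu‖ * ‖x‖ := by
  rw [diagMap_apply, Prod.norm_def, norm_mul, norm_mul]
  have h1 := norm_fst_le x
  have h2 := norm_snd_le x
  refine max_le ?_ ?_ <;> gcongr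

/-- A holomorphic map of `ℂ²` with a saddle fixed point at the origin, in linear normal form to
first order. -/
structure Sad (F : ℂ × ℂ → ℂ × ℂ) (lam mu : ℂ) (r C : ℝ) : Prop where
  diff : Differentiable ℂ F
  zero : F 0 = 0
  lam_lt : ‖lam‖ < 1
  mu_gt : 1 < ‖mu‖
  r_pos : 0 < r
  C_pos : 0 < C
  lip : ∀ x y, ‖x‖ ≤ r → ‖y‖ ≤ r →
    ‖F x - F y - diagMap lam mu (x - y)‖ ≤ C * max ‖x‖ ‖y‖ * ‖x - y‖

section
variable {F : ℂ × ℂ → ℂ × ℂ} {lam mu : ℂ} {r C : ℝ}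

lemma Sad.mu_pos (h : Sad F lam mu r C) : 0 < ‖mu‖ := one_pos.trans h.mu_gt

lemma Sad.mu_ne (h : Sad F lam mu r C) : mu ≠ 0 := norm_pos_iff.1 h.mu_pos

lemma Sad.iterate_zero (h : Sad F lam mu r C) (n : ℕ) : F^[n] 0 = 0 :=
  Function.iterate_fixed h.zero n

lemma Sad.diff_iterate (h : Sad F lam mu r C) (n : ℕ) : Differentiable ℂ F^[n] :=
  h.diff.iterate n

lemma Sad.step (h : Sad F lam mu r C) {x y : ℂ × ℂ} {s : ℝ} (hx : ‖x‖ ≤ s) (hy : ‖y‖ ≤ s)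
    (hs : s ≤ r) : ‖F x - F y‖ ≤ ‖mu‖ * Real.exp (C * s) * ‖x - y‖ := by
  have h1 := h.lip x y (hx.trans hs) (hy.trans hs)
  have h2 := norm_diagMap_le (h.lam_lt.trans h.mu_gt).le (x - y)
  have h3 : ‖F x - F y‖ ≤ ‖F x - F y - diagMap lam mu (x - y)‖ + ‖diagMap lam mu (x - y)‖ := by
    have := norm_add_le (F x - F y - diagMap lam mu (x - y)) (diagMap lam mu (x - y))
    simpa using this
  have h4 : C * max ‖x‖ ‖y‖ * ‖x - y‖ ≤ C * s * ‖x - y‖ := by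
    have := h.C_pos
    gcongr
    exact max_le hx hy
  have h5 : C * s + 1 ≤ Real.exp (C * s) := Real.add_one_le_exp _
  have h6 : 0 ≤ s := (norm_nonneg x).trans hx
  have h7 : 0 ≤ C * s := mul_nonneg h.C_pos.le h6
  have h8 := norm_nonneg (x - y)
  calc ‖F x - F y‖ ≤ (C * s + ‖mu‖) * ‖x - y‖ := by linarith
    _ ≤ (‖mu‖ * (C * s + 1)) * ‖x - y‖ := by
      gcongr
      nlinarith [h.mu_gt]
    _ ≤ _ := by gcongr

lemma Sad.orbit_lip (h : Sad F lam mu r C) {x y : ℂ × ℂ} {s : ℕ → ℝ} {n : ℕ}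
    (hx : ∀ i < n, ‖F^[i] x‖ ≤ s i) (hy : ∀ i < n, ‖F^[i] y‖ ≤ s i) (hs : ∀ i < n, s i ≤ r) :
    ‖F^[n] x - F^[n] y‖ ≤ ‖mu‖ ^ n * Real.exp (C * ∑ i ∈ Finset.range n, s i) * ‖x - y‖ := by
  induction n with
  | zero => simp
  | succ n ih =>
    have ih' := ih (fun i hi => hx i (by omega)) (fun i hi => hy i (by omega))
      (fun i hi => hs i (by omega))
    rw [Function.iterate_succ_apply', Function.iterate_succ_apply']
    refine (h.step (hx n (by omega)) (hy n (by omega)) (hs n (by omega))).trans ?_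
    rw [Finset.sum_range_succ, mul_add, Real.exp_add, pow_succ]
    have := h.mu_pos
    calc _ ≤ ‖mu‖ * Real.exp (C * s n) *
        (‖mu‖ ^ n * Real.exp (C * ∑ i ∈ Finset.range n, s i) * ‖x - y‖) := by gcongr
      _ = _ := by ring

/-- Size budget for perturbed orbits. -/
structure Budget (mu : ℂ) (r C θ κ ρ : ℝ) : Prop where
  θ_pos : 0 < θ
  θ_lt : θ < 1
  κ_nonneg : 0 ≤ κ
  ρ_pos : 0 < ρ
  le_r : κ / (1 - θ) + 4 * ρ / (‖mu‖ - 1) ≤ r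
  le_log : C * (κ / (1 - θ) + 4 * ρ / (‖mu‖ - 1)) ≤ Real.log 2
  le_one : κ ≤ 1
  small : 4 * C * κ ≤ 1 - θ

lemma sum_budget {mu : ℂ} {θ κ ρ : ℝ} (hmu : 1 < ‖mu‖) (hθ : 0 < θ) (hθ1 : θ < 1) (hκ : 0 ≤ κ)
    (hρ : 0 ≤ ρ) {i n : ℕ} (hi : i ≤ n) :
    ∑ j ∈ Finset.range i, (κ * θ ^ j + ρ * (‖mu‖ ^ j / ‖mu‖ ^ n)) ≤
      κ / (1 - θ) + ρ / (‖mu‖ - 1) := by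
  have hm : 0 < ‖mu‖ := one_pos.trans hmu
  rw [Finset.sum_add_distrib, ← Finset.mul_sum, ← Finset.mul_sum, ← Finset.sum_div,
    geom_sum_eq hmu.ne']
  have h1 : ∑ j ∈ Finset.range i, θ ^ j ≤ 1 / (1 - θ) := by
    rw [geom_sum_eq hθ1.ne, ← neg_div_neg_eq, neg_sub, neg_sub]
    have : 0 < 1 - θ := by linarith
    gcongr
    have := pow_pos hθ i
    linarith
  have h2 : (‖mu‖ ^ i - 1) / (‖mu‖ - 1) / ‖mu‖ ^ n ≤ 1 / (‖mu‖ - 1) := by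
    rw [div_right_comm]
    have : 0 < ‖mu‖ - 1 := by linarith
    gcongr
    rw [div_le_one (by positivity)]
    have := pow_le_pow_right₀ hmu.le hi
    linarith
  calc _ ≤ κ * (1 / (1 - θ)) + ρ * (1 / (‖mu‖ - 1)) := by gcongr
    _ = _ := by ring

lemma Sad.lip_two (h : Sad F lam mu r C) {θ κ ρ : ℝ} (hb : Budget mu r C θ κ ρ) {x y : ℂ × ℂ}
    {i n : ℕ} (hi : i ≤ n)
    (hx : ∀ j < i, ‖F^[j] x‖ ≤ κ * θ ^ j + 4 * ρ * (‖mu‖ ^ j / ‖mu‖ ^ n))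
    (hy : ∀ j < i, ‖F^[j] y‖ ≤ κ * θ ^ j + 4 * ρ * (‖mu‖ ^ j / ‖mu‖ ^ n)) :
    ‖F^[i] x - F^[i] y‖ ≤ 2 * ‖mu‖ ^ i * ‖x - y‖ := by
  have hm := h.mu_pos
  have hsum := sum_budget h.mu_gt hb.θ_pos hb.θ_lt hb.κ_nonneg
    (by linarith [hb.ρ_pos] : 0 ≤ 4 * ρ) hi
  have hpos : ∀ j, 0 ≤ κ * θ ^ j + 4 * ρ * (‖mu‖ ^ j / ‖mu‖ ^ n) := fun j => by
    have := hb.κ_nonneg; have := hb.θ_pos; have := hb.ρ_pos; positivity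
  have := h.orbit_lip hx hy (fun j hj =>
    (Finset.single_le_sum (f := fun j => κ * θ ^ j + 4 * ρ * (‖mu‖ ^ j / ‖mu‖ ^ n))
      (fun j _ => hpos j) (Finset.mem_range.2 hj)).trans (hsum.trans hb.le_r))
  refine this.trans ?_
  have h2 : Real.exp (C * ∑ j ∈ Finset.range i, (κ * θ ^ j + 4 * ρ * (‖mu‖ ^ j / ‖mu‖ ^ n))) ≤ 2 := by
    rw [← Real.le_log_iff_exp_le two_pos]
    refine le_trans ?_ hb.le_log
    have := h.C_pos
    gcongr
  calc _ ≤ ‖mu‖ ^ i * 2 * ‖x - y‖ := by gcongr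
    _ = _ := by ring

/-- The exponentially contracted points. -/
def Con (F : ℂ × ℂ → ℂ × ℂ) (θ κ : ℝ) : Set (ℂ × ℂ) := {x | ∀ i : ℕ, ‖F^[i] x‖ ≤ κ * θ ^ i}

lemma Sad.perturb (h : Sad F lam mu r C) {θ κ ρ : ℝ} (hb : Budget mu r C θ κ ρ) {x y : ℂ × ℂ}
    (hx : x ∈ Con F θ κ) {n : ℕ} (hy : ‖y - x‖ ≤ 2 * ρ / ‖mu‖ ^ n) {i : ℕ} (hi : i ≤ n) :
    ‖F^[i] y - F^[i] x‖ ≤ 2 * ‖mu‖ ^ i * ‖y - x‖ := by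
  have hm := h.mu_pos
  have hρ := hb.ρ_pos
  induction i using Nat.strong_induction_on with
  | _ i ih =>
    refine h.lip_two hb hi (fun j hj => ?_) (fun j hj => ?_)
    · have h1 := ih j hj (by omega)
      have h2 := hx j
      have h3 : ‖F^[j] y‖ ≤ ‖F^[j] y - F^[j] x‖ + ‖F^[j] x‖ := by
        simpa using norm_add_le (F^[j] y - F^[j] x) (F^[j] x)
      have h4 : 2 * ‖mu‖ ^ j * ‖y - x‖ ≤ 2 * ‖mu‖ ^ j * (2 * ρ / ‖mu‖ ^ n) := by gcongr
      have h5 : 2 * ‖mu‖ ^ j * (2 * ρ / ‖mu‖ ^ n) = 4 * ρ * (‖mu‖ ^ j / ‖mu‖ ^ n) := by ring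
      linarith
    · have : 0 ≤ 4 * ρ * (‖mu‖ ^ j / ‖mu‖ ^ n) := by positivity
      linarith [hx j]

end

end HenonAux

namespace HenonAux

/-- Renormalised iterates along the unstable direction. -/
def Lm (F : ℂ × ℂ → ℂ × ℂ) (mu : ℂ) (m : ℕ) (x : ℂ × ℂ) (τ : ℂ) : ℂ × ℂ :=
  F^[m] (x + (0, τ / mu ^ m))

/-- Derivative of `Lm` at `τ = 0`. -/
def dLm (F : ℂ × ℂ → ℂ × ℂ) (mu : ℂ) (m : ℕ) (x : ℂ × ℂ) : ℂ × ℂ := deriv (Lm F mu m x) 0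

section
variable {F : ℂ × ℂ → ℂ × ℂ} {lam mu : ℂ} {r C : ℝ}

lemma norm_zero_pair (t : ℂ) : ‖((0 : ℂ), t)‖ = ‖t‖ := by
  rw [Prod.norm_def]; simp

lemma Lm_zero_right (m : ℕ) (x : ℂ × ℂ) : Lm F mu m x 0 = F^[m] x := by
  simp only [Lm, zero_div]
  rw [show ((0 : ℂ), (0 : ℂ)) = 0 from rfl, add_zero]

lemma Lm_add (m q : ℕ) (x : ℂ × ℂ) (τ : ℂ) :
    Lm F mu (m + q) x τ = F^[q] (Lm F mu m x (τ / mu ^ q)) := by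
  rw [Lm, Lm, add_comm m q, Function.iterate_add_apply, div_div, ← pow_add]

lemma Sad.diff_Lm (h : Sad F lam mu r C) (m : ℕ) (x : ℂ × ℂ) : Differentiable ℂ (Lm F mu m x) := by
  have := h.diff_iterate m
  unfold Lm
  fun_prop

lemma Sad.Lm_sub_le (h : Sad F lam mu r C) {θ κ ρ : ℝ} (hb : Budget mu r C θ κ ρ) {x : ℂ × ℂ}
    (hx : x ∈ Con F θ κ) (m : ℕ) {τ : ℂ} (hτ : ‖τ‖ ≤ 2 * ρ) :
    ‖Lm F mu m x τ - F^[m] x‖ ≤ 2 * ‖τ‖ := by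
  have hm := h.mu_pos
  have h1 : ‖(x + (0, τ / mu ^ m)) - x‖ = ‖τ‖ / ‖mu‖ ^ m := by
    rw [add_sub_cancel_left, norm_zero_pair, norm_div, norm_pow]
  have := h.perturb hb hx (y := x + (0, τ / mu ^ m)) (n := m) (by rw [h1]; gcongr) le_rfl
  rw [h1] at this
  refine this.trans_eq ?_
  field_simp

lemma Con.le_one {θ κ ρ : ℝ} (hb : Budget mu r C θ κ ρ) {x : ℂ × ℂ}
    (hx : x ∈ Con F θ κ) (m : ℕ) : ‖F^[m] x‖ ≤ 1 := by
  refine (hx m).trans ?_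
  have := pow_le_one₀ (n := m) hb.θ_pos.le hb.θ_lt.le
  have h2 := hb.le_one
  have h3 := hb.κ_nonneg
  have h4 := pow_nonneg hb.θ_pos.le m
  nlinarith

lemma Sad.dLm_hasDerivAt (h : Sad F lam mu r C) (m : ℕ) (x : ℂ × ℂ) :
    HasDerivAt (Lm F mu m x) (dLm F mu m x) 0 := (h.diff_Lm m x 0).hasDerivAt

lemma Sad.norm_dLm_le (h : Sad F lam mu r C) {θ κ ρ : ℝ} (hb : Budget mu r C θ κ ρ) {x : ℂ × ℂ}
    (hx : x ∈ Con F θ κ) (m : ℕ) : ‖dLm F mu m x‖ ≤ 2 := by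
  refine (h.dLm_hasDerivAt m x).le_of_lip' two_pos.le ?_
  filter_upwards [closedBall_mem_nhds (0 : ℂ) (by linarith [hb.ρ_pos] : 0 < 2 * ρ)] with τ hτ
  rw [Lm_zero_right, sub_zero]
  exact h.Lm_sub_le hb hx m (by simpa using hτ)

lemma Sad.Lm_quad (h : Sad F lam mu r C) {θ κ ρ : ℝ} (hb : Budget mu r C θ κ ρ) {x : ℂ × ℂ}
    (hx : x ∈ Con F θ κ) (m : ℕ) {τ : ℂ} (hτ : ‖τ‖ ≤ ρ) :
    ‖Lm F mu m x τ - F^[m] x - τ • dLm F mu m x‖ ≤ 3 / ρ * ‖τ‖ ^ 2 := by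
  have hρ := hb.ρ_pos
  have hd := h.diff_Lm m x
  have hnear : ∀ z ∈ ball (0 : ℂ) (2 * ρ), ‖dslope (Lm F mu m x) 0 z‖ ≤ 2 := by
    intro z hz
    rcases eq_or_ne z 0 with rfl | hz0
    · rw [dslope_same]; exact h.norm_dLm_le hb hx m
    · rw [dslope_of_ne _ hz0, slope_def_module, norm_smul, sub_zero, norm_inv, Lm_zero_right,
        inv_mul_le_iff₀ (norm_pos_iff.2 hz0), mul_comm]
      exact h.Lm_sub_le hb hx m (by simpa using (mem_ball.1 hz).le)
  have hdd : DifferentiableOn ℂ (dslope (Lm F mu m x) 0) (ball 0 (2 * ρ)) := by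
    rw [Complex.differentiableOn_dslope (ball_mem_nhds _ (by positivity))]
    exact hd.differentiableOn
  have hmaps : MapsTo (dslope (Lm F mu m x) 0) (ball 0 (2 * ρ))
      (closedBall (dslope (Lm F mu m x) 0 0) 4) := by
    intro z hz
    rw [mem_closedBall, dist_eq_norm]
    have h1 := hnear z hz
    have h2 := hnear 0 (mem_ball_self (by positivity))
    linarith [norm_sub_le (dslope (Lm F mu m x) 0 z) (dslope (Lm F mu m x) 0 0)]
  have hτ' : τ ∈ ball (0 : ℂ) (2 * ρ) := by
    rw [mem_ball_zero_iff]; linarith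
  have key := Complex.dist_le_div_mul_dist_of_mapsTo_ball hdd hmaps hτ'
  rw [dist_eq_norm, dist_eq_norm, sub_zero, dslope_same] at key
  have e1 : Lm F mu m x τ - F^[m] x = τ • dslope (Lm F mu m x) 0 τ := by
    have := sub_smul_dslope (Lm F mu m x) 0 τ
    rw [sub_zero, Lm_zero_right] at this
    exact this.symm
  rw [e1, ← smul_sub, norm_smul]
  calc _ ≤ ‖τ‖ * (4 / (2 * ρ) * ‖τ‖) := by gcongr; exact key
    _ = 2 / ρ * ‖τ‖ ^ 2 := by field_simp; ring
    _ ≤ _ := by gcongr; norm_num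

lemma Sad.dLm_succ (h : Sad F lam mu r C) {θ κ ρ : ℝ} (hb : Budget mu r C θ κ ρ) {x : ℂ × ℂ}
    (hx : x ∈ Con F θ κ) (m : ℕ) :
    ‖dLm F mu (m + 1) x - mu⁻¹ • diagMap lam mu (dLm F mu m x)‖ ≤ 2 * C * κ * θ ^ m := by
  have hC := h.C_pos
  have hρ := hb.ρ_pos
  have hm := h.mu_pos
  have hk0 : 0 ≤ κ * θ ^ m := mul_nonneg hb.κ_nonneg (pow_nonneg hb.θ_pos.le _)
  have hsc : HasDerivAt (fun τ : ℂ => τ / mu) mu⁻¹ 0 := by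
    simpa using (hasDerivAt_id (0 : ℂ)).div_const mu
  have hcomp : HasDerivAt (fun τ : ℂ => Lm F mu m x (τ / mu)) (mu⁻¹ • dLm F mu m x) 0 := by
    have h0 := h.dLm_hasDerivAt m x
    rw [← zero_div mu] at h0
    exact h0.scomp (0 : ℂ) hsc
  have hder : HasDerivAt (fun τ => Lm F mu (m + 1) x τ - diagMap lam mu (Lm F mu m x (τ / mu)))
      (dLm F mu (m + 1) x - mu⁻¹ • diagMap lam mu (dLm F mu m x)) 0 := by
    refine (h.dLm_hasDerivAt (m + 1) x).sub ?_
    have := (diagMap lam mu).hasFDerivAt.comp_hasDerivAt (0 : ℂ) hcomp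
    rwa [map_smul] at this
  refine le_of_forall_pos_le_add fun ε hε => ?_
  have hκr : κ < r := by
    have h1 : κ ≤ κ / (1 - θ) := by
      rw [le_div_iff₀ (by linarith [hb.θ_lt])]
      nlinarith [hb.κ_nonneg, hb.θ_pos]
    have h2 : 0 < 4 * ρ / (‖mu‖ - 1) := div_pos (by linarith) (by linarith [h.mu_gt])
    linarith [hb.le_r]
  have hB : 0 ≤ 2 * C * κ * θ ^ m + ε := by nlinarith
  refine hder.le_of_lip' hB ?_
  have hδ : 0 < min (min ρ (ε / (4 * C))) ((r - κ) / 2) :=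
    lt_min (by positivity) (by linarith)
  filter_upwards [closedBall_mem_nhds (0 : ℂ) hδ] with τ hτ
  rw [mem_closedBall_zero_iff] at hτ
  have hτ1 : ‖τ‖ ≤ ρ := hτ.trans ((min_le_left _ _).trans (min_le_left _ _))
  have hτ2 : ‖τ‖ ≤ ε / (4 * C) := hτ.trans ((min_le_left _ _).trans (min_le_right _ _))
  have hτ3 : ‖τ‖ ≤ (r - κ) / 2 := hτ.trans (min_le_right _ _)
  have hτm : ‖τ / mu‖ ≤ ‖τ‖ := by
    rw [norm_div]; exact div_le_self (norm_nonneg _) h.mu_gt.le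
  set y := Lm F mu m x (τ / mu) with hy
  have hyx : ‖y - F^[m] x‖ ≤ 2 * ‖τ‖ :=
    (h.Lm_sub_le hb hx m (by linarith)).trans (by linarith)
  have hFx := hx m
  have hyn : ‖y‖ ≤ κ * θ ^ m + 2 * ‖τ‖ := by
    have : ‖y‖ ≤ ‖y - F^[m] x‖ + ‖F^[m] x‖ := by simpa using norm_add_le (y - F^[m] x) (F^[m] x)
    linarith
  have hbig : κ * θ ^ m + 2 * ‖τ‖ ≤ r := by
    have := mul_le_of_le_one_right hb.κ_nonneg (pow_le_one₀ (n := m) hb.θ_pos.le hb.θ_lt.le)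
    linarith
  have hl := h.lip y (F^[m] x) (hyn.trans hbig) (hFx.trans (by linarith [norm_nonneg τ]))
  have e : Lm F mu (m + 1) x τ = F y := by
    rw [Lm_add m 1, pow_one]; rfl
  simp only [e, zero_div, Lm_zero_right, Function.iterate_succ_apply', sub_zero]
  rw [sub_sub_sub_comm, ← map_sub]
  refine hl.trans ?_
  have hmax : max ‖y‖ ‖F^[m] x‖ ≤ κ * θ ^ m + 2 * ‖τ‖ :=
    max_le hyn (hFx.trans (by linarith [norm_nonneg τ]))
  have h4 : 2 * ‖τ‖ * C ≤ ε / 2 := by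
    rw [le_div_iff₀ (by positivity)] at hτ2
    linarith
  calc C * max ‖y‖ ‖F^[m] x‖ * ‖y - F^[m] x‖ ≤ C * (κ * θ ^ m + 2 * ‖τ‖) * (2 * ‖τ‖) := by gcongr
    _ = (2 * C * κ * θ ^ m + 2 * (2 * ‖τ‖ * C)) * ‖τ‖ := by ring
    _ ≤ _ := by gcongr; linarith

end

end HenonAux

namespace HenonAux

/-- The limiting vertical derivative. -/
def cc (F : ℂ × ℂ → ℂ × ℂ) (mu : ℂ) (x : ℂ × ℂ) : ℂ :=
  limUnder atTop fun m => (dLm F mu m x).2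

section
variable {F : ℂ × ℂ → ℂ × ℂ} {lam mu : ℂ} {r C : ℝ}

lemma Sad.dLm_snd_succ (h : Sad F lam mu r C) {θ κ ρ : ℝ} (hb : Budget mu r C θ κ ρ) {x : ℂ × ℂ}
    (hx : x ∈ Con F θ κ) (m : ℕ) :
    dist (dLm F mu m x).2 (dLm F mu (m + 1) x).2 ≤ 2 * C * κ * θ ^ m := by
  have h1 := (norm_snd_le _).trans (h.dLm_succ hb hx m)
  rw [diagMap_apply, Prod.snd_sub, Prod.smul_snd, smul_eq_mul, inv_mul_cancel_left₀ h.mu_ne] at h1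
  rwa [dist_comm, dist_eq_norm]

lemma Sad.cc_tendsto (h : Sad F lam mu r C) {θ κ ρ : ℝ} (hb : Budget mu r C θ κ ρ) {x : ℂ × ℂ}
    (hx : x ∈ Con F θ κ) : Tendsto (fun m => (dLm F mu m x).2) atTop (𝓝 (cc F mu x)) :=
  (cauchySeq_of_le_geometric θ (2 * C * κ) hb.θ_lt (h.dLm_snd_succ hb hx)).tendsto_limUnder

lemma Sad.cc_dist (h : Sad F lam mu r C) {θ κ ρ : ℝ} (hb : Budget mu r C θ κ ρ) {x : ℂ × ℂ}
    (hx : x ∈ Con F θ κ) (m : ℕ) :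
    ‖(dLm F mu m x).2 - cc F mu x‖ ≤ 2 * C * κ * θ ^ m / (1 - θ) := by
  rw [← dist_eq_norm]
  exact dist_le_of_le_geometric_of_tendsto θ (2 * C * κ) hb.θ_lt (h.dLm_snd_succ hb hx)
    (h.cc_tendsto hb hx) m

lemma dLm_zero (x : ℂ × ℂ) : dLm F mu 0 x = (0, 1) := by
  have : HasDerivAt (Lm F mu 0 x) ((0 : ℂ), (1 : ℂ)) 0 := by
    unfold Lm
    simp only [pow_zero, div_one, Function.iterate_zero, id_eq]
    exact ((hasDerivAt_const (0 : ℂ) (0 : ℂ)).prodMk (hasDerivAt_id (0 : ℂ))).const_add x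
  exact this.deriv

lemma Sad.cc_near_one (h : Sad F lam mu r C) {θ κ ρ : ℝ} (hb : Budget mu r C θ κ ρ) {x : ℂ × ℂ}
    (hx : x ∈ Con F θ κ) : ‖1 - cc F mu x‖ ≤ 1 / 2 := by
  have := h.cc_dist hb hx 0
  rw [dLm_zero] at this
  refine this.trans ?_
  rw [pow_zero, div_le_iff₀ (by linarith [hb.θ_lt])]
  linarith [hb.small]

lemma Sad.cc_bounds (h : Sad F lam mu r C) {θ κ ρ : ℝ} (hb : Budget mu r C θ κ ρ) {x : ℂ × ℂ}
    (hx : x ∈ Con F θ κ) : 1 / 2 ≤ ‖cc F mu x‖ ∧ ‖cc F mu x‖ ≤ 2 := by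
  have := h.cc_near_one hb hx
  have h1 := norm_sub_norm_le (1 : ℂ) (cc F mu x)
  have h2 := norm_sub_norm_le (cc F mu x) 1
  rw [norm_one] at *
  rw [norm_sub_rev] at h2
  constructor <;> linarith

lemma Sad.dLm_fst (h : Sad F lam mu r C) {θ κ ρ : ℝ} (hb : Budget mu r C θ κ ρ)
    (hlam : ‖lam‖ ≤ θ) {x : ℂ × ℂ} (hx : x ∈ Con F θ κ) (m : ℕ) :
    ‖(dLm F mu m x).1‖ ≤ 2 * C * κ / (θ - ‖lam‖ / ‖mu‖) * θ ^ m := by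
  have hm := h.mu_pos
  have hlt : 0 < θ - ‖lam‖ / ‖mu‖ := by
    rw [sub_pos, div_lt_iff₀ hm]
    nlinarith [hb.θ_pos, h.mu_gt]
  have hC := h.C_pos
  have hκ := hb.κ_nonneg
  have hθ := hb.θ_pos
  set K := 2 * C * κ / (θ - ‖lam‖ / ‖mu‖) with hK
  have hK2 : K * (θ - ‖lam‖ / ‖mu‖) = 2 * C * κ := by
    rw [hK, div_mul_cancel₀ _ hlt.ne']
  induction m with
  | zero =>
    rw [dLm_zero, norm_zero]
    positivity
  | succ m ih =>
    have h1 := (norm_fst_le _).trans (h.dLm_succ hb hx m)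
    rw [diagMap_apply, Prod.fst_sub, Prod.smul_fst, smul_eq_mul] at h1
    set a := (dLm F mu (m + 1) x).1
    have h2 : ‖a‖ ≤ ‖a - mu⁻¹ * (lam * (dLm F mu m x).1)‖ +
        ‖mu⁻¹ * (lam * (dLm F mu m x).1)‖ := by
      simpa using norm_add_le (a - mu⁻¹ * (lam * (dLm F mu m x).1))
        (mu⁻¹ * (lam * (dLm F mu m x).1))
    have h3 : ‖mu⁻¹ * (lam * (dLm F mu m x).1)‖ ≤ ‖lam‖ / ‖mu‖ * (K * θ ^ m) := by
      rw [norm_mul, norm_mul, norm_inv, ← mul_assoc, div_eq_inv_mul]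
      gcongr
    calc ‖a‖ ≤ 2 * C * κ * θ ^ m + ‖lam‖ / ‖mu‖ * (K * θ ^ m) := by linarith
      _ = K * θ ^ (m + 1) := by rw [← hK2]; ring

lemma Sad.dLm_near (h : Sad F lam mu r C) {θ κ ρ : ℝ} (hb : Budget mu r C θ κ ρ)
    (hlam : ‖lam‖ ≤ θ) : ∃ K, 0 ≤ K ∧ ∀ x ∈ Con F θ κ, ∀ m,
    ‖dLm F mu m x - (0, cc F mu x)‖ ≤ K * θ ^ m := by
  have hC := h.C_pos
  have hκ := hb.κ_nonneg
  have hθ := hb.θ_pos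
  have h1 : 0 < 1 - θ := by linarith [hb.θ_lt]
  refine ⟨max (2 * C * κ / (θ - ‖lam‖ / ‖mu‖)) (2 * C * κ / (1 - θ)),
    le_max_of_le_right (by positivity), fun x hx m => ?_⟩
  rw [Prod.norm_def]
  refine max_le ?_ ?_
  · simp only [Prod.fst_sub, sub_zero]
    refine (h.dLm_fst hb hlam hx m).trans ?_
    gcongr
    exact le_max_left _ _
  · simp only [Prod.snd_sub]
    refine (h.cc_dist hb hx m).trans ?_
    rw [mul_div_right_comm]
    gcongr
    exact le_max_right _ _

/-- Comparison of the renormalised iterates with those based at the fixed point. -/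
lemma Sad.Lm_compare (h : Sad F lam mu r C) {θ κ ρ : ℝ} (hb : Budget mu r C θ κ ρ)
    (hlam : ‖lam‖ ≤ θ) : ∃ K, 0 ≤ K ∧ ∀ x ∈ Con F θ κ, ∀ τ : ℂ, ‖τ‖ ≤ ρ → ∀ m q,
    ‖Lm F mu (m + q) x τ - Lm F mu q 0 (cc F mu x * τ)‖ ≤
      ‖mu‖ ^ q * (K * θ ^ m) + K / ‖mu‖ ^ q := by
  obtain ⟨K, hK, hKb⟩ := h.dLm_near hb hlam
  have hm := h.mu_pos
  have hρ := hb.ρ_pos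
  have hκ := hb.κ_nonneg
  have hθ := hb.θ_pos
  refine ⟨2 * (κ + K * ρ) + 6 * ρ, by positivity, fun x hx τ hτ m q => ?_⟩
  have hq1 : 1 ≤ ‖mu‖ ^ q := one_le_pow₀ h.mu_gt.le
  set t := τ / mu ^ q with ht
  have htn : ‖t‖ = ‖τ‖ / ‖mu‖ ^ q := by rw [ht, norm_div, norm_pow]
  have htρ : ‖t‖ ≤ ρ := by rw [htn]; exact (div_le_self (norm_nonneg _) hq1).trans hτ
  set y := Lm F mu m x t with hy
  set y' : ℂ × ℂ := (0, cc F mu x * t) with hy'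
  have e1 : Lm F mu (m + q) x τ = F^[q] y := Lm_add m q x τ
  have e2 : Lm F mu q 0 (cc F mu x * τ) = F^[q] y' := by
    rw [Lm, zero_add, hy', ht, mul_div_assoc]
  have hc := (h.cc_bounds hb hx).2
  have hb0 : (0 : ℂ × ℂ) ∈ Con F θ κ := fun i => by
    rw [h.iterate_zero, norm_zero]; positivity
  have hyd : ‖y - y'‖ ≤ κ * θ ^ m + 3 / ρ * ‖t‖ ^ 2 + ‖t‖ * (K * θ ^ m) := by
    have h1 := h.Lm_quad hb hx m htρ
    have h2 := hx m
    have h3 : ‖t • dLm F mu m x - y'‖ ≤ ‖t‖ * (K * θ ^ m) := by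
      have : t • dLm F mu m x - y' = t • (dLm F mu m x - (0, cc F mu x)) := by
        ext
        · simp [hy']
        · simp [hy']; ring
      rw [this, norm_smul]
      gcongr
      exact hKb x hx m
    have : y - y' = F^[m] x + (y - F^[m] x - t • dLm F mu m x) + (t • dLm F mu m x - y') := by abel
    rw [this]
    refine norm_add₃_le.trans ?_
    linarith
  have key : ‖F^[q] y - F^[q] y'‖ ≤ 2 * ‖mu‖ ^ q * ‖y - y'‖ := by
    refine h.lip_two hb le_rfl (fun j hj => ?_) (fun j hj => ?_)
    · have e3 : F^[j] y = F^[m + j] (x + (0, τ / mu ^ (m + q))) := by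
        rw [hy, Lm, ← Function.iterate_add_apply, add_comm j m, ht, div_div, ← pow_add, add_comm q]
      rw [e3]
      have h1 : ‖(x + (0, τ / mu ^ (m + q))) - x‖ = ‖τ‖ / ‖mu‖ ^ (m + q) := by
        rw [add_sub_cancel_left, norm_zero_pair, norm_div, norm_pow]
      have h2 := h.perturb hb hx (y := x + (0, τ / mu ^ (m + q))) (n := m + q)
        (by rw [h1]; gcongr; linarith) (i := m + j) (by omega)
      rw [h1] at h2
      have h3 := hx (m + j)
      have h4 : κ * θ ^ (m + j) ≤ κ * θ ^ j := by
        gcongr 1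
        exact pow_le_pow_of_le_one hθ.le hb.θ_lt.le (by omega)
      have h5 : 2 * ‖mu‖ ^ (m + j) * (‖τ‖ / ‖mu‖ ^ (m + q)) = 2 * ‖τ‖ * (‖mu‖ ^ j / ‖mu‖ ^ q) := by
        rw [pow_add, pow_add]; field_simp
      have h6 : 2 * ‖τ‖ * (‖mu‖ ^ j / ‖mu‖ ^ q) ≤ 4 * ρ * (‖mu‖ ^ j / ‖mu‖ ^ q) := by
        gcongr; linarith
      have h7 := norm_add_le (F^[m + j] (x + (0, τ / mu ^ (m + q))) - F^[m + j] x) (F^[m + j] x)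
      rw [sub_add_cancel] at h7
      linarith
    · have h1 : ‖y' - 0‖ ≤ 2 * ρ / ‖mu‖ ^ q := by
        rw [sub_zero, hy', norm_zero_pair, norm_mul, htn, ← mul_div_assoc]
        gcongr
      have h2 := h.perturb hb hb0 (y := y') (n := q) h1 hj.le
      rw [h.iterate_zero, sub_zero] at h2
      have h3 : 2 * ‖mu‖ ^ j * ‖y' - 0‖ ≤ 2 * ‖mu‖ ^ j * (2 * ρ / ‖mu‖ ^ q) := by gcongr
      have h4 : 2 * ‖mu‖ ^ j * (2 * ρ / ‖mu‖ ^ q) = 4 * ρ * (‖mu‖ ^ j / ‖mu‖ ^ q) := by ring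
      have h5 : 0 ≤ κ * θ ^ j := by positivity
      linarith
  rw [e1, e2]
  refine key.trans ?_
  have hθm : 0 < θ ^ m := by positivity
  calc 2 * ‖mu‖ ^ q * ‖y - y'‖ ≤
      2 * ‖mu‖ ^ q * (κ * θ ^ m + 3 / ρ * (ρ / ‖mu‖ ^ q) ^ 2 + ρ * (K * θ ^ m)) := by
        gcongr
        refine hyd.trans ?_
        have : ‖t‖ ≤ ρ / ‖mu‖ ^ q := by rw [htn]; gcongr
        gcongr
    _ = ‖mu‖ ^ q * (2 * (κ + K * ρ) * θ ^ m) + 6 * ρ / ‖mu‖ ^ q := by field_simp; ring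
    _ ≤ _ := by
      gcongr
      · linarith
      · have : 0 ≤ 2 * (κ + K * ρ) := by positivity
        linarith

end

end HenonAux

namespace HenonAux

lemma tendstoUniformlyOn_continuous_comp {α : Type*} {S : Set α} {f : ℕ → α → ℂ × ℂ}
    {f₀ : α → ℂ × ℂ} (hf : TendstoUniformlyOn f f₀ atTop S) {B : ℝ} (hB : ∀ x ∈ S, ‖f₀ x‖ ≤ B)
    {g : ℂ × ℂ → ℂ × ℂ} (hg : Continuous g) :
    TendstoUniformlyOn (fun n x => g (f n x)) (fun x => g (f₀ x)) atTop S := by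
  have huc : UniformContinuousOn g (closedBall 0 (B + 1)) :=
    (isCompact_closedBall _ _).uniformContinuousOn_of_continuous hg.continuousOn
  rw [Metric.tendstoUniformlyOn_iff] at hf ⊢
  intro ε hε
  obtain ⟨δ, hδ, hu⟩ := Metric.uniformContinuousOn_iff.1 huc ε hε
  filter_upwards [hf (min δ 1) (by positivity)] with n hn x hx
  have h1 := hn x hx
  refine hu _ ?_ _ ?_ (h1.trans_le (min_le_left _ _))
  · rw [mem_closedBall_zero_iff]; linarith [hB x hx]
  · rw [mem_closedBall_zero_iff]
    have h2 := h1.trans_le (min_le_right _ _)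
    rw [dist_comm, dist_eq_norm] at h2
    have := norm_add_le (f n x - f₀ x) (f₀ x)
    rw [sub_add_cancel] at this
    linarith [hB x hx]

lemma tendstoUniformlyOn_of_add {α : Type*} {S : Set α} {f : ℕ → α → ℂ × ℂ}
    {f₀ : α → ℂ × ℂ} {k : ℕ} (hf : TendstoUniformlyOn (fun n => f (n + k)) f₀ atTop S) :
    TendstoUniformlyOn f f₀ atTop S := by
  rw [Metric.tendstoUniformlyOn_iff] at hf ⊢
  intro ε hε
  obtain ⟨N, hN⟩ := eventually_atTop.1 (hf ε hε)
  refine eventually_atTop.2 ⟨N + k, fun n hn => ?_⟩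
  have := hN (n - k) (by omega)
  rwa [Nat.sub_add_cancel (by omega)] at this

/-- The parametrisation of the local unstable manifold, linearising the dynamics. -/
def psi (F : ℂ × ℂ → ℂ × ℂ) (mu : ℂ) (t : ℂ) : ℂ × ℂ := limUnder atTop fun q => Lm F mu q 0 t

section
variable {F : ℂ × ℂ → ℂ × ℂ} {lam mu : ℂ} {r C : ℝ}

lemma Budget.zero {θ κ ρ : ℝ} (h : Sad F lam mu r C) (hb : Budget mu r C θ κ ρ) :
    Budget mu r C θ 0 ρ := by
  have h1 : 0 ≤ κ / (1 - θ) := div_nonneg hb.κ_nonneg (by linarith [hb.θ_lt])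
  have h2 := h.C_pos
  refine ⟨hb.θ_pos, hb.θ_lt, le_rfl, hb.ρ_pos, ?_, ?_, zero_le_one, ?_⟩
  · have := hb.le_r; rw [zero_div]; linarith
  · have := hb.le_log; rw [zero_div]; nlinarith
  · linarith [hb.θ_lt]

lemma Sad.zero_mem_Con (h : Sad F lam mu r C) {θ κ : ℝ} (hθ : 0 ≤ θ) (hκ : 0 ≤ κ) :
    (0 : ℂ × ℂ) ∈ Con F θ κ := fun i => by
  rw [h.iterate_zero, norm_zero]; positivity

lemma Sad.cc_zero (h : Sad F lam mu r C) {θ κ ρ : ℝ} (hb : Budget mu r C θ κ ρ) :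
    cc F mu 0 = 1 := by
  have h0 := h.cc_dist (hb.zero h) (h.zero_mem_Con hb.θ_pos.le le_rfl) 0
  rw [dLm_zero] at h0
  simp only [mul_zero, zero_mul, zero_div] at h0
  exact (sub_eq_zero.1 (norm_le_zero_iff.1 h0)).symm

lemma exists_pow_bounds {a θ K ε : ℝ} (ha : 1 < a) (hθ : 0 < θ) (hθ1 : θ < 1)
    (hε : 0 < ε) : (∀ᶠ q in atTop, K / a ^ q < ε) ∧ ∀ q, ∀ᶠ m in atTop, a ^ q * (K * θ ^ m) < ε := by
  constructor
  · have : Tendsto (fun q : ℕ => K / a ^ q) atTop (𝓝 0) :=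
      tendsto_const_nhds.div_atTop (tendsto_pow_atTop_atTop_of_one_lt ha)
    exact this.eventually (gt_mem_nhds hε)
  · intro q
    have : Tendsto (fun m : ℕ => a ^ q * (K * θ ^ m)) atTop (𝓝 (a ^ q * (K * 0))) :=
      ((tendsto_pow_atTop_nhds_zero_of_lt_one hθ.le hθ1).const_mul K).const_mul _
    rw [mul_zero, mul_zero] at this
    exact this.eventually (gt_mem_nhds hε)

lemma Sad.psi_local (h : Sad F lam mu r C) {θ κ ρ : ℝ} (hb : Budget mu r C θ κ ρ)
    (hlam : ‖lam‖ ≤ θ) :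
    TendstoUniformlyOn (fun m => Lm F mu m 0) (psi F mu) atTop (closedBall 0 ρ) := by
  obtain ⟨K, _, hcmp⟩ := h.Lm_compare hb hlam
  have h0 := h.zero_mem_Con hb.θ_pos.le hb.κ_nonneg
  have hcau : UniformCauchySeqOn (fun m => Lm F mu m 0) atTop (closedBall 0 ρ) := by
    rw [Metric.uniformCauchySeqOn_iff]
    intro ε hε
    obtain ⟨h1, h2⟩ := exists_pow_bounds (K := K) h.mu_gt hb.θ_pos hb.θ_lt (by positivity : 0 < ε / 4)
    obtain ⟨q, hq⟩ := h1.exists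
    obtain ⟨m₀, hm₀⟩ := eventually_atTop.1 (h2 q)
    have key : ∀ n ≥ m₀ + q, ∀ τ ∈ closedBall (0 : ℂ) ρ,
        dist (Lm F mu n 0 τ) (Lm F mu q 0 τ) < ε / 2 := by
      intro n hn τ hτ
      have := hcmp 0 h0 τ (by simpa using hτ) (n - q) q
      rw [h.cc_zero hb, one_mul, Nat.sub_add_cancel (by omega)] at this
      rw [dist_eq_norm]
      linarith [hm₀ (n - q) (by omega)]
    refine ⟨m₀ + q, fun n hn n' hn' τ hτ => ?_⟩
    have a1 := key n hn τ hτ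
    have a2 := key n' hn' τ hτ
    rw [dist_comm] at a2
    linarith [dist_triangle (Lm F mu n 0 τ) (Lm F mu q 0 τ) (Lm F mu n' 0 τ)]
  exact hcau.tendstoUniformlyOn_of_tendsto fun τ hτ => (hcau.cauchySeq hτ).tendsto_limUnder

lemma Sad.psi_tendsto (h : Sad F lam mu r C) {θ κ ρ : ℝ} (hb : Budget mu r C θ κ ρ)
    (hlam : ‖lam‖ ≤ θ) (t : ℂ) :
    Tendsto (fun m => Lm F mu m 0 t) atTop (𝓝 (psi F mu t)) := by
  suffices ∃ y, Tendsto (fun m => Lm F mu m 0 t) atTop (𝓝 y) from tendsto_nhds_limUnder this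
  obtain ⟨n, hn⟩ := (((tendsto_pow_atTop_atTop_of_one_lt h.mu_gt).eventually_ge_atTop
    (‖t‖ / ρ))).exists
  have hin : t / mu ^ n ∈ closedBall (0 : ℂ) ρ := by
    rw [mem_closedBall_zero_iff, norm_div, norm_pow, div_le_iff₀ (pow_pos h.mu_pos n)]
    rwa [div_le_iff₀' hb.ρ_pos] at hn
  have h1 := (h.psi_local hb hlam).tendsto_at hin
  refine ⟨F^[n] (psi F mu (t / mu ^ n)), ?_⟩
  rw [← tendsto_add_atTop_iff_nat n]
  simp only [Lm_add]
  exact ((h.diff_iterate n).continuous.tendsto _).comp h1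

lemma Sad.psi_map (h : Sad F lam mu r C) {θ κ ρ : ℝ} (hb : Budget mu r C θ κ ρ)
    (hlam : ‖lam‖ ≤ θ) (n : ℕ) (t : ℂ) : F^[n] (psi F mu t) = psi F mu (mu ^ n * t) := by
  have h1 := h.psi_tendsto hb hlam (mu ^ n * t)
  rw [← tendsto_add_atTop_iff_nat n] at h1
  simp only [Lm_add, mul_div_cancel_left₀ t (pow_ne_zero n h.mu_ne)] at h1
  exact tendsto_nhds_unique
    (((h.diff_iterate n).continuous.tendsto _).comp (h.psi_tendsto hb hlam t)) h1

lemma Sad.psi_near (h : Sad F lam mu r C) {θ κ ρ : ℝ} (hb : Budget mu r C θ κ ρ)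
    (hlam : ‖lam‖ ≤ θ) {t : ℂ} (ht : ‖t‖ ≤ 2 * ρ) : ‖psi F mu t‖ ≤ 2 * ‖t‖ := by
  refine le_of_tendsto (h.psi_tendsto hb hlam t).norm (Eventually.of_forall fun m => ?_)
  have := h.Lm_sub_le hb (h.zero_mem_Con hb.θ_pos.le hb.κ_nonneg) m ht
  rwa [h.iterate_zero, sub_zero] at this

/-- Uniform convergence of the renormalised iterates. -/
lemma Sad.Lm_tendsto_local (h : Sad F lam mu r C) {θ κ ρ : ℝ} (hb : Budget mu r C θ κ ρ)
    (hlam : ‖lam‖ ≤ θ) :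
    TendstoUniformlyOn (fun m (z : (ℂ × ℂ) × ℂ) => Lm F mu m z.1 z.2)
      (fun z => psi F mu (cc F mu z.1 * z.2)) atTop (Con F θ κ ×ˢ closedBall 0 (ρ / 2)) := by
  obtain ⟨K, _, hcmp⟩ := h.Lm_compare hb hlam
  have hψ := h.psi_local hb hlam
  rw [Metric.tendstoUniformlyOn_iff] at hψ ⊢
  intro ε hε
  obtain ⟨h1, h2⟩ := exists_pow_bounds (K := K) h.mu_gt hb.θ_pos hb.θ_lt (by positivity : 0 < ε / 3)
  obtain ⟨q, hq, hq2⟩ := (h1.and (hψ (ε / 3) (by positivity))).exists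
  obtain ⟨m₀, hm₀⟩ := eventually_atTop.1 (h2 q)
  refine eventually_atTop.2 ⟨m₀ + q, ?_⟩
  rintro n hn ⟨x, τ⟩ ⟨hx, hτ⟩
  rw [mem_closedBall_zero_iff] at hτ
  simp only at hx hτ ⊢
  have hρ := hb.ρ_pos
  have a1 := hcmp x hx τ (by linarith) (n - q) q
  rw [Nat.sub_add_cancel (by omega), ← dist_eq_norm] at a1
  have hcτ : cc F mu x * τ ∈ closedBall (0 : ℂ) ρ := by
    rw [mem_closedBall_zero_iff, norm_mul]
    have := (h.cc_bounds hb hx).2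
    nlinarith [norm_nonneg τ]
  have a2 := hq2 _ hcτ
  have a3 := dist_triangle (psi F mu (cc F mu x * τ)) (Lm F mu q 0 (cc F mu x * τ)) (Lm F mu n x τ)
  rw [dist_comm] at a1
  linarith [hm₀ (n - q) (by omega)]

lemma Sad.psi_bounded (h : Sad F lam mu r C) {θ κ ρ : ℝ} (hb : Budget mu r C θ κ ρ)
    (hlam : ‖lam‖ ≤ θ) {t : ℂ} (ht : ‖t‖ ≤ ρ) : ‖psi F mu t‖ ≤ 2 * ρ := by
  linarith [h.psi_near hb hlam (t := t) (by linarith [hb.ρ_pos])]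

lemma Sad.Lm_tendsto (h : Sad F lam mu r C) {θ κ ρ : ℝ} (hb : Budget mu r C θ κ ρ)
    (hlam : ‖lam‖ ≤ θ) (R : ℝ) :
    TendstoUniformlyOn (fun m (z : (ℂ × ℂ) × ℂ) => Lm F mu m z.1 z.2)
      (fun z => psi F mu (cc F mu z.1 * z.2)) atTop (Con F θ κ ×ˢ closedBall 0 R) := by
  have hρ := hb.ρ_pos
  obtain ⟨n, hn⟩ := (((tendsto_pow_atTop_atTop_of_one_lt h.mu_gt).eventually_ge_atTop
    (R / (ρ / 2)))).exists
  have hin : ∀ τ : ℂ, ‖τ‖ ≤ R → τ / mu ^ n ∈ closedBall (0 : ℂ) (ρ / 2) := fun τ hτ => by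
    rw [mem_closedBall_zero_iff, norm_div, norm_pow, div_le_iff₀ (pow_pos h.mu_pos n)]
    rw [div_le_iff₀' (by positivity)] at hn
    linarith
  have h1 := tendstoUniformlyOn_continuous_comp (B := 2 * ρ) (h.Lm_tendsto_local hb hlam)
    (fun z hz => h.psi_bounded hb hlam (by
      have := (h.cc_bounds hb hz.1).2
      have h2 := hz.2
      rw [mem_closedBall_zero_iff] at h2
      rw [norm_mul]
      nlinarith [norm_nonneg z.2])) (h.diff_iterate n).continuous
  apply tendstoUniformlyOn_of_add (k := n)
  rw [Metric.tendstoUniformlyOn_iff] at h1 ⊢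
  intro ε hε
  filter_upwards [h1 ε hε] with m hm z hz
  have := hm (z.1, z.2 / mu ^ n) ⟨hz.1, hin _ (by simpa using hz.2)⟩
  simp only at this
  rwa [← Lm_add, h.psi_map hb hlam, mul_left_comm, mul_div_cancel₀ _ (pow_ne_zero n h.mu_ne)] at this

lemma Sad.psi_diff (h : Sad F lam mu r C) {θ κ ρ : ℝ} (hb : Budget mu r C θ κ ρ)
    (hlam : ‖lam‖ ≤ θ) : Differentiable ℂ (psi F mu) := by
  intro t
  have h1 := h.Lm_tendsto hb hlam (‖t‖ + 1)
  have h0 := h.zero_mem_Con (κ := κ) hb.θ_pos.le hb.κ_nonneg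
  have h2 : TendstoUniformlyOn (fun m => Lm F mu m 0) (psi F mu) atTop (ball 0 (‖t‖ + 1)) := by
    have := h1.comp (fun t : ℂ => ((0 : ℂ × ℂ), t))
    simp only [Function.comp_def, h.cc_zero hb, one_mul] at this
    refine this.mono fun s hs => ⟨h0, ?_⟩
    exact ball_subset_closedBall hs
  have := h2.tendstoLocallyUniformlyOn.differentiableOn
    (Eventually.of_forall fun m => (h.diff_Lm m 0).differentiableOn) isOpen_ball
  exact this.differentiableAt (isOpen_ball.mem_nhds (by simp))

end

end HenonAux

namespace HenonAux

section
variable {F Fi : ℂ × ℂ → ℂ × ℂ} {lam mu : ℂ} {r C : ℝ}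

lemma Sad.dLm_base (h : Sad F lam mu r C) {θ κ ρ : ℝ} (hb : Budget mu r C θ κ ρ)
    (hlam : ‖lam‖ ≤ θ) (m : ℕ) : dLm F mu m 0 = (0, 1) := by
  have hb0 := hb.zero h
  have h0 := h.zero_mem_Con hb.θ_pos.le le_rfl
  have h1 := h.dLm_fst hb0 hlam h0 m
  have h2 := h.cc_dist hb0 h0 m
  rw [h.cc_zero hb] at h2
  simp only [mul_zero, zero_mul, zero_div] at h1 h2
  exact Prod.ext (norm_le_zero_iff.1 h1) (sub_eq_zero.1 (norm_le_zero_iff.1 h2))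

lemma Sad.psi_quad (h : Sad F lam mu r C) {θ κ ρ : ℝ} (hb : Budget mu r C θ κ ρ)
    (hlam : ‖lam‖ ≤ θ) {t : ℂ} (ht : ‖t‖ ≤ ρ) : ‖psi F mu t - t • (0, 1)‖ ≤ 3 / ρ * ‖t‖ ^ 2 := by
  refine le_of_tendsto ((h.psi_tendsto hb hlam t).sub_const _).norm
    (Eventually.of_forall fun m => ?_)
  have := h.Lm_quad hb (h.zero_mem_Con hb.θ_pos.le hb.κ_nonneg) m ht
  rwa [h.iterate_zero, sub_zero, h.dLm_base hb hlam] at this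

lemma Sad.psi_zero (h : Sad F lam mu r C) {θ κ ρ : ℝ} (hb : Budget mu r C θ κ ρ)
    (hlam : ‖lam‖ ≤ θ) : psi F mu 0 = 0 := by
  have := h.psi_near hb hlam (t := 0) (by simpa using hb.ρ_pos.le)
  simpa using this

lemma Sad.psi_hasDerivAt (h : Sad F lam mu r C) {θ κ ρ : ℝ} (hb : Budget mu r C θ κ ρ)
    (hlam : ‖lam‖ ≤ θ) : HasDerivAt (psi F mu) (0, 1) 0 := by
  have h1 := (h.psi_diff hb hlam 0).hasDerivAt
  have h2 : HasDerivAt (fun t => psi F mu t - t • ((0 : ℂ), (1 : ℂ)))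
      (deriv (psi F mu) 0 - (1 : ℂ) • ((0 : ℂ), (1 : ℂ))) 0 :=
    h1.sub ((hasDerivAt_id (0 : ℂ)).smul_const _)
  have hρ := hb.ρ_pos
  have h3 : ‖deriv (psi F mu) 0 - (1 : ℂ) • ((0 : ℂ), (1 : ℂ))‖ ≤ 0 := by
    refine le_of_forall_pos_le_add fun ε hε => ?_
    rw [zero_add]
    refine h2.le_of_lip' hε.le ?_
    filter_upwards [closedBall_mem_nhds (0 : ℂ) (by positivity : 0 < min ρ (ε * ρ / 3))] with t ht
    rw [mem_closedBall_zero_iff] at ht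
    have a1 := h.psi_quad hb hlam (ht.trans (min_le_left _ _))
    have a2 := ht.trans (min_le_right _ _)
    rw [h.psi_zero hb hlam, zero_smul, sub_zero, sub_zero, sub_zero]
    refine a1.trans ?_
    calc 3 / ρ * ‖t‖ ^ 2 = 3 / ρ * ‖t‖ * ‖t‖ := by ring
      _ ≤ 3 / ρ * (ε * ρ / 3) * ‖t‖ := by gcongr
      _ = ε * ‖t‖ := by field_simp
  have h4 := norm_le_zero_iff.1 h3
  rw [one_smul, sub_eq_zero] at h4
  rwa [h4] at h1

lemma Sad.psi_antilip (h : Sad F lam mu r C) {θ κ ρ : ℝ} (hb : Budget mu r C θ κ ρ)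
    (hlam : ‖lam‖ ≤ θ) : ∃ δ > 0, ∀ t t' : ℂ, ‖t‖ ≤ δ → ‖t'‖ ≤ δ →
      1 / 2 * ‖t - t'‖ ≤ ‖psi F mu t - psi F mu t'‖ := by
  have hd : Differentiable ℂ fun t => (psi F mu t).2 := by
    have := h.psi_diff hb hlam
    fun_prop
  have h1 : HasDerivAt (fun t => (psi F mu t).2) 1 0 := (h.psi_hasDerivAt hb hlam).snd
  have h2 : HasStrictDerivAt (fun t => (psi F mu t).2) 1 0 := by
    have := (hd.analyticAt 0).hasStrictDerivAt
    rwa [h1.deriv] at this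
  have h3 := h2.hasStrictFDerivAt.isLittleO.def (by norm_num : (0 : ℝ) < 1 / 2)
  obtain ⟨δ, hδ, hball⟩ := Metric.eventually_nhds_iff_ball.1 h3
  refine ⟨δ / 2, by positivity, fun t t' ht ht' => ?_⟩
  have := hball (t, t') (by
    rw [mem_ball, dist_eq_norm, Prod.norm_def]
    simp only [Prod.fst_sub, Prod.snd_sub, sub_zero]
    exact max_lt (by linarith) (by linarith))
  simp only [ContinuousLinearMap.toSpanSingleton_apply, smul_eq_mul, mul_one] at this
  have a1 := norm_sub_norm_le (t - t') ((psi F mu t).2 - (psi F mu t').2)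
  rw [norm_sub_rev (t - t')] at a1
  have a2 := norm_snd_le (psi F mu t - psi F mu t')
  rw [Prod.snd_sub] at a2
  linarith

lemma Sad.psi_injective (h : Sad F lam mu r C) {θ κ ρ : ℝ} (hb : Budget mu r C θ κ ρ)
    (hlam : ‖lam‖ ≤ θ) (hF : Function.Injective F) : Function.Injective (psi F mu) := by
  intro t t' htt
  obtain ⟨δ, hδ, hl⟩ := h.psi_antilip hb hlam
  obtain ⟨n, hn⟩ := (((tendsto_pow_atTop_atTop_of_one_lt h.mu_gt).eventually_ge_atTop
    (max ‖t‖ ‖t'‖ / δ))).exists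
  have hmn := pow_ne_zero n h.mu_ne
  rw [div_le_iff₀ hδ] at hn
  have hs : ∀ s : ℂ, ‖s‖ ≤ max ‖t‖ ‖t'‖ → ‖s / mu ^ n‖ ≤ δ := fun s hs => by
    rw [norm_div, norm_pow, div_le_iff₀' (pow_pos h.mu_pos n)]
    exact hs.trans hn
  have e : psi F mu (t / mu ^ n) = psi F mu (t' / mu ^ n) := by
    apply hF.iterate n
    rw [h.psi_map hb hlam, h.psi_map hb hlam, mul_div_cancel₀ _ hmn, mul_div_cancel₀ _ hmn, htt]
  have := hl _ _ (hs t (le_max_left _ _)) (hs t' (le_max_right _ _))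
  rw [e, sub_self, norm_zero] at this
  have h0 : t / mu ^ n - t' / mu ^ n = 0 := norm_le_zero_iff.1 (by linarith)
  rw [← sub_div, div_eq_zero_iff] at h0
  exact sub_eq_zero.1 (h0.resolve_right hmn)

lemma Sad.psi_deriv_ne (h : Sad F lam mu r C) {θ κ ρ : ℝ} (hb : Budget mu r C θ κ ρ)
    (hlam : ‖lam‖ ≤ θ) (hl : ∀ x, Fi (F x) = x) (hFi : Differentiable ℂ Fi) (t : ℂ) :
    deriv (psi F mu) t ≠ 0 := by
  have hd := h.psi_diff hb hlam
  have hcont : ContinuousAt (deriv (psi F mu)) 0 :=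
    (hd.analyticAt 0).deriv.continuousAt
  have hne : ∀ᶠ s in 𝓝 (0 : ℂ), deriv (psi F mu) s ≠ 0 := by
    refine hcont.eventually_ne ?_
    rw [(h.psi_hasDerivAt hb hlam).deriv]
    simp
  have hlim : Tendsto (fun n : ℕ => t / mu ^ n) atTop (𝓝 0) := by
    have : Tendsto (fun n : ℕ => mu⁻¹ ^ n) atTop (𝓝 0) :=
      tendsto_pow_atTop_nhds_zero_of_norm_lt_one (by
        rw [norm_inv]; exact inv_lt_one_of_one_lt₀ h.mu_gt)
    have := this.const_mul t
    simpa [div_eq_mul_inv] using this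
  obtain ⟨n, hn⟩ := (hlim.eventually hne).exists
  intro h0
  apply hn
  have hmn := pow_ne_zero n h.mu_ne
  have e : ∀ s, psi F mu s = Fi^[n] (psi F mu (mu ^ n * s)) := fun s => by
    rw [← h.psi_map hb hlam, (Function.LeftInverse.iterate hl n) _]
  have h1 : HasDerivAt (fun s => psi F mu (mu ^ n * s)) ((mu ^ n * 1) • (0 : ℂ × ℂ)) (t / mu ^ n) := by
    have h2 : HasDerivAt (psi F mu) 0 (mu ^ n * (t / mu ^ n)) := by
      rw [mul_div_cancel₀ _ hmn, ← h0]
      exact (hd t).hasDerivAt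
    exact h2.scomp (t / mu ^ n) ((hasDerivAt_id _).const_mul _)
  have h3 := HasFDerivAt.comp_hasDerivAt (l := Fi^[n]) (f := fun s => psi F mu (mu ^ n * s))
    (t / mu ^ n) ((hFi.iterate n) (psi F mu (mu ^ n * (t / mu ^ n)))).hasFDerivAt h1
  rw [smul_zero, map_zero] at h3
  rw [show psi F mu = Fi^[n] ∘ fun s => psi F mu (mu ^ n * s) from funext e]
  exact h3.deriv

/-- The vertical derivative depends holomorphically on parameters. -/
lemma Sad.cc_diff (h : Sad F lam mu r C) {θ κ ρ : ℝ} (hb : Budget mu r C θ κ ρ)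
    {Γ : ℂ → ℂ × ℂ} {U : Set ℂ} (hU : IsOpen U) (hΓ : DifferentiableOn ℂ Γ U)
    (hcon : ∀ s ∈ U, Γ s ∈ Con F θ κ) : DifferentiableOn ℂ (fun s => cc F mu (Γ s)) U := by
  have hρ := hb.ρ_pos
  set τ : ℕ → ℂ := fun m => ((ρ / (m + 1) : ℝ) : ℂ) with hτ
  have hτn : ∀ m, ‖τ m‖ = ρ / (m + 1) := fun m => by
    rw [hτ]; simp only [Complex.norm_real]; exact abs_of_pos (by positivity)
  have hτ0 : ∀ m, τ m ≠ 0 := fun m => norm_pos_iff.1 (by rw [hτn]; positivity)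
  set f : ℕ → ℂ → ℂ := fun m s => ((τ m)⁻¹ • (Lm F mu m (Γ s) (τ m) - F^[m] (Γ s))).2 with hf
  have hfd : ∀ m, DifferentiableOn ℂ (f m) U := fun m => by
    have h1 := h.diff_iterate m
    have h2 : DifferentiableOn ℂ (fun s => Lm F mu m (Γ s) (τ m)) U := by
      unfold Lm
      exact h1.comp_differentiableOn (hΓ.add_const _)
    have h3 : DifferentiableOn ℂ (fun s => F^[m] (Γ s)) U := h1.comp_differentiableOn hΓ
    exact ((h2.sub h3).const_smul ((τ m)⁻¹)).snd
  have hest : ∀ m, ∀ s ∈ U, ‖f m s - cc F mu (Γ s)‖ ≤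
      3 / (m + 1) + 2 * C * κ / (1 - θ) * θ ^ m := by
    intro m s hs
    have h1 := h.Lm_quad hb (hcon s hs) m (τ := τ m) (by
      rw [hτn]; exact div_le_self hρ.le (by linarith [Nat.cast_nonneg (α := ℝ) m]))
    have h2 := h.cc_dist hb (hcon s hs) m
    have h3 : ‖f m s - (dLm F mu m (Γ s)).2‖ ≤ 3 / (m + 1) := by
      have e : f m s - (dLm F mu m (Γ s)).2 = ((τ m)⁻¹ • (Lm F mu m (Γ s) (τ m) - F^[m] (Γ s) -
          τ m • dLm F mu m (Γ s))).2 := by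
        rw [smul_sub, inv_smul_smul₀ (hτ0 m)]; rfl
      rw [e]
      refine (norm_snd_le _).trans ?_
      rw [norm_smul, norm_inv, hτn]
      calc _ ≤ (ρ / (m + 1))⁻¹ * (3 / ρ * (ρ / (m + 1)) ^ 2) := by gcongr; rwa [hτn] at h1
        _ = 3 / (m + 1) := by field_simp
    have := norm_add_le (f m s - (dLm F mu m (Γ s)).2) ((dLm F mu m (Γ s)).2 - cc F mu (Γ s))
    rw [sub_add_sub_cancel] at this
    rw [mul_div_right_comm] at h2
    linarith
  have hlim : Tendsto (fun m : ℕ => 3 / ((m : ℝ) + 1) + 2 * C * κ / (1 - θ) * θ ^ m) atTop (𝓝 0) := by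
    have h1 : Tendsto (fun m : ℕ => 3 / ((m : ℝ) + 1)) atTop (𝓝 0) :=
      tendsto_const_nhds.div_atTop (tendsto_atTop_add_const_right _ _ tendsto_natCast_atTop_atTop)
    have h2 := (tendsto_pow_atTop_nhds_zero_of_lt_one hb.θ_pos.le hb.θ_lt).const_mul
      (2 * C * κ / (1 - θ))
    simpa using h1.add h2
  have hu : TendstoUniformlyOn f (fun s => cc F mu (Γ s)) atTop U := by
    rw [Metric.tendstoUniformlyOn_iff]
    intro ε hε
    filter_upwards [hlim.eventually (gt_mem_nhds hε)] with m hm s hs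
    rw [dist_comm, dist_eq_norm]
    exact (hest m s hs).trans_lt hm
  exact hu.tendstoLocallyUniformlyOn.differentiableOn (Eventually.of_forall hfd) hU

end

end HenonAux

namespace HenonAux

lemma lip_of_bounded {E : Type*} [NormedAddCommGroup E] [NormedSpace ℂ E] [CompleteSpace E]
    {f : ℂ → E} {z : ℂ} {R B : ℝ} (hd : DifferentiableOn ℂ f (ball z R))
    (hB : ∀ w ∈ ball z R, ‖f w‖ ≤ B) {r : ℝ} (hr : r < R) {w w' : ℂ} (hw : w ∈ closedBall z r)
    (hw' : w' ∈ closedBall z r) : ‖f w - f w'‖ ≤ B / ((R - r) / 2) * ‖w - w'‖ := by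
  refine Convex.norm_image_sub_le_of_norm_deriv_le (𝕜 := ℂ) (s := closedBall z r)
    (fun x hx => (hd x (closedBall_subset_ball hr hx)).differentiableAt
      (isOpen_ball.mem_nhds (closedBall_subset_ball hr hx))) (fun x hx => ?_)
    (convex_closedBall _ _) hw' hw
  have hs : closedBall x ((R - r) / 2) ⊆ ball z R := fun y hy => by
    rw [mem_closedBall] at hx hy
    rw [mem_ball]
    linarith [dist_triangle y x z]
  refine Complex.norm_deriv_le_of_forall_mem_sphere_norm_le (by linarith) ?_
    fun y hy => hB y (hs (sphere_subset_closedBall hy))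
  exact (hd.mono hs).diffContOnCl_ball le_rfl

lemma exists_local_inverse {f : ℂ → ℂ} {z : ℂ} (hf : AnalyticAt ℂ f z) (hd : deriv f z ≠ 0) :
    ∃ χ : ℂ → ℂ, χ (f z) = z ∧ AnalyticAt ℂ χ (f z) ∧ (∀ᶠ s in 𝓝 (f z), f (χ s) = s) ∧
      ∀ᶠ w in 𝓝 z, χ (f w) = w := by
  have h := hf.hasStrictDerivAt
  refine ⟨h.localInverse f _ z hd, ?_, hf.analyticAt_localInverse hd, ?_, ?_⟩
  · exact (h.eventually_left_inverse hd).self_of_nhds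
  · exact h.eventually_right_inverse hd
  · exact h.eventually_left_inverse hd

lemma Half.eq_zero_of_tendsto {F : ℂ × ℂ → ℂ × ℂ} {D : ℝ} {G : ℂ × ℂ → ℝ} (h : Half F D G)
    (hD : 1 < D) (h0 : F 0 = 0) {x : ℂ × ℂ} (hx : Tendsto (fun n => F^[n] x) atTop (𝓝 0)) :
    G x = 0 := by
  have hG0 : G 0 = 0 := by
    have := h.map 0
    rw [h0] at this
    nlinarith
  have h1 : Tendsto (fun n => G (F^[n] x)) atTop (𝓝 0) := by
    have := (h.cont.tendsto 0).comp hx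
    rwa [hG0] at this
  refine le_antisymm (ge_of_tendsto h1 (Eventually.of_forall fun n => ?_)) (h.nonneg x)
  rw [h.iterate_map]
  exact le_mul_of_one_le_left (h.nonneg x) (one_le_pow₀ hD.le)

lemma Dyn.left_inv_iterate {F Fi : ℂ × ℂ → ℂ × ℂ} {D : ℝ} {Gp Gm : ℂ × ℂ → ℝ}
    (h : Dyn F Fi D Gp Gm) (n : ℕ) (x : ℂ × ℂ) : Fi^[n] (F^[n] x) = x :=
  (Function.LeftInverse.iterate h.left_inv n) x

lemma Dyn.Gm_iterate {F Fi : ℂ × ℂ → ℂ × ℂ} {D : ℝ} {Gp Gm : ℂ × ℂ → ℝ}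
    (h : Dyn F Fi D Gp Gm) (n : ℕ) (x : ℂ × ℂ) : D ^ n * Gm (F^[n] x) = Gm x := by
  rw [← h.minus.iterate_map n, h.left_inv_iterate]

lemma Dyn.Gm_iterate_le {F Fi : ℂ × ℂ → ℂ × ℂ} {D : ℝ} {Gp Gm : ℂ × ℂ → ℝ}
    (h : Dyn F Fi D Gp Gm) (n : ℕ) (x : ℂ × ℂ) : Gm (F^[n] x) ≤ Gm x := by
  rw [← h.Gm_iterate n x]
  exact le_mul_of_one_le_left (h.minus.nonneg _) (one_le_pow₀ h.one_lt.le)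

lemma norm_le_exp_lp (x : ℂ × ℂ) : ‖x‖ ≤ Real.exp (lp x) := by
  rw [lp, Real.exp_log (lt_max_of_lt_right one_pos)]
  exact le_max_left _ _

section
variable {F Fi : ℂ × ℂ → ℂ × ℂ} {lam mu : ℂ} {r C : ℝ}

lemma Sad.mem_Con (h : Sad F lam mu r C) {θ κ : ℝ} (hθ : ‖lam‖ + C * κ ≤ θ) (hθ1 : θ < 1)
    (hmu : C * κ < ‖mu‖ - 1) (hκr : κ ≤ r) {x : ℂ × ℂ} (hx : ∀ i, ‖F^[i] x‖ ≤ κ)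
    (h0 : Tendsto (fun i => F^[i] x) atTop (𝓝 0)) : x ∈ Con F θ κ := by
  have hC := h.C_pos
  have step : ∀ i, ‖F^[i + 1] x - diagMap lam mu (F^[i] x)‖ ≤ C * κ * ‖F^[i] x‖ := fun i => by
    have := h.lip (F^[i] x) 0 ((hx i).trans hκr) (by simpa using h.r_pos.le)
    rw [h.zero, sub_zero, sub_zero, ← Function.iterate_succ_apply' F, norm_zero,
      max_eq_left (norm_nonneg _)] at this
    refine this.trans ?_
    gcongr
    exact hx i
  have s1 : ∀ i, ‖(F^[i + 1] x).1‖ ≤ θ * ‖F^[i] x‖ := fun i => by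
    have a1 := (norm_fst_le _).trans (step i)
    rw [diagMap_apply, Prod.fst_sub] at a1
    have a2 := norm_sub_norm_le (F^[i + 1] x).1 (lam * (F^[i] x).1)
    rw [norm_mul] at a2
    have a3 : ‖lam‖ * ‖(F^[i] x).1‖ ≤ ‖lam‖ * ‖F^[i] x‖ := by gcongr; exact norm_fst_le _
    have a4 := mul_le_mul_of_nonneg_right hθ (norm_nonneg (F^[i] x))
    linarith
  have s2 : ∀ i, ‖mu‖ * ‖(F^[i] x).2‖ - C * κ * ‖F^[i] x‖ ≤ ‖(F^[i + 1] x).2‖ := fun i => by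
    have a1 := (norm_snd_le _).trans (step i)
    rw [diagMap_apply, Prod.snd_sub] at a1
    have a2 := norm_sub_norm_le (mu * (F^[i] x).2) (F^[i + 1] x).2
    rw [norm_mul, norm_sub_rev] at a2
    linarith
  have key : ∀ i, ‖(F^[i] x).2‖ ≤ ‖(F^[i] x).1‖ := by
    by_contra! hcon
    obtain ⟨i, hi⟩ := hcon
    have ind : ∀ n, ‖(F^[i] x).2‖ ≤ ‖(F^[i + n] x).2‖ ∧ ‖(F^[i + n] x).1‖ < ‖(F^[i + n] x).2‖ := by
      intro n
      induction n with
      | zero => exact ⟨le_rfl, hi⟩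
      | succ n ih =>
        have e : ‖F^[i + n] x‖ = ‖(F^[i + n] x).2‖ := by
          rw [Prod.norm_def]; exact max_eq_right ih.2.le
        have t1 := s1 (i + n)
        have t2 := s2 (i + n)
        rw [e] at t1 t2
        have hp : 0 < ‖(F^[i + n] x).2‖ := (norm_nonneg _).trans_lt ih.2
        rw [← add_assoc]
        constructor <;> nlinarith
    have hz : Tendsto (fun n => ‖(F^[i + n] x).2‖) atTop (𝓝 0) := by
      have a1 : Tendsto (fun n => F^[i + n] x) atTop (𝓝 0) :=
        h0.comp (tendsto_atTop_mono (fun n => Nat.le_add_left n i) tendsto_id)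
      simpa using ((continuous_snd.tendsto (0 : ℂ × ℂ)).comp a1).norm
    have := ge_of_tendsto hz (Eventually.of_forall fun n => (ind n).1)
    exact absurd ((norm_nonneg _).trans_lt hi) (not_lt.2 this)
  intro i
  have hθ0 : 0 ≤ θ := by
    have := (norm_nonneg _).trans (hx 0)
    have := norm_nonneg lam
    nlinarith [mul_nonneg hC.le ‹0 ≤ κ›]
  induction i with
  | zero => simpa using hx 0
  | succ i ih =>
    have e : ‖F^[i + 1] x‖ = ‖(F^[i + 1] x).1‖ := by
      rw [Prod.norm_def]; exact max_eq_left (key _)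
    rw [e]
    calc ‖(F^[i + 1] x).1‖ ≤ θ * ‖F^[i] x‖ := s1 i
      _ ≤ θ * (κ * θ ^ i) := by gcongr
      _ = κ * θ ^ (i + 1) := by ring

lemma Sad.exists_budget (h : Sad F lam mu r C) : ∃ θ κ ρ : ℝ, Budget mu r C θ κ ρ ∧ 0 < κ ∧
    ‖lam‖ ≤ θ ∧ ‖lam‖ + C * κ ≤ θ ∧ θ < 1 ∧ C * κ < ‖mu‖ - 1 ∧ κ ≤ r := by
  have hC := h.C_pos
  have hr := h.r_pos
  have hl := h.lam_lt
  have hl0 := norm_nonneg lam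
  have hm : 0 < ‖mu‖ - 1 := by linarith [h.mu_gt]
  set θ := (1 + ‖lam‖) / 2 with hθ
  have hθ1 : 0 < 1 - θ := by rw [hθ]; linarith
  set s := min r (Real.log 2 / C) with hs
  have hs0 : 0 < s := lt_min hr (div_pos (Real.log_pos (by norm_num)) hC)
  have hsr : s ≤ r := min_le_left _ _
  have hsl : C * s ≤ Real.log 2 := by
    have : s ≤ Real.log 2 / C := min_le_right _ _
    rwa [le_div_iff₀' hC] at this
  set κ := min (min (s * (1 - θ) / 2) 1) (min ((1 - θ) / (4 * C)) ((‖mu‖ - 1) / (2 * C))) with hκ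
  have hκ0 : 0 < κ := by
    refine lt_min (lt_min ?_ one_pos) (lt_min ?_ ?_) <;> positivity
  have k1 : κ ≤ s * (1 - θ) / 2 := (min_le_left _ _).trans (min_le_left _ _)
  have k2 : κ ≤ 1 := (min_le_left _ _).trans (min_le_right _ _)
  have k3 : κ ≤ (1 - θ) / (4 * C) := (min_le_right _ _).trans (min_le_left _ _)
  have k4 : κ ≤ (‖mu‖ - 1) / (2 * C) := (min_le_right _ _).trans (min_le_right _ _)
  rw [le_div_iff₀ (by positivity)] at k3 k4
  have k5 : κ / (1 - θ) + 4 * (s * (‖mu‖ - 1) / 8) / (‖mu‖ - 1) ≤ s := by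
    have e1 : 4 * (s * (‖mu‖ - 1) / 8) / (‖mu‖ - 1) = s / 2 := by field_simp; ring
    have e2 : κ / (1 - θ) ≤ s / 2 := by
      rw [div_le_iff₀ hθ1]; linarith
    linarith
  refine ⟨θ, κ, s * (‖mu‖ - 1) / 8, ⟨by rw [hθ]; linarith, by linarith, hκ0.le, by positivity,
    k5.trans hsr, ?_, k2, by linarith⟩, hκ0, by rw [hθ]; linarith, ?_, by linarith, ?_, ?_⟩
  · exact (mul_le_mul_of_nonneg_left k5 hC.le).trans hsl
  · have : 1 - θ = (1 - ‖lam‖) / 2 := by rw [hθ]; ring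
    have : θ = (1 + ‖lam‖) / 2 := hθ
    nlinarith
  · nlinarith
  · nlinarith

end

end HenonAux

namespace HenonAux

/-- A saddle at the origin with a linearizing parametrization `ψ` of its unstable manifold, and a
graph `s ↦ (s, γ s)` inside its stable manifold avoiding the origin; vertical perturbations of the
graph converge to `ψ` under rescaled iteration. -/
structure Model (F Fi : ℂ × ℂ → ℂ × ℂ) (D : ℝ) (Gp Gm : ℂ × ℂ → ℝ) (mu : ℂ) (ψ : ℂ → ℂ × ℂ)
    (γ c : ℂ → ℂ) (s0 : ℂ) (ρ : ℝ) : Prop where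
  dyn : Dyn F Fi D Gp Gm
  mu_gt : 1 < ‖mu‖
  ρ_pos : 0 < ρ
  ψ_diff : Differentiable ℂ ψ
  ψ_zero : ψ 0 = 0
  ψ_map : ∀ n t, F^[n] (ψ t) = ψ (mu ^ n * t)
  ψ_inj : Function.Injective ψ
  ψ_deriv : ∀ t, deriv ψ t ≠ 0
  ψ_antilip : ∃ δ > 0, ∀ t t' : ℂ, ‖t‖ ≤ δ → ‖t'‖ ≤ δ → 1 / 2 * ‖t - t'‖ ≤ ‖ψ t - ψ t'‖
  Gm_ψ : ∀ t, Gm (ψ t) = 0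
  γ_diff : DifferentiableOn ℂ γ (ball s0 ρ)
  c_diff : DifferentiableOn ℂ c (ball s0 ρ)
  c_ne : ∀ s ∈ ball s0 ρ, c s ≠ 0
  Gp_Γ : ∀ s ∈ ball s0 ρ, Gp (s, γ s) = 0
  Γ_ne : ∀ s ∈ ball s0 ρ, (s, γ s) ≠ 0
  conv : ∀ R : ℝ, TendstoUniformlyOn (fun (m : ℕ) (z : ℂ × ℂ) =>
    F^[m] ((z.1, γ z.1) + (0, z.2 / mu ^ m))) (fun z => ψ (c z.1 * z.2)) atTop
    (ball s0 ρ ×ˢ closedBall 0 R)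

variable {F Fi : ℂ × ℂ → ℂ × ℂ} {D : ℝ} {Gp Gm : ℂ × ℂ → ℝ} {lam mu : ℂ} {r C : ℝ}

lemma Dyn.bounded_of_stable (h : Dyn F Fi D Gp Gm) (hF0 : F 0 = 0) {Φ : ℂ → ℂ × ℂ}
    (hΦ : Continuous Φ) (h0 : ∀ w, Tendsto (fun n => F^[n] (Φ w)) atTop (𝓝 0)) (z : ℂ) (R : ℝ) :
    ∃ B, ∀ j, ∀ w ∈ closedBall z R, ‖F^[j] (Φ w)‖ ≤ B := by
  obtain ⟨C, hC⟩ := h.bound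
  obtain ⟨b, hb⟩ := (isCompact_closedBall z R).exists_bound_of_continuousOn
    ((h.minus.cont.comp hΦ).continuousOn)
  refine ⟨Real.exp (b + C), fun j w hw => (norm_le_exp_lp _).trans (Real.exp_le_exp.2 ?_)⟩
  have a1 : Gp (F^[j] (Φ w)) = 0 := by
    refine h.plus.eq_zero_of_tendsto h.one_lt hF0 ?_
    simp only [← Function.iterate_add_apply]
    exact (h0 w).comp (tendsto_add_atTop_nat j)
  have a2 := (abs_le.1 ((hC _).1 a1)).1
  have a3 := h.Gm_iterate_le j (Φ w)
  have a4 := (le_abs_self _).trans (hb w hw)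
  simp only [Function.comp_apply] at a4
  linarith

lemma exists_con_disc (h : Dyn F Fi D Gp Gm) (hs : Sad F lam mu r C) {θ κ : ℝ} (hκ : 0 < κ)
    (hθ : ‖lam‖ + C * κ ≤ θ) (hθ1 : θ < 1) (hmu : C * κ < ‖mu‖ - 1) (hκr : κ ≤ r)
    {Φ : ℂ → ℂ × ℂ} (hΦ : Differentiable ℂ Φ)
    (h0 : ∀ w, Tendsto (fun n => F^[n] (Φ w)) atTop (𝓝 0)) (z : ℂ) :
    ∃ (j : ℕ) (δ : ℝ), 0 < δ ∧ ∀ w ∈ closedBall z δ, F^[j] (Φ w) ∈ Con F θ κ := by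
  obtain ⟨B, hB⟩ := h.bounded_of_stable hs.zero hΦ.continuous h0 z 2
  have hB0 : 0 ≤ B := (norm_nonneg _).trans (hB 0 z (mem_closedBall_self two_pos.le))
  obtain ⟨j, hj⟩ := eventually_atTop.1
    ((tendsto_zero_iff_norm_tendsto_zero.1 (h0 z)).eventually_lt_const (half_pos hκ))
  refine ⟨j, min 1 (κ / (4 * (B + 1))), by positivity, fun w hw => ?_⟩
  rw [mem_closedBall, dist_eq_norm] at hw
  refine hs.mem_Con hθ hθ1 hmu hκr (fun i => ?_) ?_
  · rw [← Function.iterate_add_apply]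
    have a1 := lip_of_bounded (f := fun w => F^[i + j] (Φ w)) (z := z) (R := 2) (B := B) (r := 1)
      (((hs.diff_iterate _).comp hΦ).differentiableOn)
      (fun w hw => hB _ w (ball_subset_closedBall hw)) (by norm_num)
      (w := w) (w' := z) (by rw [mem_closedBall, dist_eq_norm]; exact hw.trans (min_le_left _ _))
      (mem_closedBall_self zero_le_one)
    have a2 := hw.trans (min_le_right _ _)
    rw [le_div_iff₀ (by positivity)] at a2
    have a3 := hj (i + j) (Nat.le_add_left _ _)
    have a4 := norm_sub_norm_le (F^[i + j] (Φ w)) (F^[i + j] (Φ z))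
    have a5 := norm_nonneg (w - z)
    norm_num at a1
    rw [div_eq_mul_inv, inv_div, div_one] at a1
    nlinarith
  · simp only [← Function.iterate_add_apply]
    exact (h0 w).comp (tendsto_add_atTop_nat j)

lemma Sad.fst_deriv_ne (hs : Sad F lam mu r C) {θ κ ρ : ℝ} (hb : Budget mu r C θ κ ρ)
    {Γ : ℂ → ℂ × ℂ} (hΓ : Differentiable ℂ Γ) {z : ℂ} {δ : ℝ} (hδ : 0 < δ)
    (hcon : ∀ w ∈ closedBall z δ, Γ w ∈ Con F θ κ) (hne : deriv Γ z ≠ 0) :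
    (deriv Γ z).1 ≠ 0 := by
  intro h1
  set b := (deriv Γ z).2 with hb2
  have hb0 : b ≠ 0 := fun h => hne (Prod.ext h1 h)
  have hz := hcon z (mem_closedBall_self hδ.le)
  have key : ∀ i, ‖b‖ * ‖mu‖ ^ i * ‖dLm F mu i (Γ z)‖ ≤ 1 / δ := by
    intro i
    have d1 : HasDerivAt (fun w => F^[i] (Γ w)) (fderiv ℂ F^[i] (Γ z) (deriv Γ z)) z :=
      HasFDerivAt.comp_hasDerivAt (l := F^[i]) (f := Γ) z (hs.diff_iterate i (Γ z)).hasFDerivAt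
        (hΓ z).hasDerivAt
    have d2 : HasDerivAt (Lm F mu i (Γ z)) (fderiv ℂ F^[i] (Γ z) (0, 1 / mu ^ i)) 0 := by
      have e : HasDerivAt (fun τ : ℂ => Γ z + ((0 : ℂ), τ / mu ^ i)) (0, 1 / mu ^ i) 0 :=
        ((hasDerivAt_const (0 : ℂ) (0 : ℂ)).prodMk
          ((hasDerivAt_id (0 : ℂ)).div_const (mu ^ i))).const_add (Γ z)
      refine HasFDerivAt.comp_hasDerivAt (l := F^[i])
        (f := fun τ : ℂ => Γ z + ((0 : ℂ), τ / mu ^ i)) 0 ?_ e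
      have := (hs.diff_iterate i (Γ z)).hasFDerivAt
      rwa [zero_div, show ((0 : ℂ), (0 : ℂ)) = 0 from rfl, add_zero]
    have e1 : deriv Γ z = (b * mu ^ i) • ((0 : ℂ), 1 / mu ^ i) := by
      have := pow_ne_zero i hs.mu_ne
      refine Prod.ext ?_ ?_
      · simp [h1]
      · simp only [Prod.smul_snd, smul_eq_mul, ← hb2]; field_simp
    rw [e1, map_smul, ← d2.deriv] at d1
    have a1 : ‖deriv (fun w => F^[i] (Γ w)) z‖ ≤ 1 / δ := by
      refine Complex.norm_deriv_le_of_forall_mem_sphere_norm_le hδ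
        ((hs.diff_iterate i).comp hΓ).diffContOnCl fun w hw => ?_
      exact Con.le_one hb (hcon w (sphere_subset_closedBall hw)) i
    rw [d1.deriv, norm_smul, norm_mul, norm_pow] at a1
    exact a1
  have t1 : Tendsto (fun i : ℕ => ‖b‖ / 4 * ‖mu‖ ^ i) atTop atTop :=
    (tendsto_pow_atTop_atTop_of_one_lt hs.mu_gt).const_mul_atTop
      (div_pos (norm_pos_iff.2 hb0) (by norm_num))
  have t2 := (hs.cc_tendsto hb hz).norm.eventually_const_lt
    (show (1 / 4 : ℝ) < _ from lt_of_lt_of_le (by norm_num) (hs.cc_bounds hb hz).1)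
  obtain ⟨i, hi1, hi2⟩ := ((t1.eventually_gt_atTop (1 / δ)).and t2).exists
  have k := key i
  have s1 := norm_snd_le (dLm F mu i (Γ z))
  have : ‖b‖ / 4 * ‖mu‖ ^ i ≤ ‖b‖ * ‖mu‖ ^ i * ‖dLm F mu i (Γ z)‖ := by
    have : ‖b‖ * ‖mu‖ ^ i * (1 / 4) ≤ ‖b‖ * ‖mu‖ ^ i * ‖dLm F mu i (Γ z)‖ := by
      gcongr; linarith
    linarith
  linarith

theorem exists_model (h : Dyn F Fi D Gp Gm) (hs : Sad F lam mu r C) {Φ : ℂ → ℂ × ℂ}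
    (hΦ : Differentiable ℂ Φ) (hΦ' : ∀ z, deriv Φ z ≠ 0)
    (h0 : ∀ w, Tendsto (fun n => F^[n] (Φ w)) atTop (𝓝 0)) {z : ℂ} (hz0 : Φ z ≠ 0)
    (hz : EdgeZero (fun w => Gm (Φ w)) univ z) :
    ∃ (j : ℕ) (ψ : ℂ → ℂ × ℂ) (γ c : ℂ → ℂ) (s0 : ℂ) (ρ : ℝ),
      Model F Fi D Gp Gm mu ψ γ c s0 ρ ∧ (s0, γ s0) = F^[j] (Φ z) ∧
      EdgeZero (fun s => Gm (s, γ s)) (ball s0 ρ) s0 := by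
  obtain ⟨θ, κ, ρ₁, hb, hκ, hlam, hθ, hθ1, hmu, hκr⟩ := hs.exists_budget
  obtain ⟨j, δ, hδ, hcon⟩ := exists_con_disc h hs hκ hθ hθ1 hmu hκr hΦ h0 z
  set Γ : ℂ → ℂ × ℂ := fun w => F^[j] (Φ w) with hΓdef
  have hΓ : Differentiable ℂ Γ := (hs.diff_iterate j).comp hΦ
  have hΓ' : deriv Γ z ≠ 0 := by
    intro h1
    have d1 : HasDerivAt (fun w => Fi^[j] (Γ w)) (fderiv ℂ Fi^[j] (Γ z) (deriv Γ z)) z :=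
      HasFDerivAt.comp_hasDerivAt (l := Fi^[j]) (f := Γ) z
        ((h.diff_inv.iterate j) (Γ z)).hasFDerivAt (hΓ z).hasDerivAt
    rw [h1, map_zero] at d1
    have e : (fun w => Fi^[j] (Γ w)) = Φ := funext fun w => h.left_inv_iterate j (Φ w)
    rw [e] at d1
    exact hΦ' z d1.deriv
  have hΓ1 := hs.fst_deriv_ne hb hΓ hδ hcon hΓ'
  have hΓz : Γ z ≠ 0 := by
    intro h1
    apply hz0
    rw [← h.left_inv_iterate j (Φ z), show F^[j] (Φ z) = 0 from h1]
    have := h.left_inv_iterate j 0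
    rwa [hs.iterate_zero] at this
  have hf : Differentiable ℂ fun w => (Γ w).1 := by fun_prop
  have hfd : deriv (fun w => (Γ w).1) z ≠ 0 := by
    have : HasDerivAt (fun w => (Γ w).1) (deriv Γ z).1 z := (hΓ z).hasDerivAt.fst
    rwa [this.deriv]
  obtain ⟨χ, χz, χan, χr, χl⟩ := exists_local_inverse (hf.analyticAt z) hfd
  set s0 := (Γ z).1 with hs0
  have χc : Tendsto χ (𝓝 s0) (𝓝 z) := by
    have := χan.continuousAt.tendsto
    rwa [χz] at this
  have ev1 := χc.eventually (ball_mem_nhds z hδ)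
  have ev2 := χc.eventually ((hΓ.continuous.continuousAt (x := z)).eventually_ne hΓz)
  obtain ⟨ρ, hρ, hball⟩ := Metric.eventually_nhds_iff_ball.1
    ((χr.and ev1).and (ev2.and χan.eventually_analyticAt))
  set γ : ℂ → ℂ := fun s => (Γ (χ s)).2 with hγ
  have hgr : ∀ s ∈ ball s0 ρ, (s, γ s) = Γ (χ s) := fun s hs =>
    Prod.ext (hball s hs).1.1.symm rfl
  have hgr0 : (s0, γ s0) = Γ z := by
    rw [hgr s0 (mem_ball_self hρ), χz]
  have hconγ : ∀ s ∈ ball s0 ρ, (s, γ s) ∈ Con F θ κ := fun s hs => by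
    rw [hgr s hs]
    exact hcon _ (ball_subset_closedBall (hball s hs).1.2)
  have hγd : DifferentiableOn ℂ γ (ball s0 ρ) := fun s hs => by
    have a1 := (hball s hs).2.2.differentiableAt
    have a2 : DifferentiableAt ℂ (fun s => Γ (χ s)) s := (hΓ _).comp s a1
    exact a2.snd.differentiableWithinAt
  have hψ0 := hs.psi_zero hb hlam
  have hψc := (hs.psi_diff hb hlam).continuous
  refine ⟨j, psi F mu, γ, fun s => cc F mu (s, γ s), s0, ρ,
    ⟨h, hs.mu_gt, hρ, hs.psi_diff hb hlam, hψ0, hs.psi_map hb hlam,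
      hs.psi_injective hb hlam (Function.LeftInverse.injective h.left_inv),
      hs.psi_deriv_ne hb hlam h.left_inv h.diff_inv, hs.psi_antilip hb hlam, fun t => ?_, hγd,
      hs.cc_diff hb isOpen_ball (differentiableOn_id.prodMk hγd) hconγ, fun s hs' h1 => ?_,
      fun s hs' => ?_, fun s hs' => ?_, fun R => ?_⟩, hgr0, mem_ball_self hρ, ?_, ?_⟩
  · have hFi0 : Fi 0 = 0 := by
      have := h.left_inv 0
      rwa [hs.zero] at this
    refine h.minus.eq_zero_of_tendsto h.one_lt hFi0 ?_
    have e : ∀ n, Fi^[n] (psi F mu t) = psi F mu (t / mu ^ n) := fun n => by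
      have := hs.psi_map hb hlam n (t / mu ^ n)
      rw [mul_div_cancel₀ t (pow_ne_zero n hs.mu_ne)] at this
      rw [← this, h.left_inv_iterate]
    simp only [e]
    have t1 : Tendsto (fun n : ℕ => t / mu ^ n) atTop (𝓝 0) := by
      have := (tendsto_pow_atTop_nhds_zero_of_norm_lt_one (x := mu⁻¹)
        (by rw [norm_inv]; exact inv_lt_one_of_one_lt₀ hs.mu_gt)).const_mul t
      simpa [div_eq_mul_inv] using this
    have := (hψc.tendsto 0).comp t1
    rwa [hψ0] at this
  · have := (hs.cc_bounds hb (hconγ s hs')).1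
    rw [show cc F mu (s, γ s) = 0 from h1, norm_zero] at this
    norm_num at this
  · rw [hgr s hs']
    refine h.plus.eq_zero_of_tendsto h.one_lt hs.zero ?_
    simp only [hΓdef, ← Function.iterate_add_apply]
    exact (h0 _).comp (tendsto_add_atTop_nat j)
  · rw [hgr s hs']
    exact (hball s hs').2.1
  · have := (hs.Lm_tendsto hb hlam R).comp (fun z : ℂ × ℂ => ((z.1, γ z.1), z.2))
    exact this.mono fun z hz => ⟨hconγ _ hz.1, hz.2⟩
  · have := h.Gm_iterate j (Φ z)
    have h2 : Gm (Φ z) = 0 := hz.2.1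
    rw [h2] at this
    show Gm (s0, γ s0) = 0
    rw [hgr0]
    exact (mul_eq_zero.1 this).resolve_left (pow_ne_zero j (one_pos.trans h.one_lt).ne')
  · rw [mem_closure_iff_nhds]
    intro t ht
    have e1 := (hf.continuous.tendsto z).eventually ht
    have e2 := (hf.continuous.tendsto z).eventually (ball_mem_nhds s0 hρ)
    obtain ⟨w, ⟨⟨hw1, hw2⟩, hw3⟩, -, hw4⟩ := (mem_closure_iff_nhds.1 hz.2.2) _ ((e1.and e2).and χl)
    refine ⟨(Γ w).1, hw1, hw2, ?_⟩
    show 0 < Gm ((Γ w).1, γ (Γ w).1)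
    rw [hgr _ hw2, hw3]
    have := h.Gm_iterate j (Φ w)
    have hp : 0 < Gm (Φ w) := hw4
    rw [← this] at hp
    exact pos_of_mul_pos_right hp (pow_nonneg (one_pos.trans h.one_lt).le j)

end HenonAux

namespace HenonAux

/-- Squared Euclidean length. -/
def sq (x : ℂ × ℂ) : ℝ := ‖x.1‖ ^ 2 + ‖x.2‖ ^ 2

lemma sq_continuous : Continuous sq := by unfold sq; fun_prop

lemma norm_sq_le_sq (x : ℂ × ℂ) : ‖x‖ ^ 2 ≤ sq x := by
  rw [Prod.norm_def, sq]
  rcases le_total ‖x.1‖ ‖x.2‖ with h | h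
  · rw [max_eq_right h]; nlinarith [norm_nonneg x.1]
  · rw [max_eq_left h]; nlinarith [norm_nonneg x.2]

lemma sq_le_norm_sq (x : ℂ × ℂ) : sq x ≤ 2 * ‖x‖ ^ 2 := by
  have h1 := norm_fst_le x
  have h2 := norm_snd_le x
  have := pow_le_pow_left₀ (norm_nonneg _) h1 2
  have := pow_le_pow_left₀ (norm_nonneg _) h2 2
  rw [sq]; linarith

lemma sq_pos {x : ℂ × ℂ} (hx : x ≠ 0) : 0 < sq x :=
  (pow_pos (norm_pos_iff.2 hx) 2).trans_le (norm_sq_le_sq x)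

lemma sq_smul (a : ℂ) (x : ℂ × ℂ) : sq (a • x) = ‖a‖ ^ 2 * sq x := by
  simp only [sq, Prod.smul_fst, Prod.smul_snd, smul_eq_mul, norm_mul]; ring

lemma sq_add (x y : ℂ × ℂ) : sq (x + y) =
    sq x + 2 * ((starRingEnd ℂ) x.1 * y.1 + (starRingEnd ℂ) x.2 * y.2).re + sq y := by
  simp only [sq, Prod.fst_add, Prod.snd_add, ← Complex.normSq_eq_norm_sq, Complex.normSq_add]
  simp [Complex.mul_re]
  ring

/-- Along a direction in which the logarithmic derivative of a curve is scalar, the logarithm of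
its length is superharmonic to second order. -/
lemma av_log_sq_le {E : ℂ → ℂ × ℂ} {r : ℝ} (hr : 0 < r) (hE : DifferentiableOn ℂ E (ball 0 r))
    (h0 : E 0 ≠ 0) {c : ℂ} (hd : HasDerivAt E (c • E 0) 0) {ε : ℝ} (hε : 0 < ε) :
    ∀ᶠ ν in 𝓝 (0 : ℂ), av (fun ζ => Real.log (sq (E (ζ * ν)))) ≤
      Real.log (sq (E 0)) + ε * ‖ν‖ ^ 2 := by
  set A := E 0 with hA
  set S := sq A with hS
  have hS0 : 0 < S := sq_pos h0
  set δ := √(ε * S / 2) with hδ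
  have hδ0 : 0 < δ := Real.sqrt_pos.2 (by positivity)
  have hδ2 : δ ^ 2 = ε * S / 2 := Real.sq_sqrt (by positivity)
  set k : ℂ → ℂ × ℂ := fun η => (1 + c * η)⁻¹ • E η - A with hk
  have hk0 : k 0 = 0 := by simp [hk, ← hA]
  have hlin : HasDerivAt (fun η : ℂ => 1 + c * η) c 0 := by
    simpa using ((hasDerivAt_id (0 : ℂ)).const_mul c).const_add 1
  have hkd : HasDerivAt k 0 0 := by
    have h1 : HasDerivAt (fun η : ℂ => (1 + c * η)⁻¹) (-c / (1 + c * 0) ^ 2) 0 :=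
      hlin.inv (by simp)
    have h2 := (h1.smul hd).sub_const A
    simp only [mul_zero, add_zero, inv_one, one_smul, one_pow, div_one] at h2
    rw [← hA, neg_smul, add_neg_cancel] at h2
    exact h2
  have ev1 : ∀ᶠ η in 𝓝 (0 : ℂ), ‖k η‖ ≤ δ * ‖η‖ := by
    have := (hasDerivAt_iff_isLittleO.1 hkd).def hδ0
    filter_upwards [this] with η hη
    simpa [hk0] using hη
  have ev2 : ∀ᶠ η in 𝓝 (0 : ℂ), 1 + c * η ≠ 0 :=
    hlin.continuousAt.eventually_ne (by simp)
  have ev3 : ∀ᶠ η in 𝓝 (0 : ℂ), E η ≠ 0 := hd.continuousAt.eventually_ne h0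
  obtain ⟨R, hR, hball⟩ := Metric.eventually_nhds_iff_ball.1 ((ev1.and ev2).and ev3)
  filter_upwards [ball_mem_nhds (0 : ℂ) (lt_min hR hr)] with ν hν
  rw [mem_ball_zero_iff] at hν
  have hνR := hν.trans_le (min_le_left _ _)
  have hνr := hν.trans_le (min_le_right _ _)
  have hn : ∀ ζ ∈ closedBall (0 : ℂ) 1, ‖ζ * ν‖ ≤ ‖ν‖ := fun ζ hζ => by
    rw [norm_mul]
    exact mul_le_of_le_one_left (norm_nonneg _) (mem_closedBall_zero_iff.1 hζ)
  have hinR : ∀ ζ ∈ closedBall (0 : ℂ) 1, ζ * ν ∈ ball (0 : ℂ) R := fun ζ hζ =>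
    mem_ball_zero_iff.2 ((hn ζ hζ).trans_lt hνR)
  have hinr : ∀ ζ ∈ closedBall (0 : ℂ) 1, ζ * ν ∈ ball (0 : ℂ) r := fun ζ hζ =>
    mem_ball_zero_iff.2 ((hn ζ hζ).trans_lt hνr)
  have hEν : DifferentiableOn ℂ (fun ζ => E (ζ * ν)) (closedBall 0 1) :=
    hE.comp (by fun_prop) hinr
  have hkν : DifferentiableOn ℂ (fun ζ => k (ζ * ν)) (closedBall 0 1) := by
    have : DifferentiableOn ℂ (fun ζ => (1 + c * (ζ * ν))⁻¹) (closedBall 0 1) :=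
      DifferentiableOn.fun_inv (by fun_prop) fun ζ hζ => (hball _ (hinR ζ hζ)).1.2
    exact (this.smul hEν).sub_const A
  set p : ℂ → ℂ := fun ζ => (starRingEnd ℂ) A.1 * (k (ζ * ν)).1 +
    (starRingEnd ℂ) A.2 * (k (ζ * ν)).2 with hp
  have hpd : DifferentiableOn ℂ p (closedBall 0 1) :=
    (hkν.fst.const_mul _).add (hkν.snd.const_mul _)
  have avp : av (fun ζ => (p ζ).re) = 0 := by
    rw [av_re hpd]; simp [hp, hk0]
  have avl : av (fun ζ => Real.log ‖1 + c * (ζ * ν)‖) = 0 := by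
    rw [av_log (f := fun ζ => 1 + c * (ζ * ν))]
    · simp
    · have : Differentiable ℂ (fun ζ => 1 + c * (ζ * ν)) := by fun_prop
      exact fun ζ _ => this.analyticAt ζ
    · exact fun ζ hζ => (hball _ (hinR ζ hζ)).1.2
  have cl : ContinuousOn (fun ζ => Real.log ‖1 + c * (ζ * ν)‖) (sphere 0 1) := by
    refine ContinuousOn.log (by fun_prop) fun ζ hζ => ?_
    exact norm_ne_zero_iff.2 (hball _ (hinR ζ (sphere_subset_closedBall hζ))).1.2
  have cp : ContinuousOn (fun ζ => (p ζ).re) (sphere 0 1) :=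
    Complex.continuous_re.comp_continuousOn (hpd.continuousOn.mono sphere_subset_closedBall)
  have cE : ContinuousOn (fun ζ => Real.log (sq (E (ζ * ν)))) (sphere 0 1) := by
    refine ContinuousOn.log (sq_continuous.comp_continuousOn
      (hEν.continuousOn.mono sphere_subset_closedBall)) fun ζ hζ => ?_
    exact (sq_pos (hball _ (hinR ζ (sphere_subset_closedBall hζ))).2).ne'
  have key : ∀ ζ : ℂ, ‖ζ‖ = 1 → Real.log (sq (E (ζ * ν))) ≤
      (2 * Real.log ‖1 + c * (ζ * ν)‖ + 2 / S * (p ζ).re) + (Real.log S + ε * ‖ν‖ ^ 2) := by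
    intro ζ hζ
    have hζ' : ζ ∈ closedBall (0 : ℂ) 1 := by simp [hζ]
    obtain ⟨⟨b1, b2⟩, b3⟩ := hball _ (hinR ζ hζ')
    have e1 : E (ζ * ν) = (1 + c * (ζ * ν)) • (A + k (ζ * ν)) := by
      simp only [hk, add_sub_cancel]
      rw [smul_inv_smul₀ b2]
    have hAk : A + k (ζ * ν) ≠ 0 := fun h => b3 (by rw [e1, h, smul_zero])
    have e2 : Real.log (sq (E (ζ * ν))) =
        2 * Real.log ‖1 + c * (ζ * ν)‖ + Real.log (sq (A + k (ζ * ν))) := by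
      rw [e1, sq_smul, Real.log_mul (by positivity) (sq_pos hAk).ne', Real.log_pow]
      norm_num
    have e3 : sq (k (ζ * ν)) ≤ ε * S * ‖ν‖ ^ 2 := by
      refine (sq_le_norm_sq _).trans ?_
      have : ‖k (ζ * ν)‖ ≤ δ * ‖ν‖ := b1.trans (by gcongr; exact hn ζ hζ')
      have := pow_le_pow_left₀ (norm_nonneg _) this 2
      rw [mul_pow, hδ2] at this
      linarith
    have e4 : sq (A + k (ζ * ν)) ≤ S * (1 + (2 / S * (p ζ).re + ε * ‖ν‖ ^ 2)) := by
      rw [sq_add]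
      have : S * (2 / S * (p ζ).re) = 2 * (p ζ).re := by field_simp
      rw [mul_add, mul_add, this]
      simp only [hp, ← hS]
      linarith
    have e5 : 0 < 1 + (2 / S * (p ζ).re + ε * ‖ν‖ ^ 2) :=
      pos_of_mul_pos_right ((sq_pos hAk).trans_le e4) hS0.le
    have e6 := Real.log_le_log (sq_pos hAk) e4
    rw [Real.log_mul hS0.ne' e5.ne'] at e6
    have e7 := Real.log_le_sub_one_of_pos e5
    rw [e2]
    linarith
  refine (av_mono (g := fun ζ => (2 * Real.log ‖1 + c * (ζ * ν)‖ + 2 / S * (p ζ).re) +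
    (Real.log S + ε * ‖ν‖ ^ 2)) cE (((cl.const_mul _).add (cp.const_mul _)).add continuousOn_const)
    key).trans ?_
  rw [av_add (f := fun ζ => 2 * Real.log ‖1 + c * (ζ * ν)‖ + 2 / S * (p ζ).re)
    (g := fun _ => Real.log S + ε * ‖ν‖ ^ 2) ((cl.const_mul _).add (cp.const_mul _))
    continuousOn_const,
    av_add (f := fun ζ => 2 * Real.log ‖1 + c * (ζ * ν)‖) (g := fun ζ => 2 / S * (p ζ).re)
      (cl.const_mul _) (cp.const_mul _), av_mul, av_mul, avl, avp, av_const]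
  simp

lemma exists_direction {E : ℂ × ℂ → ℂ × ℂ} {x : ℂ × ℂ} {U : Set (ℂ × ℂ)} (hU : U ∈ 𝓝 x)
    (hE : DifferentiableOn ℂ E U) (h0 : E x ≠ 0) :
    ∃ ν : ℂ × ℂ, ν ≠ 0 ∧ ∀ ε > 0, ∀ᶠ η in 𝓝 (0 : ℂ),
      av (fun ζ => Real.log (sq (E (x + (ζ * η) • ν)))) ≤ Real.log (sq (E x)) + ε * ‖η‖ ^ 2 := by
  have hEd : HasFDerivAt E (fderiv ℂ E x) x := (hE.differentiableAt hU).hasFDerivAt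
  obtain ⟨ν, c, hν, hνc⟩ : ∃ (ν : ℂ × ℂ) (c : ℂ), ν ≠ 0 ∧ fderiv ℂ E x ν = c • E x := by
    by_cases hinj : Function.Injective (fderiv ℂ E x : (ℂ × ℂ) →ₗ[ℂ] (ℂ × ℂ))
    · obtain ⟨ν, hν⟩ := (LinearMap.injective_iff_surjective.1 hinj) (E x)
      refine ⟨ν, 1, ?_, by simpa using hν⟩
      rintro rfl
      rw [map_zero] at hν
      exact h0 hν.symm
    · rw [← LinearMap.ker_eq_bot, Submodule.eq_bot_iff] at hinj
      push Not at hinj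
      obtain ⟨ν, h1, h2⟩ := hinj
      exact ⟨ν, 0, h2, by simpa using h1⟩
  refine ⟨ν, hν, fun ε hε => ?_⟩
  have hl : HasDerivAt (fun η : ℂ => x + η • ν) ν 0 := by
    simpa using ((hasDerivAt_id (0 : ℂ)).smul_const ν).const_add x
  have hc : Tendsto (fun η : ℂ => x + η • ν) (𝓝 0) (𝓝 x) := by
    simpa using hl.continuousAt.tendsto
  obtain ⟨r, hr, hball⟩ := Metric.eventually_nhds_iff_ball.1
    (hc.eventually (eventually_mem_nhds_iff.2 hU))
  have := av_log_sq_le (E := fun η => E (x + η • ν)) (c := c) hr (fun η hη => ?_) (by simpa) ?_ hε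
  · simpa using this
  · have a1 := hE.differentiableAt (hball η hη)
    refine (DifferentiableAt.comp η a1 ?_).differentiableWithinAt
    fun_prop
  · have : HasDerivAt (fun η : ℂ => E (x + η • ν)) (fderiv ℂ E x ν) 0 := by
      refine HasFDerivAt.comp_hasDerivAt (l := E) (f := fun η : ℂ => x + η • ν) 0 ?_ hl
      simpa using hEd
    simpa [hνc] using this

/-- Continuous functions whose mean values on small circles exceed the central value by a fixed
multiple of the squared radius. -/
structure StrictSub (w : ℂ → ℝ) (U : Set ℂ) (c : ℝ) : Prop where
  cont : ContinuousOn w U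
  sub : ∀ x ∈ U, ∃ r > 0, ball x r ⊆ U ∧ ∀ ν : ℂ, ‖ν‖ < r →
    w x + c * ‖ν‖ ^ 2 ≤ av (fun ζ => w (x + ζ * ν))

lemma PosHarm.strictSub {g κ : ℂ → ℝ} {U : Set ℂ} (hg : PosHarm g U) (hU : IsOpen U)
    (hκ : Barrier κ) {ε M : ℝ} (hε : 0 < ε) (hε1 : ε ≤ 1) (hM : 0 < M) :
    ∃ c > 0, StrictSub (fun x => M * ((1 - ε) * g x + ε * κ x)) U c := by
  obtain ⟨hκc, c, hc, hκ'⟩ := hκ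
  refine ⟨M * (ε * c), by positivity, ?_, fun x hx => ?_⟩
  · exact ((hg.cont.const_mul _).add (hκc.continuousOn.const_mul _)).const_mul _
  · obtain ⟨r, hr, hrU, h⟩ := hg.submean hU hx
    refine ⟨r, hr, hrU, fun ν hν => ?_⟩
    have cg := continuousOn_circle (hg.cont.mono hrU) hν
    have ck := continuousOn_circle (x := x) (hκc.continuousOn (s := ball x r)) hν
    rw [av_mul M (fun ζ => (1 - ε) * g (x + ζ * ν) + ε * κ (x + ζ * ν)),
      av_add (f := fun ζ => (1 - ε) * g (x + ζ * ν)) (g := fun ζ => ε * κ (x + ζ * ν))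
        (cg.const_mul _) (ck.const_mul _), av_mul, av_mul]
    have h1 := mul_le_mul_of_nonneg_left (h ν hν).1 (sub_nonneg.2 hε1)
    have h2 := mul_le_mul_of_nonneg_left (hκ' x ν) hε.le
    have h3 := mul_le_mul_of_nonneg_left (add_le_add h1 h2) hM.le
    linarith

lemma exists_boundary_max {w₁ w₂ : ℂ → ℝ} {U₁ U₂ : Set ℂ} {c₁ c₂ : ℝ} (hc₁ : 0 < c₁) (hc₂ : 0 < c₂)
    (h₁ : StrictSub w₁ U₁ c₁) (h₂ : StrictSub w₂ U₂ c₂) (hU₁ : IsOpen U₁) (hU₂ : IsOpen U₂)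
    {s₁ s₂ : ℂ} {ρ₁ ρ₂ : ℝ} (hρ₁ : 0 ≤ ρ₁) (hρ₂ : 0 ≤ ρ₂) (hK₁ : closedBall s₁ ρ₁ ⊆ U₁)
    (hK₂ : closedBall s₂ ρ₂ ⊆ U₂) {E : ℂ × ℂ → ℂ × ℂ} (hE : DifferentiableOn ℂ E (U₁ ×ˢ U₂))
    (hE0 : ∀ x ∈ closedBall s₁ ρ₁ ×ˢ closedBall s₂ ρ₂, E x ≠ 0) :
    ∃ x ∈ closedBall s₁ ρ₁ ×ˢ closedBall s₂ ρ₂, (x.1 ∈ sphere s₁ ρ₁ ∨ x.2 ∈ sphere s₂ ρ₂) ∧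
      ∀ y ∈ closedBall s₁ ρ₁ ×ˢ closedBall s₂ ρ₂,
        w₁ y.1 + w₂ y.2 - Real.log (sq (E y)) ≤ w₁ x.1 + w₂ x.2 - Real.log (sq (E x)) := by
  set K : Set (ℂ × ℂ) := closedBall s₁ ρ₁ ×ˢ closedBall s₂ ρ₂ with hK
  have hKU : K ⊆ U₁ ×ˢ U₂ := prod_mono hK₁ hK₂
  have hlog : ContinuousOn (fun x => Real.log (sq (E x))) K :=
    ContinuousOn.log (sq_continuous.comp_continuousOn (hE.continuousOn.mono hKU))
      fun x hx => (sq_pos (hE0 x hx)).ne'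
  have c1 : ContinuousOn (fun x : ℂ × ℂ => w₁ x.1) K :=
    h₁.cont.comp continuous_fst.continuousOn fun x hx => (hKU hx).1
  have c2 : ContinuousOn (fun x : ℂ × ℂ => w₂ x.2) K :=
    h₂.cont.comp continuous_snd.continuousOn fun x hx => (hKU hx).2
  refine exists_isMaxOn_of_submean ((isCompact_closedBall _ _).prod (isCompact_closedBall _ _))
    (show K.Nonempty from ⟨(s₁, s₂), ⟨mem_closedBall_self hρ₁, mem_closedBall_self hρ₂⟩⟩)
    (q := fun x => w₁ x.1 + w₂ x.2 - Real.log (sq (E x))) ((c1.add c2).sub hlog)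
    (fun x => x.1 ∈ sphere s₁ ρ₁ ∨ x.2 ∈ sphere s₂ ρ₂) fun x hx hB => ?_
  push Not at hB
  have i1 : x.1 ∈ ball s₁ ρ₁ := mem_ball.2 <| lt_of_le_of_ne (mem_closedBall.1 hx.1) hB.1
  have i2 : x.2 ∈ ball s₂ ρ₂ := mem_ball.2 <| lt_of_le_of_ne (mem_closedBall.1 hx.2) hB.2
  obtain ⟨r₁, hr₁, -, sub1⟩ := h₁.sub x.1 (hK₁ hx.1)
  obtain ⟨r₂, hr₂, -, sub2⟩ := h₂.sub x.2 (hK₂ hx.2)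
  obtain ⟨ν, hν, hdir⟩ := exists_direction
    ((hU₁.prod hU₂).mem_nhds (hKU hx)) hE (hE0 x hx)
  set c := min c₁ c₂
  have hc : 0 < c := lt_min hc₁ hc₂
  have hsq := sq_pos hν
  have hnb : ball s₁ ρ₁ ×ˢ ball s₂ ρ₂ ∈ 𝓝 x := prod_mem_nhds (isOpen_ball.mem_nhds i1)
    (isOpen_ball.mem_nhds i2)
  obtain ⟨r₃, hr₃, hb3⟩ := Metric.mem_nhds_iff.1 hnb
  have ev : ∀ a : ℂ, ∀ r > 0, ∀ᶠ η in 𝓝 (0 : ℂ), ‖η * a‖ < r := fun a r hr => by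
    have : Tendsto (fun η : ℂ => ‖η * a‖) (𝓝 0) (𝓝 0) := by
      have : Continuous fun η : ℂ => ‖η * a‖ := by fun_prop
      simpa using this.tendsto 0
    exact this.eventually_lt_const hr
  have ev3 : ∀ᶠ η in 𝓝 (0 : ℂ), ‖η • ν‖ < r₃ := by
    have : Tendsto (fun η : ℂ => ‖η • ν‖) (𝓝 0) (𝓝 0) := by
      have : Continuous fun η : ℂ => ‖η • ν‖ := by fun_prop
      simpa using this.tendsto 0
    exact this.eventually_lt_const hr₃
  obtain ⟨η, ⟨⟨⟨e1, e2⟩, e3⟩, e4⟩, e5⟩ := ((((((ev ν.1 r₁ hr₁).and (ev ν.2 r₂ hr₂)).and ev3).and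
    (hdir (c * sq ν / 2) (by positivity))).filter_mono nhdsWithin_le_nhds).and
    (self_mem_nhdsWithin (a := (0 : ℂ)) (s := {0}ᶜ))).exists
  have hη : 0 < ‖η‖ := norm_pos_iff.2 e5
  have hin : ∀ ζ : ℂ, ‖ζ‖ = 1 → x + ζ • (η • ν) ∈ K := fun ζ hζ => by
    have : x + ζ • (η • ν) ∈ ball x r₃ := by
      rw [mem_ball, dist_eq_norm, add_sub_cancel_left, norm_smul, hζ, one_mul]
      exact e3
    exact prod_mono ball_subset_closedBall ball_subset_closedBall (hb3 this)
  refine ⟨η • ν, hin, ?_⟩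
  have hmaps : MapsTo (fun ζ : ℂ => x + ζ • (η • ν)) (sphere 0 1) K := fun ζ hζ =>
    hin ζ (mem_sphere_zero_iff_norm.1 hζ)
  have hcl : ContinuousOn (fun ζ : ℂ => x + ζ • (η • ν)) (sphere 0 1) := by fun_prop
  have d1 := c1.comp hcl hmaps
  have d2 := c2.comp hcl hmaps
  have d3 := hlog.comp hcl hmaps
  rw [av_sub (f := fun ζ : ℂ => w₁ (x + ζ • (η • ν)).1 + w₂ (x + ζ • (η • ν)).2)
    (g := fun ζ : ℂ => Real.log (sq (E (x + ζ • (η • ν))))) (d1.add d2) d3,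
    av_add (f := fun ζ : ℂ => w₁ (x + ζ • (η • ν)).1) (g := fun ζ : ℂ => w₂ (x + ζ • (η • ν)).2)
      d1 d2]
  have f1 := sub1 (η * ν.1) e1
  have f2 := sub2 (η * ν.2) e2
  simp only [Prod.fst_add, Prod.snd_add, Prod.smul_fst, Prod.smul_snd, smul_eq_mul, smul_smul]
  rw [norm_mul, mul_pow] at f1 f2
  simp only [← mul_assoc ] at f1 f2 ⊢
  have g1 : c * ‖η‖ ^ 2 * ‖ν.1‖ ^ 2 ≤ c₁ * ‖η‖ ^ 2 * ‖ν.1‖ ^ 2 := by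
    gcongr; exact min_le_left _ _
  have g2 : c * ‖η‖ ^ 2 * ‖ν.2‖ ^ 2 ≤ c₂ * ‖η‖ ^ 2 * ‖ν.2‖ ^ 2 := by
    gcongr; exact min_le_right _ _
  have g3 : 0 < c * sq ν / 2 * ‖η‖ ^ 2 := by positivity
  have g4 : c * sq ν / 2 * ‖η‖ ^ 2 * 2 = c * ‖η‖ ^ 2 * ‖ν.1‖ ^ 2 + c * ‖η‖ ^ 2 * ‖ν.2‖ ^ 2 := by
    simp only [sq]; ring
  linarith

theorem Dyn.exists_close {F Fi : ℂ × ℂ → ℂ × ℂ} {D : ℝ} {Gp Gm : ℂ × ℂ → ℝ}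
    (h : Dyn F Fi D Gp Gm) : ∃ C₁ : ℝ, ∀ {Γ Θ : ℂ → ℂ × ℂ} {U₁ U₂ : Set ℂ} {s₁ s₂ : ℂ}
      {ρ₁ ρ₂ : ℝ} {κ₁ κ₂ : ℂ → ℝ} {Q : ℝ} {m : ℕ}, IsOpen U₁ → IsOpen U₂ →
      DifferentiableOn ℂ Γ U₁ → DifferentiableOn ℂ Θ U₂ → (∀ s ∈ U₁, Gp (Γ s) = 0) →
      (∀ ξ ∈ U₂, Gm (Θ ξ) = 0) → 0 ≤ ρ₁ → 0 ≤ ρ₂ → closedBall s₁ ρ₁ ⊆ U₁ → closedBall s₂ ρ₂ ⊆ U₂ →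
      Barrier κ₁ → Barrier κ₂ → (∀ x ∈ sphere s₁ ρ₁, κ₁ x < Gm (Γ x)) →
      (∀ x ∈ sphere s₂ ρ₂, κ₂ x < Gp (Θ x)) → 0 < Q → Q ≤ κ₁ s₁ - Gm (Γ s₁) →
      Q ≤ κ₂ s₂ - Gp (Θ s₂) → C₁ ≤ D ^ m * Q / 2 →
      ∃ s ∈ closedBall s₁ ρ₁, ∃ ξ ∈ closedBall s₂ ρ₂,
        ‖Fi^[m] (Γ s) - F^[m] (Θ ξ)‖ ≤ Real.exp (C₁ - D ^ m * Q / 2) := by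
  obtain ⟨C₀, hC₀⟩ := h.bound
  obtain ⟨c, hc, R, hsep⟩ := h.sep
  set R₁ := max R 1 with hR₁
  have hR₁1 : 1 ≤ R₁ := le_max_right _ _
  set C₁ := |Real.log 8 + 4 * C₀ - 2 * Real.log c| + |Real.log 8 + 4 * C₀ + 2 * Real.log R₁| + 1
    with hC₁
  refine ⟨C₁, ?_⟩
  intro Γ Θ U₁ U₂ s₁ s₂ ρ₁ ρ₂ κ₁ κ₂ Q m hU₁ hU₂ hΓ hΘ hΓ0 hΘ0 hρ₁ hρ₂ hK₁ hK₂ hκ₁ hκ₂ hb₁ hb₂ hQ hQ₁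
    hQ₂ hm
  have pg := h.minus.posHarm hU₁ hΓ
  have ph := h.plus.posHarm hU₂ hΘ
  set g := fun x => Gm (Γ x) with hg
  set k := fun x => Gp (Θ x) with hk
  set M := D ^ m with hM
  have hM0 : 0 < M := pow_pos (one_pos.trans h.one_lt) m
  obtain ⟨a, ha, hga, hκa, hmaxa⟩ := exists_zero_of_barrier pg hU₁ hκ₁ hK₁ hb₁
    (mem_closedBall_self hρ₁) (by linarith : g s₁ < κ₁ s₁)
  obtain ⟨b, hb, hkb, hκb, hmaxb⟩ := exists_zero_of_barrier ph hU₂ hκ₂ hK₂ hb₂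
    (mem_closedBall_self hρ₂) (by linarith : k s₂ < κ₂ s₂)
  have hQa : Q ≤ κ₁ a := hQ₁.trans (hmaxa _ (mem_closedBall_self hρ₁))
  have hQb : Q ≤ κ₂ b := hQ₂.trans (hmaxb _ (mem_closedBall_self hρ₂))
  obtain ⟨c₁, hc₁, S₁⟩ := pg.strictSub hU₁ hκ₁ (div_pos hQ hκa) ((div_le_one hκa).2 hQa) hM0
  obtain ⟨c₂, hc₂, S₂⟩ := ph.strictSub hU₂ hκ₂ (div_pos hQ hκb) ((div_le_one hκb).2 hQb) hM0
  set E : ℂ × ℂ → ℂ × ℂ := fun x => Fi^[m] (Γ x.1) - F^[m] (Θ x.2) with hEdef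
  have hE : DifferentiableOn ℂ E (U₁ ×ˢ U₂) := by
    have d1 : DifferentiableOn ℂ (fun x : ℂ × ℂ => Γ x.1) (U₁ ×ˢ U₂) :=
      hΓ.comp differentiable_fst.differentiableOn fun x hx => hx.1
    have d2 : DifferentiableOn ℂ (fun x : ℂ × ℂ => Θ x.2) (U₁ ×ˢ U₂) :=
      hΘ.comp differentiable_snd.differentiableOn fun x hx => hx.2
    exact ((h.diff_inv.iterate m).comp_differentiableOn d1).sub
      ((h.diff.iterate m).comp_differentiableOn d2)
  by_contra! hcon
  have hbig : ∀ x ∈ closedBall s₁ ρ₁ ×ˢ closedBall s₂ ρ₂, Real.exp (C₁ - M * Q / 2) < ‖E x‖ :=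
    fun x hx => hcon x.1 hx.1 x.2 hx.2
  have hEne : ∀ x ∈ closedBall s₁ ρ₁ ×ˢ closedBall s₂ ρ₂, E x ≠ 0 := fun x hx =>
    norm_pos_iff.1 ((Real.exp_pos _).trans (hbig x hx))
  obtain ⟨x, hx, hxB, hmax⟩ := exists_boundary_max hc₁ hc₂ S₁ S₂ hU₁ hU₂ hρ₁ hρ₂ hK₁ hK₂ hE hEne
  have hab : ((a, b) : ℂ × ℂ) ∈ closedBall s₁ ρ₁ ×ˢ closedBall s₂ ρ₂ :=
    ⟨ball_subset_closedBall ha, ball_subset_closedBall hb⟩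
  have hT := hmax _ hab
  have lpx : ∀ s ∈ U₁, |M * g s - lp (Fi^[m] (Γ s))| ≤ C₀ := fun s hs => by
    have e : Gp (Fi^[m] (Γ s)) = 0 := by
      have := h.plus.iterate_map m (Fi^[m] (Γ s))
      rw [(Function.LeftInverse.iterate h.right_inv m) (Γ s), hΓ0 s hs] at this
      exact (mul_eq_zero.1 this.symm).resolve_left hM0.ne'
    have := (hC₀ _).1 e
    rwa [h.minus.iterate_map m] at this
  have lpy : ∀ ξ ∈ U₂, |M * k ξ - lp (F^[m] (Θ ξ))| ≤ C₀ := fun ξ hξ => by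
    have e : Gm (F^[m] (Θ ξ)) = 0 := by
      have := h.Gm_iterate m (Θ ξ)
      rw [hΘ0 ξ hξ] at this
      exact (mul_eq_zero.1 this).resolve_left hM0.ne'
    have := (hC₀ _).2 e
    rwa [h.plus.iterate_map m] at this
  have upab : Real.log (sq (E (a, b))) ≤ Real.log 8 + 2 * C₀ := by
    have e1 := (abs_le.1 (lpx a (hK₁ hab.1))).1
    have e2 := (abs_le.1 (lpy b (hK₂ hab.2))).1
    rw [show g a = 0 from hga] at e1
    rw [show k b = 0 from hkb] at e2
    have n1 : ‖Fi^[m] (Γ a)‖ ≤ Real.exp C₀ :=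
      (norm_le_exp_lp _).trans (Real.exp_le_exp.2 (by linarith))
    have n2 : ‖F^[m] (Θ b)‖ ≤ Real.exp C₀ :=
      (norm_le_exp_lp _).trans (Real.exp_le_exp.2 (by linarith))
    have n3 : ‖E (a, b)‖ ≤ 2 * Real.exp C₀ := (norm_sub_le _ _).trans (by linarith)
    have n4 : sq (E (a, b)) ≤ 8 * Real.exp (2 * C₀) := by
      refine (sq_le_norm_sq _).trans ?_
      have := pow_le_pow_left₀ (norm_nonneg _) n3 2
      rw [mul_pow, ← Real.exp_nat_mul] at this
      push_cast at this
      linarith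
    have := Real.log_le_log (sq_pos (hEne _ hab)) n4
    rwa [Real.log_mul (by norm_num) (Real.exp_pos _).ne', Real.log_exp] at this
  have hM' : 2 * C₁ ≤ M * Q := by linarith
  have lowx : 2 * Real.log ‖E x‖ ≤ Real.log (sq (E x)) := by
    have := Real.log_le_log (pow_pos (norm_pos_iff.2 (hEne x hx)) 2) (norm_sq_le_sq (E x))
    rw [Real.log_pow] at this
    exact_mod_cast this
  have sumle : M * ((1 - Q / κ₁ a) * g x.1 + Q / κ₁ a * κ₁ x.1) +
      M * ((1 - Q / κ₂ b) * k x.2 + Q / κ₂ b * κ₂ x.2) ≤ M * g x.1 + M * k x.2 + M * Q := by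
    have e1 : Q / κ₁ a * (κ₁ x.1 - g x.1) ≤ Q := by
      have := mul_le_mul_of_nonneg_left (hmaxa _ hx.1) (div_pos hQ hκa).le
      rwa [div_mul_cancel₀ _ hκa.ne'] at this
    have e2 : Q / κ₂ b * (κ₂ x.2 - k x.2) ≤ Q := by
      have := mul_le_mul_of_nonneg_left (hmaxb _ hx.2) (div_pos hQ hκb).le
      rwa [div_mul_cancel₀ _ hκb.ne'] at this
    have e3 : Q / κ₁ a * (κ₁ x.1 - g x.1) + Q / κ₂ b * (κ₂ x.2 - k x.2) ≤ Q := by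
      rcases hxB with hs | hs
      · have := mul_nonneg (div_pos hQ hκa).le (sub_nonneg.2 (hb₁ _ hs).le)
        simp only [g] at *
        linarith
      · have := mul_nonneg (div_pos hQ hκb).le (sub_nonneg.2 (hb₂ _ hs).le)
        simp only [k] at *
        linarith
    have := mul_le_mul_of_nonneg_left e3 hM0.le
    linarith
  have valab : M * ((1 - Q / κ₁ a) * g a + Q / κ₁ a * κ₁ a) +
      M * ((1 - Q / κ₂ b) * k b + Q / κ₂ b * κ₂ b) = 2 * (M * Q) := by
    rw [show g a = 0 from hga, show k b = 0 from hkb, div_mul_cancel₀ _ hκa.ne',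
      div_mul_cancel₀ _ hκb.ne']
    ring
  simp only at hT
  rw [valab] at hT
  have gx := (abs_le.1 (lpx x.1 (hK₁ hx.1))).2
  have kx := (abs_le.1 (lpy x.2 (hK₂ hx.2))).2
  set X := Fi^[m] (Γ x.1) with hX
  set Y := F^[m] (Θ x.2) with hY
  have abs1 := le_abs_self (Real.log 8 + 4 * C₀ - 2 * Real.log c)
  have abs2 := le_abs_self (Real.log 8 + 4 * C₀ + 2 * Real.log R₁)
  have abs3 := abs_nonneg (Real.log 8 + 4 * C₀ - 2 * Real.log c)
  have abs4 := abs_nonneg (Real.log 8 + 4 * C₀ + 2 * Real.log R₁)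
  have lpmono : ∀ {Z : ℂ × ℂ} {t : ℝ}, 1 ≤ t → ‖Z‖ ≤ t → lp Z ≤ Real.log t := fun ht hZ =>
    Real.log_le_log (lt_max_of_lt_right one_pos) (max_le hZ ht)
  rcases le_or_gt R₁ (max ‖X‖ ‖Y‖) with hbigm | hsm
  · set t := max ‖X‖ ‖Y‖ with ht
    have ht1 : 1 ≤ t := hR₁1.trans hbigm
    have hp : Gp X = 0 := by
      have := h.plus.iterate_map m X
      rw [(Function.LeftInverse.iterate h.right_inv m) (Γ x.1), hΓ0 _ (hK₁ hx.1)] at this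
      exact (mul_eq_zero.1 this.symm).resolve_left hM0.ne'
    have hq : Gm Y = 0 := by
      have := h.Gm_iterate m (Θ x.2)
      rw [hΘ0 _ (hK₂ hx.2)] at this
      exact (mul_eq_zero.1 this).resolve_left hM0.ne'
    have s1 := hsep Y X hp hq (by
      rw [max_comm]; exact (le_max_left _ _).trans hbigm)
    rw [max_comm, norm_sub_rev] at s1
    have s2 : Real.log (c * t) ≤ Real.log ‖E x‖ :=
      Real.log_le_log (by positivity) s1
    rw [Real.log_mul hc.ne' (by positivity)] at s2
    have l1 := lpmono ht1 (le_max_left ‖X‖ ‖Y‖)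
    have l2 := lpmono ht1 (le_max_right ‖X‖ ‖Y‖)
    linarith
  · have l1 := lpmono hR₁1 ((le_max_left ‖X‖ ‖Y‖).trans hsm.le)
    have l2 := lpmono hR₁1 ((le_max_right ‖X‖ ‖Y‖).trans hsm.le)
    have s2 := Real.log_le_log (Real.exp_pos _) (hbig x hx).le
    rw [Real.log_exp] at s2
    linarith

/-- Entire maps are Lipschitz at unit scale on balls. -/
lemma exists_lip_of_differentiable {f : ℂ × ℂ → ℂ × ℂ} (hf : Differentiable ℂ f) (R : ℝ) :
    ∃ L : ℝ, 1 ≤ L ∧ ∀ x y, ‖y‖ ≤ R → ‖x - y‖ ≤ 1 → ‖f x - f y‖ ≤ L * ‖x - y‖ := by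
  obtain ⟨B, hB⟩ := (isCompact_closedBall (0 : ℂ × ℂ) (R + 2)).exists_bound_of_continuousOn
    hf.continuous.continuousOn
  refine ⟨max 1 (2 * B), le_max_left _ _, fun x y hy hxy => ?_⟩
  rcases eq_or_ne x y with rfl | hne
  · simp
  have hn : 0 < ‖x - y‖ := norm_pos_iff.2 (sub_ne_zero.2 hne)
  set v : ℂ × ℂ := ((‖x - y‖ : ℂ)⁻¹) • (x - y) with hv
  have hv1 : ‖v‖ = 1 := by
    rw [hv, norm_smul, norm_inv, Complex.norm_real, Real.norm_of_nonneg hn.le, inv_mul_cancel₀ hn.ne']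
  have hd : DifferentiableOn ℂ (fun t : ℂ => f (y + t • v)) (ball 0 2) := by
    have : Differentiable ℂ (fun t : ℂ => y + t • v) := by fun_prop
    exact (hf.comp this).differentiableOn
  have hb : ∀ t ∈ ball (0 : ℂ) 2, ‖f (y + t • v)‖ ≤ B := fun t ht => by
    refine hB _ (mem_closedBall_zero_iff.2 ((norm_add_le _ _).trans ?_))
    rw [norm_smul, hv1, mul_one]
    have := mem_ball_zero_iff.1 ht
    linarith
  have h0 : (0 : ℂ) ∈ closedBall (0 : ℂ) 1 := by simp
  have h1 : ((‖x - y‖ : ℝ) : ℂ) ∈ closedBall (0 : ℂ) 1 := by simpa using hxy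
  have key := lip_of_bounded hd hb (by norm_num : (1 : ℝ) < 2) h1 h0
  have e : y + ((‖x - y‖ : ℝ) : ℂ) • v = x := by
    rw [hv, smul_smul, mul_inv_cancel₀ (by exact_mod_cast hn.ne'), one_smul]; abel
  simp only [e, zero_smul, add_zero, sub_zero, Complex.norm_real, norm_norm] at key
  refine key.trans (mul_le_mul_of_nonneg_right ?_ hn.le)
  refine le_trans (le_of_eq ?_) (le_max_right _ _)
  norm_num
  ring

lemma Dyn.norm_le_of_Gm {F Fi : ℂ × ℂ → ℂ × ℂ} {D : ℝ} {Gp Gm : ℂ × ℂ → ℝ}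
    (h : Dyn F Fi D Gp Gm) (B : ℝ) : ∃ R > 0, ∀ y, Gm y = 0 → Gp y ≤ B → ‖y‖ ≤ R := by
  obtain ⟨C, hC⟩ := h.bound
  refine ⟨Real.exp (B + C), Real.exp_pos _, fun y hy hB => (norm_le_exp_lp y).trans
    (Real.exp_le_exp.2 ?_)⟩
  have := (abs_le.1 ((hC y).2 hy)).1
  linarith

theorem Dyn.backward_lipschitz {F Fi : ℂ × ℂ → ℂ × ℂ} {D : ℝ} {Gp Gm : ℂ × ℂ → ℝ}
    (h : Dyn F Fi D Gp Gm) (B : ℝ) : ∃ Λ : ℝ, 1 ≤ Λ ∧ ∀ (x y : ℂ × ℂ) (m : ℕ), Gm y = 0 →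
      Gp y ≤ B → Λ ^ m * ‖x - y‖ ≤ 1 → ‖Fi^[m] x - Fi^[m] y‖ ≤ Λ ^ m * ‖x - y‖ := by
  obtain ⟨R, -, hR⟩ := h.norm_le_of_Gm B
  obtain ⟨Λ, hΛ, hlip⟩ := exists_lip_of_differentiable h.diff_inv R
  refine ⟨Λ, hΛ, fun x y m hy hB hm => ?_⟩
  induction m with
  | zero => simp
  | succ m ih =>
    have hle : Λ ^ m * ‖x - y‖ ≤ 1 :=
      (mul_le_mul_of_nonneg_right (pow_le_pow_right₀ hΛ m.le_succ) (norm_nonneg _)).trans hm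
    have i := ih hle
    have hDm : (1 : ℝ) ≤ D ^ m := one_le_pow₀ h.one_lt.le
    have g1 : Gm (Fi^[m] y) = 0 := by rw [h.minus.iterate_map, hy, mul_zero]
    have g2 : Gp (Fi^[m] y) ≤ B := by
      have e := h.plus.iterate_map m (Fi^[m] y)
      rw [(Function.LeftInverse.iterate h.right_inv m) y] at e
      have := h.plus.nonneg (Fi^[m] y)
      nlinarith
    rw [Function.iterate_succ_apply', Function.iterate_succ_apply']
    refine (hlip _ _ (hR _ g1 g2) (i.trans hle)).trans ?_
    rw [pow_succ']
    have := mul_le_mul_of_nonneg_left i (zero_le_one.trans hΛ)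
    linarith

theorem Dyn.exists_shadow {F Fi : ℂ × ℂ → ℂ × ℂ} {D : ℝ} {Gp Gm : ℂ × ℂ → ℝ}
    (h : Dyn F Fi D Gp Gm) : ∃ C₁ Λ : ℝ, 1 ≤ Λ ∧ ∀ {Γ Θ : ℂ → ℂ × ℂ} {U₁ U₂ : Set ℂ} {s₁ s₂ : ℂ}
      {ρ₁ ρ₂ : ℝ} {κ₁ κ₂ : ℂ → ℝ} {Q : ℝ} {m : ℕ}, IsOpen U₁ → IsOpen U₂ →
      DifferentiableOn ℂ Γ U₁ → DifferentiableOn ℂ Θ U₂ → (∀ s ∈ U₁, Gp (Γ s) = 0) →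
      (∀ ξ ∈ U₂, Gm (Θ ξ) = 0) → 0 ≤ ρ₁ → 0 ≤ ρ₂ → closedBall s₁ ρ₁ ⊆ U₁ → closedBall s₂ ρ₂ ⊆ U₂ →
      Barrier κ₁ → Barrier κ₂ → (∀ x ∈ sphere s₁ ρ₁, κ₁ x < Gm (Γ x)) →
      (∀ x ∈ sphere s₂ ρ₂, κ₂ x < Gp (Θ x)) → 0 < Q → Q ≤ κ₁ s₁ - Gm (Γ s₁) →
      Q ≤ κ₂ s₂ - Gp (Θ s₂) → C₁ ≤ D ^ m * Q / 2 →
      Λ ^ m * Real.exp (C₁ - D ^ m * Q / 2) ≤ 1 →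
      ∃ s ∈ closedBall s₁ ρ₁, ∃ ξ ∈ closedBall s₂ ρ₂,
        ‖Fi^[2 * m] (Γ s) - Θ ξ‖ ≤ Λ ^ m * Real.exp (C₁ - D ^ m * Q / 2) := by
  obtain ⟨C₁, hC₁⟩ := h.exists_close
  obtain ⟨C, hC⟩ := h.bound
  obtain ⟨c, hc, R, hsep⟩ := h.sep
  set R' := max (max R (1 / c)) 1 with hR'
  obtain ⟨Λ, hΛ, hlip⟩ := h.backward_lipschitz (Real.log R' + C)
  refine ⟨C₁, Λ, hΛ, ?_⟩
  intro Γ Θ U₁ U₂ s₁ s₂ ρ₁ ρ₂ κ₁ κ₂ Q m hU₁ hU₂ hΓ hΘ hΓ0 hΘ0 hρ₁ hρ₂ hK₁ hK₂ hκ₁ hκ₂ hb₁ hb₂ hQ hQ₁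
    hQ₂ hm hsmall
  obtain ⟨s, hs, ξ, hξ, hsξ⟩ := hC₁ hU₁ hU₂ hΓ hΘ hΓ0 hΘ0 hρ₁ hρ₂ hK₁ hK₂ hκ₁ hκ₂ hb₁ hb₂ hQ hQ₁ hQ₂ hm
  refine ⟨s, hs, ξ, hξ, ?_⟩
  have hD0 : 0 < D := one_pos.trans h.one_lt
  set X := Fi^[m] (Γ s) with hX
  set Y := F^[m] (Θ ξ) with hY
  have hle1 : ‖X - Y‖ ≤ 1 := by
    refine hsξ.trans (Real.exp_le_one_iff.2 (by linarith))
  have hp : Gp X = 0 := by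
    have := h.plus.iterate_map m X
    rw [(Function.LeftInverse.iterate h.right_inv m) (Γ s), hΓ0 _ (hK₁ hs)] at this
    exact (mul_eq_zero.1 this.symm).resolve_left (pow_pos hD0 m).ne'
  have hq : Gm Y = 0 := by
    have := h.Gm_iterate m (Θ ξ)
    rw [hΘ0 _ (hK₂ hξ)] at this
    exact (mul_eq_zero.1 this).resolve_left (pow_pos hD0 m).ne'
  have hmax : max ‖X‖ ‖Y‖ ≤ R' := by
    by_contra! hlt
    have h1 : R ≤ max ‖X‖ ‖Y‖ := ((le_max_left _ _).trans (le_max_left _ _)).trans hlt.le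
    have h2 : 1 / c < max ‖X‖ ‖Y‖ := ((le_max_right _ _).trans (le_max_left _ _)).trans_lt hlt
    have h3 := hsep Y X hp hq (by rwa [max_comm])
    rw [max_comm, norm_sub_rev] at h3
    have h4 := (div_lt_iff₀' hc).1 h2
    linarith
  have hYR : Gp Y ≤ Real.log R' + C := by
    have h1 := (abs_le.1 ((hC Y).2 hq)).2
    have h2 : lp Y ≤ Real.log R' := Real.log_le_log (lt_max_of_lt_right one_pos)
      (max_le ((le_max_right _ _).trans hmax) (le_max_right _ _))
    linarith
  have hΛm : 0 < Λ ^ m := by positivity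
  have h5 := mul_le_mul_of_nonneg_left hsξ hΛm.le
  have := hlip X Y m hq hYR (h5.trans hsmall)
  rw [hX, hY, ← Function.iterate_add_apply, ← two_mul, h.left_inv_iterate] at this
  exact this.trans h5

/-- At scale `D ^ N`, the function is at most one on the disc, vanishes at the centre, and is
definite on a smaller concentric disc. -/
structure GoodFn (D : ℝ) (g : ℂ → ℝ) (N : ℕ) (ξ : ℂ) (δ : ℝ) : Prop where
  pos : 0 < δ
  zero : g ξ = 0
  le_one : ∀ x ∈ closedBall ξ δ, D ^ N * g x ≤ 1
  big : ∃ x ∈ closedBall ξ (δ / 4), 1 / (40 * D) ≤ D ^ N * g x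

lemma exists_doubling {g : ℂ → ℝ} {ξ : ℂ} {ρ₀ c : ℝ} (hρ₀ : 0 < ρ₀) (hc : 0 < c)
    (hg : ContinuousOn g (closedBall ξ ρ₀)) (hgrow : ∀ r ∈ Icc 0 ρ₀, ∃ x ∈ closedBall ξ r, c * r ≤ g x) :
    ∃ ρ, 0 < ρ ∧ ρ ≤ ρ₀ ∧ ∃ x ∈ closedBall ξ (ρ / 5), 0 < g x ∧
      ∀ y ∈ closedBall ξ ρ, g y ≤ 10 * g x := by
  have hmax : ∀ r : ℝ, ∃ x, r ∈ Icc 0 ρ₀ → x ∈ closedBall ξ r ∧ ∀ y ∈ closedBall ξ r, g y ≤ g x := by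
    intro r
    by_cases hr : r ∈ Icc 0 ρ₀
    · obtain ⟨x, hx, hm⟩ := (isCompact_closedBall ξ r).exists_isMaxOn ⟨ξ, mem_closedBall_self hr.1⟩
        (hg.mono (closedBall_subset_closedBall hr.2))
      exact ⟨x, fun _ => ⟨hx, fun y hy => hm hy⟩⟩
    · exact ⟨0, fun h => absurd h hr⟩
  choose X hX using hmax
  have hin : ∀ k : ℕ, ρ₀ / 5 ^ k ∈ Icc 0 ρ₀ := fun k =>
    ⟨by positivity, div_le_self hρ₀.le (one_le_pow₀ (by norm_num))⟩
  have hlow : ∀ k : ℕ, c * (ρ₀ / 5 ^ k) ≤ g (X (ρ₀ / 5 ^ k)) := fun k => by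
    obtain ⟨x, hx, h⟩ := hgrow _ (hin k)
    exact h.trans ((hX _ (hin k)).2 x hx)
  by_contra! hcon
  have hstep : ∀ k : ℕ, 10 ^ k * g (X (ρ₀ / 5 ^ k)) ≤ g (X ρ₀) := by
    intro k
    induction k with
    | zero => simp
    | succ k ih =>
      have e : ρ₀ / 5 ^ (k + 1) = ρ₀ / 5 ^ k / 5 := by rw [pow_succ, div_div]
      have h1 := hX _ (hin (k + 1))
      obtain ⟨y, hy, hlt⟩ := hcon (ρ₀ / 5 ^ k) (by positivity) (hin k).2 (X (ρ₀ / 5 ^ (k + 1)))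
        (by rw [← e]; exact h1.1) ((by positivity : 0 < c * (ρ₀ / 5 ^ (k + 1))).trans_le (hlow _))
      have h2 := (hX _ (hin k)).2 y hy
      rw [pow_succ]
      have h3 : (10 : ℝ) ^ k * (10 * g (X (ρ₀ / 5 ^ (k + 1)))) ≤ 10 ^ k * g (X (ρ₀ / 5 ^ k)) := by
        gcongr; linarith
      linarith
  obtain ⟨k, hk⟩ := pow_unbounded_of_one_lt (g (X ρ₀) / (c * ρ₀)) (one_lt_two (α := ℝ))
  rw [div_lt_iff₀ (by positivity)] at hk
  have h1 := mul_le_mul_of_nonneg_left (hlow k) (by positivity : (0 : ℝ) ≤ 10 ^ k)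
  have h2 : (10 : ℝ) ^ k * (c * (ρ₀ / 5 ^ k)) = 2 ^ k * (c * ρ₀) := by
    rw [show (10 : ℝ) = 2 * 5 by norm_num, mul_pow]
    field_simp
  have := hstep k
  linarith

lemma exists_level {D S : ℝ} (hD : 1 < D) (hS : 0 < S) (hS1 : S ≤ 1 / 2) :
    ∃ N : ℕ, D ^ N * S ≤ 1 / 2 ∧ 1 / 2 < D ^ (N + 1) * S := by
  have hex : ∃ n : ℕ, 1 / 2 < D ^ n * S := by
    obtain ⟨n, hn⟩ := pow_unbounded_of_one_lt (1 / 2 / S) hD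
    exact ⟨n, by rwa [div_lt_iff₀ hS] at hn⟩
  classical
  have h0 : Nat.find hex ≠ 0 := fun h => by
    have := Nat.find_spec hex
    rw [h, pow_zero, one_mul] at this
    linarith
  obtain ⟨N, hN⟩ := Nat.exists_eq_succ_of_ne_zero h0
  refine ⟨N, not_lt.1 (Nat.find_min hex (by omega)), ?_⟩
  have := Nat.find_spec hex
  rwa [hN] at this

/-- Functions close to one with a touched zero have good discs there. -/
theorem Touched.exists_good {D : ℝ} (hD : 1 < D) {g : ℂ → ℝ} {U : Set ℂ} (hg : PosHarm g U)
    (hU : IsOpen U) {ξ : ℂ} (h : Touched g U ξ) {ρm : ℝ} (hρm : 0 < ρm) :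
    ∃ ρ, 0 < ρ ∧ ρ ≤ ρm ∧ closedBall ξ ρ ⊆ U ∧ ∃ N : ℕ, ∃ β > 0, ∀ g' : ℂ → ℝ, PosHarm g' U →
      (∀ x ∈ closedBall ξ ρ, |g' x - g x| ≤ β) →
      ∃ ξ', closedBall ξ' (9 / 10 * ρ) ⊆ closedBall ξ ρ ∧ GoodFn D g' N ξ' (9 / 10 * ρ) := by
  obtain ⟨c, hc, ρ₁, hρ₁, hsub, hgrow⟩ := h.growth hg hU
  obtain ⟨ρ₀', hρ₀', hbar⟩ := h.barrier hg hU
  have hgξ : g ξ = 0 := h.2.1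
  obtain ⟨r, hr, hsmall⟩ : ∃ r > 0, ∀ y ∈ closedBall ξ r, g y ≤ 1 / 20 := by
    have ev : ∀ᶠ y in 𝓝 ξ, g y < 1 / 20 :=
      (hg.cont.continuousAt (hU.mem_nhds h.1)).eventually_lt_const (by rw [hgξ]; norm_num)
    obtain ⟨r, hr, hb⟩ := Metric.mem_nhds_iff.1 ev
    exact ⟨r / 2, by positivity, fun y hy => le_of_lt (hb (closedBall_subset_ball (by linarith) hy))⟩
  set ρ₂ := min (min ρ₁ ρm) r with hρ₂
  have hρ₂0 : 0 < ρ₂ := by positivity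
  have l1 : ρ₂ ≤ ρ₁ := (min_le_left _ _).trans (min_le_left _ _)
  have l2 : ρ₂ ≤ ρm := (min_le_left _ _).trans (min_le_right _ _)
  have l3 : ρ₂ ≤ r := min_le_right _ _
  obtain ⟨ρ, hρ, hρle, x, hx, hxpos, hdoub⟩ := exists_doubling hρ₂0 hc
    (hg.cont.mono ((closedBall_subset_closedBall l1).trans hsub))
    (fun s hs => hgrow s ⟨hs.1, hs.2.trans l1⟩)
  have hρU : closedBall ξ ρ ⊆ U := (closedBall_subset_closedBall (hρle.trans l1)).trans hsub
  have hxle : g x ≤ 1 / 20 := hsmall x (closedBall_subset_closedBall (by linarith) hx)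
  obtain ⟨N, hN1, hN2⟩ := exists_level hD (S := 10 * g x) (by linarith) (by linarith)
  set ρb := min (ρ₀' / 2) (ρ / 50) with hρb
  have hρb0 : 0 < ρb := by positivity
  have hρb1 : ρb < ρ₀' := (min_le_left _ _).trans_lt (by linarith)
  have hρb2 : ρb ≤ ρ / 50 := min_le_right _ _
  obtain ⟨hbU, κ, hκ, hκξ, hκg⟩ := hbar ρb hρb0 hρb1
  have hsne : (sphere ξ ρb).Nonempty := NormedSpace.sphere_nonempty.2 hρb0.le
  obtain ⟨z, hz, hzmin⟩ := (isCompact_sphere ξ ρb).exists_isMinOn hsne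
    ((hg.cont.mono (sphere_subset_closedBall.trans hbU)).sub hκ.1.continuousOn)
  have hz0 : 0 < g z - κ z := sub_pos.2 (hκg z hz)
  have hDN : 0 < D ^ N := pow_pos (one_pos.trans hD) N
  set β := min (min ((g z - κ z) / 2) (κ ξ / 2)) (1 / (40 * D) / D ^ N) with hβ
  have hD0 : 0 < D := one_pos.trans hD
  have hβ0 : 0 < β := by positivity
  have b1 : β ≤ (g z - κ z) / 2 := (min_le_left _ _).trans (min_le_left _ _)
  have b2 : β ≤ κ ξ / 2 := (min_le_left _ _).trans (min_le_right _ _)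
  have b3 : D ^ N * β ≤ 1 / (40 * D) := by
    have := (le_div_iff₀ hDN).1 (min_le_right (min ((g z - κ z) / 2) (κ ξ / 2)) (1 / (40 * D) / D ^ N))
    rwa [mul_comm] at this
  refine ⟨ρ, hρ, hρle.trans l2, hρU, N, β, hβ0, fun g' hg' hclose => ?_⟩
  have hb' : ∀ y ∈ sphere ξ ρb, κ y < g' y := fun y hy => by
    have a1 : g z - κ z ≤ g y - κ y := hzmin hy
    have a2 := (abs_le.1 (hclose y (closedBall_subset_closedBall (by linarith)
      (sphere_subset_closedBall hy)))).1
    linarith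
  have hb0 : g' ξ < κ ξ := by
    have := (abs_le.1 (hclose ξ (mem_closedBall_self hρ.le))).2
    rw [hgξ] at this
    linarith
  obtain ⟨ξ', hξ', hz', -, -⟩ := exists_zero_of_barrier hg' hU hκ hbU hb'
    (mem_closedBall_self hρb0.le) hb0
  have hd : dist ξ' ξ ≤ ρ / 50 := (mem_ball.1 hξ').le.trans hρb2
  have hinc : closedBall ξ' (9 / 10 * ρ) ⊆ closedBall ξ ρ :=
    closedBall_subset_closedBall' (by linarith)
  refine ⟨ξ', hinc, by positivity, hz', fun y hy => ?_, x, ?_, ?_⟩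
  · have a1 := (abs_le.1 (hclose y (hinc hy))).2
    have a2 := hdoub y (hinc hy)
    have a3 : D ^ N * g' y ≤ D ^ N * (10 * g x + β) := by gcongr; linarith
    have a4 : 1 / (40 * D) ≤ 1 / 2 := by
      rw [div_le_div_iff₀ (by positivity) (by norm_num)]; linarith
    linarith
  · rw [mem_closedBall] at hx ⊢
    have := dist_triangle x ξ ξ'
    rw [dist_comm ξ ξ'] at this
    linarith
  · have a1 := (abs_le.1 (hclose x (closedBall_subset_closedBall (by linarith) hx))).1
    have a3 : D ^ N * (g x - β) ≤ D ^ N * g' x := by gcongr; linarith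
    have a4 : 1 / (20 * D) ≤ D ^ N * g x := by
      rw [pow_succ] at hN2
      rw [div_le_iff₀ (by positivity)]
      linarith
    have a5 : 1 / (20 * D) = 1 / (40 * D) + 1 / (40 * D) := by field_simp; norm_num
    linarith

lemma exists_convergent_subseq {f : ℕ → ℂ → ℂ × ℂ} {R : ℝ}
    (hd : ∀ k, DifferentiableOn ℂ (f k) (ball 0 1)) (hb : ∀ k, ∀ x ∈ ball (0 : ℂ) 1, ‖f k x‖ ≤ R) :
    ∃ φ : ℕ → ℕ, StrictMono φ ∧ ∃ g : ℂ → ℂ × ℂ, DifferentiableOn ℂ g (ball 0 (3 / 4)) ∧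
      TendstoUniformlyOn (fun k => f (φ k)) g atTop (closedBall 0 (3 / 4)) := by
  set K : Set ℂ := closedBall 0 (3 / 4) with hK
  have hKc : IsCompact K := isCompact_closedBall _ _
  have hKb : K ⊆ ball 0 1 := closedBall_subset_ball (by norm_num)
  have : CompactSpace K := isCompact_iff_compactSpace.1 hKc
  let u : ℕ → BoundedContinuousFunction K (ℂ × ℂ) := fun k =>
    BoundedContinuousFunction.mkOfCompact ⟨fun x => f k x,
      ((hd k).continuousOn.mono hKb).domRestrict⟩
  have hu : ∀ k x, u k x = f k x := fun k x => rfl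
  have hlip : ∀ k, ∀ x ∈ K, ∀ y ∈ K, ‖f k x - f k y‖ ≤ R / ((1 - 3 / 4) / 2) * ‖x - y‖ :=
    fun k x hx y hy => lip_of_bounded (hd k) (hb k) (by norm_num) hx hy
  have hcomp : IsCompact (closure (range u)) := by
    refine BoundedContinuousFunction.arzela_ascoli (closedBall 0 R) (isCompact_closedBall _ _) _ ?_ ?_
    · rintro _ x ⟨k, rfl⟩
      rw [hu, mem_closedBall_zero_iff]
      exact hb k x (hKb x.2)
    · refine Metric.equicontinuous_of_continuity_modulus
        (fun t => R / ((1 - 3 / 4) / 2) * t) ?_ _ ?_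
      · have : Continuous fun t : ℝ => R / ((1 - 3 / 4) / 2) * t := by fun_prop
        simpa using this.tendsto 0
      · rintro x y ⟨_, k, rfl⟩
        rw [dist_eq_norm, Subtype.dist_eq, dist_eq_norm]
        exact hlip k x x.2 y y.2
  obtain ⟨g, -, φ, hφ, hg⟩ := hcomp.tendsto_subseq (fun k => subset_closure (mem_range_self k))
  classical
  set G : ℂ → ℂ × ℂ := fun x => if h : x ∈ K then g ⟨x, h⟩ else 0 with hG
  have hunif : TendstoUniformlyOn (fun k => f (φ k)) G atTop K := by
    rw [tendstoUniformlyOn_iff_tendstoUniformly_comp_coe]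
    have h1 := BoundedContinuousFunction.tendsto_iff_tendstoUniformly.1 hg
    have e : G ∘ (fun x : K => (x : ℂ)) = fun x => g x := by
      funext x
      simp [hG]
    rw [e]
    exact h1
  refine ⟨φ, hφ, G, ?_, hunif⟩
  have hs : ball (0 : ℂ) (3 / 4) ⊆ K := ball_subset_closedBall
  exact (hunif.mono hs).tendstoLocallyUniformlyOn.differentiableOn
    (Eventually.of_forall fun k => (hd (φ k)).mono (hs.trans hKb)) isOpen_ball

/-- Normalised discs in the zero set of one escape function. -/
structure Good (D : ℝ) (Gp Gm : ℂ × ℂ → ℝ) (Θ : ℂ → ℂ × ℂ) : Prop where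
  diff : Differentiable ℂ Θ
  Gm_zero : ∀ ξ, Gm (Θ ξ) = 0
  good : GoodFn D (fun ξ => Gp (Θ ξ)) 0 0 1

lemma Good.le_one {D : ℝ} {Gp Gm : ℂ × ℂ → ℝ} {Θ : ℂ → ℂ × ℂ} (h : Good D Gp Gm Θ) {ξ : ℂ}
    (hξ : ξ ∈ closedBall (0 : ℂ) 1) : Gp (Θ ξ) ≤ 1 := by
  simpa using h.good.le_one ξ hξ

theorem Dyn.good_compact {F Fi : ℂ × ℂ → ℂ × ℂ} {D : ℝ} {Gp Gm : ℂ × ℂ → ℝ}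
    (h : Dyn F Fi D Gp Gm) {Θ : ℕ → ℂ → ℂ × ℂ} (hΘ : ∀ k, Good D Gp Gm (Θ k)) :
    ∃ φ : ℕ → ℕ, StrictMono φ ∧ ∃ Θ' : ℂ → ℂ × ℂ, DifferentiableOn ℂ Θ' (ball 0 (3 / 4)) ∧
      TendstoUniformlyOn (fun k => Θ (φ k)) Θ' atTop (closedBall 0 (3 / 4)) ∧
      (∀ β > 0, ∀ᶠ k in atTop, ∀ x ∈ closedBall (0 : ℂ) (3 / 4),
        |Gp (Θ (φ k) x) - Gp (Θ' x)| ≤ β) ∧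
      ∃ ξ ∈ closedBall (0 : ℂ) (1 / 4), EdgeZero (fun x => Gp (Θ' x)) (ball 0 (3 / 4)) ξ := by
  obtain ⟨R, hR0, hR⟩ := h.norm_le_of_Gm 1
  have hbd : ∀ k, ∀ x ∈ ball (0 : ℂ) 1, ‖Θ k x‖ ≤ R := fun k x hx =>
    hR _ ((hΘ k).Gm_zero x) ((hΘ k).le_one (ball_subset_closedBall hx))
  obtain ⟨φ, hφ, Θ', hd, hunif⟩ := exists_convergent_subseq
    (fun k => (hΘ k).diff.differentiableOn) hbd
  have hsub : closedBall (0 : ℂ) (3 / 4) ⊆ ball 0 1 := closedBall_subset_ball (by norm_num)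
  have hbd' : ∀ x ∈ closedBall (0 : ℂ) (3 / 4), ‖Θ' x‖ ≤ R := fun x hx =>
    le_of_tendsto (hunif.tendsto_at hx).norm (Eventually.of_forall fun k => hbd _ x (hsub hx))
  have huc := (isCompact_closedBall (0 : ℂ × ℂ) R).uniformContinuousOn_of_continuous
    h.plus.cont.continuousOn
  have hGp : ∀ β > 0, ∀ᶠ k in atTop, ∀ x ∈ closedBall (0 : ℂ) (3 / 4),
      |Gp (Θ (φ k) x) - Gp (Θ' x)| ≤ β := by
    intro β hβ
    obtain ⟨δ, hδ, hδ'⟩ := Metric.uniformContinuousOn_iff.1 huc β hβ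
    filter_upwards [Metric.tendstoUniformlyOn_iff.1 hunif δ hδ] with k hk x hx
    have := hδ' (Θ (φ k) x) (by simpa using hbd (φ k) x (hsub hx)) (Θ' x)
      (by simpa using hbd' x hx) (by rw [dist_comm]; exact hk x hx)
    rw [Real.dist_eq] at this
    exact this.le
  have hlim : ∀ x ∈ closedBall (0 : ℂ) (3 / 4),
      Tendsto (fun k => Gp (Θ (φ k) x)) atTop (𝓝 (Gp (Θ' x))) := fun x hx =>
    (h.plus.cont.tendsto _).comp (hunif.tendsto_at hx)
  refine ⟨φ, hφ, Θ', hd, hunif, hGp, ?_⟩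
  have pz : (0 : ℂ) ∈ closedBall (0 : ℂ) (3 / 4) := mem_closedBall_self (by norm_num)
  have h0 : Gp (Θ' 0) = 0 := tendsto_nhds_unique (hlim 0 pz) (by
    have : ∀ k, Gp (Θ (φ k) 0) = 0 := fun k => (hΘ _).good.zero
    simp only [this]
    exact tendsto_const_nhds)
  have hD0 : 0 < D := one_pos.trans h.one_lt
  choose X hX hXbig using fun k => (hΘ (φ k)).good.big
  obtain ⟨x, hx, σ, hσ, hxlim⟩ := (isCompact_closedBall (0 : ℂ) (1 / 4)).tendsto_subseq hX
  have h14 : closedBall (0 : ℂ) (1 / 4) ⊆ closedBall 0 (3 / 4) :=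
    closedBall_subset_closedBall (by norm_num)
  have h14' : closedBall (0 : ℂ) (1 / 4) ⊆ ball 0 (3 / 4) := closedBall_subset_ball (by norm_num)
  have hcont : ContinuousOn (fun x => Gp (Θ' x)) (ball 0 (3 / 4)) :=
    h.plus.cont.comp_continuousOn hd.continuousOn
  have hpos : 0 < Gp (Θ' x) := by
    set c₀ := 1 / (40 * D) with hc₀
    have hc₀0 : 0 < c₀ := by positivity
    have e1 : Tendsto (fun k => Gp (Θ' (X (σ k)))) atTop (𝓝 (Gp (Θ' x))) :=
      (hcont.continuousAt (isOpen_ball.mem_nhds (h14' hx))).tendsto.comp hxlim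
    have e2 : c₀ / 2 ≤ Gp (Θ' x) := by
      refine ge_of_tendsto e1 ?_
      filter_upwards [hσ.tendsto_atTop.eventually (hGp (c₀ / 2) (by positivity))] with k hk
      have a1 := (abs_le.1 (hk (X (σ k)) (h14 (hX _)))).2
      have a2 := hXbig (σ k)
      rw [pow_zero, one_mul] at a2
      linarith
    linarith
  exact exists_edgeZero hcont (fun _ _ => h.plus.nonneg _) isOpen_ball
    (convex_closedBall (0 : ℂ) (1 / 4)).isPreconnected h14'
    (mem_closedBall_self (by norm_num)) hx h0 hpos

/-- Every good disc contains two disjoint good discs of comparable size and level. -/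
theorem Dyn.exists_children {F Fi : ℂ × ℂ → ℂ × ℂ} {D : ℝ} {Gp Gm : ℂ × ℂ → ℝ}
    (h : Dyn F Fi D Gp Gm) : ∃ M : ℕ, ∀ Θ : ℂ → ℂ × ℂ, Good D Gp Gm Θ →
      ∃ (N : Bool → ℕ) (ξ : Bool → ℂ) (r : Bool → ℝ), (∀ b, N b ≤ M ∧ 1 / (M + 1 : ℝ) ≤ r b ∧
        closedBall (ξ b) (r b) ⊆ closedBall 0 1 ∧ GoodFn D (fun x => Gp (Θ x)) (N b) (ξ b) (r b)) ∧
        Disjoint (closedBall (ξ true) (r true)) (closedBall (ξ false) (r false)) := by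
  by_contra! hcon
  choose Θ hΘ hbad using hcon
  obtain ⟨φ, hφ, Θ', hd, -, hGp, ξ, hξ, hedge⟩ := h.good_compact hΘ
  have hg := h.plus.posHarm isOpen_ball hd
  obtain ⟨ξ₁, ξ₂, -, -, hne, t1, t2⟩ := hedge.exists_two_touched hg isOpen_ball one_pos
  have hd0 : 0 < dist ξ₁ ξ₂ := dist_pos.2 hne
  obtain ⟨ρ₁, hρ₁, hρ₁l, hρ₁U, N₁, β₁, hβ₁, k1⟩ :=
    t1.exists_good h.one_lt hg isOpen_ball (ρm := dist ξ₁ ξ₂ / 3) (by positivity)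
  obtain ⟨ρ₂, hρ₂, hρ₂l, hρ₂U, N₂, β₂, hβ₂, k2⟩ :=
    t2.exists_good h.one_lt hg isOpen_ball (ρm := dist ξ₁ ξ₂ / 3) (by positivity)
  have hlarge : ∀ c > 0, ∀ᶠ k in atTop, 1 / ((φ k : ℕ) + 1 : ℝ) ≤ c := fun c hc =>
    (tendsto_one_div_add_atTop_nhds_zero_nat.comp hφ.tendsto_atTop).eventually_le_const hc
  obtain ⟨k, a1, a2, a3, a4, a5, a6⟩ := ((hGp β₁ hβ₁).and ((hGp β₂ hβ₂).and
    ((hφ.tendsto_atTop.eventually_ge_atTop N₁).and ((hφ.tendsto_atTop.eventually_ge_atTop N₂).and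
    ((hlarge (9 / 10 * ρ₁) (by positivity)).and (hlarge (9 / 10 * ρ₂) (by positivity))))))).exists
  have pg := h.plus.posHarm isOpen_ball ((hΘ (φ k)).diff.differentiableOn (s := ball 0 (3 / 4)))
  obtain ⟨x₁, s1, g1⟩ := k1 _ pg fun x hx => a1 x (ball_subset_closedBall (hρ₁U hx))
  obtain ⟨x₂, s2, g2⟩ := k2 _ pg fun x hx => a2 x (ball_subset_closedBall (hρ₂U hx))
  have hin : ball (0 : ℂ) (3 / 4) ⊆ closedBall 0 1 :=
    (ball_subset_ball (by norm_num)).trans ball_subset_closedBall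
  refine hbad (φ k) (fun b => if b then N₁ else N₂) (fun b => if b then x₁ else x₂)
    (fun b => if b then 9 / 10 * ρ₁ else 9 / 10 * ρ₂) ?_ ?_
  · intro b
    cases b
    · exact ⟨a4, a6, (s2.trans hρ₂U).trans hin, g2⟩
    · exact ⟨a3, a5, (s1.trans hρ₁U).trans hin, g1⟩
  · simp only [if_true, Bool.false_eq_true, if_false]
    refine Disjoint.mono s1 s2 (closedBall_disjoint_closedBall ?_)
    linarith

end HenonAux

namespace HenonAux

variable {F Fi : ℂ × ℂ → ℂ × ℂ} {D : ℝ} {Gp Gm : ℂ × ℂ → ℝ} {mu : ℂ} {ψ : ℂ → ℂ × ℂ} {γ c : ℂ → ℂ}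
  {s0 : ℂ} {ρ : ℝ}

lemma Model.Gp_mul (h : Model F Fi D Gp Gm mu ψ γ c s0 ρ) (n : ℕ) (t : ℂ) :
    Gp (ψ (mu ^ n * t)) = D ^ n * Gp (ψ t) := by
  rw [← h.ψ_map, h.dyn.plus.iterate_map]

lemma Model.Gp_ψ_zero (h : Model F Fi D Gp Gm mu ψ γ c s0 ρ) : Gp (ψ 0) = 0 := by
  have := h.Gp_mul 1 0
  simp only [mul_zero, pow_one] at this
  have h1 := h.dyn.one_lt
  by_contra hne
  have := mul_right_cancel₀ hne ((one_mul _).trans this)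
  linarith

lemma Model.exists_edgeZero (h : Model F Fi D Gp Gm mu ψ γ c s0 ρ) :
    ∃ t, EdgeZero (fun t => Gp (ψ t)) univ t := by
  have hc : Continuous fun t => Gp (ψ t) := h.dyn.plus.cont.comp h.ψ_diff.continuous
  have hpos : ∃ t, 0 < Gp (ψ t) := by
    by_contra! hcon
    obtain ⟨R, -, hR⟩ := h.dyn.norm_le_of_Gm 0
    have hb : Bornology.IsBounded (range ψ) := isBounded_iff_forall_norm_le.2
      ⟨R, by rintro _ ⟨t, rfl⟩; exact hR _ (h.Gm_ψ t) (hcon t)⟩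
    exact zero_ne_one (h.ψ_inj (h.ψ_diff.apply_eq_apply_of_bounded hb 0 1))
  obtain ⟨t, ht⟩ := hpos
  obtain ⟨ξ, -, hξ⟩ := HenonAux.exists_edgeZero hc.continuousOn (fun _ _ => h.dyn.plus.nonneg _)
    isOpen_univ isPreconnected_univ subset_rfl (mem_univ 0) (mem_univ t) h.Gp_ψ_zero ht
  exact ⟨ξ, hξ⟩

lemma Model.good (h : Model F Fi D Gp Gm mu ψ γ c s0 ρ) {N : ℕ} {t : ℂ} {δ : ℝ}
    (hg : GoodFn D (fun t => Gp (ψ t)) N t δ) :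
    Good D Gp Gm fun ξ => ψ (mu ^ N * (t + δ * ξ)) where
  diff := h.ψ_diff.comp (by fun_prop)
  Gm_zero ξ := h.Gm_ψ _
  good := by
    have hδ := hg.pos
    have mem : ∀ {x : ℂ} {r : ℝ}, x ∈ closedBall (0 : ℂ) r → t + δ * x ∈ closedBall t (δ * r) :=
      fun {x r} hx => by
        rw [mem_closedBall, dist_eq_norm, add_sub_cancel_left, norm_mul, Complex.norm_real,
          Real.norm_of_nonneg hδ.le]
        exact mul_le_mul_of_nonneg_left (mem_closedBall_zero_iff.1 hx) hδ.le
    refine ⟨one_pos, ?_, fun x hx => ?_, ?_⟩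
    · simp only [mul_zero, add_zero, h.Gp_mul]
      rw [hg.zero, mul_zero]
    · simp only [h.Gp_mul, pow_zero, one_mul]
      exact hg.le_one _ (by simpa using mem hx)
    · obtain ⟨x, hx, hbig⟩ := hg.big
      refine ⟨(x - t) / δ, ?_, ?_⟩
      · rw [mem_closedBall_zero_iff, norm_div, Complex.norm_real, Real.norm_of_nonneg hδ.le,
          div_le_iff₀ hδ, ← dist_eq_norm]
        have := mem_closedBall.1 hx
        linarith
      · have e : t + δ * ((x - t) / δ) = x := by
          rw [mul_div_cancel₀ _ (by exact_mod_cast hδ.ne')]; ring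
        simpa only [h.Gp_mul, pow_zero, one_mul, e] using hbig

lemma Model.goodFn_child (h : Model F Fi D Gp Gm mu ψ γ c s0 ρ) {N : ℕ} {t : ℂ} {δ : ℝ} (hδ : 0 < δ)
    {N' : ℕ} {ξ : ℂ} {r : ℝ} (hg : GoodFn D (fun x => Gp (ψ (mu ^ N * (t + δ * x)))) N' ξ r) :
    GoodFn D (fun t => Gp (ψ t)) (N + N') (t + δ * ξ) (δ * r) := by
  have hδ' : (δ : ℂ) ≠ 0 := by exact_mod_cast hδ.ne'
  have hD0 : D ≠ 0 := (one_pos.trans h.dyn.one_lt).ne'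
  refine ⟨mul_pos hδ hg.pos, ?_, fun x hx => ?_, ?_⟩
  · have := hg.zero
    simp only [h.Gp_mul] at this
    exact (mul_eq_zero.1 this).resolve_left (pow_ne_zero _ hD0)
  · have hx' : (x - t) / δ ∈ closedBall ξ r := by
      rw [mem_closedBall, dist_eq_norm] at hx ⊢
      rw [show (x - t) / δ - ξ = (x - (t + δ * ξ)) / δ by field_simp; ring, norm_div,
        Complex.norm_real, Real.norm_of_nonneg hδ.le, div_le_iff₀ hδ]
      linarith
    have := hg.le_one _ hx'
    simp only [h.Gp_mul] at this
    rw [show t + δ * ((x - t) / δ) = x by rw [mul_div_cancel₀ _ hδ']; ring] at this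
    rw [pow_add]
    linarith
  · obtain ⟨x, hx, hbig⟩ := hg.big
    refine ⟨t + δ * x, ?_, ?_⟩
    · rw [mem_closedBall, dist_eq_norm] at hx ⊢
      rw [show t + δ * x - (t + δ * ξ) = δ * (x - ξ) by ring, norm_mul, Complex.norm_real,
        Real.norm_of_nonneg hδ.le]
      have := mul_le_mul_of_nonneg_left hx hδ.le
      linarith
    · simp only [h.Gp_mul] at hbig
      rw [pow_add]
      linarith

/-- Exponentially many pairwise disjoint good discs of controlled size and level. -/
theorem Model.exists_many (h : Model F Fi D Gp Gm mu ψ γ c s0 ρ) :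
    ∃ (M N₀ : ℕ) (t₀ : ℂ) (δ₀ : ℝ), 0 < δ₀ ∧ ∀ k : ℕ, ∃ (ι : Type) (_ : Fintype ι)
      (N : ι → ℕ) (t : ι → ℂ) (δ : ι → ℝ), Fintype.card ι = 2 ^ k ∧
      (∀ i, GoodFn D (fun t => Gp (ψ t)) (N i) (t i) (δ i) ∧ N i ≤ N₀ + k * M ∧
        δ₀ * (1 / (M + 1 : ℝ)) ^ k ≤ δ i ∧ closedBall (t i) (δ i) ⊆ closedBall t₀ δ₀) ∧
      ∀ i j, i ≠ j → Disjoint (closedBall (t i) (δ i)) (closedBall (t j) (δ j)) := by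
  obtain ⟨M, hM⟩ := h.dyn.exists_children
  have hg := h.dyn.plus.posHarm isOpen_univ h.ψ_diff.differentiableOn
  obtain ⟨z, hz⟩ := h.exists_edgeZero
  obtain ⟨z', -, hz'⟩ := hz.exists_touched hg.cont hg.nonneg isOpen_univ one_pos
  obtain ⟨ρ', hρ', -, -, N₀, β, hβ, hgood⟩ := hz'.exists_good h.dyn.one_lt hg isOpen_univ one_pos
  obtain ⟨t₀, -, ht₀⟩ := hgood _ hg fun x _ => by simpa using hβ.le
  set δ₀ := 9 / 10 * ρ' with hδ₀
  refine ⟨M, N₀, t₀, δ₀, ht₀.pos, fun k => ?_⟩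
  induction k with
  | zero =>
    refine ⟨Unit, inferInstance, fun _ => N₀, fun _ => t₀, fun _ => δ₀, by simp, fun _ => ?_, ?_⟩
    · exact ⟨ht₀, by simp, by simp, subset_rfl⟩
    · intro i j hij
      exact absurd (Subsingleton.elim i j) hij
  | succ k ih =>
    obtain ⟨ι, hι, N, t, δ, hcard, hi, hdisj⟩ := ih
    choose N' ξ r hr hdis using fun i => hM _ (h.good (hi i).1)
    have sub : ∀ i b, closedBall (t i + δ i * ξ i b) (δ i * r i b) ⊆ closedBall (t i) (δ i) := by
      intro i b x hx
      have hδ := (hi i).1.pos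
      have hδ' : (δ i : ℂ) ≠ 0 := by exact_mod_cast hδ.ne'
      have hx' : (x - t i) / δ i ∈ closedBall (ξ i b) (r i b) := by
        rw [mem_closedBall, dist_eq_norm] at hx ⊢
        rw [show (x - t i) / δ i - ξ i b = (x - (t i + δ i * ξ i b)) / δ i by field_simp; ring,
          norm_div, Complex.norm_real, Real.norm_of_nonneg hδ.le, div_le_iff₀ hδ]
        linarith
      have := mem_closedBall_zero_iff.1 ((hr i b).2.2.1 hx')
      rw [norm_div, Complex.norm_real, Real.norm_of_nonneg hδ.le, div_le_one hδ] at this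
      rwa [mem_closedBall, dist_eq_norm]
    refine ⟨ι × Bool, inferInstance, fun p => N p.1 + N' p.1 p.2, fun p => t p.1 + δ p.1 * ξ p.1 p.2,
      fun p => δ p.1 * r p.1 p.2, ?_, fun p => ⟨?_, ?_, ?_, ?_⟩, ?_⟩
    · rw [Fintype.card_prod, hcard, Fintype.card_bool, pow_succ]
    · exact h.goodFn_child (hi p.1).1.pos (hr p.1 p.2).2.2.2
    · have a1 := (hi p.1).2.1
      have a2 := (hr p.1 p.2).1
      show N p.1 + N' p.1 p.2 ≤ N₀ + (k + 1) * M
      rw [add_mul, one_mul]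
      omega
    · rw [pow_succ, ← mul_assoc]
      exact mul_le_mul (hi p.1).2.2.1 (hr p.1 p.2).2.1 (by positivity) (hi p.1).1.pos.le
    · exact (sub _ _).trans (hi p.1).2.2.2
    · rintro ⟨i, b⟩ ⟨j, b'⟩ hne
      by_cases hij : i = j
      · subst hij
        have hb : b ≠ b' := fun e => hne (by rw [e])
        have hδ := (hi i).1.pos
        have hδ' : (δ i : ℂ) ≠ 0 := by exact_mod_cast hδ.ne'
        rw [Set.disjoint_left]
        intro x hx hx'
        have key : ∀ b, x ∈ closedBall (t i + δ i * ξ i b) (δ i * r i b) →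
            (x - t i) / δ i ∈ closedBall (ξ i b) (r i b) := by
          intro b hx
          rw [mem_closedBall, dist_eq_norm] at hx ⊢
          rw [show (x - t i) / δ i - ξ i b = (x - (t i + δ i * ξ i b)) / δ i by field_simp; ring,
            norm_div, Complex.norm_real, Real.norm_of_nonneg hδ.le, div_le_iff₀ hδ]
          linarith
        have k1 := key b hx
        have k2 := key b' hx'
        have d := Set.disjoint_left.1 (hdis i)
        cases b <;> cases b'
        · exact hb rfl
        · exact d k2 k1
        · exact d k1 k2
        · exact hb rfl
      · exact (hdisj i j hij).mono (sub i b) (sub j b')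

end HenonAux

namespace HenonAux

lemma exists_neg_log {f : ℂ → ℂ} {ξ : ℂ} {r : ℝ} (hr : 0 < r) (hf : DifferentiableOn ℂ f (ball ξ r))
    (h0 : ∀ x ∈ ball ξ r, f x ≠ 0) (h1 : ∀ x ∈ ball ξ r, ‖f x‖ < 1) :
    ∃ g : ℂ → ℂ, DifferentiableOn ℂ g (ball ξ r) ∧ (∀ x ∈ ball ξ r, 0 < (g x).re) ∧
      ∀ x ∈ ball ξ r, f x = Complex.exp (-g x) := by
  obtain ⟨G, hG⟩ := ((hf.deriv isOpen_ball).div hf h0).isExactOn_ball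
  have hder : ∀ x ∈ ball ξ r, HasDerivAt (fun x => f x * Complex.exp (-G x)) 0 x := by
    intro x hx
    have a := ((hf x hx).differentiableAt (isOpen_ball.mem_nhds hx)).hasDerivAt.mul (hG x hx).neg.cexp
    refine a.congr_deriv ?_
    simp only [Pi.div_apply]
    field_simp [h0 x hx]
    ring
  obtain ⟨a, ha⟩ := isOpen_ball.exists_is_const_of_deriv_eq_zero (convex_ball ξ r).isPreconnected
    (fun x hx => (hder x hx).differentiableAt.differentiableWithinAt) (fun x hx => (hder x hx).deriv)
  have hξ := mem_ball_self (x := ξ) hr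
  have ha0 : a ≠ 0 := by
    rw [← ha ξ hξ]
    exact mul_ne_zero (h0 ξ hξ) (Complex.exp_ne_zero _)
  have key : ∀ x ∈ ball ξ r, f x = Complex.exp (-(-G x - Complex.log a)) := by
    intro x hx
    rw [neg_sub, sub_neg_eq_add, Complex.exp_add, Complex.exp_log ha0, ← ha x hx, mul_assoc,
      ← Complex.exp_add, neg_add_cancel, Complex.exp_zero, mul_one]
  refine ⟨fun x => -G x - Complex.log a, fun x hx =>
    ((hG x hx).differentiableAt.neg.sub_const _).differentiableWithinAt, fun x hx => ?_, key⟩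
  have := h1 x hx
  rw [key x hx, Complex.norm_exp, Real.exp_lt_one_iff, Complex.neg_re] at this
  linarith

/-- The Schwarz lemma for maps from a disc to the right half plane. -/
lemma norm_sub_le_of_re_pos {g : ℂ → ℂ} {ξ : ℂ} {r : ℝ} (hr : 0 < r)
    (hg : DifferentiableOn ℂ g (ball ξ r)) (h0 : ∀ x ∈ ball ξ r, 0 < (g x).re) {x : ℂ}
    (hx : x ∈ ball ξ r) :
    ‖g x - g ξ‖ ≤ ‖x - ξ‖ / r * ‖g x + (starRingEnd ℂ) (g ξ)‖ := by
  have hξ := mem_ball_self (x := ξ) hr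
  have hne : ∀ x ∈ ball ξ r, g x + (starRingEnd ℂ) (g ξ) ≠ 0 := by
    intro x hx e
    have := congrArg Complex.re e
    simp only [Complex.add_re, Complex.conj_re, Complex.zero_re] at this
    linarith [h0 x hx, h0 ξ hξ]
  have hle : ∀ x ∈ ball ξ r, ‖g x - g ξ‖ ≤ ‖g x + (starRingEnd ℂ) (g ξ)‖ := by
    intro x hx
    refine (sq_le_sq₀ (norm_nonneg _) (norm_nonneg _)).1 ?_
    rw [← Complex.normSq_eq_norm_sq, ← Complex.normSq_eq_norm_sq, Complex.normSq_apply,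
      Complex.normSq_apply]
    simp only [Complex.add_re, Complex.conj_re, Complex.add_im, Complex.conj_im, Complex.sub_re,
      Complex.sub_im]
    nlinarith [mul_pos (h0 x hx) (h0 ξ hξ)]
  have hd : DifferentiableOn ℂ (fun x => (g x - g ξ) / (g x + (starRingEnd ℂ) (g ξ))) (ball ξ r) :=
    (hg.sub_const _).div (hg.add_const _) hne
  have := Complex.dist_le_div_mul_dist_of_mapsTo_ball (R₂ := 1) hd (fun x hx => by
    rw [sub_self, zero_div, mem_closedBall_zero_iff, norm_div]
    exact div_le_one_of_le₀ (hle x hx) (norm_nonneg _)) hx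
  simp only [sub_self, zero_div, dist_zero_right, norm_div] at this
  rw [div_le_iff₀ (norm_pos_iff.2 (hne x hx)), dist_eq_norm] at this
  rwa [one_div_mul_eq_div] at this

/-- Harnack's inequality for `-log ‖f‖`. -/
lemma norm_pow_three_le {f : ℂ → ℂ} {ξ : ℂ} {r : ℝ} (hr : 0 < r) (hf : DifferentiableOn ℂ f (ball ξ r))
    (h0 : ∀ x ∈ ball ξ r, f x ≠ 0) (h1 : ∀ x ∈ ball ξ r, ‖f x‖ < 1) {x : ℂ}
    (hx : x ∈ closedBall ξ (r / 2)) : ‖f x‖ ^ 3 ≤ ‖f ξ‖ := by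
  obtain ⟨g, hg, hre, hfg⟩ := exists_neg_log hr hf h0 h1
  have hx' : x ∈ ball ξ r := closedBall_subset_ball (by linarith) hx
  have hξ := mem_ball_self (x := ξ) hr
  have s := norm_sub_le_of_re_pos hr hg hre hx'
  have hq : ‖x - ξ‖ / r ≤ 1 / 2 := by
    rw [div_le_iff₀ hr, ← dist_eq_norm]
    linarith [mem_closedBall.1 hx]
  have s' : ‖g x - g ξ‖ ≤ 1 / 2 * ‖g x + (starRingEnd ℂ) (g ξ)‖ :=
    s.trans (mul_le_mul_of_nonneg_right hq (norm_nonneg _))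
  have s2 := pow_le_pow_left₀ (norm_nonneg _) s' 2
  rw [mul_pow, ← Complex.normSq_eq_norm_sq, ← Complex.normSq_eq_norm_sq, Complex.normSq_apply,
    Complex.normSq_apply] at s2
  simp only [Complex.add_re, Complex.conj_re, Complex.add_im, Complex.conj_im, Complex.sub_re,
    Complex.sub_im] at s2
  have p1 := hre x hx'
  have p2 := hre ξ hξ
  have : (g ξ).re / 3 ≤ (g x).re := by
    by_contra! hcon
    nlinarith [sq_nonneg ((g x).im - (g ξ).im)]
  rw [hfg x hx', hfg ξ hξ, Complex.norm_exp, Complex.norm_exp, ← Real.exp_nat_mul]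
  refine Real.exp_le_exp.2 ?_
  push_cast
  simp only [Complex.neg_re]
  linarith

/-- The logarithmic derivative of a nonvanishing function of modulus less than one. -/
lemma norm_deriv_le_log {f : ℂ → ℂ} {ξ : ℂ} {r : ℝ} (hr : 0 < r) (hf : DifferentiableOn ℂ f (ball ξ r))
    (h0 : ∀ x ∈ ball ξ r, f x ≠ 0) (h1 : ∀ x ∈ ball ξ r, ‖f x‖ < 1) :
    ‖deriv f ξ‖ ≤ ‖f ξ‖ * (2 / r * -Real.log ‖f ξ‖) := by
  obtain ⟨g, hg, hre, hfg⟩ := exists_neg_log hr hf h0 h1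
  have hξ := mem_ball_self (x := ξ) hr
  have hgd := ((hg ξ hξ).differentiableAt (isOpen_ball.mem_nhds hξ)).hasDerivAt
  have hgn : ‖deriv g ξ‖ ≤ 1 / r * ‖g ξ + (starRingEnd ℂ) (g ξ)‖ := by
    have t1 := (hasDerivAt_iff_tendsto_slope.1 hgd).norm
    have t2 : Tendsto (fun x => 1 / r * ‖g x + (starRingEnd ℂ) (g ξ)‖) (𝓝[≠] ξ)
        (𝓝 (1 / r * ‖g ξ + (starRingEnd ℂ) (g ξ)‖)) :=
      (tendsto_const_nhds.mul (hgd.continuousAt.add_const _).norm).mono_left nhdsWithin_le_nhds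
    refine le_of_tendsto_of_tendsto t1 t2 ?_
    filter_upwards [self_mem_nhdsWithin, nhdsWithin_le_nhds (isOpen_ball.mem_nhds hξ)] with x hx hx'
    have hne : 0 < ‖x - ξ‖ := norm_pos_iff.2 (sub_ne_zero.2 hx)
    rw [slope_def_field, norm_div, div_le_iff₀ hne]
    have := norm_sub_le_of_re_pos hr hg hre hx'
    calc _ ≤ _ := this
      _ = _ := by ring
  have hfd : HasDerivAt f (Complex.exp (-g ξ) * -deriv g ξ) ξ :=
    hgd.neg.cexp.congr_of_eventuallyEq (by
      filter_upwards [isOpen_ball.mem_nhds hξ] with x hx using hfg x hx)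
  rw [hfd.deriv, ← hfg ξ hξ, norm_mul, norm_neg]
  refine mul_le_mul_of_nonneg_left (hgn.trans_eq ?_) (norm_nonneg _)
  have hl : Real.log ‖f ξ‖ = -(g ξ).re := by
    rw [hfg ξ hξ, Complex.norm_exp, Real.log_exp, Complex.neg_re]
  rw [hl, neg_neg, Complex.add_conj, Complex.norm_real, Real.norm_of_nonneg (by linarith [hre ξ hξ])]
  ring

lemma eventually_mul_pow_mul_exp_le {A B Q D : ℝ} (hA : 1 ≤ A) (hB : 1 ≤ B) (hQ : 0 < Q) (hD : 1 < D) :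
    ∀ᶠ m : ℕ in atTop, A * B ^ m * Real.exp (-(D ^ m * Q)) ≤ Real.exp (-(3 * (m : ℝ) ^ 4)) := by
  have t := tendsto_pow_const_div_const_pow_of_one_lt 4 hD
  set c := Real.log A + Real.log B + 3 with hc
  have lA := Real.log_nonneg hA
  have lB := Real.log_nonneg hB
  have hc0 : 0 < c := by linarith
  filter_upwards [t.eventually (ge_mem_nhds (show (0 : ℝ) < Q / c by positivity)),
    eventually_ge_atTop 1] with m hm h1
  have hD0 : 0 < D ^ m := pow_pos (one_pos.trans hD) m
  rw [div_le_div_iff₀ hD0 hc0] at hm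
  have h1' : (1 : ℝ) ≤ m := by exact_mod_cast h1
  have h4 : (m : ℝ) ≤ (m : ℝ) ^ 4 := le_self_pow₀ h1' (by norm_num)
  calc A * B ^ m * Real.exp (-(D ^ m * Q))
      = Real.exp (Real.log A + m * Real.log B + -(D ^ m * Q)) := by
        rw [Real.exp_add, Real.exp_add, Real.exp_log (by linarith), Real.exp_nat_mul,
          Real.exp_log (by linarith)]
    _ ≤ _ := Real.exp_le_exp.2 (by nlinarith)

lemma eventually_mul_pow_mul_exp_sq_le {A B : ℝ} (hA : 1 ≤ A) (hB : 1 ≤ B) :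
    ∀ᶠ m : ℕ in atTop, A * B ^ m * Real.exp (-(m : ℝ) ^ 2) ≤ 1 := by
  have lA := Real.log_nonneg hA
  have lB := Real.log_nonneg hB
  filter_upwards [eventually_ge_atTop ⌈Real.log A + Real.log B⌉₊, eventually_ge_atTop 1] with m hm h1
  have h1' : (1 : ℝ) ≤ m := by exact_mod_cast h1
  have hm' : Real.log A + Real.log B ≤ m := Nat.ceil_le.1 hm
  calc A * B ^ m * Real.exp (-(m : ℝ) ^ 2)
      = Real.exp (Real.log A + m * Real.log B + -(m : ℝ) ^ 2) := by
        rw [Real.exp_add, Real.exp_add, Real.exp_log (by linarith), Real.exp_nat_mul,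
          Real.exp_log (by linarith)]
    _ ≤ 1 := Real.exp_le_one_iff.2 (by nlinarith)

/-- The set where `W` meets the graph of `γ` is open. -/
def GraphOpen (W : ℂ → ℂ × ℂ) (γ : ℂ → ℂ) (U : Set ℂ) : Prop :=
  ∀ x, (W x).1 ∈ U → (W x).2 = γ (W x).1 → ∀ᶠ x' in 𝓝 x, (W x').2 = γ (W x').1

lemma GraphOpen.graph_image {W : ℂ → ℂ × ℂ} {γ : ℂ → ℂ} {U : Set ℂ} (hNI : GraphOpen W γ U)
    (hWd : Differentiable ℂ W) (hγ : DifferentiableOn ℂ γ U) {K : Set ℂ} (hK : K ⊆ U)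
    {L : ℝ} (hL : 1 ≤ L) (hγL : ∀ x ∈ K, ∀ y ∈ K, ‖γ x - γ y‖ ≤ L * ‖x - y‖) {s ξ : ℂ}
    {ω r ε a η : ℝ} (hs : closedBall s ω ⊆ K) (hω : (1 + L) * ω < 1) (hr : 0 < r)
    (hW : ∀ x ∈ ball ξ (2 * r), ‖W x - (s, γ s)‖ ≤ ω) (hε : 0 ≤ ε)
    (hξ : (1 + L) * ‖W ξ - (s, γ s)‖ ≤ ε ^ 3) (ha : ∀ x ∈ sphere ξ r, a ≤ ‖W x - W ξ‖) (hη : 0 < η)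
    (haη : (1 + L) * (4 * η) + 2 * ε ≤ a) :
    (W ξ).1 ∈ K ∧ ∀ σ, ‖σ - (W ξ).1‖ ≤ η → σ ∈ K ∧ ∃ x ∈ closedBall ξ r, ‖(σ, γ σ) - W x‖ ≤ ε := by
  have hξm : ξ ∈ ball ξ (2 * r) := mem_ball_self (by linarith)
  have hsub : closedBall ξ r ⊆ ball ξ (2 * r) := closedBall_subset_ball (by linarith)
  have hmem : ∀ x ∈ ball ξ (2 * r), (W x).1 ∈ K := fun x hx => hs <| by
    rw [mem_closedBall, dist_eq_norm]
    exact (norm_fst_le (W x - (s, γ s))).trans (hW x hx)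
  have hsK : s ∈ K := hs (mem_closedBall_self ((norm_nonneg _).trans (hW ξ hξm)))
  set f : ℂ → ℂ := fun x => (W x).2 - γ (W x).1 with hf
  have hfd : DifferentiableOn ℂ f (ball ξ (2 * r)) := by
    refine hWd.snd.differentiableOn.sub (hγ.comp hWd.fst.differentiableOn fun x hx => hK (hmem x hx))
  have hfle : ∀ x ∈ ball ξ (2 * r), ‖f x‖ ≤ (1 + L) * ‖W x - (s, γ s)‖ := by
    intro x hx
    have e : f x = ((W x).2 - γ s) + (γ s - γ (W x).1) := by simp only [hf]; ring
    have h1 : ‖(W x).2 - γ s‖ ≤ ‖W x - (s, γ s)‖ := norm_snd_le (W x - (s, γ s))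
    have h2 : ‖(W x).1 - s‖ ≤ ‖W x - (s, γ s)‖ := norm_fst_le (W x - (s, γ s))
    have h3 := hγL _ hsK _ (hmem x hx)
    rw [norm_sub_rev s] at h3
    rw [e]
    have h4 := mul_le_mul_of_nonneg_left h2 (by linarith : (0 : ℝ) ≤ L)
    have := norm_add_le ((W x).2 - γ s) (γ s - γ (W x).1)
    linarith
  have hfε : ∀ x ∈ closedBall ξ r, ‖f x‖ ≤ ε := by
    by_cases hz : ∀ x ∈ ball ξ (2 * r), f x ≠ 0
    · intro x hx
      refine le_of_pow_le_pow_left₀ (n := 3) (by norm_num) hε ?_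
      refine (norm_pow_three_le (by linarith) hfd hz (fun x hx => ?_) (by
        rwa [mul_div_cancel_left₀ _ two_ne_zero])).trans ((hfle ξ hξm).trans hξ)
      exact (hfle x hx).trans_lt ((mul_le_mul_of_nonneg_left (hW x hx) (by linarith)).trans_lt hω)
    · push Not at hz
      obtain ⟨x₀, hx₀, hx0⟩ := hz
      have hev := hNI x₀ (hK (hmem x₀ hx₀)) (sub_eq_zero.1 hx0)
      have := (hfd.analyticOnNhd isOpen_ball).eqOn_zero_of_preconnected_of_eventuallyEq_zero
        (convex_ball ξ _).isPreconnected hx₀ (by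
          filter_upwards [hev] with x hx using sub_eq_zero.2 hx)
      intro x hx
      rw [this (hsub hx)]
      simpa using hε
  have hlow : ∀ x ∈ sphere ξ r, 4 * η ≤ ‖(W x).1 - (W ξ).1‖ := by
    intro x hx
    have hx' := sphere_subset_closedBall hx
    have h1 := hfε x hx'
    have h2 := hfε ξ (mem_closedBall_self hr.le)
    have h3 := hγL _ (hmem x (hsub hx')) _ (hmem ξ hξm)
    have h4 : ‖W x - W ξ‖ ≤ (1 + L) * ‖(W x).1 - (W ξ).1‖ + 2 * ε := by
      refine max_le ?_ ?_
      · show ‖(W x).1 - (W ξ).1‖ ≤ _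
        nlinarith [norm_nonneg ((W x).1 - (W ξ).1)]
      · show ‖(W x).2 - (W ξ).2‖ ≤ _
        have e : (W x).2 - (W ξ).2 = (γ (W x).1 - γ (W ξ).1) + (f x - f ξ) := by simp only [hf]; ring
        rw [e]
        have := norm_add_le (γ (W x).1 - γ (W ξ).1) (f x - f ξ)
        have := norm_sub_le (f x) (f ξ)
        linarith [norm_nonneg ((W x).1 - (W ξ).1)]
    have := haη.trans ((ha x hx).trans h4)
    nlinarith
  have hfreq : ∃ᶠ x in 𝓝 ξ, (W x).1 ≠ (W ξ).1 := by
    intro hev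
    simp only [not_not] at hev
    have := (hWd.fst.differentiableOn.analyticOnNhd isOpen_univ).eqOn_of_preconnected_of_eventuallyEq
      (g := fun _ => (W ξ).1) (fun _ _ => analyticAt_const) isPreconnected_univ (mem_univ ξ) hev
    obtain ⟨x, hx⟩ := NormedSpace.sphere_nonempty (E := ℂ) (x := ξ).2 hr.le
    have h1 := hlow x hx
    rw [show (W x).1 = (W ξ).1 from this (mem_univ x), sub_self, norm_zero] at h1
    linarith
  refine ⟨hmem ξ hξm, fun σ hσ => ?_⟩
  obtain ⟨x, hx, hxσ⟩ := DiffContOnCl.ball_subset_image_closedBall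
    (hWd.fst.diffContOnCl (s := ball ξ r)) hr hlow hfreq (show σ ∈ ball (W ξ).1 (4 * η / 2) by
      rw [mem_ball, dist_eq_norm]; linarith)
  subst hxσ
  refine ⟨hmem x (hsub hx), x, hx, max_le (by simpa using hε) ?_⟩
  show ‖γ (W x).1 - (W x).2‖ ≤ ε
  rw [norm_sub_rev]
  exact hfε x hx

end HenonAux

namespace HenonAux

variable {F Fi : ℂ × ℂ → ℂ × ℂ} {D : ℝ} {Gp Gm : ℂ × ℂ → ℝ}

lemma Half.exists_bound (h : Half F D Gp) (R : ℝ) : ∃ B, ∀ x, ‖x‖ ≤ R → Gp x ≤ B := by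
  obtain ⟨B, hB⟩ := (isCompact_closedBall (0 : ℂ × ℂ) R).exists_bound_of_continuousOn
    h.cont.continuousOn
  exact ⟨B, fun x hx => (le_abs_self _).trans (hB x (mem_closedBall_zero_iff.2 hx))⟩

set_option maxHeartbeats 2000000 in
theorem Dyn.exists_graph_disc (h : Dyn F Fi D Gp Gm) {U : Set ℂ} (hU : IsOpen U) {γ : ℂ → ℂ}
    (hγ : DifferentiableOn ℂ γ U) (hΓ : ∀ s ∈ U, Gp (s, γ s) = 0) {s₁ ξ₀ : ℂ} {ρ₁ ρ₂ : ℝ}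
    (hρ₁ : 0 < ρ₁) (hρ₂ : 0 < ρ₂) (hK : closedBall s₁ (2 * ρ₁) ⊆ U) {κ₁ κ₂ : ℂ → ℝ} (hκ₁ : Barrier κ₁)
    (hκ₂ : Barrier κ₂) (hb₁ : ∀ x ∈ sphere s₁ ρ₁, κ₁ x < Gm (x, γ x)) {Lγ LΘ b R Q : ℝ} (hLγ : 1 ≤ Lγ)
    (hγL : ∀ x ∈ closedBall s₁ (2 * ρ₁), ∀ y ∈ closedBall s₁ (2 * ρ₁), ‖γ x - γ y‖ ≤ Lγ * ‖x - y‖)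
    (hLΘ : 1 ≤ LΘ) (hb : 0 < b) (hb1 : b ≤ 1) (hQ : 0 < Q) (hQ₁ : Q ≤ κ₁ s₁ - Gm (s₁, γ s₁)) :
    ∃ m₀, ∀ m, m₀ ≤ m → ∀ Θ : ℂ → ℂ × ℂ, Differentiable ℂ Θ → (∀ ξ, Gm (Θ ξ) = 0) →
      (∀ x ∈ closedBall ξ₀ (2 * ρ₂), ‖Θ x‖ ≤ R) →
      (∀ x ∈ closedBall ξ₀ (2 * ρ₂), ∀ y ∈ closedBall ξ₀ (2 * ρ₂),
        ‖Θ x - Θ y‖ ≤ LΘ * ‖x - y‖ ∧ b * ‖x - y‖ ≤ ‖Θ x - Θ y‖) →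
      (∀ x ∈ sphere ξ₀ ρ₂, κ₂ x < Gp (Θ x)) → Q ≤ κ₂ ξ₀ - Gp (Θ ξ₀) →
      GraphOpen (fun x => F^[2 * m] (Θ x)) γ U →
      ∃ s ∈ closedBall s₁ (2 * ρ₁), ∀ σ, ‖σ - s‖ ≤ Real.exp (-(m : ℝ) ^ 2) →
        σ ∈ closedBall s₁ (2 * ρ₁) ∧ ∃ ξ ∈ closedBall ξ₀ (2 * ρ₂),
          ‖(σ, γ σ) - F^[2 * m] (Θ ξ)‖ ≤ Real.exp (-(m : ℝ) ^ 4) := by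
  obtain ⟨C₁, Λ₀, hΛ₀, hshadow⟩ := h.exists_shadow
  obtain ⟨B₁, hB₁⟩ := h.minus.exists_bound (R + 1)
  obtain ⟨RΓ, hRΓ⟩ := (isCompact_closedBall s₁ (2 * ρ₁)).exists_bound_of_continuousOn
    (f := fun s => (s, γ s)) (continuousOn_id.prodMk (hγ.continuousOn.mono hK))
  obtain ⟨B₂, hB₂⟩ := h.plus.exists_bound (RΓ + 1)
  obtain ⟨Λ₁, hΛ₁, hf⟩ := h.symm.backward_lipschitz B₁
  obtain ⟨Λ₂, hΛ₂, hbk⟩ := h.backward_lipschitz B₂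
  set Λ := max Λ₀ (max Λ₁ Λ₂) with hΛ
  have l0 : Λ₀ ≤ Λ := le_max_left _ _
  have l1 : Λ₁ ≤ Λ := (le_max_left _ _).trans (le_max_right _ _)
  have l2 : Λ₂ ≤ Λ := (le_max_right _ _).trans (le_max_right _ _)
  have hΛ1 : 1 ≤ Λ := hΛ₀.trans l0
  set ω := min ρ₁ (1 / (2 * (1 + Lγ))) with hω
  have hω0 : 0 < ω := lt_min hρ₁ (by positivity)
  have hω1 : (1 + Lγ) * ω ≤ 1 / 2 := by
    calc (1 + Lγ) * ω ≤ (1 + Lγ) * (1 / (2 * (1 + Lγ))) :=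
          mul_le_mul_of_nonneg_left (min_le_right _ _) (by linarith)
      _ = 1 / 2 := by field_simp
  have hωh : ω ≤ 1 / 2 := by nlinarith
  set c := min ρ₂ (ω / (2 * LΘ)) with hc
  have hc0 : 0 < c := lt_min hρ₂ (by positivity)
  have hcL : LΘ * c ≤ ω / 2 := by
    calc LΘ * c ≤ LΘ * (ω / (2 * LΘ)) := mul_le_mul_of_nonneg_left (min_le_right _ _) (by linarith)
      _ = ω / 2 := by field_simp
  have hc1 : c ≤ 1 := by nlinarith
  have hbc : b * c ≤ 1 := by nlinarith
  have r1 := eventually_mul_pow_mul_exp_le (A := 2 * (1 + Lγ) / ω * Real.exp |C₁|) (B := Λ ^ 3)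
    (Q := Q / 2) (D := D) (by
      have : 1 ≤ 2 * (1 + Lγ) / ω := by rw [le_div_iff₀ hω0]; linarith
      have := Real.one_le_exp (abs_nonneg C₁)
      nlinarith) (one_le_pow₀ hΛ1) (by linarith) h.one_lt
  have r2 := eventually_mul_pow_mul_exp_sq_le (A := (4 * (1 + Lγ) + 2) * 2 / (b * c)) (B := Λ ^ 4) (by
    rw [le_div_iff₀ (by positivity)]; linarith) (one_le_pow₀ hΛ1)
  have r3 : ∀ᶠ m : ℕ in atTop, C₁ ≤ D ^ m * Q / 2 := by
    filter_upwards [(tendsto_pow_atTop_atTop_of_one_lt h.one_lt).eventually_ge_atTop (2 * C₁ / Q)]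
      with m hm
    rw [div_le_iff₀ hQ] at hm
    linarith
  obtain ⟨m₀, hm₀⟩ := eventually_atTop.1 (r1.and (r2.and (r3.and (eventually_ge_atTop 1))))
  refine ⟨m₀, fun m hm Θ hΘ hΘm hΘR hΘL hb₂ hQ₂ hNI => ?_⟩
  obtain ⟨e1, e2, e3, e4⟩ := hm₀ m hm
  set P := Λ ^ (2 * m) with hP
  have hP1 : 1 ≤ P := one_le_pow₀ hΛ1
  set δ := Real.exp |C₁| * Λ ^ m * Real.exp (-(D ^ m * (Q / 2))) with hδ
  have hδ0 : 0 < δ := by positivity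
  set ε := Real.exp (-(m : ℝ) ^ 4) with hε
  have hε3 : ε ^ 3 = Real.exp (-(3 * (m : ℝ) ^ 4)) := by
    rw [hε, ← Real.exp_nat_mul]; push_cast; ring_nf
  have hε3' : ε ^ 3 ≤ 1 := by
    rw [hε3]; exact Real.exp_le_one_iff.2 (by have : 0 ≤ (m : ℝ) ^ 4 := by positivity
                                              linarith)
  set η := Real.exp (-(m : ℝ) ^ 2) with hη
  have hεη : ε ≤ η := by
    refine Real.exp_le_exp.2 (neg_le_neg (pow_le_pow_right₀ (by exact_mod_cast e4) (by norm_num)))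
  have e1' : (1 + Lγ) * (P * δ) ≤ ω / 2 * ε ^ 3 := by
    rw [hε3]
    refine le_trans (le_of_eq ?_) (mul_le_mul_of_nonneg_left e1 (by positivity : 0 ≤ ω / 2))
    rw [hδ, hP]
    field_simp
    ring
  have hPδ : P * δ ≤ ω / 2 := by
    have : P * δ ≤ (1 + Lγ) * (P * δ) := le_mul_of_one_le_left (by positivity) (by linarith)
    nlinarith
  have hδ1 : δ ≤ P * δ := le_mul_of_one_le_left hδ0.le hP1
  have hsh : Λ₀ ^ m * Real.exp (C₁ - D ^ m * Q / 2) ≤ δ := by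
    have : Real.exp (C₁ - D ^ m * Q / 2) ≤ Real.exp |C₁| * Real.exp (-(D ^ m * (Q / 2))) := by
      rw [← Real.exp_add]
      refine Real.exp_le_exp.2 ?_
      linarith [le_abs_self C₁]
    calc _ ≤ Λ ^ m * (Real.exp |C₁| * Real.exp (-(D ^ m * (Q / 2)))) :=
          mul_le_mul (pow_le_pow_left₀ (by linarith) l0 m) this (Real.exp_pos _).le (by positivity)
      _ = δ := by rw [hδ]; ring
  obtain ⟨s, hs, ξ, hξ, hclose⟩ := hshadow (Γ := fun s => (s, γ s)) (Θ := Θ) (U₁ := U) (U₂ := univ)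
    hU isOpen_univ (differentiableOn_id.prodMk hγ) hΘ.differentiableOn hΓ (fun ξ _ => hΘm ξ) hρ₁.le
    hρ₂.le ((closedBall_subset_closedBall (by linarith)).trans hK) (subset_univ _) hκ₁ hκ₂ hb₁ hb₂ hQ
    hQ₁ hQ₂ e3 (by linarith)
  replace hclose := hclose.trans hsh
  set X := Fi^[2 * m] (s, γ s) with hX
  have hFX : F^[2 * m] X = (s, γ s) := h.symm.left_inv_iterate (2 * m) _
  have hsK : s ∈ closedBall s₁ (2 * ρ₁) := closedBall_subset_closedBall (by linarith) hs
  have hGX : Gp X = 0 := by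
    have := h.plus.iterate_map (2 * m) X
    rw [hFX, hΓ s (hK hsK)] at this
    exact (mul_eq_zero.1 this.symm).resolve_left (pow_ne_zero _ (by linarith [h.one_lt]))
  have hsub : closedBall ξ ρ₂ ⊆ closedBall ξ₀ (2 * ρ₂) := by
    refine closedBall_subset_closedBall' ?_
    linarith [mem_closedBall.1 hξ]
  have hξ2 := hsub (mem_closedBall_self hρ₂.le)
  have hGmX : Gm X ≤ B₁ := hB₁ X <| by
    have := norm_add_le (X - Θ ξ) (Θ ξ)
    rw [sub_add_cancel] at this
    linarith [hΘR ξ hξ2]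
  have hr2 : 2 * (c / (2 * P)) = c / P := by field_simp
  have hcP : c / P ≤ c := div_le_self hc0.le hP1
  have hW : ∀ x ∈ closedBall ξ ρ₂, LΘ * ‖x - ξ‖ + δ ≤ ω / P →
      ‖F^[2 * m] (Θ x) - (s, γ s)‖ ≤ P * (LΘ * ‖x - ξ‖ + δ) := by
    intro x hx hxω
    have a1 : ‖Θ x - X‖ ≤ LΘ * ‖x - ξ‖ + δ := by
      have := norm_add_le (Θ x - Θ ξ) (Θ ξ - X)
      rw [sub_add_sub_cancel, norm_sub_rev (Θ ξ)] at this
      linarith [(hΘL x (hsub hx) ξ hξ2).1]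
    have a2 : Λ₁ ^ (2 * m) * ‖Θ x - X‖ ≤ P * (LΘ * ‖x - ξ‖ + δ) :=
      mul_le_mul (pow_le_pow_left₀ (by linarith) l1 _) a1 (norm_nonneg _) (by linarith)
    have a3 : P * (LΘ * ‖x - ξ‖ + δ) ≤ ω := by
      rwa [le_div_iff₀ (by linarith), mul_comm] at hxω
    have := hf (Θ x) X (2 * m) hGX hGmX (by linarith)
    rw [hFX] at this
    exact this.trans a2
  have hWd : Differentiable ℂ fun x => F^[2 * m] (Θ x) := (h.diff.iterate _).comp hΘ
  have hbase : ‖F^[2 * m] (Θ ξ) - (s, γ s)‖ ≤ P * δ := by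
    have := hW ξ (mem_closedBall_self hρ₂.le) (by
      rw [sub_self, norm_zero, mul_zero, zero_add, le_div_iff₀ (by linarith)]; linarith)
    simpa using this
  obtain ⟨g1, g2⟩ := hNI.graph_image (K := closedBall s₁ (2 * ρ₁)) (s := s) (ξ := ξ) (ω := ω)
    (r := c / (2 * P)) (ε := ε) (a := b * (c / (2 * P)) / P) (η := η) hWd hγ hK hLγ hγL
    (closedBall_subset_closedBall' (by
      have := mem_closedBall.1 hs
      have : ω ≤ ρ₁ := min_le_left _ _
      linarith)) (by linarith) (by positivity)
    (fun x hx => by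
      rw [hr2, mem_ball, dist_eq_norm] at hx
      have a1 : LΘ * ‖x - ξ‖ ≤ ω / 2 / P := by
        rw [le_div_iff₀ (by linarith)]
        rw [lt_div_iff₀ (by linarith)] at hx
        nlinarith
      have a2 : δ ≤ ω / 2 / P := by rw [le_div_iff₀ (by linarith)]; linarith
      have a3 : LΘ * ‖x - ξ‖ + δ ≤ ω / P := by
        calc _ ≤ ω / 2 / P + ω / 2 / P := add_le_add a1 a2
          _ = _ := by ring
      refine (hW x ?_ a3).trans ?_
      · rw [mem_closedBall, dist_eq_norm]
        have : c ≤ ρ₂ := min_le_left _ _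
        linarith
      · rwa [le_div_iff₀ (by linarith), mul_comm] at a3)
    (Real.exp_pos _).le ((mul_le_mul_of_nonneg_left hbase (by linarith)).trans (by
      have : 0 < ε ^ 3 := by positivity
      nlinarith))
    (fun x hx => by
      have hxr : ‖x - ξ‖ = c / (2 * P) := by rw [← dist_eq_norm]; exact hx
      have hcP2 : c / (2 * P) ≤ c / P := by rw [← hr2]; linarith [div_pos hc0 (by linarith : 0 < 2 * P)]
      have hcρ : c ≤ ρ₂ := min_le_left _ _
      have hx2 : x ∈ closedBall ξ₀ (2 * ρ₂) := hsub (by rw [mem_closedBall, dist_eq_norm]; linarith)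
      have hlow := (hΘL x hx2 ξ hξ2).2
      rw [hxr] at hlow
      rw [div_le_iff₀ (by linarith)]
      by_cases hsmall : Λ₂ ^ (2 * m) * ‖F^[2 * m] (Θ x) - F^[2 * m] (Θ ξ)‖ ≤ 1
      · have := hbk (F^[2 * m] (Θ x)) (F^[2 * m] (Θ ξ)) (2 * m) (by
          have := h.Gm_iterate (2 * m) (Θ ξ)
          rw [hΘm] at this
          exact (mul_eq_zero.1 this).resolve_left (pow_ne_zero _ (by linarith [h.one_lt])))
          (hB₂ _ (by
            have n1 := norm_add_le (F^[2 * m] (Θ ξ) - (s, γ s)) (s, γ s)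
            rw [sub_add_cancel] at n1
            have n2 : ‖((s, γ s) : ℂ × ℂ)‖ ≤ RΓ := hRΓ s hsK
            linarith)) hsmall
        rw [h.left_inv_iterate, h.left_inv_iterate] at this
        refine hlow.trans (this.trans ?_)
        rw [mul_comm]
        exact mul_le_mul_of_nonneg_left (pow_le_pow_left₀ (by linarith) l2 _) (norm_nonneg _)
      · push Not at hsmall
        have n1 : Λ₂ ^ (2 * m) * ‖F^[2 * m] (Θ x) - F^[2 * m] (Θ ξ)‖ ≤
            P * ‖F^[2 * m] (Θ x) - F^[2 * m] (Θ ξ)‖ :=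
          mul_le_mul_of_nonneg_right (pow_le_pow_left₀ (by linarith) l2 _) (norm_nonneg _)
        have : b * (c / (2 * P)) ≤ 1 := by nlinarith [div_pos hc0 (by linarith : 0 < 2 * P)]
        linarith) (Real.exp_pos _) (by
      have hη0 : 0 < η := Real.exp_pos _
      have hPP : (Λ ^ 4) ^ m = P * P := by rw [hP]; ring
      have e2' : (4 * (1 + Lγ) + 2) * η * (2 * (P * P)) ≤ b * c := by
        have h0 : (4 * (1 + Lγ) + 2) * 2 / (b * c) * (Λ ^ 4) ^ m * η =
          (4 * (1 + Lγ) + 2) * η * (2 * (P * P)) / (b * c) := by rw [hPP]; ring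
        have := h0 ▸ e2
        rwa [div_le_one (by positivity)] at this
      calc (1 + Lγ) * (4 * η) + 2 * ε ≤ (4 * (1 + Lγ) + 2) * η := by linarith
        _ ≤ b * c / (2 * (P * P)) := by rwa [le_div_iff₀ (by positivity)]
        _ = b * (c / (2 * P)) / P := by field_simp)
  refine ⟨_, g1, fun σ hσ => ?_⟩
  obtain ⟨k1, x, hx, k2⟩ := g2 σ hσ
  refine ⟨k1, x, hsub (closedBall_subset_closedBall ?_ hx), k2⟩
  have hcP2 : c / (2 * P) ≤ c / P := by rw [← hr2]; linarith [div_pos hc0 (by linarith : 0 < 2 * P)]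
  have hcρ : c ≤ ρ₂ := min_le_left _ _
  linarith

end HenonAux

namespace HenonAux

variable {F Fi : ℂ × ℂ → ℂ × ℂ} {D : ℝ} {Gp Gm : ℂ × ℂ → ℝ}

lemma EdgeZero.exists_touched_deriv_ne_zero {G : ℂ × ℂ → ℝ} (hG : Half F D G) {Θ : ℂ → ℂ × ℂ}
    {U : Set ℂ} (hU : IsOpen U) (hΘ : DifferentiableOn ℂ Θ U) {ξ : ℂ}
    (h : EdgeZero (fun x => G (Θ x)) U ξ) {ρ : ℝ} (hρ : 0 < ρ) :
    ∃ ξ', dist ξ' ξ < ρ ∧ Touched (fun x => G (Θ x)) U ξ' ∧ deriv Θ ξ' ≠ 0 := by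
  have hg := hG.posHarm hU hΘ
  have han := (hΘ.analyticAt (hU.mem_nhds h.1)).deriv
  rcases han.eventually_eq_zero_or_eventually_ne_zero with h0 | h0
  · obtain ⟨r, hr, hball⟩ := Metric.eventually_nhds_iff_ball.1 (h0.and (hU.mem_nhds h.1))
    obtain ⟨a, ha⟩ := isOpen_ball.exists_is_const_of_deriv_eq_zero (convex_ball ξ r).isPreconnected
      (hΘ.mono fun x hx => (hball x hx).2) fun x hx => (hball x hx).1
    obtain ⟨x, ⟨-, hx⟩, hd⟩ := Metric.mem_closure_iff.1 h.2.2 r hr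
    have h1 : G (Θ x) = 0 := by
      rw [ha x (by rwa [mem_ball, dist_comm]), ← ha ξ (mem_ball_self hr)]
      exact h.2.1
    exact absurd h1 (show 0 < G (Θ x) from hx).ne'
  · obtain ⟨r, hr, hball⟩ := Metric.mem_nhdsWithin_iff.1 h0
    obtain ⟨ξ₁, ξ₂, h1, h2, hne, t1, t2⟩ := h.exists_two_touched hg hU (lt_min hρ hr)
    by_cases hc : ξ₁ = ξ
    · refine ⟨ξ₂, h2.trans_le (min_le_left _ _), t2, hball ⟨h2.trans_le (min_le_right _ _), ?_⟩⟩
      rintro rfl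
      exact hne hc
    · exact ⟨ξ₁, h1.trans_le (min_le_left _ _), t1, hball ⟨h1.trans_le (min_le_right _ _), hc⟩⟩

lemma exists_antilip {Θ : ℂ → ℂ × ℂ} {ξ : ℂ} (h : AnalyticAt ℂ Θ ξ) :
    ∃ r > 0, ∀ x ∈ ball ξ r, ∀ y ∈ ball ξ r, ‖deriv Θ ξ‖ / 2 * ‖x - y‖ ≤ ‖Θ x - Θ y‖ := by
  by_cases hv : deriv Θ ξ = 0
  · exact ⟨1, one_pos, fun x _ y _ => by simp [hv]⟩
  have hs := h.hasStrictDerivAt.hasStrictFDerivAt.isLittleO.def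
    (half_pos (norm_pos_iff.2 hv))
  obtain ⟨r, hr, hball⟩ := Metric.eventually_nhds_iff_ball.1 hs
  refine ⟨r, hr, fun x hx y hy => ?_⟩
  have := hball (x, y) (by rw [← ball_prod_same]; exact ⟨hx, hy⟩)
  simp only [ContinuousLinearMap.toSpanSingleton_apply] at this
  have n := norm_sub_norm_le ((x - y) • deriv Θ ξ) ((x - y) • deriv Θ ξ - (Θ x - Θ y))
  rw [sub_sub_cancel, norm_sub_rev _ (Θ x - Θ y), norm_smul] at n
  linarith

theorem Dyn.exists_graph_disc_of_good (h : Dyn F Fi D Gp Gm) {U : Set ℂ} (hU : IsOpen U) {γ : ℂ → ℂ}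
    (hγ : DifferentiableOn ℂ γ U) (hΓ : ∀ s ∈ U, Gp (s, γ s) = 0) {s₀ : ℂ}
    (hs₀ : EdgeZero (fun s => Gm (s, γ s)) U s₀) :
    ∃ K ⊆ U, IsCompact K ∧ ∃ m₀, ∀ m, m₀ ≤ m → ∀ Θ : ℂ → ℂ × ℂ, Good D Gp Gm Θ →
      GraphOpen (fun x => F^[2 * m] (Θ x)) γ U →
      ∃ s ∈ K, ∀ σ, ‖σ - s‖ ≤ Real.exp (-(m : ℝ) ^ 2) →
        σ ∈ K ∧ ∃ ξ ∈ closedBall (0 : ℂ) (1 / 2),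
          ‖(σ, γ σ) - F^[2 * m] (Θ ξ)‖ ≤ Real.exp (-(m : ℝ) ^ 4) := by
  have hΓd : DifferentiableOn ℂ (fun s => (s, γ s)) U := differentiableOn_id.prodMk hγ
  have hpos := h.minus.posHarm hU hΓd
  obtain ⟨s₁, -, hs₁⟩ := hs₀.exists_touched hpos.cont hpos.nonneg hU one_pos
  obtain ⟨ρ₀, hρ₀, hbar⟩ := hs₁.barrier hpos hU
  set ρ₁ := ρ₀ / 4 with hρ₁
  have hρ₁0 : 0 < ρ₁ := by positivity
  obtain ⟨-, κ₁, hκ₁, hκ₁0, hκ₁s⟩ := hbar ρ₁ hρ₁0 (by linarith)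
  have hK3 := (hbar (3 * ρ₁) (by linarith) (by linarith)).1
  have hK : closedBall s₁ (2 * ρ₁) ⊆ U := (closedBall_subset_closedBall (by linarith)).trans hK3
  obtain ⟨Bγ, hBγ⟩ := (isCompact_closedBall s₁ (3 * ρ₁)).exists_bound_of_continuousOn
    (hγ.continuousOn.mono hK3)
  obtain ⟨R, hR0, hR⟩ := h.norm_le_of_Gm 1
  refine ⟨_, hK, isCompact_closedBall _ _, ?_⟩
  by_contra! hcon
  choose m hm Θ hG hO hbad using hcon
  obtain ⟨φ, hφ, Θ', hd, hunif, hGp, ξe, hξe, hedge⟩ := h.good_compact hG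
  obtain ⟨ξ₀, hξ₀, ht, hv⟩ := hedge.exists_touched_deriv_ne_zero h.plus isOpen_ball hd
    (show (0 : ℝ) < 1 / 8 by norm_num)
  have hξ₀n : dist ξ₀ 0 < 3 / 8 := by
    have := dist_triangle ξ₀ ξe 0
    linarith [mem_closedBall.1 hξe]
  obtain ⟨r, hr, hanti⟩ := exists_antilip (hd.analyticAt (isOpen_ball.mem_nhds ht.1))
  obtain ⟨ρ₀', hρ₀', hbar'⟩ := ht.barrier (h.plus.posHarm isOpen_ball hd) isOpen_ball
  set ρ₂ := min (ρ₀' / 2) (min (1 / 24) (r / 4)) with hρ₂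
  have hρ₂0 : 0 < ρ₂ := by positivity
  have hρ₂1 : ρ₂ ≤ 1 / 24 := (min_le_right _ _).trans (min_le_left _ _)
  have hρ₂r : ρ₂ ≤ r / 4 := (min_le_right _ _).trans (min_le_right _ _)
  have hρ₂' : ρ₂ < ρ₀' := (min_le_left _ _).trans_lt (by linarith)
  obtain ⟨hb34, κ₂, hκ₂, hκ₂0, hκ₂s⟩ := hbar' ρ₂ hρ₂0 hρ₂'
  have hin : closedBall ξ₀ (2 * ρ₂) ⊆ closedBall 0 (1 / 2) :=
    closedBall_subset_closedBall' (by linarith)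
  have hin34 : ball ξ₀ (3 * ρ₂) ⊆ closedBall 0 (3 / 4) :=
    ball_subset_closedBall.trans (closedBall_subset_closedBall' (by linarith))
  set Q := min (κ₁ s₁) (κ₂ ξ₀ / 2) with hQ
  have hQ0 : 0 < Q := lt_min hκ₁0 (by linarith)
  have hv0 : 0 < ‖deriv Θ' ξ₀‖ := norm_pos_iff.2 hv
  obtain ⟨β, hβ, hβs⟩ : ∃ β > 0, ∀ x ∈ sphere ξ₀ ρ₂, κ₂ x + 2 * β ≤ Gp (Θ' x) := by
    have hcont : ContinuousOn (fun x => Gp (Θ' x) - κ₂ x) (sphere ξ₀ ρ₂) :=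
      (h.plus.cont.comp_continuousOn (hd.continuousOn.mono
        (sphere_subset_closedBall.trans hb34))).sub hκ₂.1.continuousOn
    obtain ⟨x₀, hx₀, hmin⟩ := (isCompact_sphere ξ₀ ρ₂).exists_isMinOn
      (NormedSpace.sphere_nonempty.2 hρ₂0.le) hcont
    have hp := hκ₂s x₀ hx₀
    refine ⟨(Gp (Θ' x₀) - κ₂ x₀) / 2, by linarith, fun x hx => ?_⟩
    have : Gp (Θ' x₀) - κ₂ x₀ ≤ Gp (Θ' x) - κ₂ x := hmin hx
    linarith
  obtain ⟨m₀, hm₀⟩ := h.exists_graph_disc (R := R) (Lγ := max 1 (Bγ / (ρ₁ / 2)))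
    (LΘ := max 1 (R / ((1 - 1 / 2) / 2))) (b := min 1 (‖deriv Θ' ξ₀‖ / 4)) (Q := Q) hU hγ hΓ hρ₁0 hρ₂0
    hK hκ₁ hκ₂ hκ₁s (le_max_left _ _)
    (fun x hx y hy => by
      have := lip_of_bounded (hγ.mono (ball_subset_closedBall.trans hK3))
        (fun w hw => hBγ w (ball_subset_closedBall hw)) (show 2 * ρ₁ < 3 * ρ₁ by linarith) hx hy
      refine this.trans (mul_le_mul_of_nonneg_right ?_ (norm_nonneg _))
      rw [show 3 * ρ₁ - 2 * ρ₁ = ρ₁ by ring]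
      exact le_max_right _ _)
    (le_max_left _ _) (by positivity) (min_le_left _ _) hQ0 (by
      have : Gm (s₁, γ s₁) = 0 := hs₁.2.1
      rw [this, sub_zero]
      exact min_le_left _ _)
  have ev1 := Metric.tendstoUniformlyOn_iff.1 hunif (‖deriv Θ' ξ₀‖ * ρ₂ / 8) (by positivity)
  have ev2 := hGp β hβ
  have ev3 := hGp (κ₂ ξ₀ / 2) (by linarith)
  obtain ⟨k, k1, k2, k3, k4⟩ := (ev1.and (ev2.and (ev3.and (eventually_ge_atTop m₀)))).exists
  have hξ₀34 : ξ₀ ∈ closedBall (0 : ℂ) (3 / 4) := ball_subset_closedBall ht.1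
  have hΘR : ∀ x ∈ ball (0 : ℂ) 1, ‖Θ (φ k) x‖ ≤ R := fun x hx =>
    hR _ ((hG _).Gm_zero x) ((hG _).le_one (ball_subset_closedBall hx))
  have hup : ∀ x ∈ closedBall ξ₀ (2 * ρ₂), ∀ y ∈ closedBall ξ₀ (2 * ρ₂),
      ‖Θ (φ k) x - Θ (φ k) y‖ ≤ max 1 (R / ((1 - 1 / 2) / 2)) * ‖x - y‖ ∧
        min 1 (‖deriv Θ' ξ₀‖ / 4) * ‖x - y‖ ≤ ‖Θ (φ k) x - Θ (φ k) y‖ := by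
    intro x hx y hy
    refine ⟨?_, ?_⟩
    · exact (lip_of_bounded (hG (φ k)).diff.differentiableOn hΘR (by norm_num) (hin hx) (hin hy)).trans
        (mul_le_mul_of_nonneg_right (le_max_right _ _) (norm_nonneg _))
    · have a1 := hanti x (closedBall_subset_ball (by linarith) hx) y (closedBall_subset_ball (by linarith) hy)
      have a2 := lip_of_bounded (f := fun x => Θ' x - Θ (φ k) x) (z := ξ₀) (R := 3 * ρ₂) (r := 2 * ρ₂)
        (B := ‖deriv Θ' ξ₀‖ * ρ₂ / 8)
        ((hd.mono fun w hw => by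
          have := mem_ball.1 hw
          have := dist_triangle w ξ₀ 0
          rw [mem_ball]; linarith).sub (hG (φ k)).diff.differentiableOn)
        (fun w hw => by
          rw [← dist_eq_norm]
          exact (k1 w (hin34 hw)).le) (by linarith) hx hy
      rw [show ‖deriv Θ' ξ₀‖ * ρ₂ / 8 / ((3 * ρ₂ - 2 * ρ₂) / 2) = ‖deriv Θ' ξ₀‖ / 4 by
        rw [show 3 * ρ₂ - 2 * ρ₂ = ρ₂ by ring]; field_simp; norm_num] at a2
      have a3 := norm_sub_norm_le (Θ' x - Θ' y) (Θ' x - Θ (φ k) x - (Θ' y - Θ (φ k) y))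
      rw [show Θ' x - Θ' y - (Θ' x - Θ (φ k) x - (Θ' y - Θ (φ k) y)) = Θ (φ k) x - Θ (φ k) y by abel] at a3
      have a4 := mul_le_mul_of_nonneg_right (min_le_right 1 (‖deriv Θ' ξ₀‖ / 4)) (norm_nonneg (x - y))
      linarith
  have hb₂ : ∀ x ∈ sphere ξ₀ ρ₂, κ₂ x < Gp (Θ (φ k) x) := by
    intro x hx
    have := hβs x hx
    have := (abs_le.1 (k2 x (ball_subset_closedBall (hb34 (sphere_subset_closedBall hx))))).1
    linarith
  have hQ₂ : Q ≤ κ₂ ξ₀ - Gp (Θ (φ k) ξ₀) := by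
    have h0 : Gp (Θ' ξ₀) = 0 := ht.2.1
    have := (abs_le.1 (k3 ξ₀ hξ₀34)).2
    rw [h0] at this
    have : Q ≤ κ₂ ξ₀ / 2 := min_le_right _ _
    linarith
  obtain ⟨s, hs, hσ⟩ := hm₀ (m (φ k)) (k4.trans (hφ.le_apply.trans (hm _))) (Θ (φ k)) (hG _).diff
    (hG _).Gm_zero (fun x hx => hΘR x (closedBall_subset_ball (by norm_num) (hin hx))) hup hb₂ hQ₂ (hO _)
  obtain ⟨σ, hσ1, hσ2⟩ := hbad (φ k) s hs
  obtain ⟨hσK, ξ, hξ, hle⟩ := hσ σ hσ1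
  exact absurd hle (not_le.2 (hσ2 hσK ξ (hin hξ)))

end HenonAux

namespace HenonAux

variable {F Fi : ℂ × ℂ → ℂ × ℂ} {D : ℝ} {Gp Gm : ℂ × ℂ → ℝ} {mu : ℂ} {ψ : ℂ → ℂ × ℂ} {γ c : ℂ → ℂ}
  {s0 : ℂ} {ρ : ℝ}

lemma eventually_mul_pow_mul_exp_lt {A B : ℝ} (hA : 1 ≤ A) (hB : 1 ≤ B) :
    ∀ᶠ m : ℕ in atTop, A * B ^ m ^ 3 * Real.exp (-(m : ℝ) ^ 4) < 1 := by
  have lA := Real.log_nonneg hA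
  have lB := Real.log_nonneg hB
  filter_upwards [eventually_gt_atTop ⌈Real.log A + Real.log B⌉₊, eventually_ge_atTop 1] with m hm h1
  have h1' : (1 : ℝ) ≤ m := by exact_mod_cast h1
  have hm' : Real.log A + Real.log B < m := Nat.lt_of_ceil_lt hm
  have h3 : (1 : ℝ) ≤ (m : ℝ) ^ 3 := one_le_pow₀ h1'
  calc A * B ^ m ^ 3 * Real.exp (-(m : ℝ) ^ 4)
      = Real.exp (Real.log A + (m : ℝ) ^ 3 * Real.log B + -(m : ℝ) ^ 4) := by
        rw [Real.exp_add, Real.exp_add, Real.exp_log (by linarith), ← Nat.cast_pow m 3, Real.exp_nat_mul,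
          Real.exp_log (by linarith)]
    _ < 1 := Real.exp_lt_one_iff.2 (by nlinarith)

lemma eventually_card_lt (A N₀ M : ℕ) : ∀ᶠ m : ℕ in atTop,
    (2 * ⌈(A : ℝ) * (2 * Real.exp ((m : ℝ) ^ 2))⌉₊ + 1) ^ 2 * (N₀ + m ^ 3 * M + 1) < 2 ^ m ^ 3 := by
  set C : ℝ := (4 * A + 3) ^ 2 * (6 * (N₀ + M + 1)) with hC
  have hC1 : 1 ≤ C := by
    have : (1 : ℝ) ≤ (4 * A + 3) ^ 2 := one_le_pow₀ (by have := A.cast_nonneg (α := ℝ); linarith)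
    have : (1 : ℝ) ≤ 6 * (N₀ + M + 1) := by
      have := N₀.cast_nonneg (α := ℝ)
      have := M.cast_nonneg (α := ℝ)
      linarith
    nlinarith
  have lC := Real.log_nonneg hC1
  filter_upwards [eventually_ge_atTop ⌈2 * Real.log C + 8⌉₊] with m hm
  have hm' : 2 * Real.log C + 8 ≤ m := Nat.ceil_le.1 hm
  have h1 : (1 : ℝ) ≤ m := by linarith
  set E := Real.exp ((m : ℝ) ^ 2) with hE
  have hE1 : 1 ≤ E := Real.one_le_exp (by positivity)
  have hm3 : (m : ℝ) ^ 3 ≤ 6 * E := by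
    have := Real.pow_div_factorial_le_exp (m : ℝ) (by linarith) 3
    have h2 : Real.exp m ≤ E := Real.exp_le_exp.2 (by nlinarith)
    rw [show ((Nat.factorial 3 : ℕ) : ℝ) = 6 by norm_num [Nat.factorial]] at this
    linarith
  have hA0 := A.cast_nonneg (α := ℝ)
  have hN0 := N₀.cast_nonneg (α := ℝ)
  have hM0 := M.cast_nonneg (α := ℝ)
  have hceil := (Nat.ceil_lt_add_one (show 0 ≤ (A : ℝ) * (2 * E) by positivity)).le
  have b1 : (2 * ⌈(A : ℝ) * (2 * E)⌉₊ + 1 : ℝ) ≤ (4 * A + 3) * E := by nlinarith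
  have b2 : (N₀ + (m : ℝ) ^ 3 * M + 1 : ℝ) ≤ 6 * (N₀ + M + 1) * E := by
    nlinarith [mul_le_mul_of_nonneg_right hm3 hM0]
  have key : ((2 * ⌈(A : ℝ) * (2 * E)⌉₊ + 1 : ℝ)) ^ 2 * (N₀ + (m : ℝ) ^ 3 * M + 1) < 2 ^ m ^ 3 := by
    calc _ ≤ ((4 * A + 3) * E) ^ 2 * (6 * (N₀ + M + 1) * E) :=
          mul_le_mul (pow_le_pow_left₀ (by positivity) b1 2) b2 (by positivity) (by positivity)
      _ = C * E ^ 3 := by rw [hC]; ring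
      _ = Real.exp (Real.log C + 3 * (m : ℝ) ^ 2) := by
          rw [Real.exp_add, Real.exp_log (by linarith), hE, ← Real.exp_nat_mul]; norm_num
      _ < Real.exp ((m : ℝ) ^ 3 * Real.log 2) := by
          refine Real.exp_lt_exp.2 ?_
          have l2 := Real.log_two_gt_d9
          have h3 : (0 : ℝ) < (m : ℝ) ^ 3 := by positivity
          have : Real.log C + 3 * (m : ℝ) ^ 2 < (m : ℝ) ^ 3 * (1 / 2) := by
            have : (m : ℝ) / 2 - 3 ≤ (m : ℝ) ^ 2 * ((m : ℝ) / 2 - 3) :=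
              le_mul_of_one_le_left (by linarith) (one_le_pow₀ h1)
            nlinarith
          nlinarith
      _ = 2 ^ m ^ 3 := by
          rw [← Nat.cast_pow, Real.exp_nat_mul, Real.exp_log (by norm_num)]
  exact_mod_cast key

lemma norm_sub_le_of_floor_eq {E : ℝ} (hE : 0 < E) {s s' : ℂ} (h1 : ⌊s.re * (2 * E)⌋ = ⌊s'.re * (2 * E)⌋)
    (h2 : ⌊s.im * (2 * E)⌋ = ⌊s'.im * (2 * E)⌋) : ‖s - s'‖ ≤ E⁻¹ := by
  have e1 := Int.abs_sub_lt_one_of_floor_eq_floor h1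
  have e2 := Int.abs_sub_lt_one_of_floor_eq_floor h2
  rw [← sub_mul, abs_mul, abs_of_pos (by linarith : 0 < 2 * E)] at e1 e2
  have := Complex.norm_le_abs_re_add_abs_im (s - s')
  rw [Complex.sub_re, Complex.sub_im] at this
  rw [← one_div, le_div_iff₀ hE]
  nlinarith

lemma floor_mem_Icc {A : ℕ} {E x : ℝ} (hE : 0 < E) (hx : |x| ≤ A) :
    ⌊x * (2 * E)⌋ ∈ Finset.Icc (-(⌈(A : ℝ) * (2 * E)⌉₊ : ℤ)) ⌈(A : ℝ) * (2 * E)⌉₊ := by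
  have h1 : |x * (2 * E)| ≤ A * (2 * E) := by
    rw [abs_mul, abs_of_pos (by linarith : 0 < 2 * E)]
    exact mul_le_mul_of_nonneg_right hx (by linarith)
  have h2 := Nat.le_ceil ((A : ℝ) * (2 * E))
  obtain ⟨h3, h4⟩ := abs_le.1 h1
  rw [Finset.mem_Icc]
  refine ⟨Int.le_floor.2 ?_, ?_⟩
  · push_cast; linarith
  · have : (⌊x * (2 * E)⌋ : ℝ) ≤ ⌈(A : ℝ) * (2 * E)⌉₊ := (Int.floor_le _).trans (by linarith)
    exact_mod_cast this

/-- Points of `ψ` at macroscopic distance cannot be exponentially close after `n` steps. -/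
lemma Model.antilip (h : Model F Fi D Gp Gm mu ψ γ c s0 ρ) (B A : ℝ) :
    ∃ (n₀ : ℕ) (Λ : ℝ), 1 ≤ Λ ∧ ∀ (n : ℕ) (a b : ℂ), ‖a‖ ≤ A → ‖b‖ ≤ A → Gp (ψ (mu ^ n * b)) ≤ B →
      Λ ^ (n + n₀) * ‖ψ (mu ^ n * a) - ψ (mu ^ n * b)‖ ≤ 1 →
      1 / (2 * ‖mu‖ ^ n₀) * ‖a - b‖ ≤ Λ ^ (n + n₀) * ‖ψ (mu ^ n * a) - ψ (mu ^ n * b)‖ := by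
  obtain ⟨Λ, hΛ, hbk⟩ := h.dyn.backward_lipschitz B
  obtain ⟨δ, hδ, hanti⟩ := h.ψ_antilip
  obtain ⟨n₀, hn₀⟩ := ((tendsto_pow_atTop_atTop_of_one_lt h.mu_gt).eventually_ge_atTop (A / δ)).exists
  have hmu : mu ≠ 0 := norm_pos_iff.1 (by linarith [h.mu_gt])
  have hmn : 0 < ‖mu‖ ^ n₀ := by have := h.mu_gt; positivity
  refine ⟨n₀, Λ, hΛ, fun n a b ha hb hB hle => ?_⟩
  have hmap : ∀ a, ψ (mu ^ n * a) = F^[n + n₀] (ψ (a / mu ^ n₀)) := by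
    intro a
    rw [h.ψ_map]
    congr 1
    field_simp
    ring
  have hsmall : ∀ a, ‖a‖ ≤ A → ‖a / mu ^ n₀‖ ≤ δ := by
    intro a ha
    rw [norm_div, norm_pow, div_le_iff₀ hmn]
    rw [div_le_iff₀ hδ] at hn₀
    linarith
  have key := hbk _ _ (n + n₀) (h.Gm_ψ _) hB hle
  rw [hmap a, hmap b, h.dyn.left_inv_iterate, h.dyn.left_inv_iterate, ← hmap, ← hmap] at key
  refine le_trans (le_of_eq ?_) ((hanti _ _ (hsmall a ha) (hsmall b hb)).trans key)
  rw [← sub_div, norm_div, norm_pow]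
  field_simp

end HenonAux

namespace HenonAux

variable {F Fi : ℂ × ℂ → ℂ × ℂ} {D : ℝ} {Gp Gm : ℂ × ℂ → ℝ} {mu : ℂ} {ψ : ℂ → ℂ × ℂ} {γ c : ℂ → ℂ}
  {s0 : ℂ} {ρ : ℝ}

/-- The unstable curve `ψ` meets the graph of `γ` in a point which is not interior to the
intersection. -/
theorem Model.not_graphOpen (h : Model F Fi D Gp Gm mu ψ γ c s0 ρ)
    (hs : EdgeZero (fun s => Gm (s, γ s)) (ball s0 ρ) s0) : ¬ GraphOpen ψ γ (ball s0 ρ) := by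
  intro hNI
  obtain ⟨K, hKU, hK, m₀, hdisc⟩ := h.dyn.exists_graph_disc_of_good isOpen_ball h.γ_diff h.Gp_Γ hs
  obtain ⟨M, N₀, t₀, δ₀, hδ₀, hmany⟩ := h.exists_many
  obtain ⟨A, hA⟩ := exists_nat_ge (‖s0‖ + ρ)
  obtain ⟨RΓ, hRΓ⟩ := hK.exists_bound_of_continuousOn
    (f := fun s => (s, γ s)) (continuousOn_id.prodMk (h.γ_diff.continuousOn.mono hKU))
  obtain ⟨B, hB⟩ := h.dyn.plus.exists_bound (RΓ + 1)
  obtain ⟨n₀, Λ, hΛ, hanti⟩ := h.antilip B (‖t₀‖ + δ₀)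
  have hmu0 : 0 < ‖mu‖ := by linarith [h.mu_gt]
  set C₂ : ℝ := 4 * ‖mu‖ ^ n₀ / δ₀ with hC₂
  have hC₂0 : 0 < C₂ := by positivity
  set e := 2 + N₀ + M + n₀ with he
  have hM1 : (1 : ℝ) ≤ M + 1 := by linarith [M.cast_nonneg (α := ℝ)]
  obtain ⟨m, c1, c2, c3, c4⟩ := ((eventually_ge_atTop m₀).and ((eventually_ge_atTop 1).and
    ((eventually_card_lt A N₀ M).and (eventually_mul_pow_mul_exp_lt (A := 2 + C₂)
      (B := Λ ^ e * (M + 1)) (by linarith) (one_le_mul_of_one_le_of_one_le (one_le_pow₀ hΛ) hM1))))).exists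
  obtain ⟨ι, _, N, t, δ, hcard, hi, hdisj⟩ := hmany (m ^ 3)
  set ε := Real.exp (-(m : ℝ) ^ 4) with hε
  set E := Real.exp ((m : ℝ) ^ 2) with hE
  have hE0 : 0 < E := Real.exp_pos _
  have hEi : Real.exp (-(m : ℝ) ^ 2) = E⁻¹ := Real.exp_neg _
  have hW : ∀ i ξ, F^[2 * m] (ψ (mu ^ N i * (t i + δ i * ξ))) =
      ψ (mu ^ (2 * m + N i) * (t i + δ i * ξ)) := by
    intro i ξ
    rw [h.ψ_map, pow_add, mul_assoc]
  have hopen : ∀ i, GraphOpen (fun ξ => F^[2 * m] (ψ (mu ^ N i * (t i + δ i * ξ)))) γ (ball s0 ρ) := by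
    intro i x hx hx'
    simp only [hW] at hx hx' ⊢
    have hc : Continuous fun ξ : ℂ => mu ^ (2 * m + N i) * (t i + δ i * ξ) := by fun_prop
    exact hc.continuousAt.eventually (hNI _ hx hx')
  choose s hsK hs' using fun i => hdisc m c1 _ (h.good (hi i).1) (hopen i)
  have hsA : ∀ i, ‖s i‖ ≤ A := fun i => by
    have h1 := mem_ball.1 (hKU (hsK i))
    have h2 := norm_le_norm_add_norm_sub' (s i) s0
    rw [dist_eq_norm] at h1
    linarith
  set Z := ⌈(A : ℝ) * (2 * E)⌉₊ with hZ
  obtain ⟨i, -, j, -, hij, heq⟩ := Finset.exists_ne_map_eq_of_card_lt_of_maps_to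
    (s := Finset.univ) (t := (Finset.Icc (-(Z : ℤ)) Z ×ˢ Finset.Icc (-(Z : ℤ)) Z) ×ˢ
      Finset.range (N₀ + m ^ 3 * M + 1))
    (f := fun i : ι => ((⌊(s i).re * (2 * E)⌋, ⌊(s i).im * (2 * E)⌋), N i))
    (by
      have hZc : (Finset.Icc (-(Z : ℤ)) Z).card = 2 * Z + 1 := by
        rw [Int.card_Icc]; omega
      rw [Finset.card_product, Finset.card_product, hZc, Finset.card_range, Finset.card_univ, hcard,
        ← pow_two]
      exact c3)
    (fun i _ => by
      simp only [Finset.mem_coe, Finset.mem_product, Finset.mem_range]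
      refine ⟨⟨floor_mem_Icc hE0 ((Complex.abs_re_le_norm _).trans (hsA i)),
        floor_mem_Icc hE0 ((Complex.abs_im_le_norm _).trans (hsA i))⟩, ?_⟩
      have := (hi i).2.1
      omega)
  simp only [Prod.mk.injEq] at heq
  obtain ⟨⟨h1, h2⟩, hN⟩ := heq
  have hclose : ‖s i - s j‖ ≤ Real.exp (-(m : ℝ) ^ 2) := by
    rw [hEi]; exact norm_sub_le_of_floor_eq hE0 h1 h2
  obtain ⟨-, ξ, hξ, d1⟩ := hs' i (s i) (by rw [sub_self, norm_zero]; exact (Real.exp_pos _).le)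
  obtain ⟨-, ξ', hξ', d2⟩ := hs' j (s i) hclose
  rw [hW] at d1 d2
  rw [← hN] at d2
  set a := t i + δ i * ξ with ha
  set b := t j + δ j * ξ' with hb
  set n := 2 * m + N i with hn
  have hdist : ∀ i (ξ : ℂ), ξ ∈ closedBall (0 : ℂ) (1 / 2) → dist (t i + δ i * ξ) (t i) ≤ δ i / 2 := by
    intro i ξ hξ
    have hδ := (hi i).1.pos
    rw [dist_eq_norm, add_sub_cancel_left, norm_mul, Complex.norm_real, Real.norm_of_nonneg hδ.le]
    have := mul_le_mul_of_nonneg_left (mem_closedBall_zero_iff.1 hξ) hδ.le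
    linarith
  have hnorm : ∀ i (ξ : ℂ), ξ ∈ closedBall (0 : ℂ) (1 / 2) → ‖t i + δ i * ξ‖ ≤ ‖t₀‖ + δ₀ := by
    intro i ξ hξ
    have h1 : t i + δ i * ξ ∈ closedBall t₀ δ₀ := (hi i).2.2.2 (by
      rw [mem_closedBall]; linarith [hdist i ξ hξ, (hi i).1.pos])
    have h2 := norm_le_norm_add_norm_sub' (t i + δ i * ξ) t₀
    rw [mem_closedBall, dist_eq_norm] at h1
    linarith
  have hδq : ∀ i, δ₀ * (1 / (M + 1 : ℝ)) ^ m ^ 3 ≤ δ i := fun i => (hi i).2.2.1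
  have hab : δ₀ * (1 / (M + 1 : ℝ)) ^ m ^ 3 ≤ ‖a - b‖ := by
    have h1 := (disjoint_closedBall_closedBall_iff (hi i).1.pos.le (hi j).1.pos.le).1 (hdisj i j hij)
    have h2 := hdist i ξ hξ
    have h3 := hdist j ξ' hξ'
    have h4 := dist_triangle4 (t i) a b (t j)
    rw [dist_comm (t i) a, dist_eq_norm a b] at h4
    have := hδq i
    have := hδq j
    rw [← ha] at h2
    rw [← hb] at h3
    linarith
  have hε1 : ε ≤ 1 := Real.exp_le_one_iff.2 (neg_nonpos.2 (by positivity))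
  have hε0 : 0 < ε := Real.exp_pos _
  have hψ : ‖ψ (mu ^ n * a) - ψ (mu ^ n * b)‖ ≤ 2 * ε := by
    have := norm_sub_le ((s i, γ (s i)) - ψ (mu ^ n * b)) ((s i, γ (s i)) - ψ (mu ^ n * a))
    rw [sub_sub_sub_cancel_left] at this
    linarith
  have hΛn : Λ ^ (n + n₀) ≤ (Λ ^ e) ^ m ^ 3 := by
    rw [← pow_mul]
    refine pow_le_pow_right₀ hΛ ?_
    have h1 := (hi i).2.1
    have h3 : 1 ≤ m ^ 3 := Nat.one_le_pow _ _ c2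
    have h4 : m ≤ m ^ 3 := Nat.le_self_pow (by norm_num) m
    have : e * m ^ 3 = 2 * m ^ 3 + N₀ * m ^ 3 + m ^ 3 * M + n₀ * m ^ 3 := by rw [he]; ring
    have := Nat.le_mul_of_pos_right N₀ h3
    have := Nat.le_mul_of_pos_right n₀ h3
    omega
  have hq : (0 : ℝ) < (M + 1 : ℝ) ^ m ^ 3 := by positivity
  rw [mul_pow] at c4
  have hΛe : 0 < (Λ ^ e) ^ m ^ 3 := by positivity
  have hprod : Λ ^ (n + n₀) * ‖ψ (mu ^ n * a) - ψ (mu ^ n * b)‖ ≤ (Λ ^ e) ^ m ^ 3 * (2 * ε) :=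
    mul_le_mul hΛn hψ (norm_nonneg _) hΛe.le
  have hbig : 1 ≤ (M + 1 : ℝ) ^ m ^ 3 := one_le_pow₀ hM1
  have hX : (Λ ^ e) ^ m ^ 3 * ε ≤ (Λ ^ e) ^ m ^ 3 * (M + 1) ^ m ^ 3 * ε :=
    mul_le_mul_of_nonneg_right (le_mul_of_one_le_right hΛe.le hbig) hε0.le
  have hY : 0 < (Λ ^ e) ^ m ^ 3 * (M + 1 : ℝ) ^ m ^ 3 * ε := by positivity
  have hsum : (2 + C₂) * ((Λ ^ e) ^ m ^ 3 * (M + 1 : ℝ) ^ m ^ 3) * ε =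
    2 * ((Λ ^ e) ^ m ^ 3 * (M + 1 : ℝ) ^ m ^ 3 * ε) + C₂ * ((Λ ^ e) ^ m ^ 3 * (M + 1 : ℝ) ^ m ^ 3 * ε) := by
    ring
  have hCY := mul_pos hC₂0 hY
  have key := hanti n a b (hnorm i ξ hξ) (hnorm j ξ' hξ') (hB _ (by
    have h1 := norm_sub_norm_le (ψ (mu ^ n * b)) (s i, γ (s i))
    rw [norm_sub_rev] at h1
    have h2 : ‖((s i, γ (s i)) : ℂ × ℂ)‖ ≤ RΓ := hRΓ _ (hsK i)
    linarith)) (hprod.trans (by linarith))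
  have h5 : 1 / (2 * ‖mu‖ ^ n₀) * (δ₀ * (1 / (M + 1 : ℝ)) ^ m ^ 3) ≤ (Λ ^ e) ^ m ^ 3 * (2 * ε) :=
    (mul_le_mul_of_nonneg_left hab (by positivity)).trans (key.trans hprod)
  have h6 : 1 ≤ C₂ * ((Λ ^ e) ^ m ^ 3 * (M + 1 : ℝ) ^ m ^ 3 * ε) := by
    have h7 := mul_le_mul_of_nonneg_left h5
      (show 0 ≤ 2 * ‖mu‖ ^ n₀ / δ₀ * (M + 1 : ℝ) ^ m ^ 3 by positivity)
    rw [one_div_pow] at h7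
    have h8 : 2 * ‖mu‖ ^ n₀ / δ₀ * (M + 1 : ℝ) ^ m ^ 3 *
        (1 / (2 * ‖mu‖ ^ n₀) * (δ₀ * (1 / (M + 1 : ℝ) ^ m ^ 3))) = 1 := by field_simp
    rw [h8] at h7
    refine h7.trans (le_of_eq ?_)
    rw [hC₂]
    ring
  linarith

end HenonAux

namespace HenonAux

lemma exists_zero_of_norm_lt {f : ℂ → ℂ} {z : ℂ} {r a : ℝ} (hr : 0 < r)
    (hf : DifferentiableOn ℂ f (closedBall z r)) (hz : ‖f z‖ < a)
    (hs : ∀ w ∈ sphere z r, a ≤ ‖f w‖) : ∃ w ∈ closedBall z r, f w = 0 := by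
  by_contra! hne
  have ha : 0 < a := (norm_nonneg _).trans_lt hz
  have hg : DiffContOnCl ℂ (fun w => (f w)⁻¹) (ball z r) := by
    refine DifferentiableOn.diffContOnCl ?_
    rw [closure_ball _ hr.ne']
    exact hf.inv hne
  have h1 : ‖(f z)⁻¹‖ ≤ a⁻¹ := by
    refine Complex.norm_le_of_forall_mem_frontier_norm_le isBounded_ball hg (fun w hw => ?_)
      (subset_closure (mem_ball_self hr))
    rw [frontier_ball _ hr.ne'] at hw
    rw [norm_inv]
    exact inv_anti₀ ha (hs w hw)
  rw [norm_inv] at h1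
  have hz0 : 0 < ‖f z‖ := norm_pos_iff.2 (hne z (mem_closedBall_self hr.le))
  linarith [(inv_le_inv₀ hz0 ha).1 h1]

/-- Near a zero of finite order, `Y' / Y` blows up faster than `log |Y|`. -/
lemma exists_log_derivative_bounds {Y : ℂ → ℂ} {s : ℂ} (hY : AnalyticAt ℂ Y s) (h0 : Y s = 0)
    (hne : ¬ ∀ᶠ x in 𝓝 s, Y x = 0) {ε : ℝ} (hε : 0 < ε) :
    ∀ᶠ x in 𝓝 s, x ≠ s → Y x ≠ 0 ∧ ‖Y x‖ * (-Real.log ‖Y x‖) < ε * ‖deriv Y x‖ := by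
  obtain ⟨n, v, hv, hv0, hYv⟩ := (hY.exists_eventuallyEq_pow_smul_nonzero_iff).2 hne
  have hn : n ≠ 0 := by
    rintro rfl
    have := hYv.self_of_nhds
    simp [h0] at this
    exact hv0 this.symm
  have hn1 : (1 : ℝ) ≤ n := by exact_mod_cast Nat.one_le_iff_ne_zero.2 hn
  have e1 : ∀ᶠ x in 𝓝 s, v x ≠ 0 := hv.continuousAt.eventually_ne hv0
  have e2 : ∀ᶠ x in 𝓝 s, ‖(x - s) * deriv v x‖ < 1 / 2 * ‖v x‖ := by
    have c1 : ContinuousAt (fun x => ‖(x - s) * deriv v x‖) s :=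
      ((continuousAt_id.sub continuousAt_const).mul hv.deriv.continuousAt).norm
    have c2 : ContinuousAt (fun x => 1 / 2 * ‖v x‖) s := hv.continuousAt.norm.const_mul _
    refine c1.eventually_lt c2 ?_
    have := norm_pos_iff.2 hv0
    simp [hv0]
  have e3 : ∀ᶠ x in 𝓝 s,
      -(n * (‖x - s‖ * Real.log ‖x - s‖) + ‖x - s‖ * Real.log ‖v x‖) < ε / 2 := by
    have c1 : ContinuousAt (fun x : ℂ => ‖x - s‖) s := by fun_prop
    have c2 : ContinuousAt (fun x : ℂ => ‖x - s‖ * Real.log ‖x - s‖) s :=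
      ContinuousAt.comp (g := fun y : ℝ => y * Real.log y) (f := fun x : ℂ => ‖x - s‖)
        Real.continuous_mul_log.continuousAt c1
    have c3 : ContinuousAt (fun x : ℂ => Real.log ‖v x‖) s :=
      hv.continuousAt.norm.log (norm_ne_zero_iff.2 hv0)
    have c4 := ((c2.const_mul (n : ℝ)).add (c1.mul c3)).neg
    refine c4.eventually_lt continuousAt_const ?_
    simpa using hε
  filter_upwards [e1, e2, e3, hYv.eventually_nhds, hv.eventually_analyticAt] with x x1 x2 x3 x4 x5 hx
  have hxs : x - s ≠ 0 := sub_ne_zero.2 hx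
  have hp : 0 < ‖x - s‖ := norm_pos_iff.2 hxs
  have hvp : 0 < ‖v x‖ := norm_pos_iff.2 x1
  have hYx : Y x = (x - s) ^ n * v x := x4.self_of_nhds
  have hYne : Y x ≠ 0 := by rw [hYx]; exact mul_ne_zero (pow_ne_zero _ hxs) x1
  refine ⟨hYne, ?_⟩
  have hd : deriv Y x = n * (x - s) ^ (n - 1) * v x + (x - s) ^ n * deriv v x := by
    rw [Filter.EventuallyEq.deriv_eq (f := fun y => (y - s) ^ n * v y) x4]
    have := (((hasDerivAt_id x).sub_const s).pow n).mul x5.differentiableAt.hasDerivAt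
    change deriv ((fun y => y - s) ^ n * v) x = _
    simpa using this.deriv
  have hmul : (x - s) * deriv Y x = (x - s) ^ n * (n * v x + (x - s) * deriv v x) := by
    rw [hd]
    obtain ⟨k, rfl⟩ := Nat.exists_eq_succ_of_ne_zero hn
    simp only [Nat.succ_eq_add_one, Nat.add_sub_cancel]
    ring
  have hlow : 1 / 2 * ‖Y x‖ ≤ ‖x - s‖ * ‖deriv Y x‖ := by
    rw [← norm_mul, hmul, hYx, norm_mul, norm_mul]
    have h1 : ‖v x‖ ≤ ‖(n : ℂ) * v x‖ := by
      rw [norm_mul, Complex.norm_natCast]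
      exact le_mul_of_one_le_left hvp.le hn1
    have h2 := norm_sub_le_norm_add ((n : ℂ) * v x) ((x - s) * deriv v x)
    have h3 : 1 / 2 * ‖v x‖ ≤ ‖(n : ℂ) * v x + (x - s) * deriv v x‖ := by linarith
    have := mul_le_mul_of_nonneg_left h3 (norm_nonneg ((x - s) ^ n))
    linarith
  have hlog : Real.log ‖Y x‖ = n * Real.log ‖x - s‖ + Real.log ‖v x‖ := by
    rw [hYx, norm_mul, norm_pow, Real.log_mul (by positivity) hvp.ne', Real.log_pow]
  have hYp : 0 < ‖Y x‖ := norm_pos_iff.2 hYne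
  have h5 : ‖x - s‖ * (‖Y x‖ * (-Real.log ‖Y x‖)) < ‖x - s‖ * (ε * ‖deriv Y x‖) := by
    have h6 : ‖Y x‖ * -(n * (‖x - s‖ * Real.log ‖x - s‖) + ‖x - s‖ * Real.log ‖v x‖) <
      ‖Y x‖ * (ε / 2) := mul_lt_mul_of_pos_left x3 hYp
    rw [hlog]
    have := mul_le_mul_of_nonneg_left hlow hε.le
    nlinarith
  exact lt_of_mul_lt_mul_left h5 hp.le

/-- Discs disjoint from a given disc and converging to it cannot remain tangent to a curve which
is tangent to the limit disc. -/
lemma exists_simple_zero {S y : ℕ → ℂ → ℂ} {S₀ Y : ℂ → ℂ} {ω : ℂ} {r₀ : ℝ} (hr₀ : 0 < r₀)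
    (hS : ∀ᶠ j in atTop, DifferentiableOn ℂ (S j) (ball ω r₀))
    (hy : ∀ᶠ j in atTop, DifferentiableOn ℂ (y j) (ball ω r₀))
    (hSlim : TendstoUniformlyOn S S₀ atTop (ball ω r₀))
    (hylim : TendstoUniformlyOn y (fun x => Y (S₀ x)) atTop (ball ω r₀))
    (hS₀ : deriv S₀ ω ≠ 0) (hY : AnalyticAt ℂ Y (S₀ ω)) (hY0 : Y (S₀ ω) = 0)
    (hYne : ¬ ∀ᶠ s in 𝓝 (S₀ ω), Y s = 0)
    (hdisj : ∀ᶠ j in atTop, ∀ x ∈ ball ω r₀, y j x ≠ Y (S j x)) :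
    ∀ᶠ j in atTop, ∃ x ∈ ball ω r₀, y j x = 0 ∧ deriv (y j) x ≠ 0 := by
  have hS₀d : DifferentiableOn ℂ S₀ (ball ω r₀) :=
    (hSlim.tendstoLocallyUniformlyOn).differentiableOn hS isOpen_ball
  have hωmem : ball ω r₀ ∈ 𝓝 ω := ball_mem_nhds _ hr₀
  have hS₀a : AnalyticAt ℂ S₀ ω := hS₀d.analyticAt hωmem
  have hSd := hSlim.tendstoLocallyUniformlyOn.deriv hS isOpen_ball
  set c := ‖deriv S₀ ω‖ / 4 with hc
  have hc0 : 0 < c := by have := norm_pos_iff.2 hS₀; positivity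
  -- a disc around the limit point on which `Y` is analytic and small
  obtain ⟨η, hη, hηY⟩ := Metric.eventually_nhds_iff_ball.1 (hY.eventually_analyticAt.and
    (hY.continuousAt.norm.eventually_lt_const (u := 1 / 4) (by simp [hY0])))
  have ev1 : ∀ᶠ x in 𝓝 ω, S₀ x ∈ ball (S₀ ω) (η / 2) :=
    hS₀a.continuousAt.eventually (ball_mem_nhds _ (half_pos hη))
  have ev2 : ∀ᶠ x in 𝓝 ω, 2 * c < ‖deriv S₀ x‖ :=
    hS₀a.deriv.continuousAt.norm.eventually_const_lt
      (by have := norm_pos_iff.2 hS₀; rw [hc]; linarith)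
  obtain ⟨r₁, hr₁, h1⟩ := Metric.eventually_nhds_iff_ball.1
    ((ev1.and ev2).and (eventually_mem_nhds_iff.2 hωmem))
  set r := r₁ / 4 with hr
  have hr0 : 0 < r := by positivity
  obtain ⟨η₂, hη₂, h2⟩ := Metric.eventually_nhds_iff_ball.1
    (exists_log_derivative_bounds hY hY0 hYne (ε := c * r / 2) (by positivity))
  have ev3 : ∀ᶠ x in 𝓝 ω, S₀ x ∈ ball (S₀ ω) (η₂ / 2) :=
    hS₀a.continuousAt.eventually (ball_mem_nhds _ (half_pos hη₂))
  have ev4 : ∀ᶠ x in 𝓝 ω, x ≠ ω → S₀ x ≠ S₀ ω := by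
    have := hS₀a.differentiableAt.hasDerivAt.eventually_ne (c := S₀ ω) hS₀
    rwa [eventually_nhdsWithin_iff] at this
  obtain ⟨r₂', hr₂', h3'⟩ := Metric.eventually_nhds_iff_ball.1 (ev3.and ev4)
  set r₂ := min (r₂' / 2) r with hr₂
  have hr₂0 : 0 < r₂ := by positivity
  have hr₂r : r₂ ≤ r := min_le_right _ _
  have h3 : ∀ x ∈ closedBall ω r₂, x ∈ ball ω r₂' := fun x hx => mem_ball.2
    ((mem_closedBall.1 hx).trans_lt ((min_le_left _ _).trans_lt (by linarith)))
  have hsub : ball ω r₁ ⊆ ball ω r₀ := fun x hx => mem_of_mem_nhds (h1 x hx).2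
  have hcl : ∀ x ∈ closedBall ω r₂, x ∈ ball ω r₁ := fun x hx => mem_ball.2
    ((mem_closedBall.1 hx).trans_lt (by linarith))
  have hYS : ContinuousOn (fun x => Y (S₀ x)) (closedBall ω r₂) := by
    intro x hx
    have a1 := (hηY (S₀ x) (ball_subset_ball (by linarith) (h1 x (hcl x hx)).1.1)).1.continuousAt
    have a2 := (hS₀d.continuousOn.continuousAt (h1 x (hcl x hx)).2)
    exact (ContinuousAt.comp (f := S₀) (g := Y) a1 a2).continuousWithinAt
  obtain ⟨x₀, hx₀, hmin⟩ := (isCompact_sphere ω r₂).exists_isMinOn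
    (NormedSpace.sphere_nonempty.2 hr₂0.le) (hYS.norm.mono sphere_subset_closedBall)
  set a := ‖Y (S₀ x₀)‖ with ha
  have ha0 : 0 < a := by
    have b1 := h3' x₀ (h3 x₀ (sphere_subset_closedBall hx₀))
    have b2 : x₀ ≠ ω := by
      rintro rfl
      rw [mem_sphere, dist_self] at hx₀
      exact hr₂0.ne hx₀
    exact norm_pos_iff.2 (h2 _ (ball_subset_ball (by linarith) b1.1) (b1.2 b2)).1
  have lim1 := Metric.tendstoUniformlyOn_iff.1 hSlim (min (η / 2) (η₂ / 2)) (by positivity)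
  have lim2 := Metric.tendstoUniformlyOn_iff.1 hylim (min (a / 2) (1 / 4)) (by positivity)
  have lim3 := Metric.tendstoUniformlyOn_iff.1
    ((tendstoLocallyUniformlyOn_iff_forall_isCompact isOpen_ball).1 hSd (closedBall ω r₂)
      (fun x hx => hsub (hcl x hx)) (isCompact_closedBall _ _)) c hc0
  filter_upwards [hS, hy, hdisj, lim1, lim2, lim3] with j dS dy hj l1 l2 l3
  obtain ⟨x, hx, hx0⟩ := exists_zero_of_norm_lt (f := y j) (z := ω) (a := a / 2) hr₂0
    (dy.mono fun x hx => hsub (hcl x hx))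
    (by
      have := l2 ω (mem_ball_self hr₀)
      rw [hY0, dist_zero_left] at this
      exact this.trans_le (min_le_left _ _))
    (by
      intro w hw
      have b1 := l2 w (hsub (hcl w (sphere_subset_closedBall hw)))
      have b2 : a ≤ ‖Y (S₀ w)‖ := hmin hw
      have b3 := norm_sub_norm_le (Y (S₀ w)) (y j w)
      rw [dist_eq_norm] at b1
      have := min_le_left (a / 2) (1 / 4 : ℝ)
      linarith)
  refine ⟨x, hsub (hcl x hx), hx0, fun hder => ?_⟩
  have hball : ∀ w ∈ ball x r, w ∈ ball ω r₁ := fun w hw => mem_ball.2 (by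
    have := dist_triangle w x ω
    have := mem_ball.1 hw
    have := mem_closedBall.1 hx
    linarith)
  have hSη : ∀ w ∈ ball ω r₁, S j w ∈ ball (S₀ ω) η := fun w hw => mem_ball.2 (by
    have c1 := l1 w (hsub hw)
    have c2 := mem_ball.1 (h1 w hw).1.1
    have := dist_triangle (S j w) (S₀ w) (S₀ ω)
    rw [dist_comm] at c1
    have := min_le_left (η / 2) (η₂ / 2)
    linarith)
  have hdS : ∀ w ∈ ball ω r₁, DifferentiableAt ℂ (S j) w := fun w hw =>
    dS.differentiableAt (h1 w hw).2
  have hdY : ∀ w ∈ ball ω r₁, DifferentiableAt ℂ Y (S j w) := fun w hw =>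
    (hηY _ (hSη w hw)).1.differentiableAt
  have hκd : ∀ w ∈ ball ω r₁, DifferentiableAt ℂ (fun w => y j w - Y (S j w)) w := fun w hw =>
    (dy.differentiableAt (h1 w hw).2).sub ((hdY w hw).fun_comp' w (hdS w hw))
  have hmain := norm_deriv_le_log (f := fun w => y j w - Y (S j w)) (ξ := x) hr0
    (fun w hw => (hκd w (hball w hw)).differentiableWithinAt)
    (fun w hw => sub_ne_zero.2 (hj w (hsub (hball w hw))))
    (fun w hw => by
      have d1 := l2 w (hsub (hball w hw))
      have d2 := (hηY _ (hSη w (hball w hw))).2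
      have d3 := (hηY _ (ball_subset_ball (by linarith) (h1 w (hball w hw)).1.1)).2
      have d4 := norm_sub_le (y j w) (Y (S j w))
      have d5 := norm_sub_norm_le (y j w) (Y (S₀ w))
      rw [dist_comm, dist_eq_norm] at d1
      have := min_le_right (a / 2) (1 / 4 : ℝ)
      linarith)
  have hxx : x ∈ ball ω r₁ := hcl x hx
  have hκ' : deriv (fun w => y j w - Y (S j w)) x = -(deriv Y (S j x) * deriv (S j) x) := by
    have e1 := (dy.differentiableAt (h1 x hxx).2).hasDerivAt
    have e2 := HasDerivAt.comp x (hdY x hxx).hasDerivAt (hdS x hxx).hasDerivAt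
    have := (e1.sub e2).deriv
    rw [hder, zero_sub] at this
    exact this
  simp only [hx0, zero_sub, norm_neg, hκ'] at hmain
  rw [norm_mul] at hmain
  have hYx : Y (S j x) ≠ 0 := fun h => hj x (hsub hxx) (by rw [hx0, h])
  have hSx2 : S j x ∈ ball (S₀ ω) η₂ := mem_ball.2 (by
    have c1 := l1 x (hsub hxx)
    have c2 := mem_ball.1 (h3' x (h3 x hx)).1
    have := dist_triangle (S j x) (S₀ x) (S₀ ω)
    rw [dist_comm] at c1
    have := min_le_right (η / 2) (η₂ / 2)
    linarith)
  have hb := (h2 _ hSx2 (fun h => hYx (by rw [h, hY0]))).2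
  have hSc : c ≤ ‖deriv (S j) x‖ := by
    have f1 := l3 x hx
    have f2 := (h1 x hxx).1.2
    have f3 := norm_sub_norm_le (deriv S₀ x) (deriv (S j) x)
    rw [dist_eq_norm] at f1
    simp only [Function.comp_apply] at f1
    linarith
  have g1 := mul_le_mul_of_nonneg_left hSc (norm_nonneg (deriv Y (S j x)))
  have g2 : ‖Y (S j x)‖ * (2 / r * -Real.log ‖Y (S j x)‖) =
    2 / r * (‖Y (S j x)‖ * -Real.log ‖Y (S j x)‖) := by ring
  have g3 := mul_lt_mul_of_pos_left hb (show 0 < 2 / r by positivity)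
  have g4 : 2 / r * (c * r / 2 * ‖deriv Y (S j x)‖) = ‖deriv Y (S j x)‖ * c := by field_simp
  linarith

end HenonAux

namespace HenonAux

variable {F Fi : ℂ × ℂ → ℂ × ℂ} {D : ℝ} {Gp Gm : ℂ × ℂ → ℝ} {mu : ℂ} {ψ : ℂ → ℂ × ℂ} {γ c : ℂ → ℂ}
  {s0 : ℂ} {ρ : ℝ}

/-- Rescaled iterates of the unstable curve near a point of contact of order `m` with the stable
graph converge to an `m`-fold reparametrization of the unstable curve. -/
lemma Model.tendsto_contact (h : Model F Fi D Gp Gm mu ψ γ c s0 ρ) {t₁ ν : ℂ} {u : ℂ → ℂ} {m : ℕ}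
    (ht : (ψ t₁).1 ∈ ball s0 ρ) (hu : AnalyticAt ℂ u t₁)
    (hyu : ∀ᶠ t in 𝓝 t₁, (ψ t).2 - γ (ψ t).1 = (t - t₁) ^ m * u t)
    (hν : ν ^ m = mu⁻¹) (hν1 : ‖ν‖ < 1) (R : ℝ) :
    TendstoUniformlyOn (fun (j : ℕ) ω => ψ (mu ^ j * (t₁ + ν ^ j * ω)))
      (fun ω => ψ (c (ψ t₁).1 * (ω ^ m * u t₁))) atTop (closedBall 0 R) := by
  have hmu : mu ≠ 0 := norm_pos_iff.1 (zero_lt_one.trans h.mu_gt)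
  have hψc := h.ψ_diff.continuous
  have hS : ∀ᶠ t in 𝓝 t₁, (ψ t).1 ∈ ball s0 ρ :=
    (hψc.fst.continuousAt).eventually (isOpen_ball.mem_nhds ht)
  obtain ⟨δ, hδ, hδ'⟩ := Metric.eventually_nhds_iff_ball.1
    ((hS.and hyu).and hu.eventually_continuousAt)
  have hsub : ∀ x ∈ closedBall t₁ (δ / 2), x ∈ ball t₁ δ := fun x hx => mem_ball.2
    ((mem_closedBall.1 hx).trans_lt (by linarith))
  have ht₁ : t₁ ∈ closedBall t₁ (δ / 2) := mem_closedBall_self (by positivity)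
  have hc₁ : ContinuousOn (fun z : ℂ × ℂ => z.2 ^ m * u z.1)
      (closedBall t₁ (δ / 2) ×ˢ closedBall 0 R) := by
    intro z hz
    have a1 : ContinuousAt u z.1 := (hδ' z.1 (hsub _ hz.1)).2
    exact ((continuousAt_snd.pow m).mul
      (ContinuousAt.comp (f := Prod.fst) a1 continuousAt_fst)).continuousWithinAt
  have hc₂ : ContinuousOn (fun z : ℂ × ℂ => ψ (c (ψ z.1).1 * (z.2 ^ m * u z.1)))
      (closedBall t₁ (δ / 2) ×ˢ closedBall 0 R) := by
    refine hψc.comp_continuousOn (ContinuousOn.mul ?_ hc₁)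
    exact h.c_diff.continuousOn.comp (hψc.fst.comp continuous_fst).continuousOn
      fun z hz => (hδ' z.1 (hsub _ hz.1)).1.1
  have hK : IsCompact (closedBall t₁ (δ / 2) ×ˢ closedBall (0 : ℂ) R) :=
    (isCompact_closedBall _ _).prod (isCompact_closedBall _ _)
  obtain ⟨R', hR'⟩ := hK.exists_bound_of_continuousOn hc₁
  rw [Metric.tendstoUniformlyOn_iff]
  intro ε hε
  obtain ⟨η, hη, hη'⟩ := Metric.uniformContinuousOn_iff.1
    (hK.uniformContinuousOn_of_continuous hc₂) (ε / 2) (half_pos hε)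
  have lim := Metric.tendstoUniformlyOn_iff.1 (h.conv R') (ε / 2) (half_pos hε)
  have hsmall : ∀ᶠ j : ℕ in atTop, ‖ν‖ ^ j * R < min (δ / 2) η := by
    have := (tendsto_pow_atTop_nhds_zero_of_lt_one (norm_nonneg _) hν1).mul_const R
    rw [zero_mul] at this
    exact this.eventually_lt_const (by positivity)
  filter_upwards [lim, hsmall] with j l1 l2 ω hω
  set x := t₁ + ν ^ j * ω with hx
  have hdist : dist x t₁ < min (δ / 2) η := by
    rw [hx, dist_eq_norm, add_sub_cancel_left, norm_mul, norm_pow]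
    exact (mul_le_mul_of_nonneg_left (mem_closedBall_zero_iff.1 hω) (by positivity)).trans_lt l2
  have hxm : x ∈ closedBall t₁ (δ / 2) := mem_closedBall.2 (hdist.le.trans (min_le_left _ _))
  have hx' := (hδ' x (hsub x hxm)).1
  have e1 : ψ (mu ^ j * x) = F^[j] (((ψ x).1, γ (ψ x).1) + (0, ω ^ m * u x / mu ^ j)) := by
    rw [← h.ψ_map]
    congr 1
    refine Prod.ext (by simp) ?_
    have e2 := hx'.2
    rw [show x - t₁ = ν ^ j * ω by rw [hx]; ring, mul_pow, ← pow_mul, mul_comm j m, pow_mul, hν,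
      inv_pow] at e2
    simp only [Prod.snd_add]
    rw [sub_eq_iff_eq_add'.1 e2]
    field_simp
  rw [e1]
  have l3 := l1 ((ψ x).1, ω ^ m * u x) ⟨hx'.1, mem_closedBall_zero_iff.2 (hR' (x, ω) ⟨hxm, hω⟩)⟩
  have l4 := hη' (t₁, ω) ⟨ht₁, hω⟩ (x, ω) ⟨hxm, hω⟩ (by
    rw [dist_comm, Prod.dist_eq, dist_self, max_eq_left dist_nonneg]
    exact hdist.trans_le (min_le_right _ _))
  calc _ ≤ _ := dist_triangle _ (ψ (c (ψ x).1 * (ω ^ m * u x))) _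
    _ < ε / 2 + ε / 2 := add_lt_add l4 l3
    _ = ε := add_halves ε

end HenonAux

namespace HenonAux

variable {F Fi : ℂ × ℂ → ℂ × ℂ} {D : ℝ} {Gp Gm : ℂ × ℂ → ℝ} {mu : ℂ} {ψ : ℂ → ℂ × ℂ} {γ c : ℂ → ℂ}
  {s0 : ℂ} {ρ : ℝ}

lemma Model.hasDerivAt_sub (h : Model F Fi D Gp Gm mu ψ γ c s0 ρ) {t : ℂ}
    (ht : (ψ t).1 ∈ ball s0 ρ) :
    HasDerivAt (fun t => (ψ t).2 - γ (ψ t).1)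
      ((deriv ψ t).2 - deriv γ (ψ t).1 * (deriv ψ t).1) t := by
  have h1 : HasDerivAt (fun t => (ψ t).1) (deriv ψ t).1 t := (h.ψ_diff t).hasDerivAt.fst
  have h2 : HasDerivAt (fun t => (ψ t).2) (deriv ψ t).2 t := (h.ψ_diff t).hasDerivAt.snd
  exact h2.sub (HasDerivAt.comp t
    (h.γ_diff.differentiableAt (isOpen_ball.mem_nhds ht)).hasDerivAt h1)

/-- The unstable curve meets the stable graph transversely. -/
theorem Model.exists_transverse (h : Model F Fi D Gp Gm mu ψ γ c s0 ρ)
    (hs : EdgeZero (fun s => Gm (s, γ s)) (ball s0 ρ) s0) :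
    ∃ t, (ψ t).1 ∈ ball s0 ρ ∧ (ψ t).2 = γ (ψ t).1 ∧
      (deriv ψ t).2 ≠ deriv γ (ψ t).1 * (deriv ψ t).1 := by
  have hno := h.not_graphOpen hs
  simp only [GraphOpen, not_forall] at hno
  obtain ⟨t₁, ht₁, hy₁, hne⟩ := hno
  by_contra! hT
  have hmu : mu ≠ 0 := norm_pos_iff.1 (zero_lt_one.trans h.mu_gt)
  set S : ℂ → ℂ := fun t => (ψ t).1 with hSdef
  have hSd : Differentiable ℂ S := fun t => (h.ψ_diff t).fst
  set y : ℂ → ℂ := fun t => (ψ t).2 - γ (S t) with hydef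
  have hU : ∀ᶠ t in 𝓝 t₁, S t ∈ ball s0 ρ :=
    hSd.continuous.continuousAt.eventually (isOpen_ball.mem_nhds ht₁)
  have hya : AnalyticAt ℂ y t₁ := by
    refine Complex.analyticAt_iff_eventually_differentiableAt.2 ?_
    filter_upwards [hU] with t ht using (h.hasDerivAt_sub ht).differentiableAt
  have hy0 : y t₁ = 0 := sub_eq_zero.2 hy₁
  have hyne : ¬ ∀ᶠ t in 𝓝 t₁, y t = 0 := fun hh => hne (hh.mono fun t ht => sub_eq_zero.1 ht)
  have ht₁0 : t₁ ≠ 0 := by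
    rintro rfl
    refine h.Γ_ne _ ht₁ (Prod.ext ?_ ?_)
    · simp [h.ψ_zero]
    · rw [← hy₁]; simp [h.ψ_zero]
  have hS' : HasDerivAt S (deriv ψ t₁).1 t₁ := (h.ψ_diff t₁).hasDerivAt.fst
  have hS'ne : (deriv ψ t₁).1 ≠ 0 := fun h0 => h.ψ_deriv t₁ (Prod.ext h0 (by
    rw [hT t₁ ht₁ hy₁, h0, mul_zero]; rfl))
  obtain ⟨χ, hχ1, hχa, hχr, hχl⟩ := exists_local_inverse
    (hSd.analyticAt t₁) (by rw [hS'.deriv]; exact hS'ne)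
  set Y : ℂ → ℂ := fun s => y (χ s) with hYdef
  have hYa : AnalyticAt ℂ Y (S t₁) :=
    AnalyticAt.fun_comp (g := y) (f := χ) (by rw [hχ1]; exact hya) hχa
  have hY0 : Y (S t₁) = 0 := by simp only [hYdef, hχ1, hy0]
  have hYne : ¬ ∀ᶠ s in 𝓝 (S t₁), Y s = 0 := by
    intro hh
    refine hyne ?_
    filter_upwards [hSd.continuous.continuousAt.eventually hh, hχl] with t a1 a2
    simpa only [hYdef, a2] using a1
  obtain ⟨m, u, hua, hu0, hyu⟩ := hya.exists_eventuallyEq_pow_smul_nonzero_iff.2 hyne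
  have hm : m ≠ 0 := by
    rintro rfl
    have := hyu.self_of_nhds
    simp only [pow_zero, one_smul, hy0] at this
    exact hu0 this.symm
  obtain ⟨ν, hν⟩ := IsAlgClosed.exists_pow_nat_eq mu⁻¹ (Nat.pos_of_ne_zero hm)
  have hν1 : ‖ν‖ < 1 := by
    by_contra! h1
    have h2 := one_le_pow₀ h1 (n := m)
    rw [← norm_pow, hν, norm_inv] at h2
    exact absurd (inv_lt_one_of_one_lt₀ h.mu_gt) h2.not_gt
  have hcu : c (S t₁) * u t₁ ≠ 0 := mul_ne_zero (h.c_ne _ ht₁) hu0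
  obtain ⟨ω, hω⟩ := IsAlgClosed.exists_pow_nat_eq (t₁ / (c (S t₁) * u t₁)) (Nat.pos_of_ne_zero hm)
  have hω0 : ω ≠ 0 := by
    rintro rfl
    rw [zero_pow hm] at hω
    exact div_ne_zero ht₁0 hcu hω.symm
  set q : ℂ → ℂ := fun x => c (S t₁) * (x ^ m * u t₁) with hq
  have hqd : Differentiable ℂ q := by fun_prop
  have hqω : q ω = t₁ := by simp only [hq, hω]; field_simp [left_ne_zero_of_mul hcu]
  have hq' : deriv q ω ≠ 0 := by
    have : HasDerivAt q (c (S t₁) * (m * ω ^ (m - 1) * u t₁)) ω :=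
      ((hasDerivAt_pow m ω).mul_const _).const_mul _
    rw [this.deriv]
    have hm' : (m : ℂ) ≠ 0 := Nat.cast_ne_zero.2 hm
    exact mul_ne_zero (left_ne_zero_of_mul hcu)
      (mul_ne_zero (mul_ne_zero hm' (pow_ne_zero _ hω0)) hu0)
  -- a disc around the contact point in which the curve is a graph
  have hχb : ∀ᶠ s in 𝓝 (S t₁), ‖χ s‖ < ‖t₁‖ + 1 :=
    hχa.continuousAt.norm.eventually_lt_const (by simp only [hχ1]; linarith)
  obtain ⟨η', hη', hη1⟩ := Metric.eventually_nhds_iff_ball.1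
    ((hχr.and hχb).and (isOpen_ball.mem_nhds ht₁))
  set η := η' / 2 with hηdef
  have hη : 0 < η := half_pos hη'
  have hηsub : closedBall (S t₁) η ⊆ ball (S t₁) η' := closedBall_subset_ball (by linarith)
  have hqt : Tendsto q (𝓝 ω) (𝓝 t₁) := by
    have := hqd.continuous.tendsto ω
    rwa [hqω] at this
  have hev : ∀ᶠ x in 𝓝 ω, χ (S (q x)) = q x ∧ S (q x) ∈ ball (S t₁) (η / 2) :=
    (hqt.eventually hχl).and (hqt.eventually
      (hSd.continuous.continuousAt.eventually (ball_mem_nhds _ (half_pos hη))))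
  obtain ⟨r₀, hr₀, hr₀'⟩ := Metric.eventually_nhds_iff_ball.1 hev
  set B : ℕ → ℂ → ℂ × ℂ := fun j x => ψ (mu ^ j * (t₁ + ν ^ j * x)) with hB
  have hBd : ∀ j, Differentiable ℂ (B j) := fun j =>
    h.ψ_diff.comp (by fun_prop)
  have hBlim : TendstoUniformlyOn B (fun x => ψ (q x)) atTop (ball ω r₀) := by
    refine (h.tendsto_contact ht₁ hua (hyu.mono fun t ht => ht) hν hν1 (‖ω‖ + r₀)).mono ?_
    intro x hx
    have a1 := mem_ball.1 hx
    rw [dist_eq_norm] at a1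
    have a2 := norm_le_norm_add_norm_sub' x ω
    rw [mem_closedBall_zero_iff]
    linarith
  have hSlim : TendstoUniformlyOn (fun j x => (B j x).1) (fun x => S (q x)) atTop (ball ω r₀) :=
    uniformContinuous_fst.comp_tendstoUniformlyOn hBlim
  have hclose : ∀ᶠ j in atTop, ∀ x ∈ ball ω r₀, (B j x).1 ∈ ball (S t₁) η := by
    filter_upwards [Metric.tendstoUniformlyOn_iff.1 hSlim (η / 2) (half_pos hη)] with j hj x hx
    have a1 := hj x hx
    have a2 := mem_ball.1 (hr₀' x hx).2
    have a3 := dist_triangle (B j x).1 (S (q x)) (S t₁)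
    rw [dist_comm] at a1
    exact mem_ball.2 (by linarith)
  have hball : ∀ s ∈ ball (S t₁) η, s ∈ ball s0 ρ := fun s hs =>
    (hη1 s (hηsub (ball_subset_closedBall hs))).2
  have hylim : TendstoUniformlyOn (fun j x => (B j x).2 - γ (B j x).1) (fun x => Y (S (q x))) atTop
      (ball ω r₀) := by
    have g1 : UniformContinuousOn γ (closedBall (S t₁) η) :=
      (isCompact_closedBall _ _).uniformContinuousOn_of_continuous
        (h.γ_diff.continuousOn.mono fun s hs => (hη1 s (hηsub hs)).2)
    have g2 := UniformContinuousOn.comp_tendstoUniformlyOn_eventually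
      (hclose.mono fun j hj x hx => ball_subset_closedBall (hj x hx))
      (fun x hx => closedBall_subset_closedBall (by linarith)
        (ball_subset_closedBall (hr₀' x hx).2)) g1 hSlim
    have g3 : TendstoUniformlyOn (fun j x => (B j x).2) (fun x => (ψ (q x)).2) atTop (ball ω r₀) :=
      uniformContinuous_snd.comp_tendstoUniformlyOn hBlim
    refine (g3.sub g2).congr_right fun x hx => ?_
    simp only [hYdef, (hr₀' x hx).1]
    rfl
  have hSq : HasDerivAt (fun x => S (q x)) ((deriv ψ t₁).1 * deriv q ω) ω :=
    HasDerivAt.comp (h₂ := S) (h := q) ω (by rw [hqω]; exact hS') (hqd ω).hasDerivAt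
  have hfar : ∀ᶠ j : ℕ in atTop, ∀ x ∈ ball ω r₀, ‖t₁‖ + 1 ≤ ‖mu ^ j * (t₁ + ν ^ j * x)‖ := by
    have hp : 0 < ‖t₁‖ := norm_pos_iff.2 ht₁0
    have f1 : ∀ᶠ j : ℕ in atTop, ‖ν‖ ^ j * (‖ω‖ + r₀) < ‖t₁‖ / 2 := by
      have := (tendsto_pow_atTop_nhds_zero_of_lt_one (norm_nonneg _) hν1).mul_const (‖ω‖ + r₀)
      rw [zero_mul] at this
      exact this.eventually_lt_const (by positivity)
    have f2 : ∀ᶠ j : ℕ in atTop, (‖t₁‖ + 1) / (‖t₁‖ / 2) ≤ ‖mu‖ ^ j :=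
      (tendsto_pow_atTop_atTop_of_one_lt h.mu_gt).eventually_ge_atTop _
    filter_upwards [f1, f2] with j j1 j2 x hx
    have a1 := mem_ball.1 hx
    rw [dist_eq_norm] at a1
    have a2 := norm_le_norm_add_norm_sub' x ω
    have a3 : ‖ν ^ j * x‖ ≤ ‖ν‖ ^ j * (‖ω‖ + r₀) := by
      rw [norm_mul, norm_pow]
      exact mul_le_mul_of_nonneg_left (by linarith) (by positivity)
    have a4 := norm_sub_le_norm_add t₁ (ν ^ j * x)
    rw [norm_mul, norm_pow]
    rw [div_le_iff₀ (by positivity)] at j2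
    exact j2.trans (mul_le_mul_of_nonneg_left (by linarith) (by positivity))
  have main := exists_simple_zero (S := fun j x => (B j x).1) (y := fun j x => (B j x).2 - γ (B j x).1)
    (S₀ := fun x => S (q x)) (Y := Y) (ω := ω) hr₀
    (Eventually.of_forall fun j x _ => ((hBd j x).fst).differentiableWithinAt)
    (hclose.mono fun j hj x hx => (((hBd j x).snd).sub (DifferentiableAt.fun_comp' x
      (h.γ_diff.differentiableAt (isOpen_ball.mem_nhds (hball _ (hj x hx))))
      (hBd j x).fst)).differentiableWithinAt)
    hSlim hylim (by rw [hSq.deriv]; exact mul_ne_zero hS'ne hq')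
    (by simp only [hqω]; exact hYa) (by simp only [hqω]; exact hY0) (by simp only [hqω]; exact hYne)
    (by
      filter_upwards [hclose, hfar] with j j1 j2 x hx heq
      have a1 := hη1 _ (hηsub (ball_subset_closedBall (j1 x hx)))
      have a2 : ψ (χ (B j x).1) = B j x := by
        refine Prod.ext a1.1.1 ?_
        have a3 : S (χ (B j x).1) = (B j x).1 := a1.1.1
        simp only [hYdef, hydef, a3, sub_left_inj] at heq
        exact heq.symm
      have a4 := h.ψ_inj a2
      have a5 := a1.1.2
      rw [a4] at a5
      exact absurd (j2 x hx) a5.not_ge)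
  obtain ⟨j, j1, x, hx, hx0, hx'⟩ := (hclose.and main).exists
  refine hx' ?_
  have hin := hball _ (j1 x hx)
  have b1 := hT (mu ^ j * (t₁ + ν ^ j * x)) hin (sub_eq_zero.1 hx0)
  have b2 := h.hasDerivAt_sub hin
  rw [b1, sub_self] at b2
  have b3 : HasDerivAt (fun x => mu ^ j * (t₁ + ν ^ j * x)) (mu ^ j * (ν ^ j * 1)) x :=
    (((hasDerivAt_id x).const_mul _).const_add _).const_mul _
  have b4 := HasDerivAt.comp x b2 b3
  rw [zero_mul] at b4
  exact b4.deriv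

end HenonAux

namespace HenonAux

variable {E : Type*} [NormedAddCommGroup E] [NormedSpace ℂ E]

/-- Locally uniform limits of holomorphic maps may be differentiated. -/
lemma tendsto_fderiv_of_tendstoUniformlyOn {f : ℕ → E → E} {g : E → E} {z₀ : E} {r : ℝ}
    (hr : 0 < r) (hf : ∀ m, DifferentiableOn ℂ (f m) (ball z₀ r))
    (hg : ContinuousAt (fderiv ℂ g) z₀) (hgd : DifferentiableOn ℂ g (ball z₀ r))
    (hlim : TendstoUniformlyOn f g atTop (ball z₀ r)) :
    Tendsto (fun x : ℕ × E => fderiv ℂ (f x.1) x.2) (atTop ×ˢ 𝓝 z₀) (𝓝 (fderiv ℂ g z₀)) := by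
  rw [Metric.tendsto_nhds]
  intro ε hε
  have h1 := Metric.tendstoUniformlyOn_iff.1 hlim (ε * r / 8) (by positivity)
  have h2 : ∀ᶠ z in 𝓝 z₀, dist (fderiv ℂ g z) (fderiv ℂ g z₀) < ε / 2 :=
    Metric.tendsto_nhds.1 hg (ε / 2) (half_pos hε)
  filter_upwards [h1.prod_mk (h2.and (ball_mem_nhds z₀ (half_pos hr)))] with x hx
  obtain ⟨k1, k2, k3⟩ := hx
  have hsub : ball x.2 (r / 2) ⊆ ball z₀ r := ball_subset_ball' (by
    have := mem_ball.1 k3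
    linarith)
  have hmem : x.2 ∈ ball z₀ r := hsub (mem_ball_self (half_pos hr))
  have hb := Complex.norm_fderiv_le_div_of_mapsTo_ball (f := fun z => f x.1 z - g z) (c := x.2)
    (R₁ := r / 2) (R₂ := ε * r / 4) (((hf x.1).sub hgd).mono hsub) (fun w hw => by
      have a1 := k1 w (hsub hw)
      have a2 := k1 x.2 hmem
      rw [dist_comm, dist_eq_norm] at a1 a2
      rw [mem_closedBall, dist_eq_norm]
      exact (norm_sub_le _ _).trans (by linarith)) (half_pos hr)
  have hd : fderiv ℂ (fun z => f x.1 z - g z) x.2 = fderiv ℂ (f x.1) x.2 - fderiv ℂ g x.2 :=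
    fderiv_fun_sub ((hf x.1).differentiableAt (isOpen_ball.mem_nhds hmem))
      (hgd.differentiableAt (isOpen_ball.mem_nhds hmem))
  rw [hd, ← dist_eq_norm, show ε * r / 4 / (r / 2) = ε / 2 by field_simp; norm_num] at hb
  linarith [dist_triangle (fderiv ℂ (f x.1) x.2) (fderiv ℂ g x.2) (fderiv ℂ g z₀)]

/-- A nondegenerate zero persists along a uniformly convergent sequence of holomorphic maps. -/
lemma eventually_exists_zero [FiniteDimensional ℂ E] [Nontrivial E] {f : ℕ → E → E} {g : E → E}
    {z₀ : E} {r : ℝ}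
    (hr : 0 < r) (hf : ∀ m, DifferentiableOn ℂ (f m) (ball z₀ r))
    (hg : ContinuousAt (fderiv ℂ g) z₀) (hgd : DifferentiableOn ℂ g (ball z₀ r))
    (hlim : TendstoUniformlyOn f g atTop (ball z₀ r)) (h0 : g z₀ = 0)
    (hinj : Function.Injective (fderiv ℂ g z₀)) {P : ℕ × E → Prop}
    (hP : ∀ᶠ x in atTop ×ˢ 𝓝 z₀, P x) : ∀ᶠ m in atTop, ∃ z, f m z = 0 ∧ P (m, z) := by
  have : CompleteSpace E := FiniteDimensional.complete ℂ E
  set e : E ≃L[ℂ] E := (LinearEquiv.ofInjectiveEndo (fderiv ℂ g z₀ : E →ₗ[ℂ] E)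
    hinj).toContinuousLinearEquiv with he
  have heA : (e : E →L[ℂ] E) = fderiv ℂ g z₀ := by
    ext v
    simp [he]
  set N := e.toNonlinearRightInverse.nnnorm with hN
  have hN0 : 0 < N := e.nnnorm_symm_pos
  have hc0 : (0 : ℝ) < N⁻¹ / 2 := by positivity
  have h1 := Metric.tendsto_nhds.1
    (tendsto_fderiv_of_tendstoUniformlyOn hr hf hg hgd hlim) _ hc0
  obtain ⟨pa, ha, pb, hb, hab⟩ := eventually_prod_iff.1 (h1.and hP)
  obtain ⟨δ, hδ, hδb⟩ := Metric.eventually_nhds_iff_ball.1 (hb.and (ball_mem_nhds z₀ hr))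
  have h2 := Metric.tendstoUniformlyOn_iff.1 hlim (N⁻¹ / 2 * (δ / 2)) (by positivity)
  filter_upwards [ha, h2] with m m1 m2
  have hsub : closedBall z₀ (δ / 2) ⊆ ball z₀ δ := closedBall_subset_ball (by linarith)
  have happ : ApproximatesLinearOn (f m) (e : E →L[ℂ] E) (closedBall z₀ (δ / 2)) (N⁻¹ / 2) := by
    intro x hx y hy
    rw [heA]
    refine Convex.norm_image_sub_le_of_norm_fderiv_le' (𝕜 := ℂ) (s := closedBall z₀ (δ / 2))
      (fun w hw => (hf m).differentiableAt (isOpen_ball.mem_nhds (hδb w (hsub hw)).2))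
      (fun w hw => ?_) (convex_closedBall _ _) hy hx
    have := (hab m1 (hδb w (hsub hw)).1).1
    rw [dist_eq_norm] at this
    exact this.le
  obtain ⟨z, hz, hz0⟩ := happ.surjOn_closedBall_of_nonlinearRightInverse e.toNonlinearRightInverse
    (half_pos hδ).le Subset.rfl (show (0 : E) ∈ _ by
      have := m2 z₀ (mem_ball_self hr)
      rw [h0] at this
      rw [mem_closedBall]
      refine this.le.trans (le_of_eq ?_)
      rw [← hN]
      push_cast
      ring)
  exact ⟨z, hz0, (hab m1 (hδb z (hsub hz)).1).2⟩

end HenonAux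

namespace HenonAux

/-- Fixed points of saddle type. -/
def SaddleFix (G : ℂ × ℂ → ℂ × ℂ) (x : ℂ × ℂ) : Prop :=
  G x = x ∧ ∃ (v₁ v₂ : ℂ × ℂ) (μ₁ μ₂ : ℂ), v₁ ≠ 0 ∧ v₂ ≠ 0 ∧
    fderiv ℂ G x v₁ = μ₁ • v₁ ∧ fderiv ℂ G x v₂ = μ₂ • v₂ ∧ ‖μ₁‖ < 1 ∧ 1 < ‖μ₂‖

lemma exists_eigenvector_of_root (M : ℂ × ℂ →L[ℂ] ℂ × ℂ) {e : ℂ}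
    (he : e ^ 2 - ((M (1, 0)).1 + (M (0, 1)).2) * e +
      ((M (1, 0)).1 * (M (0, 1)).2 - (M (0, 1)).1 * (M (1, 0)).2) = 0) :
    ∃ v, v ≠ 0 ∧ M v = e • v := by
  have hM : ∀ x y : ℂ, M (x, y) = x • M (1, 0) + y • M (0, 1) := fun x y => by
    rw [← map_smul, ← map_smul, ← map_add]
    simp
  rcases hab : M (1, 0) with ⟨a, c⟩
  rcases hbd : M (0, 1) with ⟨b, d⟩
  rw [hab, hbd] at he hM
  by_cases h1 : (b, e - a) = 0
  · by_cases h2 : (e - d, c) = 0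
    · refine ⟨(1, 0), by simp, ?_⟩
      rw [Prod.mk_eq_zero] at h1 h2
      rw [hab]
      simp [h2.2, ← sub_eq_zero.1 h1.2]
    · refine ⟨_, h2, ?_⟩
      rw [Prod.mk_eq_zero] at h1
      rw [hM, h1.1]
      ext
      · simp only [smul_eq_mul, Prod.fst_add, Prod.smul_fst]
        linear_combination -(e - d) * h1.2
      · simp only [smul_eq_mul, Prod.snd_add, Prod.smul_snd]
        ring
  · refine ⟨_, h1, ?_⟩
    rw [hM]
    ext
    · simp only [smul_eq_mul, Prod.fst_add, Prod.smul_fst]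
      ring
    · simp only [smul_eq_mul, Prod.snd_add, Prod.smul_snd]
      linear_combination -he

lemma exists_saddle_eigenvectors (M : ℂ × ℂ →L[ℂ] ℂ × ℂ)
    (hT : 4 ≤ ‖(M (1, 0)).1 + (M (0, 1)).2‖)
    (hΔ : ‖(M (1, 0)).1 * (M (0, 1)).2 - (M (0, 1)).1 * (M (1, 0)).2‖ ≤
      ‖(M (1, 0)).1 + (M (0, 1)).2‖ / 4) :
    ∃ (v₁ v₂ : ℂ × ℂ) (μ₁ μ₂ : ℂ), v₁ ≠ 0 ∧ v₂ ≠ 0 ∧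
      M v₁ = μ₁ • v₁ ∧ M v₂ = μ₂ • v₂ ∧ ‖μ₁‖ < 1 ∧ 1 < ‖μ₂‖ := by
  have key := fun e => exists_eigenvector_of_root M (e := e)
  generalize (M (1, 0)).1 + (M (0, 1)).2 = T at *
  generalize (M (1, 0)).1 * (M (0, 1)).2 - (M (0, 1)).1 * (M (1, 0)).2 = Δ at *
  obtain ⟨w, hw⟩ := IsAlgClosed.exists_pow_nat_eq (T ^ 2 - 4 * Δ) two_pos
  have hsum : (T + w) / 2 + (T - w) / 2 = T := by ring
  have hprod : (T + w) / 2 * ((T - w) / 2) = Δ := by linear_combination -hw / 4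
  obtain ⟨v, hv, hMv⟩ := key ((T + w) / 2) (by linear_combination hw / 4)
  obtain ⟨v', hv', hMv'⟩ := key ((T - w) / 2) (by linear_combination hw / 4)
  have small : ∀ e e' : ℂ, e + e' = T → e * e' = Δ → ‖e'‖ ≤ ‖e‖ → 1 < ‖e‖ ∧ ‖e'‖ < 1 := by
    intro e e' h1 h2 h3
    have h4 := norm_add_le e e'
    rw [h1] at h4
    refine ⟨by linarith, ?_⟩
    by_contra! h5
    have h6 : ‖e‖ * 1 ≤ ‖e‖ * ‖e'‖ := mul_le_mul_of_nonneg_left h5 (norm_nonneg _)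
    rw [← norm_mul, h2] at h6
    linarith
  rcases le_total ‖(T - w) / 2‖ ‖(T + w) / 2‖ with h | h
  · obtain ⟨a1, a2⟩ := small _ _ hsum hprod h
    exact ⟨v', v, _, _, hv', hv, hMv', hMv, a2, a1⟩
  · obtain ⟨a1, a2⟩ := small _ _ (by rw [add_comm]; exact hsum) (by rw [mul_comm]; exact hprod) h
    exact ⟨v, v', _, _, hv, hv', hMv, hMv', a2, a1⟩

end HenonAux

namespace HenonAux

variable {F Fi : ℂ × ℂ → ℂ × ℂ} {D : ℝ} {Gp Gm : ℂ × ℂ → ℝ} {mu : ℂ} {ψ : ℂ → ℂ × ℂ} {γ c : ℂ → ℂ}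
  {s0 : ℂ} {ρ : ℝ}

lemma hasFDerivAt_graph_add {γ : ℂ → ℂ} {z : ℂ × ℂ} (a : ℂ) (hγ : DifferentiableAt ℂ γ z.1) :
    HasFDerivAt (fun z : ℂ × ℂ => (z.1, γ z.1) + (0, z.2 / a))
      ((ContinuousLinearMap.fst ℂ ℂ ℂ).prod (deriv γ z.1 • ContinuousLinearMap.fst ℂ ℂ ℂ) +
        (0 : ℂ × ℂ →L[ℂ] ℂ).prod (a⁻¹ • ContinuousLinearMap.snd ℂ ℂ ℂ)) z := by
  have h1 : HasFDerivAt (fun z : ℂ × ℂ => z.1) (ContinuousLinearMap.fst ℂ ℂ ℂ) z := hasFDerivAt_fst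
  have h2 : HasFDerivAt (fun z : ℂ × ℂ => z.2) (ContinuousLinearMap.snd ℂ ℂ ℂ) z := hasFDerivAt_snd
  have h3 := HasDerivAt.comp_hasFDerivAt z hγ.hasDerivAt h1
  have h4 : HasFDerivAt (fun z : ℂ × ℂ => z.2 / a) (a⁻¹ • ContinuousLinearMap.snd ℂ ℂ ℂ) z := by
    simp only [div_eq_inv_mul]
    exact h2.const_mul a⁻¹
  exact (h1.prodMk h3).add ((hasFDerivAt_const (0 : ℂ) z).prodMk h4)

lemma hasFDerivAt_comp_mul {ψ : ℂ → ℂ × ℂ} {c : ℂ → ℂ} {z : ℂ × ℂ} (hψ : Differentiable ℂ ψ)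
    (hc : DifferentiableAt ℂ c z.1) :
    ∃ A : ℂ × ℂ →L[ℂ] ℂ × ℂ, HasFDerivAt (fun z : ℂ × ℂ => ψ (c z.1 * z.2)) A z ∧
      ∀ v, A v = (c z.1 * v.2 + z.2 * (deriv c z.1 * v.1)) • deriv ψ (c z.1 * z.2) := by
  have h1 : HasFDerivAt (fun z : ℂ × ℂ => z.1) (ContinuousLinearMap.fst ℂ ℂ ℂ) z := hasFDerivAt_fst
  have h2 : HasFDerivAt (fun z : ℂ × ℂ => z.2) (ContinuousLinearMap.snd ℂ ℂ ℂ) z := hasFDerivAt_snd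
  have h3 := (HasDerivAt.comp_hasFDerivAt z hc.hasDerivAt h1).mul h2
  refine ⟨_, HasFDerivAt.comp z (g := ψ) (hψ _).hasDerivAt.hasFDerivAt h3, fun v => ?_⟩
  simp [add_smul, mul_smul]

/-- A transverse homoclinic intersection produces nearby saddles of iterates. -/
theorem Model.exists_saddle (h : Model F Fi D Gp Gm mu ψ γ c s0 ρ)
    (hs : EdgeZero (fun s => Gm (s, γ s)) (ball s0 ρ) s0) {ε : ℝ} (hε : 0 < ε) :
    ∃ s ∈ ball s0 ρ, ∃ x, dist x (s, γ s) < ε ∧ ∃ m : ℕ, 1 ≤ m ∧ SaddleFix F^[m] x := by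
  obtain ⟨t, hts, hty, htr⟩ := h.exists_transverse hs
  set s := (ψ t).1 with hsdef
  have hmu : mu ≠ 0 := norm_pos_iff.1 (zero_lt_one.trans h.mu_gt)
  have hmupos : 0 < ‖mu‖ := norm_pos_iff.2 hmu
  have hcs : c s ≠ 0 := h.c_ne s hts
  set z₀ : ℂ × ℂ := (s, t / c s) with hz₀
  have hct : c z₀.1 * z₀.2 = t := by simp only [hz₀]; field_simp
  obtain ⟨r₁, hr₁, hr₁'⟩ := Metric.isOpen_iff.1 isOpen_ball s hts
  set r := min r₁ 1 with hr
  have hr0 : 0 < r := lt_min hr₁ one_pos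
  set R := ‖t / c s‖ + 1 with hR
  have hin1 : ∀ z ∈ ball z₀ r, z.1 ∈ ball s0 ρ := fun z hz => hr₁' (mem_ball.2
    (((le_max_left _ _).trans_lt (mem_ball.1 hz)).trans_le (min_le_left _ _)))
  have hin2 : ∀ z ∈ ball z₀ r, ‖z.2‖ ≤ R := fun z hz => by
    have a1 : dist z.2 (t / c s) < r := (le_max_right _ _).trans_lt (mem_ball.1 hz)
    rw [dist_eq_norm] at a1
    have a2 := norm_le_norm_add_norm_sub' z.2 (t / c s)
    have := min_le_right r₁ 1
    linarith
  have hγd : ∀ z ∈ ball z₀ r, DifferentiableAt ℂ γ z.1 := fun z hz =>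
    h.γ_diff.differentiableAt (isOpen_ball.mem_nhds (hin1 z hz))
  have hcd : ∀ z ∈ ball z₀ r, DifferentiableAt ℂ c z.1 := fun z hz =>
    h.c_diff.differentiableAt (isOpen_ball.mem_nhds (hin1 z hz))
  have hz₀r : z₀ ∈ ball z₀ r := mem_ball_self hr0
  set N : ℕ → ℂ × ℂ → ℂ × ℂ := fun m z => (z.1, γ z.1) + (0, z.2 / mu ^ m) with hN
  have hNd : ∀ m, ∀ z ∈ ball z₀ r, DifferentiableAt ℂ (N m) z := fun m z hz =>
    (hasFDerivAt_graph_add (mu ^ m) (hγd z hz)).differentiableAt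
  have hFd : ∀ m, Differentiable ℂ F^[m] := fun m => h.dyn.diff.iterate m
  set L : ℕ → ℂ × ℂ → ℂ × ℂ := fun m z => F^[m] (N m z) with hL
  have hLd : ∀ m, ∀ z ∈ ball z₀ r, DifferentiableAt ℂ (L m) z := fun m z hz =>
    (hFd m _).comp z (hNd m z hz)
  set L₀ : ℂ × ℂ → ℂ × ℂ := fun z => ψ (c z.1 * z.2) with hL₀
  set N₀ : ℂ × ℂ → ℂ × ℂ := fun z => (z.1, γ z.1) with hN₀
  have hγa : AnalyticAt ℂ γ s := h.γ_diff.analyticAt (isOpen_ball.mem_nhds hts)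
  have hca : AnalyticAt ℂ c s := h.c_diff.analyticAt (isOpen_ball.mem_nhds hts)
  have hL₀a : AnalyticAt ℂ L₀ z₀ :=
    AnalyticAt.fun_comp (g := ψ) (f := fun z : ℂ × ℂ => c z.1 * z.2) (x := z₀)
      (h.ψ_diff.analyticAt _) ((AnalyticAt.fun_comp (g := c) (f := Prod.fst) (x := z₀) hca
        analyticAt_fst).fun_mul analyticAt_snd)
  have hN₀a : AnalyticAt ℂ N₀ z₀ :=
    analyticAt_fst.prod (AnalyticAt.fun_comp (g := γ) (f := Prod.fst) hγa analyticAt_fst)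
  have hL₀d : DifferentiableOn ℂ L₀ (ball z₀ r) := fun z hz =>
    ((hasFDerivAt_comp_mul h.ψ_diff (hcd z hz)).choose_spec.1).differentiableAt.differentiableWithinAt
  have hN₀d : ∀ z ∈ ball z₀ r, HasFDerivAt N₀
      ((ContinuousLinearMap.fst ℂ ℂ ℂ).prod (deriv γ z.1 • ContinuousLinearMap.fst ℂ ℂ ℂ)) z :=
    fun z hz => HasFDerivAt.prodMk hasFDerivAt_fst
      (HasDerivAt.comp_hasFDerivAt z (hγd z hz).hasDerivAt hasFDerivAt_fst)
  have hLlim : TendstoUniformlyOn L L₀ atTop (ball z₀ r) := (h.conv R).mono fun z hz =>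
    ⟨hin1 z hz, mem_closedBall_zero_iff.2 (hin2 z hz)⟩
  have hNlim : TendstoUniformlyOn N N₀ atTop (ball z₀ r) := by
    rw [Metric.tendstoUniformlyOn_iff]
    intro ε hε
    have h1 : Tendsto (fun m : ℕ => R / ‖mu‖ ^ m) atTop (𝓝 0) :=
      tendsto_const_nhds.div_atTop (tendsto_pow_atTop_atTop_of_one_lt h.mu_gt)
    filter_upwards [h1.eventually_lt_const hε] with m hm z hz
    refine lt_of_le_of_lt ?_ hm
    simp only [hN, hN₀]
    rw [dist_self_add_right, Prod.norm_mk, norm_zero, max_eq_right (norm_nonneg _), norm_div, norm_pow]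
    exact div_le_div_of_nonneg_right (hin2 z hz) (by positivity)
  obtain ⟨A, hA, hAv⟩ := hasFDerivAt_comp_mul (z := z₀) h.ψ_diff (hcd z₀ hz₀r)
  rw [hct] at hAv
  set p := deriv ψ t with hp
  set κ₀ := c s * (p.2 - deriv γ s * p.1) with hκ₀
  have hκ₀ne : κ₀ ≠ 0 := mul_ne_zero hcs (sub_ne_zero.2 htr)
  have hκ₀pos : 0 < ‖κ₀‖ := norm_pos_iff.2 hκ₀ne
  have hZ := hA.sub (hN₀d z₀ hz₀r)
  have hZinj : Function.Injective (fderiv ℂ (fun z => L₀ z - N₀ z) z₀) := by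
    rw [show fderiv ℂ (fun z => L₀ z - N₀ z) z₀ = _ from hZ.fderiv,
      injective_iff_map_eq_zero]
    rintro ⟨x, y⟩ hxy
    simp only [sub_apply, hAv, ContinuousLinearMap.prod_apply,
      ContinuousLinearMap.coe_fst', smul_apply, smul_eq_mul, Prod.ext_iff,
      Prod.fst_sub, Prod.snd_sub, Prod.smul_fst, Prod.smul_snd, Prod.fst_zero, Prod.snd_zero] at hxy
    obtain ⟨e1, e2⟩ := hxy
    have e3 : (c s * y + z₀.2 * (deriv c s * x)) * (p.2 - deriv γ s * p.1) = 0 := by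
      linear_combination e2 - deriv γ s * e1
    have e4 := (mul_eq_zero.1 e3).resolve_right (sub_ne_zero.2 htr)
    have e5 : x = 0 := by
      have : (c s * y + z₀.2 * (deriv c s * x)) * p.1 - x = 0 := e1
      rw [e4] at this
      linear_combination -this
    rw [e5, mul_zero, mul_zero, add_zero] at e4
    exact Prod.ext e5 ((mul_eq_zero.1 e4).resolve_left hcs)
  have hZ0 : L₀ z₀ - N₀ z₀ = 0 := by
    simp only [hL₀, hct, hN₀]
    exact sub_eq_zero.2 (Prod.ext rfl hty)
  -- limits of the derivatives
  have hD : Tendsto (fun x : ℕ × (ℂ × ℂ) => fderiv ℂ (L x.1) x.2) (atTop ×ˢ 𝓝 z₀) (𝓝 A) := by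
    have := tendsto_fderiv_of_tendstoUniformlyOn hr0
      (fun m z hz => (hLd m z hz).differentiableWithinAt) hL₀a.fderiv.continuousAt hL₀d hLlim
    rwa [hA.fderiv] at this
  have hDU : Tendsto (fun x : ℕ × (ℂ × ℂ) => fderiv ℂ (L x.1) x.2 (1, 0)) (atTop ×ˢ 𝓝 z₀)
      (𝓝 (A (1, 0))) :=
    ((ContinuousLinearMap.apply ℂ (ℂ × ℂ) ((1, 0) : ℂ × ℂ)).continuous.tendsto A).comp hD
  have hDT : Tendsto (fun x : ℕ × (ℂ × ℂ) => fderiv ℂ (L x.1) x.2 (0, 1)) (atTop ×ˢ 𝓝 z₀)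
      (𝓝 (A (0, 1))) :=
    ((ContinuousLinearMap.apply ℂ (ℂ × ℂ) ((0, 1) : ℂ × ℂ)).continuous.tendsto A).comp hD
  have hγ' : Tendsto (fun x : ℕ × (ℂ × ℂ) => deriv γ x.2.1) (atTop ×ˢ 𝓝 z₀) (𝓝 (deriv γ s)) :=
    hγa.deriv.continuousAt.tendsto.comp ((continuous_fst.tendsto z₀).comp tendsto_snd)
  have hκ := hDT.snd_nhds.sub (hγ'.mul hDT.fst_nhds)
  have hdet := (hDU.fst_nhds.mul hDT.snd_nhds).sub (hDT.fst_nhds.mul hDU.snd_nhds)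
  have hκv : (A (0, 1)).2 - deriv γ s * (A (0, 1)).1 = κ₀ := by
    simp only [hAv, hκ₀, smul_eq_mul, Prod.smul_fst, Prod.smul_snd]
    ring
  have hdetv : (A (1, 0)).1 * (A (0, 1)).2 - (A (0, 1)).1 * (A (1, 0)).2 = 0 := by
    simp only [hAv, smul_eq_mul, Prod.smul_fst, Prod.smul_snd]
    ring
  rw [hκv] at hκ
  rw [hdetv] at hdet
  have q1 := hκ.norm.eventually_const_lt (half_lt_self hκ₀pos)
  have q2 := hdet.norm.eventually_lt_const (u := ‖κ₀‖ / 16) (by rw [norm_zero]; positivity)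
  have q3 := hDU.fst_nhds.norm.eventually_lt_const (lt_add_one _)
  have q4 : ∀ᶠ x : ℕ × (ℂ × ℂ) in atTop ×ˢ 𝓝 z₀,
      4 + (‖(A (1, 0)).1‖ + 1) ≤ ‖mu‖ ^ x.1 * (‖κ₀‖ / 4) :=
    (((tendsto_pow_atTop_atTop_of_one_lt h.mu_gt).atTop_mul_const
      (show 0 < ‖κ₀‖ / 4 by positivity)).eventually_ge_atTop _).prod_inl _
  have q5 : ∀ᶠ x : ℕ × (ℂ × ℂ) in atTop ×ˢ 𝓝 z₀, 1 ≤ x.1 := (eventually_ge_atTop 1).prod_inl _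
  have q6 : ∀ᶠ x : ℕ × (ℂ × ℂ) in atTop ×ˢ 𝓝 z₀, x.2 ∈ ball z₀ r ∧ dist (N₀ x.2) (N₀ z₀) < ε / 2 :=
    ((show ∀ᶠ z in 𝓝 z₀, z ∈ ball z₀ r from ball_mem_nhds z₀ hr0).and (Metric.tendsto_nhds.1 hN₀a.continuousAt (ε / 2)
      (half_pos hε))).prod_inr _
  have q7 : ∀ᶠ x : ℕ × (ℂ × ℂ) in atTop ×ˢ 𝓝 z₀, ∀ z ∈ ball z₀ r, dist (N₀ z) (N x.1 z) < ε / 2 :=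
    (Metric.tendstoUniformlyOn_iff.1 hNlim (ε / 2) (half_pos hε)).prod_inl _
  obtain ⟨m, z, hmz, ⟨⟨⟨⟨⟨⟨k1, k2⟩, k3⟩, k4⟩, k5⟩, k6⟩, k7⟩⟩ := (eventually_exists_zero
    (f := fun m z => L m z - N m z) (g := fun z => L₀ z - N₀ z) hr0
    (fun m z hz => ((hLd m z hz).sub (hNd m z hz)).differentiableWithinAt)
    (hL₀a.sub hN₀a).fderiv.continuousAt
    (hL₀d.sub fun z hz => (hN₀d z hz).differentiableAt.differentiableWithinAt)
    (hLlim.sub hNlim) hZ0 hZinj ((((((q1.and q2).and q3).and q4).and q5).and q6).and q7)).exists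
  simp only at k1 k2 k3 k4 k5 k6 k7
  refine ⟨s, hts, N m z, ?_, m, k5, sub_eq_zero.1 hmz, ?_⟩
  · have a1 := k7 z k6.1
    have a2 := dist_triangle_left (N m z) (N₀ z₀) (N₀ z)
    exact a2.trans_lt (by linarith [k6.2])
  · have hch := (HasFDerivAt.comp z (hFd m (N m z)).hasFDerivAt
      (hasFDerivAt_graph_add (mu ^ m) (hγd z k6.1))).fderiv
    set M := fderiv ℂ F^[m] (N m z) with hM
    have hU : fderiv ℂ (L m) z (1, 0) = M (1, 0) + deriv γ z.1 • M (0, 1) := by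
      rw [show fderiv ℂ (L m) z = _ from hch, ← map_smul, ← map_add]
      show M _ = M _
      congr 1
      simp
    have hT : fderiv ℂ (L m) z (0, 1) = (mu ^ m)⁻¹ • M (0, 1) := by
      rw [show fderiv ℂ (L m) z = _ from hch, ← map_smul]
      show M _ = M _
      congr 1
      simp
    set U := fderiv ℂ (L m) z (1, 0) with hUdef
    set T := fderiv ℂ (L m) z (0, 1) with hTdef
    have hmum : mu ^ m ≠ 0 := pow_ne_zero _ hmu
    have hM2 : M (0, 1) = mu ^ m • T := by rw [hT, smul_inv_smul₀ hmum]
    have hM1 : M (1, 0) = U - (deriv γ z.1 * mu ^ m) • T := by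
      rw [hU, hM2, smul_smul, add_sub_cancel_right]
    have htr' : (M (1, 0)).1 + (M (0, 1)).2 = U.1 + mu ^ m * (T.2 - deriv γ z.1 * T.1) := by
      rw [hM1, hM2]
      simp only [Prod.fst_sub, Prod.smul_fst, Prod.smul_snd, smul_eq_mul]
      ring
    have hdet' : (M (1, 0)).1 * (M (0, 1)).2 - (M (0, 1)).1 * (M (1, 0)).2 =
        mu ^ m * (U.1 * T.2 - T.1 * U.2) := by
      rw [hM1, hM2]
      simp only [Prod.fst_sub, Prod.snd_sub, Prod.smul_fst, Prod.smul_snd, smul_eq_mul]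
      ring
    have hmp : 0 < ‖mu‖ ^ m := by positivity
    have b1 : ‖mu‖ ^ m * (‖κ₀‖ / 2) ≤ ‖mu ^ m * (T.2 - deriv γ z.1 * T.1)‖ := by
      rw [norm_mul (mu ^ m), norm_pow]
      exact mul_le_mul_of_nonneg_left k1.le hmp.le
    have b2 : ‖mu ^ m * (U.1 * T.2 - T.1 * U.2)‖ ≤ ‖mu‖ ^ m * (‖κ₀‖ / 16) := by
      rw [norm_mul, norm_pow]
      exact mul_le_mul_of_nonneg_left k2.le hmp.le
    have b3 := norm_sub_le_norm_add (mu ^ m * (T.2 - deriv γ z.1 * T.1)) U.1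
    rw [add_comm (mu ^ m * _)] at b3
    have b4 := norm_nonneg (A (1, 0)).1
    refine exists_saddle_eigenvectors M ?_ ?_
    · rw [htr']
      linarith
    · rw [htr', hdet']
      linarith

end HenonAux

namespace HenonAux

variable {F Fi : ℂ × ℂ → ℂ × ℂ} {D : ℝ} {Gp Gm : ℂ × ℂ → ℝ} {lam mu : ℂ} {r C : ℝ}
  {ψ : ℂ → ℂ × ℂ} {γ c : ℂ → ℂ} {s0 : ℂ} {ρ : ℝ}

lemma EdgeZero.mono {g : ℂ → ℝ} {U V : Set ℂ} {ξ : ℂ} (h : EdgeZero g U ξ) (hV : IsOpen V)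
    (hξ : ξ ∈ V) : EdgeZero g V ξ := by
  refine ⟨hξ, h.2.1, ?_⟩
  have := hV.inter_closure ⟨hξ, h.2.2⟩
  exact closure_mono (fun x hx => show x ∈ V ∧ 0 < g x from ⟨hx.1, hx.2.2⟩) this

lemma Model.mono (h : Model F Fi D Gp Gm mu ψ γ c s0 ρ) {ρ' : ℝ} (hρ' : 0 < ρ') (hle : ρ' ≤ ρ) :
    Model F Fi D Gp Gm mu ψ γ c s0 ρ' where
  dyn := h.dyn
  mu_gt := h.mu_gt
  ρ_pos := hρ'
  ψ_diff := h.ψ_diff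
  ψ_zero := h.ψ_zero
  ψ_map := h.ψ_map
  ψ_inj := h.ψ_inj
  ψ_deriv := h.ψ_deriv
  ψ_antilip := h.ψ_antilip
  Gm_ψ := h.Gm_ψ
  γ_diff := h.γ_diff.mono (ball_subset_ball hle)
  c_diff := h.c_diff.mono (ball_subset_ball hle)
  c_ne s hs := h.c_ne s (ball_subset_ball hle hs)
  Gp_Γ s hs := h.Gp_Γ s (ball_subset_ball hle hs)
  Γ_ne s hs := h.Γ_ne s (ball_subset_ball hle hs)
  conv R := (h.conv R).mono (prod_mono_left (ball_subset_ball hle))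

/-- Saddles are transported by differentiable semiconjugacies with a differentiable left inverse. -/
lemma SaddleFix.map {F G h g : ℂ × ℂ → ℂ × ℂ} {x : ℂ × ℂ} (hx : SaddleFix F x)
    (hF : Differentiable ℂ F) (hG : Differentiable ℂ G) (hh : Differentiable ℂ h)
    (hg : Differentiable ℂ g) (hgh : ∀ x, g (h x) = x) (hsemi : ∀ x, h (F x) = G (h x)) :
    SaddleFix G (h x) := by
  obtain ⟨hfix, v₁, v₂, μ₁, μ₂, h1, h2, e1, e2, l1, l2⟩ := hx
  have hinj : ∀ v, v ≠ 0 → fderiv ℂ h x v ≠ 0 := by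
    intro v hv h0
    have a1 : fderiv ℂ (g ∘ h) x = fderiv ℂ id x := by
      rw [show g ∘ h = id from funext hgh]
    rw [fderiv_comp x (hg _) (hh x), fderiv_id] at a1
    have a2 := congrArg (fun A : ℂ × ℂ →L[ℂ] ℂ × ℂ => A v) a1
    simp only [ContinuousLinearMap.comp_apply, h0, map_zero, ContinuousLinearMap.id_apply] at a2
    exact hv a2.symm
  have key : ∀ v, fderiv ℂ G (h x) (fderiv ℂ h x v) = fderiv ℂ h x (fderiv ℂ F x v) := by
    intro v
    have a1 : fderiv ℂ (G ∘ h) x = fderiv ℂ (h ∘ F) x := by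
      rw [show G ∘ h = h ∘ F from funext fun x => (hsemi x).symm]
    rw [fderiv_comp x (hG _) (hh x), fderiv_comp x (hh _) (hF x), hfix] at a1
    exact congrArg (fun A : ℂ × ℂ →L[ℂ] ℂ × ℂ => A v) a1
  exact ⟨by rw [← hsemi, hfix], _, _, μ₁, μ₂, hinj v₁ h1, hinj v₂ h2, by rw [key, e1, map_smul],
    by rw [key, e2, map_smul], l1, l2⟩

/-- Saddles of iterates accumulate at every edge zero of `Gm` on the stable manifold. -/
theorem exists_saddle_near (h : Dyn F Fi D Gp Gm) (hs : Sad F lam mu r C) {Φ : ℂ → ℂ × ℂ}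
    (hΦ : Differentiable ℂ Φ) (hΦ' : ∀ z, deriv Φ z ≠ 0)
    (h0 : ∀ w, Tendsto (fun n => F^[n] (Φ w)) atTop (𝓝 0)) {z : ℂ} (hz0 : Φ z ≠ 0)
    (hz : EdgeZero (fun w => Gm (Φ w)) univ z) {ε : ℝ} (hε : 0 < ε) :
    ∃ y, dist y (Φ z) < ε ∧ ∃ m : ℕ, 1 ≤ m ∧ SaddleFix F^[m] y := by
  obtain ⟨j, ψ, γ, c, s0, ρ, hM, hj, hE⟩ := exists_model h hs hΦ hΦ' h0 hz0 hz
  have hinv : Fi^[j] (s0, γ s0) = Φ z := by rw [hj, h.left_inv_iterate]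
  have hFid := h.diff_inv.iterate j
  obtain ⟨δ, hδ, hδ'⟩ := Metric.continuousAt_iff.1 (hFid (s0, γ s0)).continuousAt ε hε
  rw [hinv] at hδ'
  have hγ : ContinuousAt (fun s => (s, γ s)) s0 :=
    continuousAt_id.prodMk (hM.γ_diff.differentiableAt
      (isOpen_ball.mem_nhds (mem_ball_self hM.ρ_pos))).continuousAt
  obtain ⟨η, hη, hη'⟩ := Metric.continuousAt_iff.1 hγ (δ / 2) (half_pos hδ)
  have hlt : 0 < min ρ η := lt_min hM.ρ_pos hη
  obtain ⟨s, hs1, x, hx, m, hm, hxs⟩ := (hM.mono hlt (min_le_left _ _)).exists_saddle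
    (hE.mono isOpen_ball (mem_ball_self hlt)) (half_pos hδ)
  refine ⟨Fi^[j] x, hδ' ?_, m, hm, ?_⟩
  · have a1 := hη' (lt_of_lt_of_le (mem_ball.1 hs1) (min_le_right _ _))
    have a2 := dist_triangle x (s, γ s) (s0, γ s0)
    linarith
  · refine hxs.map (h.diff.iterate m) (h.diff.iterate m) hFid (h.diff.iterate j)
      (h.symm.left_inv_iterate j) fun y => ?_
    have hcomm : Function.Commute Fi F := fun y => by rw [h.left_inv, h.right_inv]
    exact hcomm.iterate_iterate j m y

end HenonAux

namespace HenonAux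

lemma _root_.HenonMap.contDiff (H : HenonMap) : ContDiff ℂ 2 H.toFun := by
  unfold HenonMap.toFun
  induction H.comps with
  | nil => exact contDiff_id
  | cons f l ih =>
    refine ContDiff.comp (g := f.toFun) ?_ ih
    unfold ElemHenon.toFun
    exact ((f.P.contDiff_aeval 2).comp contDiff_fst |>.add (contDiff_const.mul contDiff_snd)).prodMk
      (contDiff_const.mul contDiff_fst)

lemma _root_.HenonMap.contDiff_iterate (H : HenonMap) (n : ℕ) : ContDiff ℂ 2 H.toFun^[n] := by
  induction n with
  | zero => exact contDiff_id
  | succ n ih => exact ih.comp H.contDiff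

lemma exists_sad {F : ℂ × ℂ → ℂ × ℂ} {lam mu : ℂ} (hF : ContDiff ℂ 2 F) (h0 : F 0 = 0)
    (hlam : ‖lam‖ < 1) (hmu : 1 < ‖mu‖) (hd : fderiv ℂ F 0 = diagMap lam mu) :
    ∃ r C, Sad F lam mu r C := by
  have hFd : Differentiable ℂ F := hF.differentiable two_ne_zero
  have h1 : ContDiff ℂ 1 (fderiv ℂ F) := hF.fderiv_right (by norm_num)
  obtain ⟨K, t, ht, hK⟩ := h1.contDiffAt (x := (0 : ℂ × ℂ)) |>.exists_lipschitzOnWith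
  obtain ⟨r, hr, hrt⟩ := Metric.nhds_basis_closedBall.mem_iff.1 ht
  refine ⟨r, K + 1, hFd, h0, hlam, hmu, hr, by positivity, fun x y hx hy => ?_⟩
  have hmax : max ‖x‖ ‖y‖ ≤ r := max_le hx hy
  refine Convex.norm_image_sub_le_of_norm_fderiv_le' (𝕜 := ℂ) (s := closedBall 0 (max ‖x‖ ‖y‖))
    (fun z _ => hFd z) (fun z hz => ?_) (convex_closedBall _ _)
    (mem_closedBall_zero_iff.2 (le_max_right _ _)) (mem_closedBall_zero_iff.2 (le_max_left _ _))
  have hz' := mem_closedBall_zero_iff.1 hz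
  have := hK.dist_le_mul z (hrt (mem_closedBall_zero_iff.2 (hz'.trans hmax))) 0
    (hrt (mem_closedBall_self hr.le))
  rw [dist_eq_norm, hd, dist_zero_right] at this
  refine this.trans ?_
  have hK0 : (0 : ℝ) ≤ K := K.2
  nlinarith [norm_nonneg z]

lemma exists_basis_equiv {A : ℂ × ℂ →L[ℂ] ℂ × ℂ} {v₁ v₂ : ℂ × ℂ} {μ₁ μ₂ : ℂ} (h₁ : v₁ ≠ 0)
    (h₂ : v₂ ≠ 0) (e₁ : A v₁ = μ₁ • v₁) (e₂ : A v₂ = μ₂ • v₂) (hne : μ₁ ≠ μ₂) :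
    ∃ e : (ℂ × ℂ) ≃L[ℂ] (ℂ × ℂ), ∀ u, e u = u.1 • v₁ + u.2 • v₂ := by
  let l : (ℂ × ℂ) →ₗ[ℂ] (ℂ × ℂ) :=
    (LinearMap.fst ℂ ℂ ℂ).smulRight v₁ + (LinearMap.snd ℂ ℂ ℂ).smulRight v₂
  have hl : ∀ u, l u = u.1 • v₁ + u.2 • v₂ := fun u => rfl
  have hinj : Function.Injective l := by
    rw [injective_iff_map_eq_zero]
    intro u hu
    rw [hl] at hu
    have a1 : u.1 • μ₁ • v₁ + u.2 • μ₂ • v₂ = 0 := by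
      have := congrArg A hu
      simpa only [map_add, map_smul, e₁, e₂, map_zero] using this
    have a2 : (u.1 * (μ₁ - μ₂)) • v₁ = 0 := by
      have : (u.1 * (μ₁ - μ₂)) • v₁ =
        (u.1 • μ₁ • v₁ + u.2 • μ₂ • v₂) - μ₂ • (u.1 • v₁ + u.2 • v₂) := by module
      rw [this, a1, hu, smul_zero, sub_zero]
    have a3 : u.1 = 0 := ((smul_eq_zero.1 a2).resolve_right h₁ |> mul_eq_zero.1).resolve_right
      (sub_ne_zero.2 hne)
    rw [a3, zero_smul, zero_add] at hu
    exact Prod.ext a3 ((smul_eq_zero.1 hu).resolve_right h₂)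
  exact ⟨(LinearEquiv.ofInjectiveEndo l hinj).toContinuousLinearEquiv, hl⟩

lemma fderiv_conj (e : (ℂ × ℂ) ≃L[ℂ] (ℂ × ℂ)) (p : ℂ × ℂ) {F : ℂ × ℂ → ℂ × ℂ} (u v : ℂ × ℂ)
    (hF : DifferentiableAt ℂ F (p + e u)) :
    fderiv ℂ (conj e p F) u v = e.symm (fderiv ℂ F (p + e u) (e v)) := by
  have h1 : HasFDerivAt (fun u => p + e u) (e : (ℂ × ℂ) →L[ℂ] (ℂ × ℂ)) u :=
    e.hasFDerivAt.const_add p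
  have h2 := (hF.hasFDerivAt.comp u h1).sub_const p
  have h3 := (e.symm.hasFDerivAt).comp u h2
  rw [show fderiv ℂ (conj e p F) u = _ from h3.fderiv]
  rfl

/-- On the stable manifold of a saddle, an edge zero of `G⁻` lies in the closure of the saddles. -/
theorem mem_Jstar_of_edgeZero (H : HenonMap) {p : ℂ × ℂ} (hp : IsSaddlePeriodic H p)
    {Φ : ℂ → ℂ × ℂ} (hΦ : IsStableParam H p Φ) {z : ℂ}
    (hz : EdgeZero (fun w => Gminus H (Φ w)) univ z) : Φ z ∈ Jstar H := by
  by_cases hzp : Φ z = p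
  · rw [hzp]
    exact subset_closure hp
  obtain ⟨k, hk, hfix, v₁, v₂, μ₁, μ₂, h1, h2, e1, e2, l1, l2⟩ := hp
  obtain ⟨hΦd, -, hΦ', -, hΦr⟩ := hΦ
  obtain ⟨e, he⟩ := exists_basis_equiv h1 h2 e1 e2 (fun h => by rw [h] at l1; linarith)
  set T := H.toFun^[k] with hT
  have hTc : ContDiff ℂ 2 T := H.contDiff_iterate k
  have hTd : Differentiable ℂ T := hTc.differentiable two_ne_zero
  have hdyn := (H.dyn.iterate (k := k) (by omega)).conj e p
  have hFc : ContDiff ℂ 2 (conj e p T) :=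
    e.symm.contDiff.comp ((hTc.comp (contDiff_const.add e.contDiff)).sub contDiff_const)
  have hF0 : conj e p T 0 = 0 := by simp [conj, hfix]
  obtain ⟨r, C, hsad⟩ := exists_sad (lam := μ₁) (mu := μ₂) hFc hF0 l1 l2 (by
    refine ContinuousLinearMap.ext fun u => ?_
    rw [fderiv_conj e p _ _ (hTd _), e.symm_apply_eq, map_zero, add_zero, he u, he, diagMap_apply,
      map_add, map_smul, map_smul, e1, e2, smul_smul, smul_smul, mul_comm μ₁, mul_comm μ₂])
  set Φ' : ℂ → ℂ × ℂ := fun w => e.symm (Φ w - p) with hΦ'def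
  have hpe : ∀ w, p + e (Φ' w) = Φ w := fun w => by simp [hΦ'def]
  have hΦ'has : ∀ w, HasDerivAt Φ' (e.symm (deriv Φ w)) w := fun w =>
    (e.symm : (ℂ × ℂ) →L[ℂ] (ℂ × ℂ)).hasFDerivAt.comp_hasDerivAt w
      ((hΦd w).hasDerivAt.sub_const p)
  have hpn : ∀ n, T^[n] p = p := Function.iterate_fixed hfix
  have hlim : ∀ w, Tendsto (fun n => (conj e p T)^[n] (Φ' w)) atTop (𝓝 0) := by
    intro w
    have a1 : Φ w ∈ Ws H p := hΦr ▸ mem_range_self w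
    have a2 : Tendsto (fun n => T^[n] (Φ w)) atTop (𝓝 p) := by
      rw [tendsto_iff_dist_tendsto_zero]
      have := a1.comp (tendsto_id.const_mul_atTop' (Nat.zero_lt_of_lt hk))
      refine this.congr fun n => ?_
      simp only [Function.comp_apply, id, Function.iterate_mul]
      rw [← hT, hpn]
    have a3 : ∀ n, (conj e p T)^[n] (Φ' w) = e.symm (T^[n] (Φ w) - p) := fun n => by
      rw [← hpe w, ← conj_iterate_spec, add_sub_cancel_left, e.symm_apply_apply]
    simp only [a3]
    have := (e.symm.continuous.tendsto (p - p)).comp (a2.sub_const p)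
    rwa [sub_self, map_zero] at this
  refine Metric.mem_closure_iff.2 fun ε hε => ?_
  obtain ⟨δ, hδ, hδ'⟩ := Metric.continuousAt_iff.1
    (show ContinuousAt (fun u => p + e u) (Φ' z) by fun_prop) ε hε
  simp only [hpe] at hδ'
  obtain ⟨y, hy, m, hm, hys⟩ := exists_saddle_near hdyn hsad (Φ := Φ')
    (fun w => (hΦ'has w).differentiableAt)
    (fun w => by rw [(hΦ'has w).deriv]; simpa using hΦ' w) hlim (z := z)
    (by simpa [hΦ'def, sub_eq_zero] using hzp) (by simpa only [hpe] using hz) hδ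
  refine ⟨p + e y, ⟨k * m, Nat.mul_pos hk hm, ?_⟩, by rw [dist_comm]; exact hδ' hy⟩
  rw [Function.iterate_mul]
  exact hys.map (h := fun u => p + e u) (g := fun x => e.symm (x - p)) (hdyn.diff.iterate m)
    (hTd.iterate m) (by fun_prop) (by fun_prop) (fun x => by simp) (conj_iterate_spec e p T m)

end HenonAux

/-- For a periodic saddle point `p` of a complex Hénon map and a connected component `V` of
`ℂ ∖ J*_{p,s}`, the function `G⁻ ∘ Φ^s_p` on `V` either vanishes identically or is strictly
positive. -/
theorem Gminus_dichotomy_on_component_of_saddle (H : HenonMap)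
    (p : ℂ × ℂ) (hp : IsSaddlePeriodic H p)
    (Φ : ℂ → ℂ × ℂ) (hΦ : IsStableParam H p Φ)
    (V : Set ℂ) (z₀ : ℂ) (hz₀ : z₀ ∈ V)
    (hV : V = connectedComponentIn (Φ ⁻¹' Jstar H)ᶜ z₀) :
    (∀ z ∈ V, Gminus H (Φ z) = 0) ∨ (∀ z ∈ V, 0 < Gminus H (Φ z)) := by
  have hG := H.dyn.minus.posHarm isOpen_univ hΦ.1.differentiableOn
  have hpre : IsPreconnected V := hV ▸ isPreconnected_connectedComponentIn
  have hsub : V ⊆ (Φ ⁻¹' Jstar H)ᶜ := hV ▸ connectedComponentIn_subset _ _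
  by_contra! hcon
  obtain ⟨⟨y, hy, hy0⟩, x, hx, hx0⟩ := hcon
  have hnn := fun w => hG.nonneg w (mem_univ w)
  obtain ⟨ξ, hξ, hE⟩ := HenonAux.exists_edgeZero hG.cont hG.nonneg isOpen_univ hpre (subset_univ V)
    hx hy (le_antisymm hx0 (hnn x)) (lt_of_le_of_ne (hnn y) (Ne.symm hy0))
  exact hsub hξ (HenonAux.mem_Jstar_of_edgeZero H hp hΦ hE)

end
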